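/- Let K be a p-adically closed field (e.g., elementarily equivalent to a finite extension of ℚ_p) and let F/K be a field extension such that res : G_F → G_K is an isomorphism of absolute Galois groups. Then K is an elementary substructure of F in the language of rings. Consequently, any variety over K with an F-rational point has a K-rational point. -/

import Mathlib

open FirstOrder

/-- Two commutative rings are elementarily equivalent in the language of rings. -/
def RingElemEquiv (K E : Type*) [CommRing K] [CommRing E] : Prop :=
  ∀ φ : Language.ring.Sentence,
    (letI := Ring.compatibleRingOfRing K; φ.Realize K) ↔
      (letI := Ring.compatibleRingOfRing E; φ.Realize E)

/-- A field `K` is *p-adically closed* if it is elementarily equivalent (in the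
language of rings) to some finite extension of `ℚ_p`. -/
def IsPAdicallyClosed (p : ℕ) [Fact p.Prime] (K : Type*) [Field K] : Prop :=
  ∃ (E : Type) (fE : Field E),
    letI := fE
    ∃ aE : Algebra ℚ_[p] E,
      letI := aE
      FiniteDimensional ℚ_[p] E ∧ RingElemEquiv K E

section Part1
open Polynomial
open scoped IntermediateField

namespace PAC

/-- Henselianity of a valued field, through coefficients of irreducible polynomials. -/
def Hens {K Γ : Type*} [Field K] [LinearOrderedCommGroupWithZero Γ] (v : Valuation K Γ) : Prop :=
  ∀ g : K[X], g.Monic → Irreducible g → v (g.coeff 0) ≤ 1 → ∀ i, v (g.coeff i) ≤ 1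

section
variable {K Ω Γ Γ' : Type*} [Field K] [Field Ω] [Algebra K Ω]
  [LinearOrderedCommGroupWithZero Γ] [LinearOrderedCommGroupWithZero Γ']

lemma Hens.of_equiv {v : Valuation K Γ} {v' : Valuation K Γ'} (h : v.IsEquiv v') (hv : Hens v) :
    Hens v' := by
  intro g hg hi h0 i
  have := hv g hg hi (by rwa [h.le_one_iff_le_one]) i
  rwa [← h.le_one_iff_le_one]

lemma root_le_one (w : Valuation Ω Γ) (g : K[X]) (hg : g.Monic)
    (hc : ∀ i, w (algebraMap K Ω (g.coeff i)) ≤ 1) (θ : Ω) (hθ : aeval θ g = 0) : w θ ≤ 1 := by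
  by_contra hlt
  push Not at hlt
  have hd : 0 < g.natDegree := by
    rcases Nat.eq_zero_or_pos g.natDegree with h | h
    · rw [hg.natDegree_eq_zero] at h
      simp [h] at hθ
    · exact h
  rw [aeval_eq_sum_range, Finset.sum_range_succ, hg.coeff_natDegree, one_smul] at hθ
  have h1 : w (∑ i ∈ Finset.range g.natDegree, g.coeff i • θ ^ i) < w (θ ^ g.natDegree) := by
    apply Valuation.map_sum_lt
    · rw [map_pow]; exact pow_ne_zero _ (zero_lt_one.trans hlt).ne'
    · intro i hi
      rw [Algebra.smul_def, map_mul, map_pow, map_pow]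
      calc _ ≤ 1 * w θ ^ i := by gcongr; exact hc i
        _ = w θ ^ i := one_mul _
        _ < _ := by
          apply pow_lt_pow_right₀ hlt (Finset.mem_range.1 hi)
  have h2 := Valuation.map_add_eq_of_lt_right w h1
  rw [hθ, map_zero] at h2
  have := (h1.trans_eq h2.symm)
  exact absurd this (not_lt_zero)

/-- integral constants of a unit norm element -/
lemma minpoly_coeff_zero_pow [FiniteDimensional K Ω] (y : Ω) :
    ∃ n : ℕ, 0 < n ∧ Algebra.norm K y =
      ((-1) ^ (minpoly K y).natDegree * (minpoly K y).coeff 0) ^ n := by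
  refine ⟨Module.finrank K⟮y⟯ Ω, Module.finrank_pos, ?_⟩
  rw [Algebra.norm_eq_norm_adjoin]
  congr 1
  have hy : IsIntegral K y := IsIntegral.of_finite K y
  have := Algebra.PowerBasis.norm_gen_eq_coeff_zero_minpoly (IntermediateField.adjoin.powerBasis hy)
  rw [IntermediateField.adjoin.powerBasis_gen, IntermediateField.minpoly_gen] at this
  exact this

lemma Hens.norm_one_le {w : Valuation Ω Γ} (h : Hens (w.comap (algebraMap K Ω)))
    [FiniteDimensional K Ω] (y : Ω) (hy : w (algebraMap K Ω (Algebra.norm K y)) = 1) : w y ≤ 1 := by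
  obtain ⟨n, hn, he⟩ := minpoly_coeff_zero_pow (K := K) y
  have hyi : IsIntegral K y := IsIntegral.of_finite K y
  have hc : w (algebraMap K Ω ((minpoly K y).coeff 0)) = 1 := by
    rw [he] at hy
    simp only [map_pow, map_mul, map_neg, map_one, Valuation.map_neg, one_pow, one_mul] at hy
    exact (pow_eq_one_iff_of_nonneg zero_le hn.ne').1 hy
  exact root_le_one w _ (minpoly.monic hyi)
    (h _ (minpoly.monic hyi) (minpoly.irreducible hyi) (by simpa using hc.le)) y (minpoly.aeval K y)

lemma Hens.pow_aux {w : Valuation Ω Γ} (h : Hens (w.comap (algebraMap K Ω)))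
    [FiniteDimensional K Ω] (y : Ω) :
    w y ^ (Module.finrank K Ω) = w (algebraMap K Ω (Algebra.norm K y)) := by
  by_cases hy0 : y = 0
  · subst hy0
    simp [Module.finrank_pos.ne']
  set N := Algebra.norm K y with hN
  have hN0 : N ≠ 0 := by simpa [hN, Algebra.norm_eq_zero_iff] using hy0
  set d := Module.finrank K Ω
  set z := y ^ d / algebraMap K Ω N with hz
  have hNz : Algebra.norm K z = 1 := by
    have h1 : z * algebraMap K Ω N = y ^ d := by
      rw [hz, div_mul_cancel₀]; simpa using hN0
    have h2 := congrArg (Algebra.norm K) h1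
    rw [map_mul, map_pow, Algebra.norm_algebraMap, ← hN] at h2
    exact mul_right_cancel₀ (pow_ne_zero d hN0) (by rw [h2, one_mul])
  have h1 := h.norm_one_le z (by simp [hNz])
  have hz0 : z ≠ 0 := by
    rintro h0; rw [h0] at hNz; simp at hNz
  have h2 := h.norm_one_le z⁻¹ (by
    have : Algebra.norm K (z * z⁻¹) = 1 := by rw [mul_inv_cancel₀ hz0, map_one]
    rw [map_mul, hNz, one_mul] at this
    simp [this])
  have h3 : w z = 1 := by
    apply le_antisymm h1
    rw [map_inv₀] at h2
    exact (inv_le_one₀ ((Valuation.pos_iff w).2 hz0)).1 h2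
  rw [hz, map_div₀, map_pow, div_eq_one_iff_eq] at h3
  · exact h3
  · simpa using hN0

lemma Hens.pow_eq {w : Valuation Ω Γ} (h : Hens (w.comap (algebraMap K Ω)))
    (y : Ω) (hy : IsIntegral K y) :
    w y ^ (minpoly K y).natDegree = w (algebraMap K Ω ((minpoly K y).coeff 0)) := by
  have : FiniteDimensional K K⟮y⟯ := IntermediateField.adjoin.finiteDimensional hy
  have h' : Hens ((w.comap (algebraMap K⟮y⟯ Ω)).comap (algebraMap K K⟮y⟯)) := h
  have := h'.pow_aux (IntermediateField.AdjoinSimple.gen K y)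
  rw [IntermediateField.adjoin.finrank hy] at this
  have h3 := Algebra.PowerBasis.norm_gen_eq_coeff_zero_minpoly (IntermediateField.adjoin.powerBasis hy)
  rw [IntermediateField.adjoin.powerBasis_gen, IntermediateField.minpoly_gen] at h3
  rw [h3] at this
  simp only [Valuation.comap_apply, map_mul, map_pow, map_neg, map_one, Valuation.map_neg, one_pow,
    one_mul, IntermediateField.AdjoinSimple.algebraMap_gen] at this
  exact this

lemma Hens.conj {w : Valuation Ω Γ} (h : Hens (w.comap (algebraMap K Ω)))
    {x y : Ω} (hx : IsIntegral K x) (hxy : minpoly K x = minpoly K y) : w x = w y := by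
  have hd : (minpoly K x).natDegree ≠ 0 := (minpoly.natDegree_pos hx).ne'
  have hy : IsIntegral K y := by
    by_contra hy
    rw [minpoly.eq_zero hy] at hxy
    exact minpoly.ne_zero hx hxy
  have h1 := h.pow_eq x hx
  have h2 := h.pow_eq y hy
  rw [← hxy, ← h1] at h2
  exact ((pow_left_inj₀ zero_le zero_le hd).1 h2).symm

lemma Hens.inv {w : Valuation Ω Γ} (h : Hens (w.comap (algebraMap K Ω)))
    (σ : Ω ≃ₐ[K] Ω) (x : Ω) (hx : IsIntegral K x) : w (σ x) = w x :=
  (h.conj hx (minpoly.algEquiv_eq σ x).symm).symm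

/-- two extensions agree on order comparisons of algebraic elements -/
lemma Hens.le_one_iff {w : Valuation Ω Γ} {w' : Valuation Ω Γ'}
    (h : Hens (w.comap (algebraMap K Ω)))
    (he : (w.comap (algebraMap K Ω)).IsEquiv (w'.comap (algebraMap K Ω)))
    {x : Ω} (hx : IsIntegral K x) : w x ≤ 1 ↔ w' x ≤ 1 := by
  have hd : (minpoly K x).natDegree ≠ 0 := (minpoly.natDegree_pos hx).ne'
  have h1 := h.pow_eq x hx
  have h2 := (h.of_equiv he).pow_eq x hx
  rw [← pow_le_one_iff_of_nonneg zero_le hd, h1, ← pow_le_one_iff_of_nonneg (a := w' x) zero_le hd,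
    h2]
  exact he.le_one_iff_le_one

variable (K) in
/-- invariance of a valuation on the algebraic closure -/
def Inv (w : Valuation Ω Γ) : Prop := ∀ (σ : Ω ≃ₐ[K] Ω) x, w (σ x) = w x

lemma exists_algEquiv [IsAlgClosed Ω] [Algebra.IsAlgebraic K Ω] {x y : Ω}
    (h : aeval y (minpoly K x) = 0) : ∃ σ : Ω ≃ₐ[K] Ω, σ x = y := by
  have : IsAlgClosure K Ω := ⟨inferInstance, inferInstance⟩
  have hx : IsIntegral K x := Algebra.IsIntegral.isIntegral x
  have := (minpoly.eq_iff_aeval_minpoly_eq_zero hx).2 h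
  obtain ⟨σ, hσ⟩ := (Normal.minpoly_eq_iff_mem_orbit Ω).1 this
  exact ⟨σ⁻¹, by rw [← hσ]; exact σ.symm_apply_apply y⟩

lemma monic_coeff_le (w : Valuation Ω Γ) (s : Multiset Ω) (hs : ∀ θ ∈ s, w θ ≤ 1) (i : ℕ) :
    w (((s.map (fun a => X - C a)).prod).coeff i) ≤ 1 := by
  induction s using Multiset.induction_on generalizing i with
  | empty =>
    rw [Multiset.map_zero, Multiset.prod_zero, coeff_one]
    split_ifs <;> simp
  | cons a s ih =>
    rw [Multiset.map_cons, Multiset.prod_cons, sub_mul, coeff_sub, coeff_C_mul]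
    have ih' := ih (fun θ hθ => hs θ (Multiset.mem_cons_of_mem hθ))
    have ha := hs a (Multiset.mem_cons_self a s)
    refine (Valuation.map_sub w _ _).trans (max_le ?_ ?_)
    · cases i with
      | zero => simp
      | succ n => rw [coeff_X_mul]; exact ih' n
    · rw [map_mul]; exact mul_le_one' ha (ih' i)

lemma conj_same [IsAlgClosed Ω] [Algebra.IsAlgebraic K Ω] {w : Valuation Ω Γ} (hw : Inv K w)
    {g : K[X]} (hg : g.Monic) (hi : Irreducible g) {x y : Ω} (hx : aeval x g = 0)
    (hy : aeval y g = 0) : w x = w y := by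
  have := minpoly.eq_of_irreducible_of_monic hi hx hg
  rw [this] at hy
  obtain ⟨σ, rfl⟩ := exists_algEquiv hy
  exact (hw σ x).symm

lemma map_eq_prod_roots [IsAlgClosed Ω] {g : K[X]} (hg : g.Monic) :
    g.map (algebraMap K Ω) =
      (((g.map (algebraMap K Ω)).roots).map (fun a => X - C a)).prod := by
  have := (IsAlgClosed.splits (g.map (algebraMap K Ω))).eq_prod_roots
  rwa [(hg.map _).leadingCoeff, C_1, one_mul] at this

lemma w_prod_roots [IsAlgClosed Ω] (w : Valuation Ω Γ) {g : K[X]} (hg : g.Monic) :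
    w (algebraMap K Ω (g.coeff 0)) = (((g.map (algebraMap K Ω)).roots).map w).prod := by
  have := (IsAlgClosed.splits (g.map (algebraMap K Ω))).coeff_zero_eq_prod_roots_of_monic (hg.map _)
  rw [coeff_map] at this
  rw [this, map_mul, map_pow, Valuation.map_neg, map_one, one_pow, one_mul, map_multiset_prod]

lemma Inv.pow_eq_of_root [IsAlgClosed Ω] [Algebra.IsAlgebraic K Ω] {w : Valuation Ω Γ}
    (hw : Inv K w) {g : K[X]} (hg : g.Monic) (hi : Irreducible g) {x : Ω} (hx : aeval x g = 0) :
    w (algebraMap K Ω (g.coeff 0)) = w x ^ g.natDegree := by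
  rw [w_prod_roots w hg, (Multiset.eq_replicate_card (s := Multiset.map w _) (a := w x)).2 ?_,
    Multiset.prod_replicate, Multiset.card_map,
    ← (IsAlgClosed.splits (g.map (algebraMap K Ω))).natDegree_eq_card_roots, natDegree_map]
  intro a ha
  obtain ⟨b, hb, rfl⟩ := Multiset.mem_map.1 ha
  rw [mem_roots (hg.map _).ne_zero, IsRoot.def, eval_map_algebraMap] at hb
  exact conj_same hw hg hi hb hx

lemma Inv.hens [IsAlgClosed Ω] [Algebra.IsAlgebraic K Ω] {w : Valuation Ω Γ} (hw : Inv K w) :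
    Hens (w.comap (algebraMap K Ω)) := by
  intro g hg hi h0 i
  rw [Valuation.comap_apply, ← coeff_map, map_eq_prod_roots hg]
  apply monic_coeff_le
  intro θ hθ
  rw [mem_roots (hg.map _).ne_zero, IsRoot.def, eval_map_algebraMap] at hθ
  rw [Valuation.comap_apply, hw.pow_eq_of_root hg hi hθ] at h0
  exact (pow_le_one_iff_of_nonneg zero_le hi.natDegree_pos.ne').1 h0

lemma Hens.toInv [Algebra.IsAlgebraic K Ω] {w : Valuation Ω Γ}
    (h : Hens (w.comap (algebraMap K Ω))) : Inv K w :=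
  fun σ x => h.inv σ x (Algebra.IsIntegral.isIntegral x)

/-- Chevalley extension. -/
lemma exists_extension (v : Valuation K Γ) :
    ∃ V : ValuationSubring Ω, (V.valuation.comap (algebraMap K Ω)).IsEquiv v := by
  let L : LocalSubring Ω := LocalSubring.map (algebraMap K Ω) v.valuationSubring.toLocalSubring
  obtain ⟨V, hV⟩ := LocalSubring.exists_le_valuationSubring L
  refine ⟨V, ?_⟩
  apply Valuation.isEquiv_of_val_le_one
  intro x
  rw [Valuation.comap_apply, ValuationSubring.valuation_le_one_iff]
  obtain ⟨hle, hloc⟩ := hV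
  constructor
  · intro hx
    by_contra hlt
    push Not at hlt
    have hx0 : x ≠ 0 := fun h => by simp [h] at hlt
    have hxi : v x⁻¹ ≤ 1 := by
      rw [map_inv₀]; exact inv_le_one_of_one_le₀ hlt.le
    have hmem : algebraMap K Ω x⁻¹ ∈ L.toSubring := ⟨x⁻¹, hxi, rfl⟩
    have hu : IsUnit (Subring.inclusion hle ⟨_, hmem⟩) := by
      refine IsUnit.of_mul_eq_one ⟨algebraMap K Ω x, hx⟩ ?_
      apply Subtype.ext
      change algebraMap K Ω x⁻¹ * algebraMap K Ω x = 1
      rw [← map_mul, inv_mul_cancel₀ hx0, map_one]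
    have hu2 := hloc.map_nonunit _ hu
    obtain ⟨⟨b, hb⟩, hb2⟩ := hu2.exists_right_inv
    have hb3 := congrArg Subtype.val hb2
    obtain ⟨z, hz, rfl⟩ := hb
    change algebraMap K Ω x⁻¹ * algebraMap K Ω z = 1 at hb3
    rw [← map_mul, ← map_one (algebraMap K Ω)] at hb3
    have := (algebraMap K Ω).injective hb3
    have hzx : z = x := by
      field_simp at this; exact this
    rw [hzx] at hz
    exact absurd hlt (not_lt.2 hz)
  · intro hx
    exact hle ⟨x, hx, rfl⟩

lemma exists_pow_eq (w : Valuation Ω Γ) {g : K[X]} (hg : g ≠ 0) {x : Ω} (hx0 : x ≠ 0)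
    (hx : aeval x g = 0) : ∃ n, 0 < n ∧ n ≤ g.natDegree ∧ ∃ m : K, m ≠ 0 ∧
      w x ^ n = w (algebraMap K Ω m) := by
  have hne : g.support.Nonempty := by simpa using hg
  obtain ⟨i, hi, hmax⟩ := Finset.exists_max_image g.support
    (fun i => w (g.coeff i • x ^ i)) hne
  have hci : g.coeff i ≠ 0 := mem_support_iff.1 hi
  have hex : ∃ j ∈ g.support, j ≠ i ∧ w (g.coeff j • x ^ j) = w (g.coeff i • x ^ i) := by
    by_contra hcon
    push Not at hcon
    rw [aeval_def, eval₂_eq_sum, Polynomial.sum_def] at hx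
    simp only [← Algebra.smul_def] at hx
    rw [← Finset.add_sum_erase _ _ hi] at hx
    have hlt : w (∑ j ∈ g.support.erase i, g.coeff j • x ^ j) < w (g.coeff i • x ^ i) := by
      apply Valuation.map_sum_lt
      · rw [Valuation.ne_zero_iff]
        simp [hci, hx0, smul_eq_zero]
      · intro j hj
        have hj' := Finset.mem_erase.1 hj
        exact lt_of_le_of_ne (hmax j hj'.2) (hcon j hj'.2 hj'.1)
    have h2 := Valuation.map_add_eq_of_lt_left w hlt
    rw [hx, map_zero] at h2
    exact not_lt_zero (hlt.trans_eq h2.symm)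
  obtain ⟨j, hj, hji, he⟩ := hex
  have hcj : g.coeff j ≠ 0 := mem_support_iff.1 hj
  have key : ∀ i j : ℕ, g.coeff i ≠ 0 → g.coeff j ≠ 0 → i < j →
      w (g.coeff j • x ^ j) = w (g.coeff i • x ^ i) → ∃ n, 0 < n ∧ n ≤ g.natDegree ∧
      ∃ m : K, m ≠ 0 ∧ w x ^ n = w (algebraMap K Ω m) := by
    intro i j hci hcj hij he
    refine ⟨j - i, by omega, (Nat.sub_le _ _).trans (le_natDegree_of_ne_zero hcj),
      g.coeff i / g.coeff j, div_ne_zero hci hcj, ?_⟩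
    simp only [Algebra.smul_def, map_mul, map_pow] at he
    have hxw : w x ≠ 0 := by simpa using hx0
    have hcjw : w (algebraMap K Ω (g.coeff j)) ≠ 0 := by simpa using hcj
    rw [map_div₀, map_div₀, eq_div_iff hcjw]
    have : w x ^ j = w x ^ (j - i) * w x ^ i := by rw [← pow_add]; congr 1; omega
    rw [this] at he
    apply mul_right_cancel₀ (pow_ne_zero i hxw)
    rw [← he, mul_right_comm, mul_comm]
  rcases lt_or_gt_of_ne hji with h | h
  · exact key j i hcj hci h he.symm
  · exact key i j hci hcj h he

/-- strict coefficient bound -/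
lemma coeff_lt_one_of_roots (w : Valuation Ω Γ) (s : Multiset Ω) (hs : ∀ θ ∈ s, w θ < 1) (i : ℕ)
    (hi : i < Multiset.card s) : w (((s.map (fun a => X - C a)).prod).coeff i) < 1 := by
  induction s using Multiset.induction_on generalizing i with
  | empty => simp at hi
  | cons a s ih =>
    rw [Multiset.map_cons, Multiset.prod_cons, sub_mul, coeff_sub, coeff_C_mul]
    have ih' := ih (fun θ hθ => hs θ (Multiset.mem_cons_of_mem hθ))
    have ha := hs a (Multiset.mem_cons_self a s)
    rw [Multiset.card_cons] at hi
    refine (Valuation.map_sub w _ _).trans_lt (max_lt ?_ ?_)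
    · cases i with
      | zero => simp
      | succ n => rw [coeff_X_mul]; exact ih' n (by omega)
    · rw [map_mul]
      exact mul_lt_one_of_nonneg_of_lt_one_left zero_le ha
        (monic_coeff_le w s (fun θ hθ => (hs θ (Multiset.mem_cons_of_mem hθ)).le) i)

lemma Hens.coeff_lt_one {v : Valuation K Γ} (h : Hens v) {g : K[X]} (hg : g.Monic)
    (hi : Irreducible g) (h0 : v (g.coeff 0) < 1) (i : ℕ) (hid : i < g.natDegree) :
    v (g.coeff i) < 1 := by
  obtain ⟨V, hV⟩ := exists_extension (Ω := AlgebraicClosure K) v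
  have h' := h.of_equiv hV.symm
  have hinv := h'.toInv
  rw [← hV.lt_one_iff_lt_one] at h0 ⊢
  rw [Valuation.comap_apply, ← coeff_map, map_eq_prod_roots hg]
  apply coeff_lt_one_of_roots
  · intro θ hθ
    rw [mem_roots (hg.map _).ne_zero, IsRoot.def, eval_map_algebraMap] at hθ
    rw [Valuation.comap_apply, hinv.pow_eq_of_root hg hi hθ] at h0
    exact (pow_lt_one_iff_of_nonneg zero_le hi.natDegree_pos.ne').1 h0
  · rw [← (IsAlgClosed.splits (g.map (algebraMap K (AlgebraicClosure K)))).natDegree_eq_card_roots,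
      natDegree_map]
    exact hid

lemma factor_coeff (v : Valuation K Γ) {g q : K[X]} (hg : g.Monic)
    (hq : q.Monic) (hqg : q ∣ g) (hc : ∀ i, v (g.coeff i) ≤ 1) (i : ℕ) : v (q.coeff i) ≤ 1 := by
  obtain ⟨V, hV⟩ := exists_extension (Ω := AlgebraicClosure K) v
  rw [← hV.le_one_iff_le_one]
  rw [Valuation.comap_apply, ← coeff_map, map_eq_prod_roots hq]
  apply monic_coeff_le
  intro θ hθ
  rw [mem_roots (hq.map _).ne_zero, IsRoot.def, eval_map_algebraMap] at hθ
  refine root_le_one V.valuation g hg (fun i => ?_) θ ?_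
  · have := hc i
    rwa [← hV.le_one_iff_le_one] at this
  · obtain ⟨r, rfl⟩ := hqg
    simp [hθ]

/-- Hensel at zero. -/
lemma Hens.root_zero {v : Valuation K Γ} (h : Hens v) {g : K[X]} (hg : g.Monic)
    (hc : ∀ i, v (g.coeff i) ≤ 1) (h0 : v (g.coeff 0) < 1) (h1 : v (g.coeff 1) = 1) :
    ∃ b, g.eval b = 0 ∧ v b < 1 := by
  have hex : ∃ q : K[X], q.Monic ∧ Irreducible q ∧ q ∣ g ∧ v (q.coeff 0) < 1 := by
    by_contra hcon
    push Not at hcon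
    have : ∀ n (g : K[X]), g.natDegree = n → g.Monic →
        (∀ q : K[X], q.Monic → Irreducible q → q ∣ g → 1 ≤ v (q.coeff 0)) →
        1 ≤ v (g.coeff 0) := by
      intro n
      induction n using Nat.strong_induction_on with
      | _ n ih =>
        intro g hgn hg hq
        by_cases hu : IsUnit g
        · rw [hg.eq_one_of_isUnit hu]; simp
        · obtain ⟨q, hqm, hqi, hqd⟩ := exists_monic_irreducible_factor g hu
          obtain ⟨r, hr⟩ := hqd
          have hrm : r.Monic := hqm.of_mul_monic_left (hr ▸ hg)
          have hdeg : r.natDegree < n := by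
            rw [← hgn, hr, hqm.natDegree_mul hrm]
            have := hqi.natDegree_pos
            omega
          have h2 := ih _ hdeg r rfl hrm (fun q' h1 h2 h3 => hq q' h1 h2
            (h3.trans (hr ▸ Dvd.intro_left q rfl)))
          have h3 := hq q hqm hqi ⟨r, hr⟩
          rw [hr, mul_coeff_zero, map_mul]
          exact one_le_mul h3 h2
    exact absurd h0 (not_lt.2 (this _ g rfl hg hcon))
  obtain ⟨q, hqm, hqi, ⟨r, hr⟩, hq0⟩ := hex
  have hrm : r.Monic := hqm.of_mul_monic_left (hr ▸ hg)
  have hrc := factor_coeff v hg hrm (hr ▸ Dvd.intro_left q rfl) hc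
  have hd : q.natDegree = 1 := by
    by_contra hne
    have hpos := hqi.natDegree_pos
    have hq1 := h.coeff_lt_one hqm hqi hq0 1 (by omega)
    rw [hr, coeff_mul, Finset.Nat.antidiagonal_succ] at h1
    simp at h1
    have h2 : v (q.coeff 0 * r.coeff 1 + q.coeff 1 * r.coeff 0) < 1 := by
      refine (Valuation.map_add v _ _).trans_lt (max_lt ?_ ?_) <;> rw [map_mul]
      · exact mul_lt_one_of_nonneg_of_lt_one_left zero_le hq0 (hrc 1)
      · exact mul_lt_one_of_nonneg_of_lt_one_left zero_le hq1 (hrc 0)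
    exact h2.ne h1
  refine ⟨- q.coeff 0, ?_, by rwa [Valuation.map_neg]⟩
  rw [hr, eval_mul]
  have : q.eval (-q.coeff 0) = 0 := by
    rw [hqm.eq_X_add_C hd]; simp
  rw [this, zero_mul]

/-- Hensel lemma. -/
lemma Hens.root {v : Valuation K Γ} (h : Hens v) {g : K[X]} (hg : g.Monic)
    (hc : ∀ i, v (g.coeff i) ≤ 1) (a : K) (ha : v a ≤ 1) (h0 : v (g.eval a) < 1)
    (h1 : v (g.derivative.eval a) = 1) :
    ∃ b, g.eval b = 0 ∧ v (b - a) < 1 := by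
  have hc' : ∀ i, v ((taylor a g).coeff i) ≤ 1 := by
    intro i
    rw [taylor_coeff, eval_eq_sum_range]
    apply Valuation.map_sum_le
    intro j _
    rw [map_mul, map_pow]
    refine mul_le_one' ?_ (pow_le_one' ha j)
    rw [hasseDeriv_coeff, map_mul]
    refine mul_le_one' ?_ (hc _)
    exact (natCast_mem v.integer _)
  obtain ⟨b, hb, hb1⟩ := h.root_zero (g := taylor a g) (by rw [taylor_apply]; exact hg.comp_X_add_C a) hc' (by rwa [taylor_coeff_zero])
    (by rwa [taylor_coeff_one])
  refine ⟨b + a, ?_, by simpa using hb1⟩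
  rwa [taylor_eval] at hb

end
end PAC
end Part1

section Part2
namespace PAC

section rigid
variable {F : Type*} [Field F]

/-- Data for the rigid element construction of a valuation ring. -/
structure Rigid (S T U : Set F) : Prop where
  S0 : (0 : F) ∉ S
  S1 : (1 : F) ∈ S
  Smul : ∀ {x y}, x ∈ S → y ∈ S → x * y ∈ S
  Sinv : ∀ {x}, x ∈ S → x⁻¹ ∈ S
  T0 : (0 : F) ∉ T
  Tmul : ∀ {x y}, x ∈ T → y ∈ T → x * y ∈ T
  Tinv : ∀ {x}, x ∈ T → x⁻¹ ∈ T
  ST : S ⊆ T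
  UT : U ⊆ T
  U1 : (1 : F) ∈ U
  Umul : ∀ {x y}, x ∈ U → y ∈ U → x * y ∈ U
  Uinv : ∀ {x}, x ∈ U → x⁻¹ ∈ U
  Uneg : (-1 : F) ∈ U
  rig : ∀ x, x ≠ 0 → x ∉ T → 1 + x ∈ S ∨ (1 + x) / x ∈ S
  good : ∀ u ∈ U, (u - 1 ∈ U ∧ u / (u - 1) ∉ S) ∨ ∃ g h, g ∈ U ∧ h ∈ U ∧ u = g * h ∧
    (g - 1 ∈ U ∧ g / (g - 1) ∉ S) ∧ (h - 1 ∈ U ∧ h / (h - 1) ∉ S)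

/-- the rigid infinitesimals -/
def rI (S T : Set F) : Set F := {x | x ≠ 0 ∧ x ∉ T ∧ 1 + x ∈ S}

/-- the second auxiliary set -/
def rJ (S U : Set F) : Set F := {x | ∀ u ∈ U, 1 + u * x ∈ S}

namespace Rigid
variable {S T U : Set F} (R : Rigid S T U)
include R

lemma Sne {x : F} (h : x ∈ S) : x ≠ 0 := fun h0 => R.S0 (h0 ▸ h)
lemma Tne {x : F} (h : x ∈ T) : x ≠ 0 := fun h0 => R.T0 (h0 ▸ h)
lemma Une {x : F} (h : x ∈ U) : x ≠ 0 := R.Tne (R.UT h)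
lemma Sdiv {x y : F} (h : x ∈ S) (h' : y ∈ S) : x / y ∈ S := by
  rw [div_eq_mul_inv]; exact R.Smul h (R.Sinv h')

lemma T_cancel {x t : F} (ht : t ∈ T) (h : x * t ∈ T) : x ∈ T := by
  have := R.Tmul h (R.Tinv ht)
  rwa [mul_assoc, mul_inv_cancel₀ (R.Tne ht), mul_one] at this

lemma notT_mul {x t : F} (hx : x ∉ T) (ht : t ∈ T) : x * t ∉ T := fun h => hx (R.T_cancel ht h)

lemma notT_inv {x : F} (hx : x ∉ T) : x⁻¹ ∉ T := fun h => hx (by simpa using R.Tinv h)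

lemma inv_mem_I {x : F} (h0 : x ≠ 0) (hT : x ∉ T) (h : x ∉ rI S T) : x⁻¹ ∈ rI S T := by
  refine ⟨inv_ne_zero h0, R.notT_inv hT, ?_⟩
  rcases R.rig x h0 hT with h1 | h1
  · exact absurd ⟨h0, hT, h1⟩ h
  · have : 1 + x⁻¹ = (1 + x) / x := by field_simp; ring
    rwa [this]

/-- core rigidity step: if `x ∉ T`, then `1 + x ∈ T` forces `1 + x ∈ S` -/
lemma mem_S_of_T {x : F} (h0 : x ≠ 0) (hT : x ∉ T) (h : 1 + x ∈ T) : 1 + x ∈ S := by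
  rcases R.rig x h0 hT with h1 | h1
  · exact h1
  · exfalso
    have h2 := R.Tmul h (R.Tinv (R.ST h1))
    have h3 : (1 + x) * ((1 + x) / x)⁻¹ = x := by
      have := R.Tne h
      field_simp
    exact hT (h3 ▸ h2)

lemma good_mul {u x : F} (hu : u ∈ U) (hu1 : u - 1 ∈ U) (hus : u / (u - 1) ∉ S)
    (hx : x ∈ rI S T) : u * x ∈ rI S T := by
  obtain ⟨h0, hT, hS⟩ := hx
  have hu0 := R.Une hu
  have hu10 := R.Une hu1
  have huxT : u * x ∉ T := by rw [mul_comm]; exact R.notT_mul hT (R.UT hu)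
  by_contra hcon
  obtain ⟨-, -, hS2⟩ := R.inv_mem_I (mul_ne_zero hu0 h0) huxT hcon
  set s1 := 1 + x with hs1
  set s2 := 1 + (u * x)⁻¹ with hs2
  have hs10 := R.Sne hS
  have hux : u * x * s2 = 1 + u * x := by
    rw [hs2]; field_simp; ring
  have key : 1 + (-1) * (s2 / s1) * x = (u - 1) / (u * s1) := by
    field_simp
    have : u * s1 - u * x * s2 = u - 1 := by rw [hux, hs1]; ring
    linear_combination this
  have hc : (-1) * (s2 / s1) ∈ T := R.Tmul (R.UT R.Uneg) (R.ST (R.Sdiv hS2 hS))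
  have hz : (-1) * (s2 / s1) * x ∉ T := by rw [mul_comm]; exact R.notT_mul hT hc
  have hzT : 1 + (-1) * (s2 / s1) * x ∈ T := by
    rw [key, div_eq_mul_inv]
    exact R.Tmul (R.UT hu1) (R.Tinv (R.Tmul (R.UT hu) (R.ST hS)))
  have h3 := R.mem_S_of_T (mul_ne_zero (R.Tne hc) h0) hz hzT
  rw [key] at h3
  apply hus
  have := R.Sinv (R.Smul h3 hS)
  have h4 : ((u - 1) / (u * s1) * s1)⁻¹ = u / (u - 1) := by field_simp
  rwa [h4] at this

lemma U_mul {u x : F} (hu : u ∈ U) (hx : x ∈ rI S T) : u * x ∈ rI S T := by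
  rcases R.good u hu with ⟨h1, h2⟩ | ⟨g, h, hg, hh, rfl, ⟨h1, h2⟩, h3, h4⟩
  · exact R.good_mul hu h1 h2 hx
  · rw [mul_assoc]
    exact R.good_mul hg h1 h2 (R.good_mul hh h3 h4 hx)

lemma neg_mem_I {x : F} (hx : x ∈ rI S T) : -x ∈ rI S T := by
  have := R.U_mul R.Uneg hx
  rwa [neg_one_mul] at this

lemma exists_good : ∃ u ∈ U, u - 1 ∈ U ∧ u / (u - 1) ∉ S := by
  rcases R.good 1 R.U1 with ⟨h1, _⟩ | ⟨g, h, hg, hh, _, h1, h3⟩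
  · simp only [sub_self] at h1
    exact absurd rfl (R.Une h1)
  · exact ⟨g, hg, h1⟩

lemma exists_nonpower : ∃ a ∈ U, a - 1 ∈ U ∧ a ∉ S := by
  obtain ⟨u, hu, hu1, hus⟩ := R.exists_good
  have h1 := R.Une hu1
  refine ⟨u / (u - 1), ?_, ?_, hus⟩
  · rw [div_eq_mul_inv]; exact R.Umul hu (R.Uinv hu1)
  · have : u / (u - 1) - 1 = (u - 1)⁻¹ := by field_simp; ring
    rw [this]; exact R.Uinv hu1

lemma I_sub_J : rI S T ⊆ rJ S U := fun _ hx _ hu => (R.U_mul hu hx).2.2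

lemma J_U {u x : F} (hu : u ∈ U) (hx : x ∈ rJ S U) : u * x ∈ rJ S U := by
  intro u' hu'
  rw [← mul_assoc]; exact hx _ (R.Umul hu' hu)

lemma P_step {a x y : F} (ha : a ∈ U) (hx : x ∈ rI S T) (hy : y ∈ rJ S U) :
    1 + x * y ∈ S ∨ (1 + x * y) / (-1 * a * x) ∈ S := by
  have h1 : 1 + a * x ∈ S := (R.U_mul ha hx).2.2
  have h2 : 1 + (-1) * a⁻¹ * y ∈ S := hy _ (R.Umul R.Uneg (R.Uinv ha))
  have ha0 := R.Une ha
  have hx0 := hx.1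
  set s1 := 1 + a * x with hs1
  set s2 := 1 + (-1) * a⁻¹ * y with hs2
  have hs10 := R.Sne h1
  have hs20 := R.Sne h2
  have e1 : 1 + x * y = s1 + (-1) * a * x * s2 := by
    rw [hs1, hs2]; field_simp; ring
  set c := (-1) * a * (s2 / s1) with hc
  have hcT : c ∈ T := R.Tmul (R.UT (R.Umul R.Uneg ha)) (R.ST (R.Sdiv h2 h1))
  have e2 : 1 + x * y = s1 * (1 + x * c) := by
    rw [e1, hc]; field_simp
  rcases R.rig (x * c) (mul_ne_zero hx0 (R.Tne hcT)) (R.notT_mul hx.2.1 hcT) with h | h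
  · left; rw [e2]; exact R.Smul h1 h
  · right
    have : (1 + x * y) / (-1 * a * x) = s2 * ((1 + x * c) / (x * c)) := by
      rw [e2, hc]; field_simp
    rw [this]; exact R.Smul h2 h

lemma P {x y : F} (hx : x ∈ rI S T) (hy : y ∈ rJ S U) : 1 + x * y ∈ S := by
  obtain ⟨a, ha, -, haS⟩ := R.exists_nonpower
  rcases R.P_step ha hx hy with h | h
  · exact h
  rcases R.P_step R.U1 hx hy with h' | h'
  · exact h'
  exfalso
  apply haS
  have := R.Sdiv h' h
  have hx0 := hx.1
  have ha0 := R.Une ha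
  have hne : 1 + x * y ≠ 0 := by
    intro h0; rw [h0, zero_div] at h; exact R.S0 h
  have e : (1 + x * y) / (-1 * 1 * x) / ((1 + x * y) / (-1 * a * x)) = a := by
    field_simp
  rwa [e] at this

lemma IJ {x y : F} (hx : x ∈ rI S T) (hy : y ∈ rJ S U) : x * y ∈ rJ S U := by
  intro u hu
  rw [← mul_assoc]
  exact R.P (R.U_mul hu hx) hy

lemma J_notT {x : F} (hx : x ∈ rJ S U) (h0 : x ≠ 0) (hT : x ∉ T) : x ∈ rI S T :=
  ⟨h0, hT, by simpa using hx 1 R.U1⟩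

lemma div_mem {x y : F} (hy : y ∈ rI S T) (hx : x ∈ rJ S U) : y / (1 + x) ∈ rI S T := by
  have hs : 1 + x ∈ S := by simpa using hx 1 R.U1
  have hs0 := R.Sne hs
  have hy0 := hy.1
  have hT : y / (1 + x) ∉ T := by
    rw [div_eq_mul_inv]; exact R.notT_mul hy.2.1 (R.Tinv (R.ST hs))
  by_contra hcon
  have h1 := R.inv_mem_I (div_ne_zero hy0 hs0) hT hcon
  obtain ⟨a, ha, ha1, haS⟩ := R.exists_nonpower
  have h2 := R.P (R.U_mul ha1 h1) (R.I_sub_J hy)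
  have e : 1 + (a - 1) * (y / (1 + x))⁻¹ * y = a * (1 + ((a - 1) * a⁻¹) * x) := by
    have ha0 := R.Une ha
    field_simp; ring
  rw [e] at h2
  have h3 := hx _ (R.Umul ha1 (R.Uinv ha))
  apply haS
  have h4 := R.Sdiv h2 h3
  rwa [mul_div_assoc, div_self (R.Sne h3), mul_one] at h4

lemma J_add {x y : F} (hx : x ∈ rJ S U) (hy : y ∈ rI S T) : y + x ∈ rJ S U := by
  intro u hu
  have h1 := R.div_mem (R.U_mul hu hy) (R.J_U hu hx)
  have h2 := hx u hu
  have e : 1 + u * (y + x) = (1 + u * x) * (1 + u * y / (1 + u * x)) := by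
    have := R.Sne h2
    field_simp; ring
  rw [e]; exact R.Smul h2 h1.2.2

lemma J_zero : (0 : F) ∈ rJ S U := fun u _ => by simpa using R.S1

lemma closure_sub_J {x : F} (hx : x ∈ AddSubgroup.closure (rI S T)) : x ∈ rJ S U := by
  induction hx using AddSubgroup.closure_induction_left with
  | zero => exact R.J_zero
  | add_left y hy x _ ih => exact R.J_add ih hy
  | neg_add_cancel y hy x _ ih => exact R.J_add ih (R.neg_mem_I hy)

lemma II {x y : F} (hx : x ∈ rI S T) (hy : y ∈ rI S T) :
    x * y ∈ AddSubgroup.closure (rI S T) := by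
  have hyJ := R.I_sub_J hy
  have hs : 1 + y ∈ S := hy.2.2
  have hs0 := R.Sne hs
  have h1 := R.div_mem (R.neg_mem_I hy) hyJ
  have h2 := R.div_mem hx (R.I_sub_J h1)
  have e : x / (1 + -y / (1 + y)) = x * (1 + y) := by
    have : 1 + -y / (1 + y) = 1 / (1 + y) := by field_simp; ring
    rw [this]; field_simp
  rw [e] at h2
  have e2 : x * y = x * (1 + y) - x := by ring
  rw [e2]
  exact sub_mem (AddSubgroup.subset_closure h2) (AddSubgroup.subset_closure hx)

lemma mul_closure {x y : F} (hx : ∀ y ∈ rI S T, x * y ∈ AddSubgroup.closure (rI S T))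
    (hy : y ∈ AddSubgroup.closure (rI S T)) : x * y ∈ AddSubgroup.closure (rI S T) := by
  induction hy using AddSubgroup.closure_induction with
  | mem y hy => exact hx y hy
  | zero => rw [mul_zero]; exact zero_mem _
  | add a b _ _ ha hb => rw [mul_add]; exact add_mem ha hb
  | neg a _ ha => rw [mul_neg]; exact neg_mem ha

lemma not_both {a : F} (h0 : a ≠ 0) (h1 : a ∈ rJ S U) (h2 : a⁻¹ ∈ rJ S U) : False := by
  obtain ⟨b, hb, -, hbS⟩ := R.exists_nonpower
  have key : ∀ u ∈ U, u * a ∈ S := by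
    intro u hu
    have h3 := h1 u hu
    have h4 := h2 _ (R.Uinv hu)
    have hu0 := R.Une hu
    have e : (1 + u * a) / (1 + u⁻¹ * a⁻¹) = u * a := by
      have h5 := R.Sne h3
      have : 1 + u⁻¹ * a⁻¹ = (1 + u * a) / (u * a) := by field_simp; ring
      rw [this]; field_simp
    rw [← e]; exact R.Sdiv h3 h4
  apply hbS
  have h3 := R.Sdiv (key b hb) (key 1 R.U1)
  have e : b * a / (1 * a) = b := by field_simp
  rwa [e] at h3

/-- The valuation ring attached to rigid elements. -/
theorem exists_valuationSubring : ∃ O : ValuationSubring F,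
    (∀ x, x ∈ O ↔ ∀ y ∈ rI S T, x * y ∈ AddSubgroup.closure (rI S T)) ∧
    (∀ x ∈ U, x ∈ O) ∧ (∀ x ∈ rJ S U, x ∈ O) ∧ (∀ x ∈ rI S T, x⁻¹ ∉ O) ∧
    (∀ x, x ≠ 0 → x ∈ O → x⁻¹ ∈ O → x ∈ T) ∧
    (∀ f, f ≠ 0 → f ∈ O → f⁻¹ ∉ O → f ∈ T →
      ∃ z, z ≠ 0 ∧ z ∉ T ∧ z ∈ O ∧ f / z ∈ O ∧ (f / z)⁻¹ ∉ O) := by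
  have hInO : ∀ x ∈ rI S T, ∀ y ∈ rI S T, x * y ∈ AddSubgroup.closure (rI S T) :=
    fun x hx y hy => R.II hx hy
  have hone : (1 : F) ∉ AddSubgroup.closure (rI S T) := by
    intro h
    have := R.closure_sub_J h (-1) R.Uneg
    simp only [mul_one, add_neg_cancel] at this
    exact R.S0 this
  have hinvI : ∀ x ∈ rI S T, ¬ ∀ y ∈ rI S T, x⁻¹ * y ∈ AddSubgroup.closure (rI S T) := by
    intro x hx h
    have := h x hx
    rw [inv_mul_cancel₀ hx.1] at this
    exact hone this
  let O : ValuationSubring F :=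
    { carrier := {x | ∀ y ∈ rI S T, x * y ∈ AddSubgroup.closure (rI S T)}
      mul_mem' := by
        intro a b ha hb y hy
        rw [mul_assoc]
        exact R.mul_closure ha (hb y hy)
      one_mem' := by
        intro y hy
        rw [one_mul]; exact AddSubgroup.subset_closure hy
      add_mem' := by
        intro a b ha hb y hy
        rw [add_mul]; exact add_mem (ha y hy) (hb y hy)
      zero_mem' := by
        intro y hy
        rw [zero_mul]; exact zero_mem _
      neg_mem' := by
        intro a ha y hy
        rw [neg_mul]; exact neg_mem (ha y hy)
      mem_or_inv_mem' := by
        intro x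
        by_cases h0 : x = 0
        · left; intro y hy; rw [h0, zero_mul]; exact zero_mem _
        by_cases hT : x ∈ T
        · by_contra hcon
          push Not at hcon
          obtain ⟨h1, h2⟩ := hcon
          simp only [Set.mem_setOf_eq] at h1 h2
          push Not at h1 h2
          obtain ⟨y, hy, hxy⟩ := h1
          obtain ⟨z, hz, hxz⟩ := h2
          have hy' : (x * y)⁻¹ ∈ rI S T := by
            apply R.inv_mem_I (mul_ne_zero h0 hy.1)
            · rw [mul_comm]; exact R.notT_mul hy.2.1 hT
            · exact fun h => hxy (AddSubgroup.subset_closure h)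
          have hz' : (x⁻¹ * z)⁻¹ ∈ rI S T := by
            apply R.inv_mem_I (mul_ne_zero (inv_ne_zero h0) hz.1)
            · rw [mul_comm]; exact R.notT_mul hz.2.1 (R.Tinv hT)
            · exact fun h => hxz (AddSubgroup.subset_closure h)
          have h3 := R.IJ hy' (R.I_sub_J hz')
          have h4 := R.IJ hy (R.I_sub_J hz)
          refine R.not_both (mul_ne_zero hy.1 hz.1) h4 ?_
          have hy0 := hy.1
          have hz0 := hz.1
          have e : (x * y)⁻¹ * (x⁻¹ * z)⁻¹ = (y * z)⁻¹ := by field_simp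
          rwa [e] at h3
        · by_cases hI : x ∈ rI S T
          · left; exact hInO x hI
          · right; exact hInO _ (R.inv_mem_I h0 hT hI) }
  have hO : ∀ x, x ∈ O ↔ ∀ y ∈ rI S T, x * y ∈ AddSubgroup.closure (rI S T) := fun x => Iff.rfl
  refine ⟨O, hO, ?_, ?_, ?_, ?_, ?_⟩
  · intro x hx y hy
    exact AddSubgroup.subset_closure (R.U_mul hx hy)
  · intro x hx y hy
    by_cases h0 : x = 0
    · rw [h0, zero_mul]; exact zero_mem _
    by_cases hT : x ∈ T
    · apply AddSubgroup.subset_closure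
      rw [mul_comm]
      exact R.J_notT (R.IJ hy hx) (mul_ne_zero hy.1 h0) (R.notT_mul hy.2.1 hT)
    · exact R.II (R.J_notT hx h0 hT) hy
  · exact hinvI
  · intro x h0 h1 h2
    by_contra hT
    by_cases hI : x ∈ rI S T
    · exact hinvI x hI h2
    · have := R.inv_mem_I h0 hT hI
      apply hinvI _ this
      rw [inv_inv]; exact h1
  · intro f h0 hf hfi hT
    rw [hO] at hfi
    push Not at hfi
    obtain ⟨y, hy, hfy⟩ := hfi
    have h3 : (f⁻¹ * y)⁻¹ ∈ rI S T := by
      apply R.inv_mem_I (mul_ne_zero (inv_ne_zero h0) hy.1)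
      · rw [mul_comm]; exact R.notT_mul hy.2.1 (R.Tinv hT)
      · exact fun h => hfy (AddSubgroup.subset_closure h)
    have e : (f⁻¹ * y)⁻¹ = f / y := by rw [mul_inv, inv_inv, div_eq_mul_inv]
    rw [e] at h3
    exact ⟨y, hy.1, hy.2.1, hInO y hy, hInO _ h3, hinvI _ h3⟩

end Rigid
end rigid
end PAC
end Part2

section Part3
open Polynomial
open scoped IntermediateField

namespace PAC

section res
variable {K : Type*} (F : Type*) {Ω : Type*} [Field K] [Field F] [Field Ω] [Algebra K F] [Algebra F Ω]
    [Algebra K Ω] [IsScalarTower K F Ω]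

/-- `x` is fixed by all automorphisms over `F` fixing `L` pointwise. -/
def Fx (L : IntermediateField K Ω) (x : Ω) : Prop :=
  ∀ σ : Ω ≃ₐ[F] Ω, (∀ a ∈ L, σ a = a) → σ x = x

variable (K Ω) in
/-- The consequences of the isomorphism of absolute Galois groups which are used. -/
structure ResData : Prop where
  r1 : ∀ L : IntermediateField K Ω, L ≤ algebraicClosure K Ω → ∀ x, IsAlgebraic K x →
    Fx F L x → x ∈ L
  r2 : ∀ L : IntermediateField K Ω, L ≤ algebraicClosure K Ω → ∀ x, x ≠ 0 → Fx F L x → ∀ n : ℕ,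
    0 < n → ∃ c ∈ L, ∃ t, c ≠ 0 ∧ t ≠ 0 ∧ Fx F L t ∧ x = c * t ^ n
  r3 : ∀ x : Ω, ∃ s : Finset Ω, (∀ a ∈ s, IsAlgebraic K a) ∧ x ∈ IntermediateField.adjoin F (s : Set Ω)
  lift : ∀ x y : Ω, IsAlgebraic K x → ∀ L : IntermediateField K Ω, L ≤ algebraicClosure K Ω →
    aeval y (minpoly L x) = 0 → ∃ σ : Ω ≃ₐ[F] Ω, (∀ a ∈ L, σ a = a) ∧ σ x = y

variable {F}
variable [IsAlgClosed Ω] [Algebra.IsAlgebraic F Ω] [CharZero K]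

theorem resData_of_bijective (hres : Function.Bijective
      (fun σ : Ω ≃ₐ[F] Ω =>
        AlgEquiv.restrictNormal (σ.restrictScalars K) (separableClosure K Ω))) :
    ResData K F Ω := by
  have : CharZero F := charZero_of_injective_algebraMap (algebraMap K F).injective
  have : IsAlgClosure F Ω := ⟨inferInstance, inferInstance⟩
  have : Normal F Ω := IsAlgClosure.normal F Ω
  have hGal : IsGalois F Ω := ⟨⟩
  have hA : ∀ x : Ω, x ∈ separableClosure K Ω ↔ IsAlgebraic K x := by
    intro x
    rw [mem_separableClosure_iff]
    exact ⟨fun h => h.isIntegral.isAlgebraic, fun h => (minpoly.irreducible h.isIntegral).separable⟩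
  have hcomm : ∀ (σ : Ω ≃ₐ[F] Ω) (a : separableClosure K Ω),
      ((AlgEquiv.restrictNormal (σ.restrictScalars K) (separableClosure K Ω) a :
        separableClosure K Ω) : Ω) = σ a := by
    intro σ a
    exact AlgEquiv.restrictNormal_commutes (σ.restrictScalars K) (separableClosure K Ω) a
  have hle : algebraicClosure K Ω ≤ separableClosure K Ω := fun x hx =>
    (hA x).2 (mem_algebraicClosure_iff.1 hx)
  have r1 : ∀ L : IntermediateField K Ω, L ≤ algebraicClosure K Ω → ∀ x, IsAlgebraic K x →
    Fx F L x → x ∈ L := by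
    intro L hL x hx hfix
    have hxA := (hA x).2 hx
    set L' : IntermediateField K (separableClosure K Ω) := L.comap (separableClosure K Ω).val
    have h1 : (⟨x, hxA⟩ : separableClosure K Ω) ∈ IntermediateField.fixedField L'.fixingSubgroup := by
      rintro ⟨τ, hτ⟩
      obtain ⟨σ, rfl⟩ := hres.2 τ
      apply Subtype.ext
      rw [Subgroup.smul_def, AlgEquiv.smul_def]
      change ((AlgEquiv.restrictNormal (σ.restrictScalars K) (separableClosure K Ω) ⟨x, hxA⟩ :
        separableClosure K Ω) : Ω) = x
      rw [hcomm]
      apply hfix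
      intro a ha
      rw [← hcomm σ ⟨a, hle (hL ha)⟩]
      have := (IntermediateField.mem_fixingSubgroup_iff L' _).1 hτ ⟨a, hle (hL ha)⟩ ha
      exact congrArg Subtype.val this
    rw [InfiniteGalois.fixedField_fixingSubgroup] at h1
    exact h1
  have htop : IntermediateField.adjoin F (separableClosure K Ω : Set Ω) = ⊤ := by
    rw [← InfiniteGalois.fixedField_fixingSubgroup (IntermediateField.adjoin F _)]
    have : (IntermediateField.adjoin F (separableClosure K Ω : Set Ω)).fixingSubgroup = ⊥ := by
      rw [eq_bot_iff]
      intro σ hσ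
      rw [Subgroup.mem_bot]
      apply hres.1
      apply AlgEquiv.ext
      intro a
      apply Subtype.ext
      simp only [hcomm]
      exact (IntermediateField.mem_fixingSubgroup_iff _ _).1 hσ a
        (IntermediateField.subset_adjoin F _ a.2)
    rw [this, IntermediateField.fixedField_bot]
  have hspan : (⊤ : Submodule (separableClosure K Ω) Ω) ≤
      Submodule.span (separableClosure K Ω) (Set.range (algebraMap F Ω)) := by
    intro x _
    have hx : x ∈ Algebra.adjoin F (separableClosure K Ω : Set Ω) := by
      have h1 : x ∈ (IntermediateField.adjoin F (separableClosure K Ω : Set Ω)).toSubalgebra := by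
        rw [htop]; trivial
      rwa [IntermediateField.adjoin_toSubalgebra_of_isAlgebraic
        (fun a _ => Algebra.IsAlgebraic.isAlgebraic a)] at h1
    have hmul : ∀ a b, a ∈ Submodule.span (separableClosure K Ω) (Set.range (algebraMap F Ω)) →
        b ∈ Submodule.span (separableClosure K Ω) (Set.range (algebraMap F Ω)) →
        a * b ∈ Submodule.span (separableClosure K Ω) (Set.range (algebraMap F Ω)) := by
      intro a b ha hb
      have := Submodule.mul_mem_mul ha hb
      rw [Submodule.span_mul_span] at this
      refine Submodule.span_mono ?_ this
      rintro _ ⟨_, ⟨u, rfl⟩, _, ⟨v, rfl⟩, rfl⟩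
      exact ⟨u * v, map_mul _ _ _⟩
    induction hx using Algebra.adjoin_induction with
    | mem a ha =>
      have : a = (⟨a, ha⟩ : separableClosure K Ω) • (1 : Ω) := by
        rw [Algebra.smul_def, mul_one]; rfl
      rw [this]
      exact Submodule.smul_mem _ _ (Submodule.subset_span ⟨1, map_one _⟩)
    | algebraMap r => exact Submodule.subset_span ⟨r, rfl⟩
    | add a b _ _ h1 h2 => exact add_mem (h1 trivial) (h2 trivial)
    | mul a b _ _ h1 h2 => exact hmul a b (h1 trivial) (h2 trivial)
  let B := Module.Basis.ofSpan hspan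
  have hB : ∀ i, ∃ f, algebraMap F Ω f = B i := fun i =>
    Module.Basis.ofSpan_subset hspan ⟨i, rfl⟩
  have hrepr : ∀ (σ : Ω ≃ₐ[F] Ω) y i, ((B.repr (σ y) i : separableClosure K Ω) : Ω)
      = σ (B.repr y i : separableClosure K Ω) := by
    intro σ y i
    set τ := AlgEquiv.restrictNormal (σ.restrictScalars K) (separableClosure K Ω) with hτ
    have h1 : σ y = ((B.repr y).mapRange τ (map_zero τ)).sum (fun i a => a • B i) := by
      conv_lhs => rw [← B.linearCombination_repr y, Finsupp.linearCombination_apply]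
      rw [Finsupp.sum_mapRange_index (by simp), map_finsuppSum]
      apply Finsupp.sum_congr
      intro j _
      obtain ⟨f, hf⟩ := hB j
      rw [Algebra.smul_def, Algebra.smul_def, map_mul, ← hf, AlgEquiv.commutes]
      congr 1
      exact (hcomm σ _).symm
    have h2 : B.repr (σ y) = (B.repr y).mapRange τ (map_zero τ) := by
      rw [h1, ← Finsupp.linearCombination_apply, B.repr_linearCombination]
    rw [h2, Finsupp.mapRange_apply]
    exact hcomm σ _
  refine ⟨r1, ?_, ?_, ?_⟩
  · intro L hL x hx0 hfix n hn
    obtain ⟨y, hy⟩ := IsAlgClosed.exists_pow_nat_eq x hn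
    have hy0 : y ≠ 0 := by rintro rfl; rw [zero_pow hn.ne'] at hy; exact hx0 hy.symm
    have hne : B.repr y ≠ 0 := by simpa using hy0
    obtain ⟨i, hi⟩ := Finsupp.ne_iff.1 hne
    set a : Ω := ((B.repr y i : separableClosure K Ω) : Ω) with ha
    have ha0 : a ≠ 0 := by
      simpa [ha] using hi
    have key : ∀ σ : Ω ≃ₐ[F] Ω, (∀ a ∈ L, σ a = a) → ∃ χ : Ω, χ ^ n = 1 ∧ σ y = χ * y ∧
        σ a = χ * a := by
      intro σ hσ
      have hχ : (σ y / y) ^ n = 1 := by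
        rw [div_pow, ← map_pow, hy, hfix σ hσ, div_self hx0]
      have hχA : σ y / y ∈ separableClosure K Ω := by
        rw [hA]
        exact ⟨X ^ n - 1, X_pow_sub_C_ne_zero hn 1, by simp [hχ]⟩
      refine ⟨σ y / y, hχ, by field_simp, ?_⟩
      have h1 : σ y = (⟨σ y / y, hχA⟩ : separableClosure K Ω) • y := by
        rw [Algebra.smul_def]
        change σ y = σ y / y * y
        field_simp
      have h2 := hrepr σ y i
      rw [h1, map_smul, Finsupp.smul_apply, smul_eq_mul] at h2
      rw [ha, ← h2]
      rfl
    refine ⟨a ^ n, ?_, y / a, pow_ne_zero n ha0, div_ne_zero hy0 ha0, ?_, ?_⟩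
    · apply r1 L hL
      · exact ((hA a).1 (B.repr y i).2).pow n
      · intro σ hσ
        obtain ⟨χ, h1, h2, h3⟩ := key σ hσ
        rw [map_pow, h3, mul_pow, h1, one_mul]
    · intro σ hσ
      obtain ⟨χ, h1, h2, h3⟩ := key σ hσ
      have : χ ≠ 0 := by rintro rfl; rw [zero_pow hn.ne'] at h1; exact zero_ne_one h1
      rw [map_div₀, h2, h3]; field_simp
    · rw [div_pow, hy]; field_simp
  · intro x
    have : x ∈ IntermediateField.adjoin F (separableClosure K Ω : Set Ω) := by rw [htop]; trivial
    obtain ⟨s, hs, hx⟩ := IntermediateField.exists_finset_of_mem_adjoin this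
    exact ⟨s, fun a ha => (hA a).1 (hs ha), hx⟩
  · intro x y hx L hL hxy
    classical
    have hfin : (Set.range (fun σ : {σ : Ω ≃ₐ[F] Ω // ∀ a ∈ L, σ a = a} => σ.1 x)).Finite := by
      refine Set.Finite.subset ((minpoly K x).aroots Ω).toFinset.finite_toSet ?_
      rintro _ ⟨σ, rfl⟩
      simp only [Finset.mem_coe, Multiset.mem_toFinset]
      rw [mem_aroots]
      refine ⟨minpoly.ne_zero hx.isIntegral, ?_⟩
      have := aeval_algHom_apply ((σ.1.restrictScalars K) : Ω →ₐ[K] Ω) x (minpoly K x)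
      rw [minpoly.aeval, map_zero] at this
      exact this
    set O := hfin.toFinset with hO
    have hmem : ∀ r, r ∈ O ↔ ∃ σ : Ω ≃ₐ[F] Ω, (∀ a ∈ L, σ a = a) ∧ σ x = r := by
      intro r; simp [hO]
    set q : Polynomial Ω := ∏ r ∈ O, (X - C r) with hq
    have hcoeff : ∀ n, q.coeff n ∈ L := by
      intro n
      apply r1 L hL
      · rw [← hA]
        have : q ∈ Polynomial.lifts (algebraMap (separableClosure K Ω) Ω) := by
          apply Subsemiring.prod_mem
          intro r hr
          have hr' : r ∈ separableClosure K Ω := by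
            rw [hA]
            obtain ⟨σ, _, rfl⟩ := (hmem r).1 hr
            exact hx.algHom ((σ.restrictScalars K) : Ω →ₐ[K] Ω)
          exact ⟨X - C ⟨r, hr'⟩, by simp⟩
        obtain ⟨z, hz⟩ := (Polynomial.lifts_iff_coeff_lifts q).1 this n
        rw [← hz]; exact z.2
      · intro σ hσ
        have : q.map (σ : Ω →+* Ω) = q := by
          rw [hq, Polynomial.map_prod]
          refine Finset.prod_bij (fun r _ => σ r) ?_ ?_ ?_ ?_
          · intro r hr
            obtain ⟨τ, h1, rfl⟩ := (hmem r).1 hr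
            exact (hmem _).2 ⟨σ * τ, fun a ha => by
              rw [AlgEquiv.mul_apply, h1 a ha, hσ a ha], rfl⟩
          · intro a _ b _ h; exact σ.injective h
          · intro r hr
            obtain ⟨τ, h1, rfl⟩ := (hmem r).1 hr
            refine ⟨σ⁻¹ (τ x), (hmem _).2 ⟨σ⁻¹ * τ, fun a ha => ?_, rfl⟩, ?_⟩
            · rw [AlgEquiv.mul_apply, h1 a ha]
              apply σ.injective
              rw [hσ a ha]; exact σ.apply_symm_apply a
            · exact σ.apply_symm_apply _
          · intro r hr; simp
        conv_rhs => rw [← this]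
        rw [coeff_map]; rfl
    have hlift : q ∈ Polynomial.lifts (algebraMap L Ω) := by
      rw [Polynomial.lifts_iff_coeff_lifts]
      intro n
      exact ⟨⟨_, hcoeff n⟩, rfl⟩
    obtain ⟨Q, hQ⟩ := hlift
    have hQ : Q.map (algebraMap L Ω) = q := hQ
    have hQx : aeval x Q = 0 := by
      rw [aeval_def, eval₂_eq_eval_map, hQ, hq, eval_prod]
      exact Finset.prod_eq_zero ((hmem x).2 ⟨1, fun _ _ => rfl, rfl⟩) (by simp)
    obtain ⟨R, hR⟩ := minpoly.dvd L x hQx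
    have hQy : aeval y Q = 0 := by rw [hR, map_mul, hxy, zero_mul]
    rw [aeval_def, eval₂_eq_eval_map, hQ, hq, eval_prod, Finset.prod_eq_zero_iff] at hQy
    obtain ⟨r, hr, h0⟩ := hQy
    simp only [eval_sub, eval_X, eval_C, sub_eq_zero] at h0
    subst h0
    exact (hmem y).1 hr

end res
end PAC
end Part3

section Part4
open Polynomial
open scoped IntermediateField

namespace PAC

section FF
variable {k : Type*} [Field k] [Fintype k] [DecidableEq k]

open Classical in
lemma ff_card (l : ℕ) (hl : l.Prime) (ζ : k) (h1 : ζ ≠ 1) (h2 : ζ ^ l = 1) :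
    l * (Finset.univ.filter (fun a : k => a ≠ 0 ∧ ∃ b, b ^ l = a)).card = Fintype.card k - 1 := by
  have hζ0 : ζ ≠ 0 := by rintro rfl; rw [zero_pow hl.ne_zero] at h2; exact zero_ne_one h2
  have h3 : orderOf (Units.mk0 ζ hζ0) = l := by
    have : Fact l.Prime := ⟨hl⟩
    apply orderOf_eq_prime
    · ext; simpa using h2
    · intro h; apply h1; simpa using congrArg Units.val h
  have h4 : l ∣ Nat.card kˣ := h3 ▸ orderOf_dvd_natCard _
  have h5 := IsCyclic.card_powMonoidHom_range (G := kˣ) l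
  rw [Nat.gcd_eq_right h4] at h5
  rw [← Fintype.card_units, ← Nat.card_eq_fintype_card (α := kˣ), ← Nat.mul_div_cancel' h4]
  congr 1
  rw [← h5, Nat.card_eq_fintype_card, Fintype.card_of_subtype
    ((Finset.univ.filter (fun a : k => a ≠ 0 ∧ ∃ b, b ^ l = a)).attach.image
      (fun a => Units.mk0 a.1 (Finset.mem_filter.1 a.2).2.1))]
  · rw [Finset.card_image_of_injective, Finset.card_attach]
    intro a b h
    apply Subtype.ext
    exact congrArg Units.val h
  · intro x
    simp only [Finset.mem_image, Finset.mem_attach, true_and, Subtype.exists, Finset.mem_filter,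
      Finset.mem_univ, MonoidHom.mem_range, powMonoidHom_apply]
    constructor
    · rintro ⟨a, ⟨h0, b, rfl⟩, rfl⟩
      have : b ≠ 0 := by rintro rfl; exact h0 (zero_pow hl.ne_zero)
      exact ⟨Units.mk0 b this, by ext; simp⟩
    · rintro ⟨y, rfl⟩
      exact ⟨(y : k) ^ l, ⟨pow_ne_zero _ y.ne_zero, y, rfl⟩, by ext; simp⟩

open Classical in
lemma ff_card' (l : ℕ) (hl : l.Prime) (ζ : k) (h1 : ζ ≠ 1) (h2 : ζ ^ l = 1) :
    (Finset.univ.filter (fun a : k => a ≠ 0 ∧ ¬ ∃ b, b ^ l = a)).card =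
      (l - 1) * (Finset.univ.filter (fun a : k => a ≠ 0 ∧ ∃ b, b ^ l = a)).card := by
  have h := ff_card l hl ζ h1 h2
  have h3 : (Finset.univ.filter (fun a : k => a ≠ 0)).card = Fintype.card k - 1 := by
    rw [Finset.filter_ne', Finset.card_erase_of_mem (Finset.mem_univ _), Finset.card_univ]
  have h4 := Finset.card_filter_add_card_filter_not (s := Finset.univ.filter (fun a : k => a ≠ 0))
    (fun a => ∃ b, b ^ l = a)
  rw [Finset.filter_filter, Finset.filter_filter, h3, ← h] at h4
  rw [Nat.sub_mul, one_mul]; omega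

open Classical in
lemma ff_good (l : ℕ) (hl : l.Prime) (ζ : k) (h1 : ζ ≠ 1) (h2 : ζ ^ l = 1) (a : k) (ha : a ≠ 0) :
    (a ≠ 1 ∧ ¬ ∃ b, b ^ l = a / (a - 1)) ∨ ∃ g h : k, g ≠ 0 ∧ h ≠ 0 ∧ a = g * h ∧
    (g ≠ 1 ∧ ¬ ∃ b, b ^ l = g / (g - 1)) ∧ (h ≠ 1 ∧ ¬ ∃ b, b ^ l = h / (h - 1)) := by
  set G := Finset.univ.filter (fun a : k => a ≠ 0 ∧ a ≠ 1 ∧ ¬ ∃ b, b ^ l = a / (a - 1)) with hG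
  have hcard : G.card = (Finset.univ.filter (fun a : k => a ≠ 0 ∧ ¬ ∃ b, b ^ l = a)).card := by
    refine Finset.card_bij' (fun a _ => a / (a - 1)) (fun a _ => a / (a - 1)) ?_ ?_ ?_ ?_
    · intro x hx
      simp only [hG, Finset.mem_filter, Finset.mem_univ, true_and] at hx ⊢
      exact ⟨div_ne_zero hx.1 (sub_ne_zero.2 hx.2.1), hx.2.2⟩
    · intro x hx
      simp only [hG, Finset.mem_filter, Finset.mem_univ, true_and] at hx ⊢
      have hx1 : x ≠ 1 := by rintro rfl; exact hx.2 ⟨1, one_pow _⟩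
      have hx2 : x - 1 ≠ 0 := sub_ne_zero.2 hx1
      have e : x / (x - 1) / (x / (x - 1) - 1) = x := by
        rw [div_sub_one hx2]; field_simp; ring
      refine ⟨div_ne_zero hx.1 hx2, ?_, ?_⟩
      · intro h; rw [div_eq_one_iff_eq hx2] at h; have := sub_eq_self.1 h.symm; exact one_ne_zero this
      · rw [e]; exact hx.2
    all_goals
      intro x hx
      simp only [hG, Finset.mem_filter, Finset.mem_univ, true_and] at hx ⊢
      have hx1 : x ≠ 1 := by
        first
        | exact hx.2.1
        | (rintro rfl; exact hx.2 ⟨1, one_pow _⟩)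
      have hx2 : x - 1 ≠ 0 := sub_ne_zero.2 hx1
      rw [div_sub_one hx2]; field_simp; ring
  by_contra hcon
  push Not at hcon
  obtain ⟨hc1, hc2⟩ := hcon
  have haG : a ∉ G := by
    simp only [hG, Finset.mem_filter, Finset.mem_univ, true_and, not_and, not_not]
    intro _ h; exact hc1 h
  have hinj : (G.image (fun g => a / g)).card = G.card := by
    apply Finset.card_image_of_injOn
    intro x hx y hy hxy
    simp only [hG, Finset.coe_filter, Finset.mem_univ, true_and] at hx hy
    have hx0 := hx.1
    have hy0 := hy.1
    simp only at hxy
    rw [div_eq_div_iff hx0 hy0] at hxy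
    exact (mul_left_cancel₀ ha hxy).symm
  have hdisj : Disjoint G (G.image (fun g => a / g)) := by
    rw [Finset.disjoint_left]
    intro x hx hx'
    obtain ⟨g, hg, rfl⟩ := Finset.mem_image.1 hx'
    simp only [hG, Finset.mem_filter, Finset.mem_univ, true_and] at hx hg
    obtain ⟨b, hb⟩ := hc2 g (a / g) hg.1 hx.1 (by rw [mul_div_cancel₀ _ hg.1]) ⟨hg.2.1, fun b hb => hg.2.2 ⟨b, hb⟩⟩ hx.2.1
    exact hx.2.2 ⟨b, hb⟩
  have hsub : G ∪ G.image (fun g => a / g) ⊆ (Finset.univ.erase (0 : k)).erase 1 := by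
    intro x hx
    rw [Finset.mem_union] at hx
    rcases hx with hx | hx
    · simp only [hG, Finset.mem_filter, Finset.mem_univ, true_and] at hx
      simp [hx.1, hx.2.1]
    · obtain ⟨g, hg, rfl⟩ := Finset.mem_image.1 hx
      have hg' := hg
      simp only [hG, Finset.mem_filter, Finset.mem_univ, true_and] at hg'
      simp only [Finset.mem_erase, Finset.mem_univ, and_true]
      refine ⟨?_, div_ne_zero ha hg'.1⟩
      intro h
      rw [div_eq_one_iff_eq hg'.1] at h
      exact haG (h ▸ hg)
  have h5 := Finset.card_le_card hsub
  rw [Finset.card_union_of_disjoint hdisj, hinj, hcard, ff_card' l hl ζ h1 h2,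
    Finset.card_erase_of_mem (by simp), Finset.card_erase_of_mem (Finset.mem_univ _),
    Finset.card_univ, ← ff_card l hl ζ h1 h2] at h5
  have hl2 := hl.two_le
  have hpos : 0 < (Finset.univ.filter (fun a : k => a ≠ 0 ∧ ∃ b, b ^ l = a)).card :=
    Finset.card_pos.2 ⟨1, by simpa using ⟨1, one_pow l⟩⟩
  obtain ⟨m, rfl⟩ := Nat.exists_eq_add_of_le hl2
  set n := (Finset.univ.filter (fun a : k => a ≠ 0 ∧ ∃ b, b ^ (2 + m) = a)).card
  have e1 : 2 + m - 1 = 1 + m := by omega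
  rw [e1] at h5
  have : (2 + m) * n ≤ (1 + m) * n + (1 + m) * n := by nlinarith
  have : 0 < (2 + m) * n := by positivity
  omega

open Classical in
lemma ff_three (ζ : k) (h1 : ζ ≠ 1) (h2 : ζ ^ 3 = 1) :
    ∃ u b : k, u ≠ 0 ∧ (¬ ∃ b, b ^ 3 = u) ∧ b ≠ 0 ∧ 1 + u = u ^ 2 * b ^ 3 := by
  by_contra hcon
  push Not at hcon
  set Q := (powMonoidHom 3 : kˣ →* kˣ).range with hQ
  have hζ0 : ζ ≠ 0 := by rintro rfl; norm_num at h2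
  have h3 : orderOf (Units.mk0 ζ hζ0) = 3 := by
    have : Fact (3 : ℕ).Prime := ⟨Nat.prime_three⟩
    apply orderOf_eq_prime
    · ext; simpa using h2
    · intro h; apply h1; simpa using congrArg Units.val h
  have hidx : Nat.card (kˣ ⧸ Q) = 3 := by
    have : Q.index = 3 := by
      rw [IsCyclic.index_powMonoidHom_range, Nat.gcd_eq_right]
      rw [← h3]; exact orderOf_dvd_natCard _
    exact this
  have hmemQ : ∀ x : kˣ, x ∈ Q ↔ ∃ b : k, b ^ 3 = x := by
    intro x
    rw [hQ, MonoidHom.mem_range]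
    constructor
    · rintro ⟨y, rfl⟩; exact ⟨y, by simp⟩
    · rintro ⟨b, hb⟩
      have : b ≠ 0 := by rintro rfl; exact x.ne_zero (by rw [← hb]; simp)
      exact ⟨Units.mk0 b this, by ext; simpa using hb⟩
  have htri : ∀ r x : k, r ≠ 0 → x ≠ 0 → (¬ ∃ b, b ^ 3 = r) →
      (∃ b, b ^ 3 = x) ∨ (∃ b, b ^ 3 = x / r) ∨ ∃ b, b ^ 3 = x / r ^ 2 := by
    intro r x hr hx hnr
    have : Fact (3 : ℕ).Prime := ⟨Nat.prime_three⟩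
    have hr1 : ((Units.mk0 r hr : kˣ) : kˣ ⧸ Q) ≠ 1 := by
      rw [Ne, QuotientGroup.eq_one_iff, hmemQ]; exact hnr
    obtain ⟨n, hn⟩ := mem_powers_of_prime_card (g' := ((Units.mk0 x hx : kˣ) : kˣ ⧸ Q)) hidx hr1
    have hpow : ∀ n : ℕ, ((Units.mk0 r hr : kˣ) : kˣ ⧸ Q) ^ n = ((Units.mk0 x hx : kˣ) : kˣ ⧸ Q) →
        ∃ b, b ^ 3 = x / r ^ n := by
      intro n hn
      rw [← QuotientGroup.mk_pow, QuotientGroup.eq, hmemQ] at hn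
      obtain ⟨b, hb⟩ := hn
      refine ⟨b, ?_⟩
      rw [hb]; simp [div_eq_inv_mul]
    simp only at hn
    rw [← pow_mod_natCard, hidx] at hn
    have := hpow _ hn
    have h3 : n % 3 < 3 := Nat.mod_lt _ (by norm_num)
    interval_cases n % 3
    · left; simpa using this
    · right; left; simpa using this
    · right; right; exact this
  have hrig : ∀ r : k, r ≠ 0 → (¬ ∃ b, b ^ 3 = r) → (∃ b, b ^ 3 = 1 + r) ∨ ∃ b, b ^ 3 = 1 + r⁻¹ := by
    intro r hr hnr
    have h0 : 1 + r ≠ 0 := by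
      intro h
      exact hnr ⟨-1, by linear_combination -h⟩
    rcases htri r (1 + r) hr h0 hnr with h | ⟨b, hb⟩ | ⟨b, hb⟩
    · exact Or.inl h
    · right; exact ⟨b, by rw [hb]; field_simp; ring⟩
    · exfalso
      have hb0 : b ≠ 0 := by
        rintro rfl
        rw [eq_comm, zero_pow (by norm_num), div_eq_zero_iff] at hb
        rcases hb with hb | hb
        · exact h0 hb
        · exact pow_ne_zero 2 hr hb
      exact hcon r b hr (fun b hb => hnr ⟨b, hb⟩) hb0 (by rw [hb]; field_simp)
  set P := Finset.univ.filter (fun a : k => a ≠ 0 ∧ ∃ b, b ^ 3 = a) with hP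
  set NP := Finset.univ.filter (fun a : k => a ≠ 0 ∧ ¬ ∃ b, b ^ 3 = a) with hNP
  have hc : NP.card = 2 * P.card := ff_card' 3 Nat.prime_three ζ h1 h2
  have hPpos : 0 < P.card := Finset.card_pos.2 ⟨1, by simpa [hP] using ⟨1, one_pow 3⟩⟩
  set I := NP.filter (fun r => ∃ b, b ^ 3 = 1 + r) with hI
  have hI1 : I.card ≤ (P.erase 1).card := by
    apply Finset.card_le_card_of_injOn (fun r => 1 + r)
    · intro r hr
      simp only [hI, hNP, Finset.coe_filter, Finset.mem_filter, Finset.mem_univ, true_and] at hr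
      simp only [hP, Finset.coe_erase]
      refine ⟨?_, ?_⟩
      · simp only [Finset.coe_filter, Finset.mem_univ, true_and]
        refine ⟨?_, hr.2⟩
        intro h
        exact hr.1.2 ⟨-1, by linear_combination -h⟩
      · simpa using hr.1.1
    · intro a _ b _ h; simpa using h
  rw [Finset.card_erase_of_mem (by simpa [hP] using ⟨1, one_pow 3⟩)] at hI1
  have hI2 : (NP.filter (fun r => ¬ ∃ b, b ^ 3 = 1 + r)).card ≤ I.card := by
    apply Finset.card_le_card_of_injOn (fun r => r⁻¹)
    · intro r hr
      simp only [hNP, Finset.coe_filter, Finset.mem_filter, Finset.mem_univ, true_and] at hr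
      simp only [hI, hNP, Finset.coe_filter, Finset.mem_filter, Finset.mem_univ, true_and]
      refine ⟨⟨inv_ne_zero hr.1.1, ?_⟩, (hrig r hr.1.1 hr.1.2).resolve_left hr.2⟩
      rintro ⟨b, hb⟩
      exact hr.1.2 ⟨b⁻¹, by rw [inv_pow, hb, inv_inv]⟩
    · intro a _ b _ h; simpa using h
  have hsum : I.card + (NP.filter (fun r => ¬ ∃ b, b ^ 3 = 1 + r)).card = NP.card := by
    rw [hI]
    convert Finset.card_filter_add_card_filter_not (s := NP) (fun r => ∃ b, b ^ 3 = 1 + r)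
  omega

end FF
end PAC
end Part4

section Part5
open Polynomial
open scoped IntermediateField

namespace PAC

/-- henselian discrete-like valued field with finite residue field -/
structure PA0 {K Γ : Type*} [Field K] [LinearOrderedCommGroupWithZero Γ] (v : Valuation K Γ)
    (π : K) : Prop where
  π0 : π ≠ 0
  unif : ∀ x, v x < 1 ↔ v x ≤ v π
  fin : ∃ R : Finset K, ∀ x, v x ≤ 1 → ∃ r ∈ R, v (x - r) < 1
  hens : Hens v

section units
variable {K Γ : Type*} [Field K] [LinearOrderedCommGroupWithZero Γ] {v : Valuation K Γ} {π : K}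

lemma PA0.lt_one (h : PA0 v π) : v π < 1 := (h.unif π).2 le_rfl

lemma PA0.of_equiv {Γ' : Type*} [LinearOrderedCommGroupWithZero Γ'] {v' : Valuation K Γ'}
    (he : v.IsEquiv v') (h : PA0 v π) : PA0 v' π := by
  obtain ⟨R, hR⟩ := h.fin
  refine ⟨h.π0, fun x => ?_, ⟨R, fun x hx => ?_⟩, h.hens.of_equiv he⟩
  · rw [← he.lt_one_iff_lt_one, h.unif]; exact he _ _
  · obtain ⟨r, hr, h1⟩ := hR x (he.le_one_iff_le_one.2 hx)
    exact ⟨r, hr, he.lt_one_iff_lt_one.1 h1⟩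

/-- not an n-th power value -/
lemma PA0.not_pow (h : PA0 v π) {n : ℕ} (hn : 1 < n) (y : K) (u : K) (hu : v u = 1) : π ≠ u * y ^ n := by
  intro hy
  have h0 : v π ≠ 0 := by simpa using h.π0
  have h1 : v π = v y ^ n := by
    have := congrArg v hy
    rwa [map_mul, hu, one_mul, map_pow] at this
  have h2 : v y < 1 := by
    by_contra hcon
    push Not at hcon
    exact absurd h.lt_one (not_lt.2 (h1 ▸ one_le_pow₀ hcon))
  have h3 := (h.unif y).1 h2
  have h4 : v y ≠ 0 := by
    intro h'; rw [h', zero_pow (by omega)] at h1; exact h0 h1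
  have : v y ^ n < v y := by
    obtain ⟨m, rfl⟩ := Nat.exists_eq_add_of_lt hn
    rw [show 1 + m + 1 = (m + 1) + 1 by ring, pow_succ]
    have : v y ^ (m + 1) < 1 := pow_lt_one₀ zero_le h2 (by omega)
    calc v y ^ (m+1) * v y < 1 * v y := by
          apply mul_lt_mul_of_pos_right this (zero_lt_iff.2 h4)
      _ = v y := one_mul _
  rw [← h1] at this
  exact absurd this (not_lt.2 h3)

/-- the residue field -/
abbrev kk (v : Valuation K Γ) := IsLocalRing.ResidueField v.valuationSubring

/-- the residue of a integral element -/
noncomputable def rs (v : Valuation K Γ) (x : K) (hx : v x ≤ 1) : kk v :=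
  IsLocalRing.residue v.valuationSubring ⟨x, hx⟩

lemma lt_one_iff_residue (x : v.valuationSubring) :
    IsLocalRing.residue v.valuationSubring x = 0 ↔ v (x : K) < 1 := by
  rw [IsLocalRing.residue_eq_zero_iff, IsLocalRing.mem_maximalIdeal, mem_nonunits_iff,
    ← not_iff_not, not_not, not_lt]
  constructor
  · rintro ⟨u, rfl⟩
    have h1 : v ((u : v.valuationSubring) : K) * v (((u⁻¹ : (v.valuationSubring)ˣ) : v.valuationSubring) : K) = 1 := by
      rw [← map_mul, ← MulMemClass.coe_mul, Units.mul_inv]; simp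
    have h2 : v (((u⁻¹ : (v.valuationSubring)ˣ) : v.valuationSubring) : K) ≤ 1 :=
      ((u⁻¹ : (v.valuationSubring)ˣ) : v.valuationSubring).2
    rw [← h1]
    exact mul_le_of_le_one_right zero_le h2
  · intro hx
    have hx0 : (x : K) ≠ 0 := by intro h; rw [h, map_zero] at hx; exact absurd hx (by simp)
    refine IsUnit.of_mul_eq_one ⟨(x : K)⁻¹, ?_⟩ ?_
    · change v _ ≤ 1
      rw [map_inv₀]; exact inv_le_one_of_one_le₀ hx
    · ext; simp [hx0]

lemma rs_eq (x y : K) (hx : v x ≤ 1) (hy : v y ≤ 1) : rs v x hx = rs v y hy ↔ v (x - y) < 1 := by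
  rw [← sub_eq_zero, rs, rs, ← map_sub, lt_one_iff_residue]; rfl

lemma rs_zero (x : K) (hx : v x ≤ 1) : rs v x hx = 0 ↔ v x < 1 := lt_one_iff_residue _

lemma rs_surj (a : kk v) : ∃ x, ∃ hx : v x ≤ 1, rs v x hx = a := by
  obtain ⟨y, rfl⟩ := IsLocalRing.residue_surjective a
  exact ⟨y, y.2, rfl⟩

lemma PA0.finite (h : PA0 v π) : Finite (kk v) := by
  classical
  obtain ⟨R, hR⟩ := h.fin
  have : ∀ a : kk v, ∃ r : R, ∃ x, ∃ hx : v x ≤ 1, rs v x hx = a ∧ v (x - r) < 1 := by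
    intro a
    obtain ⟨x, hx, rfl⟩ := rs_surj a
    obtain ⟨r, hr, h1⟩ := hR x hx
    exact ⟨⟨r, hr⟩, x, hx, rfl, h1⟩
  choose f hf using this
  refine Finite.of_injective f ?_
  intro a b hab
  obtain ⟨x, hx, rfl, h1⟩ := hf a
  obtain ⟨y, hy, rfl, h2⟩ := hf b
  rw [rs_eq]
  rw [hab] at h1
  have := v.map_sub_lt h1 h2
  simpa using this

lemma Hens.root_pow (h : Hens v) {n : ℕ} (hn : 0 < n) (hvn : v (n : K) = 1) (u y : K) (hu : v u = 1)
    (hy : v y = 1) (hyu : v (y ^ n - u) < 1) : ∃ z, z ^ n = u ∧ v (z - y) < 1 := by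
  have hc : ∀ i, v ((X ^ n - C u : K[X]).coeff i) ≤ 1 := by
    intro i
    rw [coeff_sub, coeff_X_pow, coeff_C]
    refine (v.map_sub _ _).trans (max_le ?_ ?_)
    · split_ifs <;> simp
    · split_ifs <;> simp [hu]
  obtain ⟨b, hb, h1⟩ := h.root (monic_X_pow_sub_C u hn.ne') hc y hy.le (by simpa using hyu)
    (by simp [derivative_X_pow, hvn, hy])
  refine ⟨b, ?_, h1⟩
  simpa [sub_eq_zero] using hb

lemma Hens.one_add_pow (h : Hens v) {n : ℕ} (hn : 0 < n) (hvn : v (n : K) = 1) (m : K) (hm : v m < 1) :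
    ∃ z, z ^ n = 1 + m ∧ v (z - 1) < 1 := by
  refine h.root_pow hn hvn (1 + m) 1 ?_ (map_one v) ?_
  · rw [v.map_one_add_of_lt hm]
  · simpa [v.map_neg] using hm

lemma Hens.pow_iff (h : Hens v) {n : ℕ} (hn : 0 < n) (hvn : v (n : K) = 1) (u : K) (hu : v u = 1) :
    (∃ y, y ^ n = u) ↔ ∃ b : kk v, b ^ n = rs v u hu.le := by
  constructor
  · rintro ⟨y, rfl⟩
    have hy : v y ≤ 1 := by
      rw [map_pow] at hu
      exact (pow_le_one_iff_of_nonneg zero_le hn.ne').1 hu.le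
    refine ⟨rs v y hy, ?_⟩
    rw [rs, ← map_pow]; rfl
  · rintro ⟨b, hb⟩
    obtain ⟨y, hy, rfl⟩ := rs_surj b
    have h2 : rs v (y ^ n) (by rw [map_pow]; exact pow_le_one₀ zero_le hy) = rs v u hu.le := by
      rw [← hb]; exact map_pow (IsLocalRing.residue v.valuationSubring) ⟨y, hy⟩ n
    rw [rs_eq] at h2
    have hy1 : v y = 1 := by
      have : v (y ^ n) = 1 := by
        rw [← hu]
        exact v.map_eq_of_sub_lt (by rw [v.map_sub_swap, hu]; rwa [v.map_sub_swap]) |>.symm ▸ rfl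
      rw [map_pow] at this
      exact (pow_eq_one_iff_of_nonneg zero_le hn.ne').1 this
    obtain ⟨z, hz, _⟩ := h.root_pow hn hvn u y hu hy1 h2
    exact ⟨z, hz⟩

lemma zeta_ne (n : ℕ) (hvn : v (n : K) = 1) (ζ : K) (h1 : ζ ≠ 1)
    (h2 : ζ ^ n = 1) : ∃ z : kk v, z ≠ 1 ∧ z ^ n = 1 := by
  have hn : n ≠ 0 := by rintro rfl; simp at hvn
  have hζ : v ζ ≤ 1 := by
    have := congrArg v h2
    rw [map_pow, map_one] at this
    exact (pow_le_one_iff_of_nonneg zero_le hn).1 this.le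
  refine ⟨rs v ζ hζ, ?_, ?_⟩
  · intro h
    let z : v.valuationSubring := ⟨ζ, hζ⟩
    have hz : z ^ n - 1 = 0 := by apply Subtype.ext; simp [z, h2]
    rw [← mul_geom_sum, mul_eq_zero] at hz
    rcases hz with hz | hz
    · apply h1
      have := congrArg Subtype.val hz
      simpa [z, sub_eq_zero] using this
    · have := congrArg (IsLocalRing.residue v.valuationSubring) hz
      rw [map_sum] at this
      have h' : IsLocalRing.residue v.valuationSubring z = 1 := h
      simp only [map_pow, h', one_pow, Finset.sum_const, Finset.card_range, map_zero] at this
      rw [nsmul_one] at this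
      have h3 := (lt_one_iff_residue (v := v) (n : v.valuationSubring)).1 (by simpa using this)
      simp [hvn] at h3
  · rw [rs, ← map_pow]
    have : (⟨ζ, hζ⟩ : v.valuationSubring) ^ n = 1 := by apply Subtype.ext; simp [h2]
    rw [this, map_one]

lemma unit_lift (a : kk v) (ha : a ≠ 0) : ∃ x, ∃ hx : v x = 1, rs v x hx.le = a := by
  obtain ⟨x, hx, rfl⟩ := rs_surj a
  rw [Ne, rs_zero, not_lt] at ha
  exact ⟨x, le_antisymm hx ha, rfl⟩

lemma rs_div (x y : K) (hx : v x ≤ 1) (hy : v y = 1) :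
    rs v (x / y) (by rw [map_div₀, hy, div_one]; exact hx) = rs v x hx / rs v y hy.le := by
  have hy0 : rs v y hy.le ≠ 0 := by rw [Ne, rs_zero, hy]; exact lt_irrefl _
  have : y ≠ 0 := by rintro rfl; simp at hy
  rw [eq_div_iff hy0, rs, rs, rs, ← map_mul]
  congr 1
  apply Subtype.ext
  simp [this]

lemma PA0.good (h : PA0 v π) (l : ℕ) (hl : l.Prime) (hvl : v (l : K) = 1) (ζ : K) (h1 : ζ ≠ 1)
    (h2 : ζ ^ l = 1) (u : K) (hu : v u = 1) :
    (v (u - 1) = 1 ∧ ¬ ∃ y, y ^ l = u / (u - 1)) ∨ ∃ g h : K, v g = 1 ∧ v h = 1 ∧ u = g * h ∧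
      (v (g - 1) = 1 ∧ ¬ ∃ y, y ^ l = g / (g - 1)) ∧ (v (h - 1) = 1 ∧ ¬ ∃ y, y ^ l = h / (h - 1)) := by
  classical
  have := h.finite
  have := Fintype.ofFinite (kk v)
  obtain ⟨z, hz1, hz2⟩ := zeta_ne l hvl ζ h1 h2
  have key : ∀ x (hx : v x = 1), (rs v x hx.le ≠ 1 ∧ ¬ ∃ b, b ^ l = rs v x hx.le / (rs v x hx.le - 1)) →
      (v (x - 1) = 1 ∧ ¬ ∃ y, y ^ l = x / (x - 1)) := by
    intro x hx hh
    have hx1 : v (x - 1) ≤ 1 := (v.map_sub _ _).trans (by simp [hx])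
    have e : rs v (x - 1) hx1 = rs v x hx.le - 1 := by
      rw [rs, rs, ← map_one (IsLocalRing.residue _), ← map_sub]; rfl
    have hv : v (x - 1) = 1 := by
      apply le_antisymm hx1
      rw [← not_lt, ← rs_zero _ hx1, e, sub_eq_zero]; exact hh.1
    refine ⟨hv, ?_⟩
    rw [h.hens.pow_iff hl.pos hvl _ (by rw [map_div₀, hx, hv, div_one]), rs_div _ _ hx.le hv, e]
    exact hh.2
  have hu0 : rs v u hu.le ≠ 0 := by rw [Ne, rs_zero, hu]; exact lt_irrefl _
  rcases ff_good l hl z hz1 hz2 (rs v u hu.le) hu0 with hg | ⟨g, h', hg0, hh0, e, hg1, hh1⟩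
  · exact Or.inl (key u hu hg)
  · right
    obtain ⟨x, hx, rfl⟩ := unit_lift g hg0
    have hu0' : u ≠ 0 := by rintro rfl; simp at hu
    have hx0 : x ≠ 0 := by rintro rfl; simp at hx
    have hy : v (u / x) = 1 := by rw [map_div₀, hu, hx, div_one]
    have e2 : rs v (u / x) hy.le = h' := by
      rw [rs_div _ _ hu.le hx, e]; field_simp
    refine ⟨x, u / x, hx, hy, by rw [mul_div_cancel₀ _ hx0], key x hx hg1, key _ hy ?_⟩
    rw [e2]; exact hh1

lemma PA0.three (h : PA0 v π) (hvl : v ((3 : ℕ) : K) = 1) (ζ : K) (h1 : ζ ≠ 1) (h2 : ζ ^ 3 = 1) :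
    ∃ u b : K, v u = 1 ∧ (¬ ∃ y, y ^ 3 = u) ∧ b ≠ 0 ∧ 1 + u = u ^ 2 * b ^ 3 := by
  classical
  have := h.finite
  have := Fintype.ofFinite (kk v)
  obtain ⟨z, hz1, hz2⟩ := zeta_ne 3 hvl ζ h1 h2
  obtain ⟨a, b, ha, hna, hb, e⟩ := ff_three z hz1 hz2
  obtain ⟨u, hu, rfl⟩ := unit_lift a ha
  obtain ⟨y, hy, rfl⟩ := unit_lift b hb
  have hu0 : u ≠ 0 := by rintro rfl; simp at hu
  have hyu : v (y ^ 3 - (1 + u) / u ^ 2) < 1 := by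
    have : (IsLocalRing.residue v.valuationSubring) ((1 + ⟨u, hu.le⟩) - ⟨u, hu.le⟩ ^ 2 * ⟨y, hy.le⟩ ^ 3) = 0 := by
      rw [map_sub, map_add, map_mul, map_pow, map_pow, map_one]
      exact sub_eq_zero.2 e
    rw [lt_one_iff_residue] at this
    have e2 : y ^ 3 - (1 + u) / u ^ 2 = - ((1 + u) - u ^ 2 * y ^ 3) / u ^ 2 := by field_simp; ring
    rw [e2, map_div₀, map_pow, hu, one_pow, div_one, v.map_neg]
    exact this
  have hv1 : v ((1 + u) / u ^ 2) = 1 := by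
    have h3 : v (y ^ 3) = 1 := by rw [map_pow, hy, one_pow]
    rw [← h3]
    exact (v.map_eq_of_sub_lt (by rw [h3, v.map_sub_swap]; exact hyu))
  obtain ⟨s, hs, _⟩ := h.hens.root_pow (by norm_num) hvl _ y hv1 hy hyu
  refine ⟨u, s, hu, ?_, ?_, ?_⟩
  · rwa [h.hens.pow_iff (by norm_num) hvl u hu]
  · rintro rfl
    rw [← hs] at hv1; simp at hv1
  · rw [hs]; field_simp

end units
end PAC
end Part5

section Part6
open Polynomial
open scoped IntermediateField

namespace PAC
set_option linter.unusedSectionVars false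

section nm
variable {K F Ω : Type*} [Field K] [Field F] [Field Ω] [Algebra K F] [Algebra F Ω]
    [Algebra K Ω] [IsScalarTower K F Ω] [IsAlgClosed Ω] [Algebra.IsAlgebraic F Ω] [CharZero K]

variable (K) in
include K in
lemma mem_F_of_fixed (x : Ω) (h : ∀ σ : Ω ≃ₐ[F] Ω, σ x = x) : ∃ f, algebraMap F Ω f = x := by
  have : CharZero F := charZero_of_injective_algebraMap (algebraMap K F).injective
  have : IsAlgClosure F Ω := ⟨inferInstance, inferInstance⟩
  have : Normal F Ω := IsAlgClosure.normal F Ω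
  have hGal : IsGalois F Ω := ⟨⟩
  have h1 := InfiniteGalois.fixedField_fixingSubgroup (⊥ : IntermediateField F Ω)
  have h2 : x ∈ IntermediateField.fixedField (⊥ : IntermediateField F Ω).fixingSubgroup := by
    rintro ⟨τ, hτ⟩
    exact h τ
  rw [h1, IntermediateField.mem_bot] at h2
  exact h2

lemma Fx_bot (x : F) : Fx F (⊥ : IntermediateField K Ω) (algebraMap F Ω x) :=
  fun σ _ => σ.commutes x

lemma fixes_bot (σ : Ω ≃ₐ[F] Ω) : ∀ a ∈ (⊥ : IntermediateField K Ω), σ a = a := by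
  intro a ha
  obtain ⟨b, rfl⟩ := IntermediateField.mem_bot.1 ha
  rw [IsScalarTower.algebraMap_apply K F Ω]; exact σ.commutes _

lemma ResData.mem_K (R : ResData K F Ω) (x : F) (hx : IsAlgebraic K (algebraMap F Ω x)) :
    ∃ a, algebraMap K F a = x := by
  have := R.r1 ⊥ bot_le _ hx (Fx_bot x)
  obtain ⟨a, ha⟩ := IntermediateField.mem_bot.1 this
  refine ⟨a, (algebraMap F Ω).injective ?_⟩
  rw [← IsScalarTower.algebraMap_apply K F Ω]; exact ha

lemma ResData.decomp (R : ResData K F Ω) (x : F) (hx : x ≠ 0) {n : ℕ} (hn : 0 < n) :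
    ∃ (c : K) (t : F), c ≠ 0 ∧ t ≠ 0 ∧ x = algebraMap K F c * t ^ n := by
  obtain ⟨c, hc, t, hc0, ht0, ht, e⟩ := R.r2 ⊥ bot_le (algebraMap F Ω x) (by simpa using hx)
    (Fx_bot x) n hn
  obtain ⟨c, rfl⟩ := IntermediateField.mem_bot.1 hc
  obtain ⟨t, rfl⟩ := mem_F_of_fixed K t (fun σ => ht σ (fixes_bot σ))
  refine ⟨c, t, by simpa using hc0, by simpa using ht0, (algebraMap F Ω).injective ?_⟩
  rw [e, map_mul, map_pow, IsScalarTower.algebraMap_apply K F Ω]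

lemma fixes_adjoin (σ : Ω ≃ₐ[F] Ω) (S : Set Ω) (hS : ∀ a ∈ S, σ a = a) :
    ∀ a ∈ IntermediateField.adjoin K S, σ a = a := by
  intro a ha
  induction ha using IntermediateField.adjoin_induction with
  | mem x hx => exact hS x hx
  | algebraMap x => rw [IsScalarTower.algebraMap_apply K F Ω]; exact σ.commutes _
  | add x y _ _ h1 h2 => rw [map_add, h1, h2]
  | inv x _ h => rw [map_inv₀, h]
  | mul x y _ _ h1 h2 => rw [map_mul, h1, h2]

lemma adjoin_le_algClosure {θ : Ω} (hθ : IsAlgebraic K θ) : K⟮θ⟯ ≤ algebraicClosure K Ω := by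
  rw [IntermediateField.adjoin_simple_le_iff]
  exact mem_algebraicClosure_iff.2 hθ

/-- norm maps -/
lemma ResData.exists_norm (R : ResData K F Ω) (θ : Ω) (hθ : IsAlgebraic K θ) :
    ∃ Nm : Ω →* Ω, (∀ x, Fx F K⟮θ⟯ x → ∃ f, Nm x = algebraMap F Ω f) ∧
      (∀ s : F, Nm (algebraMap F Ω s - θ) = aeval (algebraMap F Ω s) (minpoly K θ)) ∧
      (∀ f : F, Nm (algebraMap F Ω f) = algebraMap F Ω (f ^ (minpoly K θ).natDegree)) ∧
      (∀ x, IsAlgebraic K x → IsAlgebraic K (Nm x)) ∧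
      (∀ {Γ : Type _} [LinearOrderedCommGroupWithZero Γ] (w : Valuation Ω Γ),
        Hens (w.comap (algebraMap K Ω)) → ∀ x, IsAlgebraic K x →
          w (Nm x) = w x ^ (minpoly K θ).natDegree ∧ (w (x - 1) < 1 → w (Nm x - 1) < 1)) := by
  classical
  set I := ((minpoly K θ).aroots Ω).toFinset with hI
  have hmemI : ∀ r, r ∈ I ↔ aeval r (minpoly K θ) = 0 := by
    intro r
    rw [hI, Multiset.mem_toFinset, mem_aroots]
    exact ⟨fun h => h.2, fun h => ⟨minpoly.ne_zero hθ.isIntegral, h⟩⟩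
  have hex : ∀ r : Ω, ∃ σ : Ω ≃ₐ[F] Ω, r ∈ I → σ θ = r := by
    intro r
    by_cases hr : r ∈ I
    · obtain ⟨σ, _, h⟩ := R.lift θ r hθ ⊥ bot_le (by
        obtain ⟨Q, hQ⟩ := Polynomial.map_surjective (algebraMap K (⊥ : IntermediateField K Ω))
          (fun a => by
            obtain ⟨b, hb⟩ := IntermediateField.mem_bot.1 a.2
            exact ⟨b, Subtype.ext hb⟩) (minpoly (⊥ : IntermediateField K Ω) θ)
        have h3 : aeval θ Q = 0 := by
          rw [← aeval_map_algebraMap (⊥ : IntermediateField K Ω), hQ, minpoly.aeval]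
        obtain ⟨Q', hQ'⟩ := minpoly.dvd K θ h3
        rw [← hQ, aeval_map_algebraMap, hQ', map_mul, (hmemI r).1 hr, zero_mul])
      exact ⟨σ, fun _ => h⟩
    · exact ⟨1, fun h => absurd h hr⟩
  choose σ hσ using hex
  have hsplit : (minpoly K θ).map (algebraMap K Ω) = ∏ r ∈ I, (X - C r) := by
    have h1 := map_eq_prod_roots (Ω := Ω) (minpoly.monic hθ.isIntegral)
    have hnd : ((minpoly K θ).map (algebraMap K Ω)).roots.Nodup :=
      nodup_roots ((minpoly.irreducible hθ.isIntegral).separable.map)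
    rw [h1, hI, Finset.prod, Multiset.toFinset_val]
    congr 2
    exact hnd.dedup.symm
  have hcard : I.card = (minpoly K θ).natDegree := by
    rw [← natDegree_map (algebraMap K Ω) (p := minpoly K θ), hsplit, natDegree_prod_of_monic]
    · simp
    · intro r _; exact monic_X_sub_C r
  let Nm : Ω →* Ω :=
    { toFun := fun x => ∏ r ∈ I, σ r x
      map_one' := by simp
      map_mul' := fun x y => by simp [Finset.prod_mul_distrib] }
  refine ⟨Nm, ?_, ?_, ?_, ?_, ?_⟩
  · intro x hx
    obtain ⟨f, hf⟩ := mem_F_of_fixed (F := F) K (Nm x) (by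
      intro τ
      change τ (∏ r ∈ I, σ r x) = ∏ r ∈ I, σ r x
      rw [map_prod]
      have hτI : ∀ τ : Ω ≃ₐ[F] Ω, ∀ r ∈ I, τ r ∈ I := by
        intro τ r hr
        rw [hmemI] at hr ⊢
        have := aeval_algHom_apply ((τ.restrictScalars K) : Ω →ₐ[K] Ω) r (minpoly K θ)
        rw [hr, map_zero] at this
        exact this
      refine Finset.prod_bij (fun r _ => τ r) (fun r hr => hτI τ r hr) ?_ ?_ ?_
      · intro a _ b _ h; exact τ.injective h
      · intro r hr
        exact ⟨τ.symm r, hτI τ.symm r hr, τ.apply_symm_apply r⟩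
      · intro r hr
        have hfix : ((σ (τ r)).symm * τ * σ r : Ω ≃ₐ[F] Ω) θ = θ := by
          change (σ (τ r)).symm (τ (σ r θ)) = θ
          rw [hσ r hr, AlgEquiv.symm_apply_eq, hσ (τ r) (hτI τ r hr)]
        have := hx ((σ (τ r)).symm * τ * σ r) (by
          intro a ha
          exact fixes_adjoin _ {θ} (by simpa using hfix) a ha)
        change (σ (τ r)).symm (τ (σ r x)) = x at this
        rwa [AlgEquiv.symm_apply_eq] at this)
    exact ⟨f, hf.symm⟩
  · intro s
    change ∏ r ∈ I, σ r (algebraMap F Ω s - θ) = _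
    rw [aeval_def, eval₂_eq_eval_map, hsplit, eval_prod]
    apply Finset.prod_congr rfl
    intro r hr
    rw [map_sub, AlgEquiv.commutes, hσ r hr]; simp
  · intro f
    change ∏ r ∈ I, σ r (algebraMap F Ω f) = _
    simp [hcard]
  · intro x hx
    change IsAlgebraic K (∏ r ∈ I, σ r x)
    refine Finset.prod_induction _ (IsAlgebraic K) (fun a b ha hb => ha.mul hb) isAlgebraic_one ?_
    intro r _
    exact hx.algHom (((σ r).restrictScalars K) : Ω →ₐ[K] Ω)
  · intro Γ _ w hw x hx
    have hinv : ∀ (τ : Ω ≃ₐ[F] Ω) x, IsAlgebraic K x → w (τ x) = w x := fun τ x hx =>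
      hw.inv (τ.restrictScalars K) x hx.isIntegral
    constructor
    · change w (∏ r ∈ I, σ r x) = _
      rw [map_prod, Finset.prod_congr rfl (fun r _ => hinv (σ r) x hx), Finset.prod_const, hcard]
    · intro h1
      change w (∏ r ∈ I, σ r x - 1) < 1
      refine Finset.prod_induction _ (fun y => w (y - 1) < 1) ?_ (by simp) ?_
      · intro a b ha hb
        rw [show a * b - 1 = (a - 1) * (b - 1) + ((a - 1) + (b - 1)) by ring]
        refine w.map_add_lt ?_ (w.map_add_lt ha hb)
        rw [map_mul]; exact mul_lt_one_of_nonneg_of_lt_one_left zero_le ha hb.le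
      · intro r _
        have : σ r x - 1 = σ r (x - 1) := by rw [map_sub, map_one]
        rw [this, hinv _ _ (hx.sub isAlgebraic_one)]; exact h1

end nm
end PAC
end Part6

section Part7
open Polynomial
open scoped IntermediateField

namespace PAC
set_option linter.unusedSectionVars false

section dom
variable {K Ω Γ : Type*} [Field K] [Field Ω] [Algebra K Ω] [LinearOrderedCommGroupWithZero Γ]

/-- coprimality in the value group -/
lemma val_coprime (v : Valuation K Γ) {c b : K} (hc : c ≠ 0) (hb : b ≠ 0) {m l : ℕ} (hml : Nat.Coprime m l)
    (h : v c ^ m = v b ^ l) : ∃ a, a ≠ 0 ∧ v c = v a ^ l := by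
  have hb' := Nat.gcd_eq_gcd_ab m l
  rw [hml] at hb'
  set α := Nat.gcdA m l
  set β := Nat.gcdB m l
  refine ⟨b ^ α * c ^ β, mul_ne_zero (zpow_ne_zero _ hb) (zpow_ne_zero _ hc), ?_⟩
  have hvc : v c ≠ 0 := by simpa using hc
  have hvb : v b ≠ 0 := by simpa using hb
  have : v c ^ (1 : ℤ) = (v b ^ α * v c ^ β) ^ l := by
    have e : ((1 : ℕ) : ℤ) = m * α + l * β := hb'
    rw [Nat.cast_one] at e
    rw [e, zpow_add₀ hvc, zpow_mul, zpow_natCast, h, mul_pow, zpow_mul, zpow_natCast,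
      ← zpow_natCast (v b ^ α), ← zpow_natCast (v c ^ β), ← zpow_natCast (v b), ← zpow_natCast (v c),
      ← zpow_mul, ← zpow_mul, ← zpow_mul, ← zpow_mul, mul_comm (l : ℤ) α, mul_comm (l : ℤ) β]
  rw [zpow_one] at this
  rw [this, map_mul, map_zpow₀, map_zpow₀]

/-- in a totally ramified radical extension of prime degree, one monomial dominates -/
lemma dominant (w : Valuation Ω Γ) {l : ℕ} (hl : l.Prime) (s : Ω) (c : K) (hc : c ≠ 0)
    (hs : w s ^ l = w (algebraMap K Ω c))
    (hnp : ∀ a : K, a ≠ 0 → w (algebraMap K Ω c) ≠ w (algebraMap K Ω a) ^ l)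
    (P : K[X]) (hP : P ≠ 0) (hd : P.natDegree < l) :
    ∃ i, i < l ∧ P.coeff i ≠ 0 ∧ w (aeval s P / (algebraMap K Ω (P.coeff i) * s ^ i) - 1) < 1 := by
  have hs0 : s ≠ 0 := by
    rintro rfl
    rw [map_zero, zero_pow hl.ne_zero, eq_comm, map_eq_zero] at hs
    exact hc (by simpa using hs)
  have hws : w s ≠ 0 := by simpa using hs0
  have hne : P.support.Nonempty := by simpa using hP
  obtain ⟨i, hi, hmax⟩ := Finset.exists_max_image P.support
    (fun i => w (algebraMap K Ω (P.coeff i) * s ^ i)) hne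
  have hil : i < l := (le_natDegree_of_mem_supp i hi).trans_lt hd
  have hci : P.coeff i ≠ 0 := mem_support_iff.1 hi
  have hci' : algebraMap K Ω (P.coeff i) ≠ 0 := by simpa using hci
  refine ⟨i, hil, hci, ?_⟩
  have aux : ∀ i j, i < j → j < l → P.coeff i ≠ 0 → P.coeff j ≠ 0 →
      w (algebraMap K Ω (P.coeff i) * s ^ i) ≠ w (algebraMap K Ω (P.coeff j) * s ^ j) := by
    intro i j hij hjl hi hj heq
    have hj' : w (algebraMap K Ω (P.coeff j)) ≠ 0 := by simpa using hj
    obtain ⟨m, rfl⟩ := Nat.exists_eq_add_of_lt hij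
    have h1 : w s ^ (m + 1) = w (algebraMap K Ω (P.coeff i / P.coeff (i + m + 1))) := by
      rw [map_mul, map_mul, map_pow, map_pow, show i + m + 1 = i + (m + 1) by ring, pow_add,
        mul_left_comm, mul_comm (w s ^ i)] at heq
      have h2 := mul_right_cancel₀ (pow_ne_zero i hws) (heq.trans (by rw [mul_comm]))
      rw [map_div₀, map_div₀, eq_div_iff hj', mul_comm]
      rw [h2]; rfl
    have hcop : Nat.Coprime (m + 1) l := by
      apply Nat.Coprime.symm
      rw [Nat.Prime.coprime_iff_not_dvd hl]
      exact Nat.not_dvd_of_pos_of_lt (by omega) (by omega)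
    obtain ⟨a, ha, h3⟩ := val_coprime (w.comap (algebraMap K Ω)) hc (div_ne_zero hi hj) hcop (by
      change w (algebraMap K Ω c) ^ _ = w (algebraMap K Ω _) ^ _
      rw [← h1, ← hs, ← pow_mul, ← pow_mul, mul_comm])
    exact hnp a ha h3
  have hlt : ∀ j ∈ P.support, j ≠ i →
      w (algebraMap K Ω (P.coeff j) * s ^ j) < w (algebraMap K Ω (P.coeff i) * s ^ i) := by
    intro j hj hji
    refine lt_of_le_of_ne (hmax j hj) ?_
    have hjl : j < l := (le_natDegree_of_mem_supp j hj).trans_lt hd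
    rcases lt_or_gt_of_ne hji with h | h
    · exact aux j i h hil (mem_support_iff.1 hj) hci
    · exact (aux i j h hjl hci (mem_support_iff.1 hj)).symm
  have hpos : w (algebraMap K Ω (P.coeff i) * s ^ i) ≠ 0 := by
    rw [Ne, map_eq_zero]; exact mul_ne_zero hci' (pow_ne_zero i hs0)
  have hM : algebraMap K Ω (P.coeff i) * s ^ i ≠ 0 := mul_ne_zero hci' (pow_ne_zero i hs0)
  rw [div_sub_one hM, map_div₀, div_lt_one₀ (zero_lt_iff.2 hpos), aeval_eq_sum_range' hd]
  have hsum : ∑ j ∈ Finset.range l, P.coeff j • s ^ j - algebraMap K Ω (P.coeff i) * s ^ i =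
      ∑ j ∈ (Finset.range l).erase i, algebraMap K Ω (P.coeff j) * s ^ j := by
    rw [← Finset.add_sum_erase _ _ (Finset.mem_range.2 hil)]
    simp [Algebra.smul_def]
  rw [hsum]
  refine w.map_sum_lt hpos ?_
  intro j hj
  rw [Finset.mem_erase] at hj
  by_cases h0 : P.coeff j = 0
  · rw [h0, map_zero, zero_mul, map_zero]; exact zero_lt_iff.2 hpos
  · exact hlt j (mem_support_iff.2 h0) hj.1

lemma mem_adjoin_poly (s : Ω) (hs : IsIntegral K s) (d : Ω) (hd : d ∈ K⟮s⟯) :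
    ∃ P : K[X], P.natDegree < (minpoly K s).natDegree ∧ aeval s P = d := by
  have h1 : d ∈ (K⟮s⟯).toSubalgebra := hd
  rw [IntermediateField.adjoin_simple_toSubalgebra_of_isAlgebraic hs.isAlgebraic,
    Algebra.adjoin_singleton_eq_range_aeval] at h1
  obtain ⟨Q, hQ⟩ := h1
  refine ⟨Q %ₘ minpoly K s, ?_, ?_⟩
  · exact natDegree_modByMonic_lt _ (minpoly.monic hs) (minpoly.ne_one K s)
  · rw [← hQ]
    have := modByMonic_add_div Q (minpoly K s)
    conv_rhs => rw [← this]
    simp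

end dom

section weak
variable {K F Ω : Type*} [Field K] [Field F] [Field Ω] [Algebra K F] [Algebra F Ω]
    [Algebra K Ω] [IsScalarTower K F Ω] [IsAlgClosed Ω] [Algebra.IsAlgebraic F Ω] [CharZero K]
    {Γ : Type*} [LinearOrderedCommGroupWithZero Γ]

/-- weak rigidity -/
lemma ResData.weak (R : ResData K F Ω) (w : Valuation Ω Γ) (hw : Hens (w.comap (algebraMap K Ω)))
    {l : ℕ} (hl : l.Prime) (hvl : w (l : Ω) = 1) (x : F) (hx : x ≠ 0)
    (hT : ∀ u : K, w (algebraMap K Ω u) = 1 → ∀ y : F, x ≠ algebraMap K F u * y ^ l) :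
    ∃ i < l, ∃ z : F, 1 + x = x ^ i * z ^ l := by
  obtain ⟨c, y, hc, hy, rfl⟩ := R.decomp x hx hl.pos
  have hnp : ∀ a : K, a ≠ 0 → w (algebraMap K Ω c) ≠ w (algebraMap K Ω a) ^ l := by
    intro a ha h
    have ha' : algebraMap K F a ≠ 0 := by simpa using ha
    refine hT (c / a ^ l) ?_ (algebraMap K F a * y) ?_
    · have : w (algebraMap K Ω a) ^ l ≠ 0 := by
        apply pow_ne_zero; simpa using ha
      rw [map_div₀, map_div₀, map_pow, map_pow, h, div_self this]
    · rw [map_div₀, map_pow, mul_pow]; field_simp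
  set c' : K := (-1) ^ (l - 1) * c with hc'
  have hc'0 : c' ≠ 0 := mul_ne_zero (pow_ne_zero _ (by norm_num)) hc
  have hwc' : w (algebraMap K Ω c') = w (algebraMap K Ω c) := by
    rw [hc', map_mul, map_mul, map_pow, map_pow]; simp
  obtain ⟨s, hs⟩ := IsAlgClosed.exists_pow_nat_eq (algebraMap K Ω c') hl.pos
  have hirr : Irreducible (X ^ l - C c' : K[X]) := by
    apply X_pow_sub_C_irreducible_of_prime hl
    intro b hb
    have hb0 : b ≠ 0 := by rintro rfl; rw [zero_pow hl.ne_zero] at hb; exact hc'0 hb.symm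
    apply hnp b hb0
    rw [← hwc', ← hb, map_pow, map_pow]
  have hmin : minpoly K s = X ^ l - C c' := by
    symm
    apply minpoly.eq_of_irreducible_of_monic hirr (by simp [hs]) (monic_X_pow_sub_C c' hl.ne_zero)
  have hsalg : IsAlgebraic K s := ⟨X ^ l - C c', X_pow_sub_C_ne_zero hl.pos c', by simp [hs]⟩
  have hdeg : (minpoly K s).natDegree = l := by rw [hmin, natDegree_X_pow_sub_C]
  have hs0 : s ≠ 0 := by
    rintro rfl; rw [zero_pow hl.ne_zero] at hs; exact hc'0 (by simpa using hs.symm)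
  obtain ⟨Nm, hN1, hN2, hN3, hN4, hN5⟩ := R.exists_norm s hsalg
  rw [hdeg] at hN3
  have hsK : s ∈ K⟮s⟯ := IntermediateField.mem_adjoin_simple_self K s
  have hy' : algebraMap F Ω y ≠ 0 := by simpa using hy
  have hNx : Nm (1 + s * algebraMap F Ω y) = algebraMap F Ω (1 + algebraMap K F c * y ^ l) := by
    have h1 : 1 + s * algebraMap F Ω y = algebraMap F Ω (-y) * (algebraMap F Ω (-y⁻¹) - s) := by
      simp only [map_neg, map_inv₀]; field_simp; ring
    rw [h1, map_mul, hN3, hN2, hmin]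
    simp only [map_sub, map_pow, aeval_X, aeval_C]
    rw [IsScalarTower.algebraMap_apply K F Ω, ← map_pow (algebraMap F Ω) (-y⁻¹), ← map_sub, ← map_pow (algebraMap F Ω) (-y), ← map_mul, hc']
    congr 1
    have h2 : (-y) ^ l * (-y⁻¹) ^ l = 1 := by
      rw [← mul_pow]; simp [hy]
    have h3 : (-1 : F) ^ l * (-1) ^ (l - 1) = -1 := by
      rw [← pow_add, show l + (l - 1) = 2 * (l - 1) + 1 by have := hl.pos; omega, pow_succ, pow_mul]
      simp
    rw [mul_sub, h2, map_mul, map_pow, map_neg, map_one, neg_pow y l]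
    linear_combination (-(algebraMap K F c * y ^ l)) * h3
  have hNs : Nm s = algebraMap F Ω (algebraMap K F c) := by
    have h1 : s = algebraMap F Ω (-1) * (algebraMap F Ω 0 - s) := by simp
    rw [h1, map_mul, hN3, hN2, hmin]
    simp only [map_sub, map_pow, aeval_X, aeval_C]
    rw [IsScalarTower.algebraMap_apply K F Ω, ← map_pow (algebraMap F Ω) (0:F), ← map_sub, ← map_pow (algebraMap F Ω) (-1:F), ← map_mul, hc']
    congr 1
    have h3 : (-1 : F) ^ l * (-1) ^ (l - 1) = -1 := by
      rw [← pow_add, show l + (l - 1) = 2 * (l - 1) + 1 by have := hl.pos; omega, pow_succ, pow_mul]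
      simp
    rw [zero_pow hl.ne_zero, map_mul, map_pow, map_neg, map_one]
    linear_combination (-(algebraMap K F c)) * h3
  have h10 : 1 + s * algebraMap F Ω y ≠ 0 := by
    intro h
    rw [h] at hNx
    have h0 : 1 + algebraMap K F c * y ^ l = 0 := by
      apply (algebraMap F Ω).injective
      have := hN3 0
      rw [zero_pow hl.ne_zero, map_zero] at this
      rw [← hNx, this, map_zero]
    apply hT (-1) (by simp) 1
    rw [map_neg, map_one]; linear_combination h0
  have hFx : Fx F K⟮s⟯ (1 + s * algebraMap F Ω y) := by
    intro σ hσ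
    rw [map_add, map_mul, map_one, hσ s hsK, AlgEquiv.commutes]
  obtain ⟨d, hd, t, hd0, ht0, ht, e⟩ := R.r2 K⟮s⟯ (adjoin_le_algClosure hsalg) _ h10 hFx l hl.pos
  obtain ⟨P, hP, rfl⟩ := mem_adjoin_poly s hsalg.isIntegral d hd
  rw [hdeg] at hP
  have hP0 : P ≠ 0 := by rintro rfl; simp at hd0
  obtain ⟨i, hil, hi0, hi⟩ := dominant w hl s c hc (by rw [← map_pow, hs, hwc']) hnp P hP0 hP
  set D := aeval s P / (algebraMap K Ω (P.coeff i) * s ^ i) with hD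
  have hM : algebraMap K Ω (P.coeff i) * s ^ i ≠ 0 := mul_ne_zero (by simpa using hi0) (pow_ne_zero i hs0)
  have hDmem : D ∈ K⟮s⟯ := div_mem hd (mul_mem (IntermediateField.algebraMap_mem _ _) (pow_mem hsK i))
  have hDalg : IsAlgebraic K D := mem_algebraicClosure_iff.1 (adjoin_le_algClosure hsalg hDmem)
  obtain ⟨f, hf⟩ := hN1 D (fun σ hσ => hσ D hDmem)
  obtain ⟨a, ha⟩ := R.mem_K f (by rw [← hf]; exact hN4 D hDalg)
  have hwa : w (algebraMap K Ω (a - 1)) < 1 := by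
    have := (hN5 w hw D hDalg).2 hi
    rw [hf, ← ha, ← IsScalarTower.algebraMap_apply K F Ω] at this
    rwa [map_sub, map_one]
  obtain ⟨b, hb, _⟩ := hw.one_add_pow hl.pos (by simpa using hvl) (a - 1) hwa
  rw [add_sub_cancel] at hb
  obtain ⟨T, hT'⟩ := hN1 t ht
  refine ⟨i, hil, algebraMap K F (P.coeff i) * algebraMap K F b * T / y ^ i, ?_⟩
  apply (algebraMap F Ω).injective
  rw [← hNx, e, map_mul, map_pow, hT']
  have h5 : aeval s P = algebraMap F Ω (algebraMap K F (P.coeff i)) * s ^ i * D := by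
    rw [hD, ← IsScalarTower.algebraMap_apply K F Ω, mul_div_cancel₀ _ hM]
  rw [h5, map_mul, map_mul, hN3, map_pow Nm, hNs, hf, ← ha, ← hb]
  simp only [map_mul, map_pow, map_div₀]
  have h6 : (algebraMap F Ω y ^ i) ^ l ≠ 0 := pow_ne_zero l (pow_ne_zero i hy')
  rw [div_pow, mul_div_assoc', eq_div_iff h6]
  ring

end weak
end PAC
end Part7

section Part8
open Polynomial
open scoped IntermediateField

namespace PAC
set_option linter.unusedSectionVars false

section excl

lemma three_lin {M : Type*} [AddCommGroup M] (A U : M) (hA : (3 : ℤ) • A = 0) (hU : (3 : ℤ) • U = 0)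
    (j k : ℕ) (hj : j < 3) (hk : k < 3)
    (h : (2 : ℤ) • U + (j : ℤ) • (A - (2 : ℤ) • U) = (2 : ℤ) • A + (k : ℤ) • (U - (2 : ℤ) • A)) :
    U = 0 ∨ A = 0 ∨ A = U := by
  interval_cases j <;> interval_cases k <;> push_cast at h
  · right; right; linear_combination (norm := module) hA - hU + h
  · left; linear_combination (norm := module) h
  · right; left; linear_combination (norm := module) hA - h
  · right; left; linear_combination (norm := module) -h
  · right; right; linear_combination (norm := module) h
  · left; linear_combination (norm := module) hU + h - hA
  · left; linear_combination (norm := module) hU + h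
  · right; left; linear_combination (norm := module) hA - h - hU
  · right; right; linear_combination (norm := module) h - hA + hU

lemma three_excl {F : Type*} [Field F] (a u b z r s : F) (ha : a ≠ 0) (hu : u ≠ 0)
    (hb : b ≠ 0) (hz : z ≠ 0) (hr : r ≠ 0) (hs : s ≠ 0)
    (h1 : 1 + u = u ^ 2 * b ^ 3) (h2 : 1 + a = a ^ 2 * z ^ 3) (j k : ℕ) (hj : j < 3) (hk : k < 3)
    (h3 : 1 + a / (1 + u) = (a / (1 + u)) ^ j * r ^ 3)
    (h4 : 1 + u / (1 + a) = (u / (1 + a)) ^ k * s ^ 3) :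
    (∃ y, y ^ 3 = u) ∨ (∃ y, y ^ 3 = a) ∨ ∃ y, a = u * y ^ 3 := by
  obtain ⟨Q, _, q, hq3, hq1⟩ : ∃ (Q : Type _) (_ : CommGroup Q) (q : Fˣ →* Q),
      (∀ x : Fˣ, q (x ^ 3) = 1) ∧ ∀ x : Fˣ, q x = 1 → ∃ y : Fˣ, y ^ 3 = x := by
    refine ⟨Fˣ ⧸ (powMonoidHom 3 : Fˣ →* Fˣ).range, inferInstance, QuotientGroup.mk' _, ?_, ?_⟩
    · intro x
      exact (QuotientGroup.eq_one_iff _).2 ⟨x, rfl⟩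
    · intro x hx
      obtain ⟨y, hy⟩ := (QuotientGroup.eq_one_iff _).1 hx
      exact ⟨y, hy⟩
  have e1 : (1 + u) * (1 + a / (1 + u)) = (1 + a) * (1 + u / (1 + a)) := by
    have : 1 + u ≠ 0 := by rw [h1]; positivity
    have : 1 + a ≠ 0 := by rw [h2]; positivity
    field_simp; ring
  rw [h3, h4, h1, h2] at e1
  let a' := Units.mk0 a ha
  let u' := Units.mk0 u hu
  let b' := Units.mk0 b hb
  let z' := Units.mk0 z hz
  let r' := Units.mk0 r hr
  let s' := Units.mk0 s hs
  have e2 : (u' ^ 2 * b' ^ 3) * ((a' / (u' ^ 2 * b' ^ 3)) ^ j * r' ^ 3) =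
      (a' ^ 2 * z' ^ 3) * ((u' / (a' ^ 2 * z' ^ 3)) ^ k * s' ^ 3) := by
    ext
    simpa [a', u', b', z', r', s'] using e1
  have e3 := congrArg q e2
  simp only [map_mul, _root_.map_div, map_pow q (_ / _), hq3, mul_one] at e3
  have e4 := congrArg Additive.ofMul e3
  have := three_lin (Additive.ofMul (q a')) (Additive.ofMul (q u')) (by
      have := congrArg Additive.ofMul (hq3 a'); rw [map_pow] at this; exact_mod_cast this) (by
      have := congrArg Additive.ofMul (hq3 u'); rw [map_pow] at this; exact_mod_cast this) j k hj hk (by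
      simp only [map_pow] at e4
      norm_cast)
  rcases this with h | h | h
  · left
    obtain ⟨y, hy⟩ := hq1 u' h
    exact ⟨y, by rw [← Units.val_pow_eq_pow_val, hy]; rfl⟩
  · right; left
    obtain ⟨y, hy⟩ := hq1 a' h
    exact ⟨y, by rw [← Units.val_pow_eq_pow_val, hy]; rfl⟩
  · right; right
    have h' : q a' = q u' := h
    obtain ⟨y, hy⟩ := hq1 (a' / u') (by rw [_root_.map_div, h', div_self'])
    refine ⟨y, ?_⟩
    rw [← Units.val_pow_eq_pow_val, hy, Units.val_div_eq_div_val]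
    simp only [a', u', Units.val_mk0]
    field_simp

end excl
section rigid
variable {K F Ω : Type*} [Field K] [Field F] [Field Ω] [Algebra K F] [Algebra F Ω]
    [Algebra K Ω] [IsScalarTower K F Ω] [IsAlgClosed Ω] [Algebra.IsAlgebraic F Ω] [CharZero K]
    {Γ : Type*} [LinearOrderedCommGroupWithZero Γ]

variable (F) in
/-- nonzero `l`-th powers -/
def pS (l : ℕ) : Set F := {x | ∃ y, y ≠ 0 ∧ y ^ l = x}

/-- units of the base times `l`-th powers -/
def pT (F : Type*) [Field F] [Algebra K F] (v : Valuation K Γ) (l : ℕ) : Set F :=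
  {x | ∃ u : K, v u = 1 ∧ ∃ y, y ≠ 0 ∧ x = algebraMap K F u * y ^ l}

/-- units of the base -/
def pU (F : Type*) [Field F] [Algebra K F] (v : Valuation K Γ) : Set F := {x | ∃ u : K, v u = 1 ∧ algebraMap K F u = x}

lemma pT_ne {v : Valuation K Γ} {l : ℕ} {x : F} (hx : x ∈ pT F v l) : x ≠ 0 := by
  obtain ⟨u, hu, y, hy, rfl⟩ := hx
  have : u ≠ 0 := by rintro rfl; simp at hu
  refine mul_ne_zero (by simpa using this) (pow_ne_zero _ hy)

lemma pT_mul {v : Valuation K Γ} {l : ℕ} {x y : F} (hx : x ∈ pT F v l) (hy : y ∈ pT F v l) :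
    x * y ∈ pT F v l := by
  obtain ⟨u, hu, a, ha, rfl⟩ := hx
  obtain ⟨u', hu', a', ha', rfl⟩ := hy
  exact ⟨u * u', by rw [map_mul, hu, hu', one_mul], a * a', mul_ne_zero ha ha', by rw [map_mul]; ring⟩

lemma pT_inv {v : Valuation K Γ} {l : ℕ} {x : F} (hx : x ∈ pT F v l) : x⁻¹ ∈ pT F v l := by
  obtain ⟨u, hu, a, ha, rfl⟩ := hx
  exact ⟨u⁻¹, by rw [map_inv₀, hu, inv_one], a⁻¹, inv_ne_zero ha, by rw [map_inv₀, mul_inv, inv_pow]⟩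

lemma pT_of_pow {v : Valuation K Γ} {l : ℕ} {y : F} (hy : y ≠ 0) : y ^ l ∈ pT F v l :=
  ⟨1, map_one v, y, hy, by simp⟩

lemma pT_of_unit {v : Valuation K Γ} {l : ℕ} {u : K} (hu : v u = 1) : algebraMap K F u ∈ pT F v l :=
  ⟨u, hu, 1, one_ne_zero, by simp⟩

lemma pT_of_sq {v : Valuation K Γ} {a : F} (ha : a ≠ 0) (h : a ^ 2 ∈ pT F v 3) : a ∈ pT F v 3 := by
  have := pT_mul (pT_of_pow (v := v) (l := 3) ha) (pT_inv h)
  have e : a ^ 3 * (a ^ 2)⁻¹ = a := by field_simp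
  rwa [e] at this

theorem ResData.rigid (R : ResData K F Ω) (w : Valuation Ω Γ) {π : K}
    (hA : PA0 (w.comap (algebraMap K Ω)) π)
    {l : ℕ} (hl : l = 2 ∨ l = 3) (hvl : w (l : Ω) = 1) (ζ : K) (hζ1 : ζ ≠ 1) (hζ : ζ ^ l = 1) :
    Rigid (pS F l) (pT F (w.comap (algebraMap K Ω)) l) (pU F (w.comap (algebraMap K Ω))) := by
  set v := w.comap (algebraMap K Ω) with hv
  have hlp : l.Prime := by rcases hl with rfl | rfl <;> norm_num
  have hvl' : v (l : K) = 1 := by rw [hv, Valuation.comap_apply, map_natCast, hvl]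
  have hK : ∀ u : K, (∃ y : F, y ^ l = algebraMap K F u) → ∃ y : K, y ^ l = u := by
    rintro u ⟨y, hy⟩
    obtain ⟨a, rfl⟩ := R.mem_K y (by
      refine ⟨X ^ l - C u, X_pow_sub_C_ne_zero hlp.pos u, ?_⟩
      rw [map_sub, map_pow, aeval_X, aeval_C, ← map_pow, hy, ← IsScalarTower.algebraMap_apply, sub_self])
    refine ⟨a, (algebraMap K F).injective ?_⟩
    rw [map_pow, hy]
  have hweak : ∀ x : F, x ≠ 0 → x ∉ pT F v l → 1 + x ≠ 0 ∧ ∃ i < l, ∃ z : F, z ≠ 0 ∧ 1 + x = x ^ i * z ^ l := by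
    intro x hx hT
    have h1 : 1 + x ≠ 0 := by
      intro h
      apply hT
      have : x = algebraMap K F (-1) := by rw [map_neg, map_one]; linear_combination h
      rw [this]
      exact pT_of_unit (by simp)
    obtain ⟨i, hi, z, hz⟩ := R.weak w hA.hens hlp hvl x hx (by
      intro u hu y hxy
      refine hT ⟨u, hu, y, ?_, hxy⟩
      rintro rfl
      rw [zero_pow hlp.ne_zero, mul_zero] at hxy
      exact hx hxy)
    refine ⟨h1, i, hi, z, ?_, hz⟩
    rintro rfl
    rw [zero_pow hlp.ne_zero, mul_zero] at hz
    exact h1 hz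
  have hgood : ∀ u : K, (v (u - 1) = 1 ∧ ¬ ∃ y, y ^ l = u / (u - 1)) →
      (algebraMap K F u - 1 ∈ pU F v ∧ algebraMap K F u / (algebraMap K F u - 1) ∉ pS F l) := by
    rintro u ⟨h1, h2⟩
    refine ⟨⟨u - 1, h1, by simp⟩, ?_⟩
    rintro ⟨y, -, hy⟩
    apply h2
    apply hK
    exact ⟨y, by rw [hy]; simp⟩
  constructor
  · rintro ⟨y, hy, h⟩; exact hy (by simpa using pow_eq_zero_iff hlp.ne_zero |>.1 h)
  · exact ⟨1, one_ne_zero, one_pow _⟩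
  · rintro _ _ ⟨x, hx, rfl⟩ ⟨y, hy, rfl⟩; exact ⟨x * y, mul_ne_zero hx hy, mul_pow _ _ _⟩
  · rintro _ ⟨x, hx, rfl⟩; exact ⟨x⁻¹, inv_ne_zero hx, inv_pow _ _⟩
  · intro h; exact pT_ne h rfl
  · exact pT_mul
  · exact pT_inv
  · rintro _ ⟨x, hx, rfl⟩; exact pT_of_pow hx
  · rintro _ ⟨x, hx, rfl⟩; exact pT_of_unit hx
  · exact ⟨1, map_one v, map_one _⟩
  · rintro _ _ ⟨x, hx, rfl⟩ ⟨y, hy, rfl⟩; exact ⟨x * y, by rw [map_mul, hx, hy, one_mul], map_mul _ _ _⟩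
  · rintro _ ⟨x, hx, rfl⟩; exact ⟨x⁻¹, by rw [map_inv₀, hx, inv_one], map_inv₀ _ _⟩
  · exact ⟨-1, by simp, by simp⟩
  · intro x hx hT
    obtain ⟨h1, i, hi, z, hz, e⟩ := hweak x hx hT
    by_cases hi0 : i = 0
    · left; subst hi0; exact ⟨z, hz, by rw [e]; simp⟩
    by_cases hi1 : i = 1
    · right; subst hi1; exact ⟨z, hz, by rw [e]; field_simp⟩
    exfalso
    have hl3 : l = 3 := by rcases hl with rfl | rfl <;> omega
    have hi2 : i = 2 := by omega
    subst hl3 hi2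
    obtain ⟨u, b, hu, hnu, hb, e1⟩ := hA.three hvl' ζ hζ1 hζ
    have hu0 : u ≠ 0 := by rintro rfl; simp at hu
    have hu0' : algebraMap K F u ≠ 0 := by simpa using hu0
    have hb' : algebraMap K F b ≠ 0 := by simpa using hb
    have e1' : 1 + algebraMap K F u = algebraMap K F u ^ 2 * algebraMap K F b ^ 3 := by
      have := congrArg (algebraMap K F) e1
      simpa using this
    have h1u : 1 + algebraMap K F u ∈ pT F v 3 := by
      rw [e1', ← map_pow]
      exact pT_mul (pT_of_unit (by rw [map_pow, hu, one_pow])) (pT_of_pow hb')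
    have h1x : 1 + x ∉ pT F v 3 := by
      intro h
      apply hT
      apply pT_of_sq hx
      have := pT_mul h (pT_inv (pT_of_pow (v := v) (l := 3) hz))
      rw [e] at this
      have e' : x ^ 2 * z ^ 3 * (z ^ 3)⁻¹ = x ^ 2 := by field_simp
      rwa [e'] at this
    have n1 : x / (1 + algebraMap K F u) ∉ pT F v 3 := by
      intro h
      have := pT_mul h h1u
      rw [div_mul_cancel₀ _ (pT_ne h1u)] at this
      exact hT this
    have n2 : algebraMap K F u / (1 + x) ∉ pT F v 3 := by
      intro h
      have := pT_mul (pT_of_unit (F := F) (v := v) (l := 3) hu) (pT_inv h)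
      have e' : algebraMap K F u * (algebraMap K F u / (1 + x))⁻¹ = 1 + x := by field_simp
      rw [e'] at this
      exact h1x this
    obtain ⟨-, j, hj, r, hr, e3⟩ := hweak _ (div_ne_zero hx (pT_ne h1u)) n1
    obtain ⟨-, k, hk, s, hs, e4⟩ := hweak _ (div_ne_zero hu0' h1) n2
    rcases three_excl x (algebraMap K F u) (algebraMap K F b) z r s hx hu0' hb' hz hr hs e1' e j k hj hk e3 e4 with h | h | h
    · exact hnu (hK u h)
    · obtain ⟨y, rfl⟩ := h
      exact hT (pT_of_pow (by rintro rfl; simp at hx))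
    · obtain ⟨y, hy⟩ := h
      exact hT ⟨u, hu, y, by rintro rfl; exact hx (by rw [hy]; simp), hy⟩
  · rintro _ ⟨u, hu, rfl⟩
    rcases hA.good l hlp hvl' ζ hζ1 hζ u hu with h | ⟨g, h, hg, hh, rfl, h1, h2⟩
    · left; exact hgood u h
    · right
      exact ⟨algebraMap K F g, algebraMap K F h, ⟨g, hg, rfl⟩, ⟨h, hh, rfl⟩, map_mul _ _ _, hgood g h1, hgood h h2⟩

/-- The valuation ring obtained from rigidity. -/
theorem ResData.exists_ring (R : ResData K F Ω) (w : Valuation Ω Γ) {π : K}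
    (hA : PA0 (w.comap (algebraMap K Ω)) π)
    {l : ℕ} (hl : l = 2 ∨ l = 3) (hvl : w (l : Ω) = 1) (ζ : K) (hζ1 : ζ ≠ 1) (hζ : ζ ^ l = 1) :
    ∃ O : ValuationSubring F,
    (∀ x, x ∈ O ↔ ∀ y ∈ rI (pS F l) (pT F (w.comap (algebraMap K Ω)) l),
      x * y ∈ AddSubgroup.closure (rI (pS F l) (pT F (w.comap (algebraMap K Ω)) l))) ∧
    (∀ a : K, algebraMap K F a ∈ O ↔ w (algebraMap K Ω a) ≤ 1) ∧
    (∀ x, x ≠ 0 → x ∈ O → x⁻¹ ∈ O → x ∈ pT F (w.comap (algebraMap K Ω)) l) ∧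
    (∀ f, f ≠ 0 → f ∈ O → f⁻¹ ∉ O → f ∈ pT F (w.comap (algebraMap K Ω)) l →
      ∃ z, z ≠ 0 ∧ z ∉ pT F (w.comap (algebraMap K Ω)) l ∧ z ∈ O ∧ f / z ∈ O ∧ (f / z)⁻¹ ∉ O) := by
  obtain ⟨O, h1, h2, h3, h4, h5, h6⟩ := (R.rigid w hA hl hvl ζ hζ1 hζ).exists_valuationSubring
  refine ⟨O, h1, ?_, h5, h6⟩
  set v := w.comap (algebraMap K Ω) with hv
  have hlp : l.Prime := by rcases hl with rfl | rfl <;> norm_num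
  have hvl' : v (l : K) = 1 := by rw [hv, Valuation.comap_apply, map_natCast, hvl]
  have hm : ∀ a : K, v a < 1 → 1 + algebraMap K F a ∈ pS F l := by
    intro a ha
    obtain ⟨z, hz, hz'⟩ := hA.hens.one_add_pow hlp.pos hvl' a ha
    refine ⟨algebraMap K F z, ?_, by rw [← map_pow, hz]; simp⟩
    have : z ≠ 0 := by
      rintro rfl
      rw [zero_sub, Valuation.map_neg, map_one] at hz'
      exact lt_irrefl _ hz'
    simpa using this
  have hle : ∀ a : K, v a ≤ 1 → algebraMap K F a ∈ O := by
    intro a ha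
    rcases ha.lt_or_eq with h | h
    · apply h3
      rintro _ ⟨u, hu, rfl⟩
      rw [← map_mul]
      apply hm
      rwa [map_mul, hu, one_mul]
    · exact h2 _ ⟨a, h, rfl⟩
  have hπ : (algebraMap K F π)⁻¹ ∉ O := by
    apply h4
    refine ⟨by simpa using hA.π0, ?_, hm π hA.lt_one⟩
    rintro ⟨u, hu, y, hy, e⟩
    have hu0 : u ≠ 0 := by rintro rfl; simp at hu
    have hu0' : algebraMap K F u ≠ 0 := by simpa using hu0
    obtain ⟨a, rfl⟩ := R.mem_K y (by
      refine ⟨X ^ l - C (π / u), X_pow_sub_C_ne_zero hlp.pos _, ?_⟩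
      rw [map_sub, map_pow, aeval_X, aeval_C, ← map_pow, IsScalarTower.algebraMap_apply K F Ω, ← map_sub, map_div₀, e]
      rw [mul_div_cancel_left₀ _ hu0', sub_self, map_zero])
    apply hA.not_pow hlp.one_lt a u hu
    apply (algebraMap K F).injective
    rw [e]; simp
  intro a
  refine ⟨fun h => ?_, hle a⟩
  by_contra hc
  have hc' : 1 < v a := not_le.1 hc
  have ha0 : a ≠ 0 := by rintro rfl; simp at hc'
  have : v a⁻¹ < 1 := by rw [map_inv₀]; exact inv_lt_one_of_one_lt₀ hc'
  rw [hA.unif] at this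
  have hvπ : v π ≠ 0 := by simpa using hA.π0
  have h7 : v (a⁻¹ * π⁻¹) ≤ 1 := by
    rw [map_mul, map_inv₀ v π]
    exact mul_inv_le_one_of_le₀ this zero_le
  have := O.mul_mem _ _ h (hle _ h7)
  rw [← map_mul, mul_inv_cancel_left₀ ha0, map_inv₀] at this
  exact hπ this

end rigid
end PAC
end Part8

section Part9
open Polynomial
open scoped IntermediateField

namespace PAC
set_option linter.unusedSectionVars false

section uniq
variable {K F Ω : Type*} [Field K] [Field F] [Field Ω] [Algebra K F] [Algebra F Ω]
    [Algebra K Ω] [IsScalarTower K F Ω] [IsAlgClosed Ω] [Algebra.IsAlgebraic F Ω] [CharZero K]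
    {Γ Γ₂ Γ₃ : Type*} [LinearOrderedCommGroupWithZero Γ]
    [LinearOrderedCommGroupWithZero Γ₂] [LinearOrderedCommGroupWithZero Γ₃]

variable (K) in
include K in
lemma mem_of_fixed (E : IntermediateField F Ω) (x : Ω) (h : ∀ σ : Ω ≃ₐ[F] Ω, (∀ a ∈ E, σ a = a) → σ x = x) :
    x ∈ E := by
  have : CharZero F := charZero_of_injective_algebraMap (algebraMap K F).injective
  have : IsAlgClosure F Ω := ⟨inferInstance, inferInstance⟩
  have : Normal F Ω := IsAlgClosure.normal F Ω
  have hGal : IsGalois F Ω := ⟨⟩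
  have h1 := InfiniteGalois.fixedField_fixingSubgroup E
  rw [← h1, IntermediateField.mem_fixedField_iff]
  intro σ hσ
  apply h
  intro a ha
  exact (IntermediateField.mem_fixingSubgroup_iff _ _).1 hσ a ha

lemma pT_zpow {v : Valuation K Γ} {l : ℕ} {x : F} (hx : x ∈ pT F v l) (n : ℤ) : x ^ n ∈ pT F v l := by
  have hn : ∀ m : ℕ, x ^ m ∈ pT F v l := by
    intro m
    induction m with
    | zero => rw [pow_zero]; exact ⟨1, map_one v, 1, one_ne_zero, by simp⟩
    | succ k ih => rw [pow_succ]; exact pT_mul ih hx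
  rcases n with m | m
  · simpa using hn m
  · rw [zpow_negSucc]; exact pT_inv (hn _)

lemma pT_coprime {v : Valuation K Γ} {l m : ℕ} (h : Nat.Coprime m l) {x : F} (h0 : x ≠ 0) (hx : x ^ m ∈ pT F v l) :
    x ∈ pT F v l := by
  have hb' := Nat.gcd_eq_gcd_ab m l
  rw [h] at hb'
  have h1 := pT_mul (pT_zpow hx (Nat.gcdA m l)) (pT_zpow (pT_of_pow (v := v) (l := l) h0) (Nat.gcdB m l))
  rw [← zpow_natCast, ← zpow_natCast x l, ← zpow_mul, ← zpow_mul, ← zpow_add₀ h0, ← hb'] at h1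
  simpa using h1

lemma ResData.uniq_aux (R : ResData K F Ω) (v : Valuation K Γ) (w₂ : Valuation Ω Γ₂) (w₃ : Valuation Ω Γ₃)
    (he : (w₂.comap (algebraMap F Ω)).IsEquiv (w₃.comap (algebraMap F Ω)))
    (hH : Hens (w₂.comap (algebraMap K Ω))) {l : ℕ} (hl : l.Prime)
    (hunit : ∀ x : F, x ≠ 0 → w₂ (algebraMap F Ω x) = 1 → x ∈ pT F v l)
    (x : Ω) (f : F) (hf : f ≠ 0) (h2 : w₂ x = w₂ (algebraMap F Ω f)) (h3 : w₃ x = 1) : f ∈ pT F v l := by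
  classical
  have : CharZero F := charZero_of_injective_algebraMap (algebraMap K F).injective
  have hfin := fun a b => Valuation.IsEquiv.eq_iff he (r := a) (s := b)
  simp only [Valuation.comap_apply] at hfin
  have heK : (w₂.comap (algebraMap K Ω)).IsEquiv (w₃.comap (algebraMap K Ω)) := by
    intro a b
    have := he (algebraMap K F a) (algebraMap K F b)
    simpa [Valuation.comap_apply, ← IsScalarTower.algebraMap_apply] using this
  have hH3 : Hens (w₃.comap (algebraMap K Ω)) := hH.of_equiv heK
  have hx0 : x ≠ 0 := by rintro rfl; simp at h3
  obtain ⟨s, hs, hxs⟩ := R.r3 x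
  set L := IntermediateField.adjoin K (s : Set Ω) with hL
  set E := IntermediateField.adjoin F (s : Set Ω) with hE
  have hLalg : L ≤ algebraicClosure K Ω := by
    rw [hL, IntermediateField.adjoin_le_iff]
    intro a ha
    exact mem_algebraicClosure_iff.2 (hs a ha)
  have hsL : ∀ a ∈ s, a ∈ L := fun a ha => IntermediateField.subset_adjoin K _ ha
  have hfixE : ∀ σ : Ω ≃ₐ[F] Ω, (∀ a ∈ L, σ a = a) → ∀ a ∈ E, σ a = a := fun σ hσ =>
    fixes_adjoin (K := F) σ (s : Set Ω) (fun a ha => hσ a (hsL a ha))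
  have hfixL : ∀ σ : Ω ≃ₐ[F] Ω, (∀ a ∈ E, σ a = a) → ∀ a ∈ L, σ a = a := fun σ hσ =>
    fixes_adjoin (K := K) σ (s : Set Ω) (fun a ha => hσ a (IntermediateField.subset_adjoin F _ ha))
  have hFx : Fx F L x := fun σ hσ => hfixE σ hσ x hxs
  have : FiniteDimensional K L := IntermediateField.finiteDimensional_adjoin
    (fun a ha => (hs a ha).isIntegral)
  have : FiniteDimensional F E := IntermediateField.finiteDimensional_adjoin
    (fun a ha => (Algebra.IsIntegral.isIntegral a))
  set D1 := Module.finrank K L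
  set D2 := Module.finrank F E
  have hD1 : D1 ≠ 0 := Module.finrank_pos.ne'
  obtain ⟨a, N, hN, hNe⟩ := Nat.exists_eq_pow_mul_and_not_dvd (n := D1 * D2.factorial)
    (mul_ne_zero hD1 (Nat.factorial_ne_zero _)) l hl.ne_one
  obtain ⟨c, hc, t, hc0, ht0, ht, e⟩ := R.r2 L hLalg x hx0 hFx (l ^ (a + 1)) (pow_pos hl.pos _)
  have htE : t ∈ E := mem_of_fixed K E t (fun σ hσ => ht σ (hfixL σ hσ))
  -- the element c
  have hcalg : IsIntegral K c := (mem_algebraicClosure_iff.1 (hLalg hc)).isIntegral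
  have hcd : (minpoly K c).natDegree ∣ D1 := by
    have := minpoly.degree_dvd (K := K) (x := (⟨c, hc⟩ : L)) (Algebra.IsIntegral.isIntegral _)
    rwa [← minpoly.algebraMap_eq (algebraMap L Ω).injective] at this
  obtain ⟨q, hq⟩ := hcd
  obtain ⟨c0, hc0'⟩ : ∃ c0 : F, c0 = algebraMap K F ((minpoly K c).coeff 0) ^ (q * D2.factorial) := ⟨_, rfl⟩
  have hc2 : w₂ c ^ (D1 * D2.factorial) = w₂ (algebraMap F Ω c0) := by
    rw [hq, mul_assoc, pow_mul, hH.pow_eq c hcalg, hc0', map_pow, map_pow, ← IsScalarTower.algebraMap_apply]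
  have hc3 : w₃ c ^ (D1 * D2.factorial) = w₃ (algebraMap F Ω c0) := by
    rw [hq, mul_assoc, pow_mul, hH3.pow_eq c hcalg, hc0', map_pow, map_pow, ← IsScalarTower.algebraMap_apply]
  -- the element t
  have htint : IsIntegral F t := Algebra.IsIntegral.isIntegral t
  have htd : (minpoly F t).natDegree ≤ D2 := by
    have := minpoly.natDegree_le (A := F) (⟨t, htE⟩ : E)
    rwa [← minpoly.algebraMap_eq (algebraMap E Ω).injective] at this
  have key : ∀ {Γ' : Type _} [LinearOrderedCommGroupWithZero Γ'] (w : Valuation Ω Γ'),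
      ∃ h : F, h ≠ 0 ∧ w t ^ (D1 * D2.factorial) = w (algebraMap F Ω h) := by
    intro Γ' _ w
    obtain ⟨n, hn, hnd, m, hm, e⟩ := exists_pow_eq w (minpoly.ne_zero htint) ht0 (minpoly.aeval F t)
    obtain ⟨k, hk⟩ := Nat.dvd_factorial hn (hnd.trans htd)
    refine ⟨m ^ (D1 * k), pow_ne_zero _ hm, ?_⟩
    rw [hk, show D1 * (n * k) = n * (D1 * k) by ring, pow_mul, e, map_pow, map_pow]
  have key2 : ∃ h : F, h ≠ 0 ∧ w₂ t ^ (D1 * D2.factorial) = w₂ (algebraMap F Ω h) := by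
    obtain ⟨n, hn, hnd, m, hm, e⟩ := exists_pow_eq w₂ (minpoly.ne_zero htint) ht0 (minpoly.aeval F t)
    obtain ⟨k, hk⟩ := Nat.dvd_factorial hn (hnd.trans htd)
    refine ⟨m ^ (D1 * k), pow_ne_zero _ hm, ?_⟩
    rw [hk, show D1 * (n * k) = n * (D1 * k) by ring, pow_mul, e, map_pow, map_pow]
  obtain ⟨k2, hk2, e2⟩ := key2
  obtain ⟨k3, hk3, e3⟩ := key w₃
  have hf2 : w₂ (algebraMap F Ω (f ^ (D1 * D2.factorial))) = w₂ (algebraMap F Ω (c0 * k2 ^ (l ^ (a + 1)))) := by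
    rw [map_pow, map_pow, ← h2, e, map_mul, map_pow, mul_pow, hc2, ← pow_mul, mul_comm (l ^ (a + 1)), pow_mul, e2,
      map_mul (algebraMap F Ω), map_mul, map_pow (algebraMap F Ω) k2, map_pow]
  have hf3 : w₃ (algebraMap F Ω 1) = w₃ (algebraMap F Ω (c0 * k3 ^ (l ^ (a + 1)))) := by
    have : w₃ x ^ (D1 * D2.factorial) = 1 := by rw [h3, one_pow]
    rw [map_one, map_one, ← this, e, map_mul, map_pow, mul_pow, hc3, ← pow_mul, mul_comm (l ^ (a + 1)), pow_mul, e3,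
      map_mul (algebraMap F Ω), map_mul, map_pow (algebraMap F Ω) k3, map_pow]
  rw [← hfin, map_one, map_one, map_mul, map_mul] at hf3
  have hc0ne : w₂ (algebraMap F Ω c0) ≠ 0 := by
    intro h; rw [h, zero_mul] at hf3; exact one_ne_zero hf3
  have hk2' : w₂ (algebraMap F Ω k2) ≠ 0 := by simpa using hk2
  have hk3' : w₂ (algebraMap F Ω k3) ≠ 0 := by simpa using hk3
  have hfin1 : w₂ (algebraMap F Ω f) ^ (D1 * D2.factorial) = w₂ (algebraMap F Ω (k2 / k3)) ^ (l ^ (a + 1)) := by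
    rw [← map_pow, ← map_pow, hf2, map_div₀, map_div₀, div_pow, map_mul, map_mul, map_pow, map_pow,
      eq_div_iff (pow_ne_zero _ hk3')]
    rw [map_pow, map_pow] at hf3
    calc _ = (w₂ (algebraMap F Ω c0) * w₂ (algebraMap F Ω k3) ^ l ^ (a + 1)) * w₂ (algebraMap F Ω k2) ^ l ^ (a + 1) := by rw [mul_right_comm]
      _ = _ := by rw [← hf3, one_mul]
  rw [hNe, mul_comm (l ^ a), pow_mul, pow_succ l, mul_comm (l ^ a), pow_mul] at hfin1
  have h5 := (pow_left_inj₀ zero_le zero_le (pow_pos hl.pos a).ne').1 hfin1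
  set h := k2 / k3
  have hh : h ≠ 0 := div_ne_zero hk2 hk3
  have h6 : f ^ N / h ^ l ∈ pT F v l := by
    apply hunit _ (div_ne_zero (pow_ne_zero _ hf) (pow_ne_zero _ hh))
    rw [map_div₀, map_div₀, map_pow, map_pow, map_pow, map_pow, h5, div_self]
    apply pow_ne_zero; simpa using hh
  have h7 := pT_mul h6 (pT_of_pow (v := v) (l := l) hh)
  rw [div_mul_cancel₀ _ (pow_ne_zero _ hh)] at h7
  exact pT_coprime (Nat.Coprime.symm (hl.coprime_iff_not_dvd.2 hN)) hf h7

lemma val_pow_sub_one (w : Valuation Ω Γ) (y : Ω) (h : w (1 - y) < 1) (m : ℕ) : w (1 - y ^ m) < 1 := by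
  have hy : w y = 1 := by
    have := w.map_one_sub_of_lt h
    simpa using this
  induction m with
  | zero => simp
  | succ k ih =>
    have e : 1 - y ^ (k + 1) = (1 - y ^ k) * y + (1 - y) := by ring
    rw [e]
    refine w.map_add_lt ?_ h
    rwa [map_mul, hy, mul_one]

theorem ResData.uniq (R : ResData K F Ω) (v : Valuation K Γ) (w₂ : Valuation Ω Γ₂) (w₃ : Valuation Ω Γ₃)
    (he : (w₂.comap (algebraMap F Ω)).IsEquiv (w₃.comap (algebraMap F Ω)))
    (hH : Hens (w₂.comap (algebraMap K Ω))) {l : ℕ} (hl : l.Prime)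
    (hunit : ∀ x : F, x ≠ 0 → w₂ (algebraMap F Ω x) = 1 → x ∈ pT F v l)
    (hz : ∀ f : F, f ≠ 0 → w₂ (algebraMap F Ω f) < 1 → f ∈ pT F v l →
      ∃ z : F, z ≠ 0 ∧ z ∉ pT F v l ∧ w₂ (algebraMap F Ω z) ≤ 1 ∧ w₂ (algebraMap F Ω f) < w₂ (algebraMap F Ω z))
    (r : Ω) (hr2 : w₂ r ≤ 1) : w₃ r ≤ 1 := by
  by_contra hr3
  rw [not_le] at hr3
  have hr0 : r ≠ 0 := by rintro rfl; simp at hr3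
  obtain ⟨n, hn, -, f, hf, e⟩ := exists_pow_eq w₃ (minpoly.ne_zero (Algebra.IsIntegral.isIntegral (R := F) r)) hr0
    (minpoly.aeval F r)
  have hf3 : 1 < w₃ (algebraMap F Ω f) := by rw [← e]; exact one_lt_pow₀ hr3 hn.ne'
  have hf2 : 1 < w₂ (algebraMap F Ω f) := by
    have := Valuation.IsEquiv.one_lt_iff_one_lt he (x := f)
    exact this.2 hf3
  have hf' : algebraMap F Ω f ≠ 0 := by simpa using hf
  set r1 := r ^ (2 * n) / algebraMap F Ω f with hr1
  have h2r1 : w₂ r1 < 1 := by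
    rw [hr1, map_div₀, map_pow]
    refine (div_lt_one₀ (zero_lt_one.trans hf2)).2 (lt_of_le_of_lt (pow_le_one₀ zero_le hr2) hf2)
  have h3r1 : 1 < w₃ r1 := by
    rw [hr1, map_div₀, map_pow, mul_comm, pow_mul, e, sq, mul_div_assoc, div_self, mul_one]
    · exact hf3
    · exact (zero_lt_one.trans hf3).ne'
  have h10 : 1 + r1 ≠ 0 := by
    intro h
    have : w₂ r1 = 1 := by rw [← Valuation.map_neg, ← Valuation.map_one w₂]; congr 1; linear_combination -h
    exact h2r1.ne this
  set y := r1 / (1 + r1) with hy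
  have hy1 : 1 - y = 1 / (1 + r1) := by rw [hy]; field_simp; ring
  have hr10 : r1 ≠ 0 := by rintro h; rw [h] at h3r1; simp at h3r1
  have hy0 : y ≠ 0 := div_ne_zero hr10 h10
  have h2y : w₂ y < 1 := by
    rw [hy, map_div₀, w₂.map_one_add_of_lt h2r1, div_one]; exact h2r1
  have h3y : w₃ (1 - y) < 1 := by
    rw [hy1, map_div₀, map_one, add_comm, w₃.map_add_eq_of_lt_left (by rwa [map_one]), one_div]
    exact inv_lt_one_of_one_lt₀ h3r1
  have h3ym : ∀ m, w₃ (y ^ m) = 1 := by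
    intro m
    have := w₃.map_one_sub_of_lt (val_pow_sub_one w₃ y h3y m)
    simpa using this
  obtain ⟨m, hm, -, g, hg, e2⟩ := exists_pow_eq w₂ (minpoly.ne_zero (Algebra.IsIntegral.isIntegral (R := F) y)) hy0
    (minpoly.aeval F y)
  by_cases hgT : g ∈ pT F v l
  · obtain ⟨z, hz0, hzT, hz1, hz2⟩ := hz g hg (by rw [← e2]; exact pow_lt_one₀ zero_le h2y hm.ne') hgT
    apply hzT
    have h2ym : w₂ (y ^ m) < 1 := by rw [map_pow]; exact pow_lt_one₀ zero_le h2y hm.ne'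
    refine R.uniq_aux v w₂ w₃ he hH hl hunit (algebraMap F Ω z * (1 - y ^ m) + y ^ m) z hz0 ?_ ?_
    · have e3 : w₂ (algebraMap F Ω z * (1 - y ^ m)) = w₂ (algebraMap F Ω z) := by
        rw [map_mul, w₂.map_one_sub_of_lt h2ym, mul_one]
      rw [w₂.map_add_eq_of_lt_left, e3]
      rw [e3, map_pow, e2]; exact hz2
    · rw [w₃.map_add_eq_of_lt_right, h3ym]
      rw [h3ym, map_mul]
      have hz3 : w₃ (algebraMap F Ω z) ≤ 1 := (Valuation.IsEquiv.le_one_iff_le_one he (x := z)).1 hz1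
      exact mul_lt_one_of_nonneg_of_lt_one_right hz3 zero_le (val_pow_sub_one w₃ y h3y m)
  · exact hgT (R.uniq_aux v w₂ w₃ he hH hl hunit (y ^ m) g hg (by rw [map_pow, e2]) (h3ym m))

end uniq
end PAC
end Part9

section Part10
open Polynomial
open scoped IntermediateField

namespace PAC
set_option linter.unusedSectionVars false

section bc
variable {K L F E Ω : Type*} [Field K] [Field L] [Field F] [Field E] [Field Ω] [Algebra K F] [Algebra F Ω]
    [Algebra K Ω] [IsScalarTower K F Ω] [Algebra K L] [Algebra L Ω] [IsScalarTower K L Ω]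
    [Algebra F E] [Algebra E Ω] [IsScalarTower F E Ω] [Algebra L E] [IsScalarTower L E Ω]

lemma ResData.base_change [Algebra.IsAlgebraic K L] (R : ResData K F Ω)
    (hE : ∀ σ : Ω ≃ₐ[F] Ω, (∀ a : L, σ (algebraMap L Ω a) = algebraMap L Ω a) →
      ∀ x : E, σ (algebraMap E Ω x) = algebraMap E Ω x) : ResData L E Ω := by
  have hlift : ∀ σ : Ω ≃ₐ[F] Ω, (∀ a : L, σ (algebraMap L Ω a) = algebraMap L Ω a) →
      ∃ τ : Ω ≃ₐ[E] Ω, ∀ x, τ x = σ x := by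
    intro σ hσ
    exact ⟨AlgEquiv.ofRingEquiv (f := σ.toRingEquiv) (hE σ hσ), fun x => rfl⟩
  have hFx : ∀ (M : IntermediateField L Ω) x, Fx E M x ↔ Fx F (M.restrictScalars K) x := by
    intro M x
    constructor
    · intro h σ hσ
      obtain ⟨τ, hτ⟩ := hlift σ (fun a => hσ _ (M.algebraMap_mem a))
      rw [← hτ]
      exact h τ (fun a ha => by rw [hτ]; exact hσ a ha)
    · intro h σ hσ
      exact h (σ.restrictScalars F) hσ
  have hle : ∀ M : IntermediateField L Ω, M ≤ algebraicClosure L Ω → M.restrictScalars K ≤ algebraicClosure K Ω := by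
    intro M hM x hx
    have : IsAlgebraic L x := mem_algebraicClosure_iff.1 (hM hx)
    exact mem_algebraicClosure_iff.2 (this.restrictScalars K)
  constructor
  · intro M hM x hx hf
    exact R.r1 (M.restrictScalars K) (hle M hM) x (hx.restrictScalars K) ((hFx M x).1 hf)
  · intro M hM x hx hf n hn
    obtain ⟨c, hc, t, h1, h2, h3, h4⟩ := R.r2 (M.restrictScalars K) (hle M hM) x hx ((hFx M x).1 hf) n hn
    exact ⟨c, hc, t, h1, h2, (hFx M t).2 h3, h4⟩
  · intro x
    obtain ⟨s, hs, hx⟩ := R.r3 x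
    refine ⟨s, fun a ha => (hs a ha).tower_top L, ?_⟩
    have : IntermediateField.adjoin F (s : Set Ω) ≤ (IntermediateField.adjoin E (s : Set Ω)).restrictScalars F := by
      rw [IntermediateField.adjoin_le_iff]
      exact IntermediateField.subset_adjoin E _
    exact this hx
  · intro x y hx M hM hy
    obtain ⟨σ, hσ, h⟩ := R.lift x y (hx.restrictScalars K) (M.restrictScalars K) (hle M hM) hy
    obtain ⟨τ, hτ⟩ := hlift σ (fun a => hσ _ (M.algebraMap_mem a))
    exact ⟨τ, fun a ha => by rw [hτ]; exact hσ a ha, by rw [hτ, h]⟩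
end bc

section exV
variable {K F Ω : Type*} [Field K] [Field F] [Field Ω] [Algebra K F] [Algebra F Ω]
    [Algebra K Ω] [IsScalarTower K F Ω] [IsAlgClosed Ω] [Algebra.IsAlgebraic F Ω] [CharZero K]
    {Γ : Type*} [LinearOrderedCommGroupWithZero Γ]

lemma closure_stable {I : Set F} (e : F ≃+* F) (h : ∀ x ∈ I, e x ∈ I) (x : F) (hx : x ∈ AddSubgroup.closure I) :
    e x ∈ AddSubgroup.closure I := by
  induction hx using AddSubgroup.closure_induction with
  | mem x hx => exact AddSubgroup.subset_closure (h x hx)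
  | zero => rw [map_zero]; exact zero_mem _
  | add x y _ _ h1 h2 => rw [map_add]; exact add_mem h1 h2
  | neg x _ h1 => rw [map_neg]; exact neg_mem h1

lemma rI_stable (T : Set F) (l : ℕ) (e : F ≃+* F) (h : ∀ x ∈ T, e.symm x ∈ T) :
    ∀ x ∈ rI (pS F l) T, e x ∈ rI (pS F l) T := by
  rintro x ⟨h0, h1, y, hy, h2⟩
  refine ⟨by simpa using h0, fun h3 => h1 (by simpa using h _ h3), e y, by simpa using hy, ?_⟩
  rw [← map_pow, h2, map_add, map_one]

lemma O_stable (T : Set F) (l : ℕ) (e : F ≃+* F) (h : ∀ x ∈ T, e x ∈ T) (h' : ∀ x ∈ T, e.symm x ∈ T) (x : F)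
    (hx : ∀ y ∈ rI (pS F l) T, x * y ∈ AddSubgroup.closure (rI (pS F l) T)) :
    ∀ y ∈ rI (pS F l) T, e x * y ∈ AddSubgroup.closure (rI (pS F l) T) := by
  intro y hy
  have h1 := rI_stable T l e.symm (by simpa using h) y hy
  have h2 := closure_stable e (rI_stable T l e h') _ (hx _ h1)
  simpa using h2

lemma ResData.exists_V (R : ResData K F Ω) (w : Valuation Ω Γ) {π : K}
    (hA : PA0 (w.comap (algebraMap K Ω)) π)
    {l : ℕ} (hl : l = 2 ∨ l = 3) (hvl : w (l : Ω) = 1) (ζ : K) (hζ1 : ζ ≠ 1) (hζ : ζ ^ l = 1) :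
    ∃ V : ValuationSubring Ω, (V.valuation.comap (algebraMap K Ω)).IsEquiv (w.comap (algebraMap K Ω)) ∧
    ∀ (g : Ω ≃+* Ω) (e : F ≃+* F), (∀ x, g (algebraMap F Ω x) = algebraMap F Ω (e x)) →
    (∀ x ∈ pT F (w.comap (algebraMap K Ω)) l, e x ∈ pT F (w.comap (algebraMap K Ω)) l) →
    (∀ x ∈ pT F (w.comap (algebraMap K Ω)) l, e.symm x ∈ pT F (w.comap (algebraMap K Ω)) l) →
    ∀ r, V.valuation r ≤ 1 → V.valuation (g r) ≤ 1 := by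
  obtain ⟨O, h1, h2, h3, h4⟩ := R.exists_ring w hA hl hvl ζ hζ1 hζ
  have hlp : l.Prime := by rcases hl with rfl | rfl <;> norm_num
  obtain ⟨V, hV⟩ := exists_extension (Ω := Ω) O.valuation
  have hVK : (V.valuation.comap (algebraMap K Ω)).IsEquiv (w.comap (algebraMap K Ω)) := by
    apply Valuation.isEquiv_of_val_le_one
    intro a
    rw [Valuation.comap_apply, Valuation.comap_apply, ← h2, ← ValuationSubring.valuation_le_one_iff,
      ← hV.le_one_iff_le_one, Valuation.comap_apply, ← IsScalarTower.algebraMap_apply]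
  refine ⟨V, hVK, ?_⟩
  intro g e hge hT hT'
  have hVO : ∀ x : F, V.valuation (algebraMap F Ω x) ≤ 1 ↔ x ∈ O := by
    intro x
    rw [← ValuationSubring.valuation_le_one_iff, ← hV.le_one_iff_le_one, Valuation.comap_apply]
  have hVO' : ∀ x : F, V.valuation (algebraMap F Ω x) < 1 ↔ x = 0 ∨ (x ∈ O ∧ x⁻¹ ∉ O) := by
    intro x
    by_cases hx : x = 0
    · simp [hx]
    have hx' : V.valuation (algebraMap F Ω x) ≠ 0 := by simpa using hx
    rw [← hVO, ← hVO, map_inv₀, map_inv₀, not_le]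
    constructor
    · intro h
      exact Or.inr ⟨h.le, (one_lt_inv₀ (zero_lt_iff.2 hx')).2 h⟩
    · rintro (h | ⟨_, h⟩)
      · exact absurd h hx
      · exact (one_lt_inv₀ (zero_lt_iff.2 hx')).1 h
  have hOe : ∀ x, x ∈ O ↔ e x ∈ O := by
    intro x
    rw [h1, h1]
    refine ⟨O_stable _ l e hT hT' x, fun h => ?_⟩
    have := O_stable _ l e.symm hT' (by simpa using hT) _ h
    simpa using this
  intro r hr
  have := R.uniq (w.comap (algebraMap K Ω)) V.valuation (V.valuation.comap (g : Ω →+* Ω)) (l := l) ?_ ?_ hlp ?_ ?_ r hr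
  · exact this
  · apply Valuation.isEquiv_of_val_le_one
    intro x
    rw [Valuation.comap_apply, Valuation.comap_apply, Valuation.comap_apply, RingEquiv.coe_toRingHom, hge, hVO, hVO]
    exact hOe x
  · exact hA.hens.of_equiv hVK.symm
  · intro x hx hx1
    apply h3 x hx ((hVO x).1 hx1.le)
    rw [← hVO, map_inv₀, map_inv₀, hx1, inv_one]
  · intro f hf hf1 hfT
    rw [hVO'] at hf1
    obtain ⟨ha, hb⟩ := hf1.resolve_left hf
    obtain ⟨z, hz0, hz1, hz2, hz3, hz4⟩ := h4 f hf ha hb hfT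
    refine ⟨z, hz0, hz1, (hVO z).2 hz2, ?_⟩
    have := (hVO' (f / z)).2 (Or.inr ⟨hz3, hz4⟩)
    rw [map_div₀, map_div₀] at this
    exact (div_lt_one₀ (zero_lt_iff.2 (by simpa using hz0))).1 this

lemma Inv_of_le (w : Valuation Ω Γ) (h : ∀ (g : Ω ≃ₐ[F] Ω) r, w r ≤ 1 → w (g r) ≤ 1) : Inv F w := by
  intro σ x
  by_cases hx : x = 0
  · simp [hx]
  obtain ⟨n, hn, -, f, hf, e⟩ := exists_pow_eq w (minpoly.ne_zero (Algebra.IsIntegral.isIntegral (R := F) x)) hx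
    (minpoly.aeval F x)
  have hf' : algebraMap F Ω f ≠ 0 := by simpa using hf
  have hwf : w (algebraMap F Ω f) ≠ 0 := by simpa using hf
  have h1 : w (x ^ n / algebraMap F Ω f) = 1 := by rw [map_div₀, map_pow, e, div_self hwf]
  have h2 : w ((x ^ n / algebraMap F Ω f)⁻¹) = 1 := by rw [map_inv₀, h1, inv_one]
  have h3 := h σ _ h1.le
  have h4 := h σ _ h2.le
  rw [map_inv₀, map_inv₀] at h4
  rw [map_div₀, map_pow, AlgEquiv.commutes, map_div₀, map_pow] at h3 h4
  have h5 : w (σ x) ^ n / w (algebraMap F Ω f) = 1 := by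
    apply le_antisymm h3
    by_contra hc
    rw [not_le] at hc
    have hp : 0 < w (σ x) ^ n / w (algebraMap F Ω f) := by
      rw [zero_lt_iff]; exact div_ne_zero (pow_ne_zero _ (by simpa using hx)) hwf
    exact absurd h4 (not_le.2 ((one_lt_inv₀ hp).2 hc))
  rw [div_eq_one_iff_eq hwf, ← e] at h5
  exact (pow_left_inj₀ zero_le zero_le hn.ne').1 h5

end exV
end PAC
end Part10

section Part11
open Polynomial
open scoped IntermediateField

namespace PAC
set_option linter.unusedSectionVars false

section tw
variable {K L Ω Γ : Type*} [Field K] [Field L] [Field Ω] [Algebra K Ω] [Algebra K L] [Algebra L Ω]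
  [IsScalarTower K L Ω] [LinearOrderedCommGroupWithZero Γ]

lemma Hens.tower [IsAlgClosed Ω] [Algebra.IsAlgebraic K L] {w : Valuation Ω Γ}
    (h : Hens (w.comap (algebraMap K Ω))) : Hens (w.comap (algebraMap L Ω)) := by
  intro g hg hi h0 i
  have key : ∀ x y : Ω, aeval x g = 0 → aeval y g = 0 → w x = w y := by
    intro x y hx hy
    have hxL : IsIntegral L x := ⟨g, hg, by rwa [← aeval_def]⟩
    have hxK : IsIntegral K x := isIntegral_trans (A := L) x hxL
    have e1 := minpoly.eq_of_irreducible_of_monic hi hx hg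
    have hy' : aeval y (minpoly K x) = 0 := by
      have : g ∣ (minpoly K x).map (algebraMap K L) := by
        rw [e1]; exact minpoly.dvd_map_of_isScalarTower K L x
      obtain ⟨q, hq⟩ := this
      rw [← aeval_map_algebraMap L, hq, map_mul, hy, zero_mul]
    exact h.conj hxK (minpoly.eq_of_irreducible_of_monic (minpoly.irreducible hxK) hy' (minpoly.monic hxK))
  rw [Valuation.comap_apply, ← coeff_map, map_eq_prod_roots hg]
  apply monic_coeff_le
  intro θ hθ
  rw [mem_roots (hg.map _).ne_zero, IsRoot.def, eval_map_algebraMap] at hθ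
  rw [Valuation.comap_apply, w_prod_roots w hg, (Multiset.eq_replicate_card (s := Multiset.map w _) (a := w θ)).2 ?_,
    Multiset.prod_replicate, Multiset.card_map,
    ← (IsAlgClosed.splits (g.map (algebraMap L Ω))).natDegree_eq_card_roots, natDegree_map] at h0
  · exact (pow_le_one_iff_of_nonneg zero_le hi.natDegree_pos.ne').1 h0
  intro a ha
  obtain ⟨b, hb, rfl⟩ := Multiset.mem_map.1 ha
  rw [mem_roots (hg.map _).ne_zero, IsRoot.def, eval_map_algebraMap] at hb
  exact key _ _ hb hθ

variable {w : Valuation Ω Γ} {π : K} {ζ : L}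

/-- values in the unramified quadratic extension -/
lemma quad_val (hA : Hens (w.comap (algebraMap K Ω))) (h2 : w (2 : Ω) < 1)
    (hζ : ζ ^ 2 + ζ + 1 = 0) (hζK : ∀ a : K, algebraMap K L a ≠ ζ) (a b : K) :
    w (algebraMap K Ω a + algebraMap K Ω b * algebraMap L Ω ζ) = max (w (algebraMap K Ω a)) (w (algebraMap K Ω b)) := by
  set z := algebraMap L Ω ζ with hz
  have hz2 : z ^ 2 + z + 1 = 0 := by
    have := congrArg (algebraMap L Ω) hζ
    simpa using this
  have hz3 : z ^ 3 = 1 := by linear_combination (z - 1) * hz2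
  have hwz : w z = 1 := by
    have := congrArg w hz3
    rw [map_pow, map_one] at this
    exact (pow_eq_one_iff_of_nonneg zero_le (by norm_num)).1 this
  have key : ∀ a : K, w (algebraMap K Ω a) ≤ 1 → w (algebraMap K Ω a + z) = 1 := by
    intro a ha
    have e : (algebraMap K Ω a + z) * (algebraMap K Ω a + z ^ 2) = algebraMap K Ω (a ^ 2 - a + 1) := by
      simp only [map_add, map_sub, map_pow, map_one]
      linear_combination (algebraMap K Ω a) * hz2 + hz3
    have l1 : w (algebraMap K Ω a + z) ≤ 1 := (w.map_add _ _).trans (max_le ha hwz.le)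
    have l2 : w (algebraMap K Ω a + z ^ 2) ≤ 1 := (w.map_add _ _).trans (max_le ha (by rw [map_pow, hwz, one_pow]))
    by_contra hne
    have hlt := lt_of_le_of_ne l1 hne
    have h3 : w (algebraMap K Ω (a ^ 2 - a + 1)) < 1 := by
      rw [← e, map_mul]
      exact mul_lt_one_of_lt_of_le hlt l2
    have hg : (X ^ 2 - X + C 1 : K[X]).Monic := by monicity!
    obtain ⟨b, hb, -⟩ := hA.root hg (v := w.comap (algebraMap K Ω)) (by
      intro i
      rw [coeff_add, coeff_sub, coeff_X_pow, coeff_X, coeff_C, Valuation.comap_apply]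
      split_ifs <;> simp <;> omega) a ha (by simpa using h3) (by
      simp only [derivative_add, derivative_sub, derivative_X_pow, derivative_X, derivative_C, Valuation.comap_apply,
        eval_add, eval_sub, eval_mul, eval_C, eval_pow, eval_X, eval_one, eval_zero]
      have : w (algebraMap K Ω (2 * a)) < 1 := by
        rw [map_mul, map_mul, map_ofNat]
        exact mul_lt_one_of_lt_of_le h2 ha
      have e2 : algebraMap K Ω (((2:ℕ) : K) * a ^ (2 - 1) - 1 + 0) = algebraMap K Ω (2 * a) - 1 := by
        simp
      rw [e2, w.map_sub_swap]
      exact Valuation.map_one_sub_of_lt w this)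
    simp only [eval_add, eval_sub, eval_pow, eval_X, eval_C] at hb
    have hb' := congrArg (algebraMap K L) hb
    simp only [map_add, map_sub, map_pow, map_one, map_zero] at hb'
    have : (ζ + algebraMap K L b) * (ζ + 1 - algebraMap K L b) = 0 := by
      linear_combination hζ - hb'
    rcases mul_eq_zero.1 this with h | h
    · exact hζK (-b) (by rw [map_neg]; linear_combination -h)
    · exact hζK (b - 1) (by rw [map_sub, map_one]; linear_combination -h)
  rcases lt_or_ge (w (algebraMap K Ω b)) (w (algebraMap K Ω a)) with h | h
  · rw [max_eq_left h.le]
    apply Valuation.map_add_eq_of_lt_left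
    rwa [map_mul, hwz, mul_one]
  · rw [max_eq_right h]
    by_cases hb : b = 0
    · subst hb
      have : w (algebraMap K Ω a) = 0 := le_antisymm (by simpa using h) zero_le
      simp only [map_zero, zero_mul, add_zero, this]
    have hb' : algebraMap K Ω b ≠ 0 := by simpa using hb
    have hwb : w (algebraMap K Ω b) ≠ 0 := by simpa using hb
    have e : algebraMap K Ω a + algebraMap K Ω b * z = algebraMap K Ω b * (algebraMap K Ω (a / b) + z) := by
      rw [map_div₀]; field_simp
    rw [e, map_mul, key, mul_one]
    rw [map_div₀, map_div₀]
    exact div_le_one_of_le₀ h zero_le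

lemma quad_PA0 [IsAlgClosed Ω] [Algebra.IsAlgebraic K L] (hA : PA0 (w.comap (algebraMap K Ω)) π) (h2 : w (2 : Ω) < 1)
    (hζ : ζ ^ 2 + ζ + 1 = 0) (hζK : ∀ a : K, algebraMap K L a ≠ ζ)
    (hL : ∀ z : L, ∃ a b : K, z = algebraMap K L a + algebraMap K L b * ζ) :
    PA0 (w.comap (algebraMap L Ω)) (algebraMap K L π) := by
  have hv : ∀ a b : K, w (algebraMap L Ω (algebraMap K L a + algebraMap K L b * ζ)) =
      max (w (algebraMap K Ω a)) (w (algebraMap K Ω b)) := by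
    intro a b
    rw [← quad_val hA.hens h2 hζ hζK, map_add, map_mul, ← IsScalarTower.algebraMap_apply, ← IsScalarTower.algebraMap_apply]
  constructor
  · simpa using hA.π0
  · intro z
    obtain ⟨a, b, rfl⟩ := hL z
    rw [Valuation.comap_apply, hv, Valuation.comap_apply, ← IsScalarTower.algebraMap_apply, max_lt_iff, max_le_iff]
    exact and_congr (hA.unif a) (hA.unif b)
  · obtain ⟨R, hR⟩ := hA.fin
    classical
    refine ⟨(R ×ˢ R).image (fun q => algebraMap K L q.1 + algebraMap K L q.2 * ζ), ?_⟩
    intro z hz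
    obtain ⟨a, b, rfl⟩ := hL z
    rw [Valuation.comap_apply, hv, max_le_iff] at hz
    obtain ⟨r, hr, hr'⟩ := hR a hz.1
    obtain ⟨s, hs, hs'⟩ := hR b hz.2
    refine ⟨_, Finset.mem_image.2 ⟨(r, s), Finset.mem_product.2 ⟨hr, hs⟩, rfl⟩, ?_⟩
    have e : algebraMap K L a + algebraMap K L b * ζ - (algebraMap K L r + algebraMap K L s * ζ) =
      algebraMap K L (a - r) + algebraMap K L (b - s) * ζ := by simp only [map_sub]; ring
    simp only
    rw [e, Valuation.comap_apply, hv, max_lt_iff]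
    exact ⟨hr', hs'⟩
  · exact hA.hens.tower
end tw

section bc
variable {K L F E Ω : Type*} [Field K] [Field L] [Field F] [Field E] [Field Ω] [Algebra K F] [Algebra F Ω]
    [Algebra K Ω] [IsScalarTower K F Ω] [Algebra K L] [Algebra L Ω] [IsScalarTower K L Ω]
    [Algebra F E] [Algebra E Ω] [IsScalarTower F E Ω] [Algebra L E] [IsScalarTower L E Ω]
    [IsAlgClosed Ω] [Algebra.IsAlgebraic F Ω] [CharZero K]
    {Γ : Type*} [LinearOrderedCommGroupWithZero Γ]

lemma ResData.exists_hens_quad [Algebra.IsAlgebraic K L] (R : ResData K F Ω) (w : Valuation Ω Γ) {π : K}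
    (hA : PA0 (w.comap (algebraMap K Ω)) π) (h2 : w (2 : Ω) < 1) {ζ : L}
    (hζ : ζ ^ 2 + ζ + 1 = 0) (hζK : ∀ a : K, algebraMap K L a ≠ ζ)
    (hL : ∀ z : L, ∃ a b : K, z = algebraMap K L a + algebraMap K L b * ζ)
    (hE : ∀ x : E, ∃ a b : F, x = algebraMap F E a + algebraMap F E b * algebraMap L E ζ) :
    ∃ V : ValuationSubring Ω, (V.valuation.comap (algebraMap K Ω)).IsEquiv (w.comap (algebraMap K Ω)) ∧
      Inv F V.valuation := by
  have : Algebra.IsAlgebraic E Ω := Algebra.IsAlgebraic.tower_top (K := F) E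
  have : CharZero L := charZero_of_injective_algebraMap (algebraMap K L).injective
  set z := algebraMap L Ω ζ with hz
  have hz2 : z ^ 2 + z + 1 = 0 := by
    have := congrArg (algebraMap L Ω) hζ
    simpa using this
  have hEz : ∀ a b : F, algebraMap E Ω (algebraMap F E a + algebraMap F E b * algebraMap L E ζ) =
      algebraMap F Ω a + algebraMap F Ω b * z := by
    intro a b
    rw [map_add, map_mul, ← IsScalarTower.algebraMap_apply, ← IsScalarTower.algebraMap_apply,
      ← IsScalarTower.algebraMap_apply L E Ω]
  have hLz : ∀ a b : K, algebraMap L Ω (algebraMap K L a + algebraMap K L b * ζ) =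
      algebraMap K Ω a + algebraMap K Ω b * z := by
    intro a b
    rw [map_add, map_mul, ← IsScalarTower.algebraMap_apply, ← IsScalarTower.algebraMap_apply]
  have R' : ResData L E Ω := R.base_change (by
    intro σ hσ x
    obtain ⟨a, b, rfl⟩ := hE x
    rw [hEz, map_add, map_mul, σ.commutes, σ.commutes, hσ])
  have hA' := quad_PA0 hA h2 hζ hζK hL
  have hw3 : w ((3 : ℕ) : Ω) = 1 := by
    have : ((3 : ℕ) : Ω) = 1 + 2 := by norm_num
    rw [this]; exact Valuation.map_one_add_of_lt w h2
  have hζ1 : ζ ≠ 1 := fun h => hζK 1 (by rw [map_one, h])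
  obtain ⟨V, hV, hVg⟩ := R'.exists_V w hA' (l := 3) (Or.inr rfl) hw3 ζ hζ1 (by linear_combination (ζ - 1) * hζ)
  have hVK : (V.valuation.comap (algebraMap K Ω)).IsEquiv (w.comap (algebraMap K Ω)) := by
    apply Valuation.isEquiv_of_val_le_one
    intro a
    have := hV.le_one_iff_le_one (x := algebraMap K L a)
    simpa only [Valuation.comap_apply, ← IsScalarTower.algebraMap_apply] using this
  refine ⟨V, hVK, Inv_of_le _ ?_⟩
  intro g
  have hσz : ∀ g : Ω ≃ₐ[F] Ω, g z = z ∨ g z = -1 - z := by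
    intro g
    have h1 := congrArg g hz2
    rw [map_add, map_add, map_pow, map_one, map_zero] at h1
    have : (g z - z) * (g z + 1 + z) = 0 := by linear_combination h1 - hz2
    rcases mul_eq_zero.1 this with h | h
    · left; linear_combination h
    · right; linear_combination h
  have hgE : ∀ g : Ω ≃ₐ[F] Ω, ∀ x : E, ∃ y : E, g (algebraMap E Ω x) = algebraMap E Ω y := by
    intro g x
    obtain ⟨a, b, rfl⟩ := hE x
    rw [hEz, map_add, map_mul, g.commutes, g.commutes]
    rcases hσz g with h | h
    · exact ⟨algebraMap F E a + algebraMap F E b * algebraMap L E ζ, by rw [h, hEz]⟩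
    · exact ⟨algebraMap F E (a - b) + algebraMap F E (-b) * algebraMap L E ζ, by
        rw [h, hEz, map_sub, map_neg]; ring⟩
  have hgL : ∀ g : Ω ≃ₐ[F] Ω, ∀ x : L, ∃ y : L, g (algebraMap L Ω x) = algebraMap L Ω y := by
    intro g x
    obtain ⟨a, b, rfl⟩ := hL x
    rw [hLz, map_add, map_mul, IsScalarTower.algebraMap_apply K F Ω, g.commutes,
      IsScalarTower.algebraMap_apply K F Ω, g.commutes, ← IsScalarTower.algebraMap_apply K F Ω,
      ← IsScalarTower.algebraMap_apply K F Ω]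
    rcases hσz g with h | h
    · exact ⟨algebraMap K L a + algebraMap K L b * ζ, by rw [h, hLz]⟩
    · exact ⟨algebraMap K L (a - b) + algebraMap K L (-b) * ζ, by
        rw [h, hLz, map_sub, map_neg]; ring⟩
  choose e he using hgE
  have hinj := (algebraMap E Ω).injective
  have hinv : ∀ g : Ω ≃ₐ[F] Ω, ∀ x, e g.symm (e g x) = x := by
    intro g x
    apply hinj
    rw [← he, ← he, AlgEquiv.symm_apply_apply]
  have hT : ∀ g : Ω ≃ₐ[F] Ω, ∀ x ∈ pT E (w.comap (algebraMap L Ω)) 3, e g x ∈ pT E (w.comap (algebraMap L Ω)) 3 := by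
    rintro g x ⟨u, hu, y, hy, rfl⟩
    obtain ⟨u', hu'⟩ := hgL g u
    have hint : IsIntegral K (algebraMap L Ω u) := (Algebra.IsIntegral.isIntegral (R := K) u).algebraMap
    refine ⟨u', ?_, e g y, ?_, ?_⟩
    · rw [Valuation.comap_apply, ← hu']
      have := hA.hens.inv (g.restrictScalars K) _ hint
      exact this.trans hu
    · intro h0
      apply hy
      rw [← hinv g y, h0]
      apply hinj
      rw [← he, map_zero, map_zero]
    · apply hinj
      rw [← he, map_mul, map_mul, map_mul, map_pow, map_pow, map_pow, he g y, ← IsScalarTower.algebraMap_apply L E Ω,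
        ← IsScalarTower.algebraMap_apply L E Ω, hu']
  let eg : E ≃+* E :=
    { toFun := e g
      invFun := e g.symm
      left_inv := hinv g
      right_inv := by intro x; simpa using hinv g.symm x
      map_mul' := by intro x y; apply hinj; rw [← he, map_mul, map_mul, map_mul, he, he]
      map_add' := by intro x y; apply hinj; rw [← he, map_add, map_add, map_add, he, he] }
  exact hVg g.toRingEquiv eg (fun x => he g x) (hT g) (hT g.symm)
end bc

section fin
variable {K F Ω : Type*} [Field K] [Field F] [Field Ω] [Algebra K F] [Algebra F Ω]
    [Algebra K Ω] [IsScalarTower K F Ω] [IsAlgClosed Ω] [Algebra.IsAlgebraic F Ω] [CharZero K]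
    {Γ : Type*} [LinearOrderedCommGroupWithZero Γ]

lemma adjoin_quad (K : Type*) [Field K] [Algebra K Ω] (z : Ω) (hz : z ^ 2 + z + 1 = 0) (x : Ω) (hx : x ∈ K⟮z⟯) :
    ∃ a b : K, x = algebraMap K Ω a + algebraMap K Ω b * z := by
  induction hx using IntermediateField.adjoin_induction with
  | mem x hx => exact ⟨0, 1, by rw [Set.mem_singleton_iff.1 hx]; simp⟩
  | algebraMap a => exact ⟨a, 0, by simp⟩
  | add x y hx hy h1 h2 =>
    obtain ⟨a, b, rfl⟩ := h1
    obtain ⟨c, d, rfl⟩ := h2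
    exact ⟨a + c, b + d, by simp only [map_add]; ring⟩
  | mul x y hx hy h1 h2 =>
    obtain ⟨a, b, rfl⟩ := h1
    obtain ⟨c, d, rfl⟩ := h2
    refine ⟨a * c - b * d, a * d + b * c - b * d, ?_⟩
    simp only [map_add, map_sub, map_mul]
    linear_combination (algebraMap K Ω b * algebraMap K Ω d) * hz
  | inv x hx h1 =>
    obtain ⟨a, b, rfl⟩ := h1
    by_cases h0 : a ^ 2 - a * b + b ^ 2 = 0
    · by_cases hx0 : algebraMap K Ω a + algebraMap K Ω b * z = 0
      · exact ⟨0, 0, by rw [hx0]; simp⟩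
      have h0' := congrArg (algebraMap K Ω) h0
      simp only [map_add, map_sub, map_mul, map_pow, map_zero] at h0'
      have hc : (algebraMap K Ω a + algebraMap K Ω b * z) * (algebraMap K Ω (a - b) + algebraMap K Ω (-b) * z) = 0 := by
        simp only [map_add, map_sub, map_neg]
        linear_combination h0' - (algebraMap K Ω b)^2 * hz
      have h2 := (mul_eq_zero.1 hc).resolve_left hx0
      by_cases hb : b = 0
      · subst hb
        refine ⟨a⁻¹, 0, by simp⟩
      · have hb' : algebraMap K Ω b ≠ 0 := by simpa using hb
        have hzz : z = algebraMap K Ω ((a - b) / b) := by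
          rw [map_div₀, eq_div_iff hb']
          rw [map_neg] at h2
          linear_combination -h2
        refine ⟨(a + b * ((a - b) / b))⁻¹, 0, ?_⟩
        simp only [hzz, map_add, map_sub, map_mul, map_inv₀, map_zero]
        ring
    · refine ⟨(a - b) / (a ^ 2 - a * b + b ^ 2), -b / (a ^ 2 - a * b + b ^ 2), ?_⟩
      have h0' : algebraMap K Ω (a ^ 2 - a * b + b ^ 2) ≠ 0 := (_root_.map_ne_zero _).2 h0
      apply inv_eq_of_mul_eq_one_right
      rw [map_div₀, map_div₀, div_mul_eq_mul_div, ← add_div, mul_div_assoc', div_eq_one_iff_eq h0']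
      simp only [map_add, map_sub, map_mul, map_pow, map_neg]
      linear_combination -(algebraMap K Ω b)^2 * hz

theorem ResData.exists_hens (R : ResData K F Ω) (w : Valuation Ω Γ) {π : K}
    (hA : PA0 (w.comap (algebraMap K Ω)) π) :
    ∃ V : ValuationSubring Ω, (V.valuation.comap (algebraMap K Ω)).IsEquiv (w.comap (algebraMap K Ω)) ∧
      Inv F V.valuation := by
  have h0 : ∀ {l : ℕ} (hl : l = 2 ∨ l = 3) (hvl : w (l : Ω) = 1) (ζ : K) (hζ1 : ζ ≠ 1) (hζ : ζ ^ l = 1),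
      ∃ V : ValuationSubring Ω, (V.valuation.comap (algebraMap K Ω)).IsEquiv (w.comap (algebraMap K Ω)) ∧
      Inv F V.valuation := by
    intro l hl hvl ζ hζ1 hζ
    obtain ⟨V, hV, hg⟩ := R.exists_V w hA hl hvl ζ hζ1 hζ
    refine ⟨V, hV, Inv_of_le _ fun g => hg g.toRingEquiv (RingEquiv.refl F) (fun x => g.commutes x)
      (fun x hx => hx) (fun x hx => hx)⟩
  have hw2 : w (2 : Ω) ≤ 1 := by
    have : (2 : Ω) = 1 + 1 := by norm_num
    rw [this]
    refine (w.map_add _ _).trans (max_le ?_ ?_) <;> rw [map_one]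
  have : CharZero Ω := charZero_of_injective_algebraMap (algebraMap K Ω).injective
  rcases hw2.eq_or_lt with h2 | h2
  · refine h0 (l := 2) (Or.inl rfl) (by exact_mod_cast h2) (-1) ?_ (by norm_num)
    intro h
    have : (2 : K) = 0 := by linear_combination -h
    norm_num at this
  obtain ⟨z, hz⟩ : ∃ z : Ω, z ^ 2 + z + 1 = 0 := by
    obtain ⟨z, hz⟩ := IsAlgClosed.exists_root (X ^ 2 + X + C 1 : Polynomial Ω) (by
      have : (X ^ 2 + X + C 1 : Polynomial Ω).degree = 2 := by compute_degree!
      rw [this]; norm_num)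
    exact ⟨z, by simpa using hz⟩
  by_cases hK : ∃ a : K, algebraMap K Ω a = z
  · obtain ⟨a, rfl⟩ := hK
    have ha : a ^ 2 + a + 1 = 0 := by
      apply (algebraMap K Ω).injective
      simpa using hz
    refine h0 (l := 3) (Or.inr rfl) ?_ a ?_ (by linear_combination (a - 1) * ha)
    · have : ((3 : ℕ) : Ω) = 1 + 2 := by norm_num
      rw [this]; exact Valuation.map_one_add_of_lt w h2
    · rintro rfl
      norm_num at ha
  push Not at hK
  have hzi : IsIntegral K z := ⟨X ^ 2 + X + C 1, by monicity!, by simpa using hz⟩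
  have := IntermediateField.isAlgebraic_adjoin_simple hzi
  have hle : ∀ x ∈ K⟮z⟯, x ∈ F⟮z⟯ := by
    intro x hx
    obtain ⟨a, b, rfl⟩ := adjoin_quad K z hz x hx
    rw [IsScalarTower.algebraMap_apply K F Ω, IsScalarTower.algebraMap_apply K F Ω]
    exact add_mem (F⟮z⟯.algebraMap_mem _) (mul_mem (F⟮z⟯.algebraMap_mem _) (IntermediateField.mem_adjoin_simple_self F z))
  let f : K⟮z⟯ →+* F⟮z⟯ :=
    { toFun := fun x => ⟨x.1, hle x.1 x.2⟩
      map_one' := rfl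
      map_zero' := rfl
      map_mul' := fun _ _ => rfl
      map_add' := fun _ _ => rfl }
  letI := f.toAlgebra
  haveI : IsScalarTower K⟮z⟯ F⟮z⟯ Ω := IsScalarTower.of_algebraMap_eq (fun x => rfl)
  refine R.exists_hens_quad (L := K⟮z⟯) (E := F⟮z⟯) w hA h2 (ζ := ⟨z, IntermediateField.mem_adjoin_simple_self K z⟩) ?_ ?_ ?_ ?_
  · exact Subtype.ext hz
  · intro a h
    exact hK a (congrArg Subtype.val h)
  · rintro ⟨x, hx⟩
    obtain ⟨a, b, rfl⟩ := adjoin_quad K z hz x hx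
    exact ⟨a, b, rfl⟩
  · rintro ⟨x, hx⟩
    obtain ⟨a, b, rfl⟩ := adjoin_quad F z hz x hx
    exact ⟨a, b, rfl⟩
end fin
end PAC
end Part11

section Part12
open Polynomial
open scoped IntermediateField

namespace PAC
set_option linter.unusedSectionVars false

/-- `v` is a `p`-valuation of ramification index `e` with uniformiser `π`, henselian, with value group
a `ℤ`-group -/
structure PA {K Γ : Type*} [Field K] [LinearOrderedCommGroupWithZero Γ] (v : Valuation K Γ)
    (π : K) (p e : ℕ) : Prop extends PA0 v π where
  prime : p.Prime
  epos : 0 < e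
  ram : v (p : K) = v π ^ e
  zgrp : ∀ n : ℕ, 0 < n → ∀ x, x ≠ 0 → ∃ y, y ≠ 0 ∧ ∃ i < n, v x = v π ^ i * v y ^ n

section val
variable {K Γ : Type*} [Field K] [LinearOrderedCommGroupWithZero Γ] {v : Valuation K Γ} {π : K} {p e : ℕ}

lemma v_nat_le (v : Valuation K Γ) (n : ℕ) : v (n : K) ≤ 1 := by
  induction n with
  | zero => simp
  | succ n ih =>
    rw [Nat.cast_succ]
    exact (v.map_add _ _).trans (max_le ih (map_one v).le)

lemma v_int_le (v : Valuation K Γ) (n : ℤ) : v (n : K) ≤ 1 := by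
  obtain ⟨m, rfl | rfl⟩ := n.eq_nat_or_neg
  · rw [Int.cast_natCast]; exact v_nat_le v _
  · rw [Int.cast_neg, v.map_neg, Int.cast_natCast]; exact v_nat_le v _

lemma v_nat_eq_one (hp : p.Prime) (hvp : v (p : K) < 1) {n : ℕ} (hn : ¬ p ∣ n) : v (n : K) = 1 := by
  apply le_antisymm (v_nat_le v n)
  by_contra h
  rw [not_le] at h
  have hc : Nat.gcd n p = 1 := ((Nat.Prime.coprime_iff_not_dvd hp).2 hn).symm
  have := Nat.gcd_eq_gcd_ab n p
  rw [hc] at this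
  have h2 : (1 : K) = n * (Nat.gcdA n p : ℤ) + p * (Nat.gcdB n p : ℤ) := by
    have := congrArg (Int.cast (R := K)) this
    push_cast at this
    exact this
  have h3 : v (1 : K) < 1 := by
    rw [h2]
    refine (v.map_add _ _).trans_lt (max_lt ?_ ?_) <;> rw [map_mul]
    · exact mul_lt_one_of_lt_of_le h (v_int_le v _)
    · exact mul_lt_one_of_lt_of_le hvp (v_int_le v _)
  simp at h3

lemma v_add_pow (hp : p.Prime) (x y : K) (hx : v x ≤ 1) (hy : v y ≤ 1) :
    ∃ r, v r ≤ 1 ∧ (x + y) ^ p = x ^ p + y ^ p + p * x * y * r := by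
  obtain ⟨r, hr⟩ := exists_add_pow_prime_eq hp (⟨x, hx⟩ : v.valuationSubring) ⟨y, hy⟩
  refine ⟨r, r.2, ?_⟩
  have := congrArg (Subtype.val) hr
  simpa using this

lemma PA.lt (h : PA v π p e) : v (p : K) < 1 := by
  rw [h.ram]; exact pow_lt_one₀ zero_le h.lt_one h.epos.ne'

lemma PA.v_nat [CharZero K] (h : PA v π p e) {n : ℕ} (hn : n ≠ 0) : ∃ k, v (n : K) = v π ^ k := by
  obtain ⟨k, m, hm, rfl⟩ := Nat.exists_eq_pow_mul_and_not_dvd hn p h.prime.ne_one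
  refine ⟨e * k, ?_⟩
  rw [Nat.cast_mul, Nat.cast_pow, map_mul, map_pow, h.ram, v_nat_eq_one h.prime h.lt hm, mul_one, pow_mul]

lemma PA.small [CharZero K] (h : PA v π p e) {n : ℕ} (hn : n ≠ 0) : ∃ N, 0 < N ∧ v π ^ N < v (n : K) ^ n := by
  obtain ⟨k, hk⟩ := h.v_nat hn
  refine ⟨k * n + 1, by omega, ?_⟩
  rw [hk, ← pow_mul, pow_succ]
  have : 0 < v π := zero_lt_iff.2 (by simpa using h.π0)
  exact mul_lt_of_lt_one_right (pow_pos this _) h.lt_one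

lemma zeta_bound (v : Valuation K Γ) {n : ℕ} (ζ : K) (h1 : ζ ^ n = 1) (hζ : ζ ≠ 1) : v (n : K) ≤ v (1 - ζ) := by
  have hn : n ≠ 0 ∨ n = 0 := by tauto
  rcases hn with hn | rfl
  swap
  · simp
  have hvz : v ζ = 1 := by
    have := congrArg v h1
    rw [map_pow, map_one] at this
    exact (pow_eq_one_iff_of_nonneg zero_le hn).1 this
  have h2 : ∑ i ∈ Finset.range n, ζ ^ i = 0 := by
    have := geom_sum_mul ζ n
    rw [h1, sub_self] at this
    exact (mul_eq_zero.1 this).resolve_right (sub_ne_zero.2 hζ)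
  have h3 : (n : K) = ∑ i ∈ Finset.range n, (1 - ζ ^ i) := by
    rw [Finset.sum_sub_distrib, h2]; simp
  rw [h3]
  apply v.map_sum_le
  intro i _
  have := mul_neg_geom_sum ζ i
  rw [← this, map_mul]
  refine mul_le_of_le_one_right zero_le (v.map_sum_le fun j _ => ?_)
  rw [map_pow, hvz, one_pow]

lemma Hens.power [CharZero K] (h : Hens v) {n : ℕ} (hn : n ≠ 0) (b : K) (hb : v b < v (n : K) ^ n) :
    ∃ z, z ^ n = 1 + b := by
  obtain ⟨V, hV⟩ := exists_extension (Ω := AlgebraicClosure K) v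
  set w := V.valuation with hw
  have hI : Inv K w := (h.of_equiv hV.symm).toInv
  have hb' : w (algebraMap K _ b) < w (n : AlgebraicClosure K) ^ n := by
    have := (hV.lt_iff_lt (x := b) (y := (n : K) ^ n)).2 (by rwa [map_pow])
    simpa using this
  set f : K[X] := X ^ n - C (1 + b) with hf
  have hfm : f.Monic := monic_X_pow_sub_C _ hn
  have hfn : f.natDegree = n := natDegree_X_pow_sub_C
  have hs := map_eq_prod_roots (Ω := AlgebraicClosure K) hfm
  have hcard : Multiset.card (f.map (algebraMap K (AlgebraicClosure K))).roots = n := by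
    rw [← (IsAlgClosed.splits (f.map (algebraMap K (AlgebraicClosure K)))).natDegree_eq_card_roots, natDegree_map, hfn]
  have h1 := congrArg (eval 1) hs
  rw [eval_multiset_prod, Multiset.map_map] at h1
  have h1' : w (algebraMap K _ b) = (((f.map (algebraMap K (AlgebraicClosure K))).roots).map (fun a => w (1 - a))).prod := by
    have h2 := congrArg w h1
    rw [map_multiset_prod, Multiset.map_map] at h2
    rw [show w (algebraMap K _ b) = w (eval 1 (Polynomial.map (algebraMap K (AlgebraicClosure K)) f)) by
      simp [hf] ]
    rw [h2]
    congr 1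
    apply Multiset.map_congr rfl
    intro x _
    simp
  obtain ⟨θ, hθ, hθ1⟩ : ∃ θ ∈ (f.map (algebraMap K (AlgebraicClosure K))).roots, w (1 - θ) < w (n : AlgebraicClosure K) := by
    by_contra hcon
    push Not at hcon
    have := Multiset.pow_card_le_prod (s := ((f.map (algebraMap K (AlgebraicClosure K))).roots).map (fun a => w (1 - a)))
      (a := w (n : AlgebraicClosure K)) (by
        intro x hx
        obtain ⟨y, hy, rfl⟩ := Multiset.mem_map.1 hx
        exact hcon y hy)
    rw [← h1', Multiset.card_map, hcard] at this
    exact absurd hb' (not_lt.2 this)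
  rw [mem_roots (hfm.map _).ne_zero, IsRoot.def, eval_map_algebraMap, hf] at hθ
  have hθn : θ ^ n = algebraMap K _ (1 + b) := by
    simp only [map_sub, map_pow, aeval_X, aeval_C] at hθ
    exact sub_eq_zero.1 hθ
  have hb1 : w (algebraMap K _ b) < 1 := hb'.trans_le (pow_le_one₀ zero_le (v_nat_le w n))
  have hwθ : w θ = 1 := by
    have h3 := congrArg w hθn
    rw [map_pow, map_add, map_one, w.map_one_add_of_lt hb1] at h3
    exact (pow_eq_one_iff_of_nonneg zero_le hn).1 h3
  have hθ0 : θ ≠ 0 := by rintro rfl; simp at hwθ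
  obtain ⟨a, ha⟩ := mem_F_of_fixed K (F := K) θ (by
    intro σ
    by_contra hne
    have h4 : (σ θ / θ) ^ n = 1 := by
      rw [div_pow, ← map_pow, hθn, AlgEquiv.commutes, ← hθn, div_self (pow_ne_zero _ hθ0)]
    have h5 : σ θ / θ ≠ 1 := fun h => hne ((div_eq_one_iff_eq hθ0).1 h)
    have h6 := zeta_bound w _ h4 h5
    have h7 : 1 - σ θ / θ = (θ - σ θ) / θ := by field_simp
    rw [h7, map_div₀, hwθ, div_one] at h6
    have h8 : w (θ - σ θ) < w (n : AlgebraicClosure K) := by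
      have e : θ - σ θ = (1 - σ θ) - (1 - θ) := by ring
      rw [e]
      refine (w.map_sub _ _).trans_lt (max_lt ?_ hθ1)
      have := hI σ (1 - θ)
      rw [map_sub, map_one] at this
      rwa [this]
    exact absurd h8 (not_lt.2 h6))
  refine ⟨a, (algebraMap K (AlgebraicClosure K)).injective ?_⟩
  rw [map_pow, ha, hθn]

/-- finiteness of residues modulo powers of the uniformiser -/
lemma PA0.fin_pow (h : PA0 v π) (N : ℕ) : ∃ S : Finset K, ∀ x, v x ≤ 1 → ∃ s ∈ S, v (x - s) ≤ v π ^ N := by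
  classical
  induction N with
  | zero => exact ⟨{0}, fun x hx => ⟨0, by simp, by simpa using hx⟩⟩
  | succ N ih =>
    obtain ⟨S, hS⟩ := ih
    obtain ⟨R, hR⟩ := h.fin
    refine ⟨(S ×ˢ R).image (fun q => q.1 + π ^ N * q.2), ?_⟩
    intro x hx
    obtain ⟨s, hs, hsx⟩ := hS x hx
    have hπ : π ^ N ≠ 0 := pow_ne_zero _ h.π0
    have hvπ : 0 < v (π ^ N) := zero_lt_iff.2 (by simpa using hπ)
    obtain ⟨r, hr, hrx⟩ := hR ((x - s) / π ^ N) (by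
      rw [map_div₀]
      apply div_le_one_of_le₀ _ zero_le
      rwa [map_pow])
    refine ⟨_, Finset.mem_image.2 ⟨(s, r), Finset.mem_product.2 ⟨hs, hr⟩, rfl⟩, ?_⟩
    have e : x - (s + π ^ N * r) = π ^ N * ((x - s) / π ^ N - r) := by field_simp; ring
    simp only
    rw [e, map_mul, pow_succ, map_pow]
    gcongr
    exact (h.unif _).1 hrx

/-- finiteness of the power classes -/
lemma PA.cl [CharZero K] (h : PA v π p e) {n : ℕ} (hn : 0 < n) : ∃ C : Finset K, (∀ c ∈ C, c ≠ 0) ∧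
    ∀ x, x ≠ 0 → ∃ c ∈ C, ∃ y, y ≠ 0 ∧ x = c * y ^ n := by
  classical
  obtain ⟨N, hN0, hN⟩ := h.small hn.ne'
  obtain ⟨S, hS⟩ := h.fin_pow N
  refine ⟨((Finset.range n ×ˢ S).image (fun q => π ^ q.1 * q.2)).filter (· ≠ 0), fun c hc => (Finset.mem_filter.1 hc).2, ?_⟩
  intro x hx
  obtain ⟨y, hy, i, hi, hxy⟩ := h.zgrp n hn x hx
  have hπ : π ^ i ≠ 0 := pow_ne_zero _ h.π0
  have hyn : y ^ n ≠ 0 := pow_ne_zero _ hy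
  have hu : v (x / (π ^ i * y ^ n)) = 1 := by
    rw [map_div₀, map_mul, map_pow, map_pow, hxy]
    exact div_self (mul_ne_zero (pow_ne_zero _ (by simpa using h.π0)) (pow_ne_zero _ (by simpa using hy)))
  set u := x / (π ^ i * y ^ n) with hudef
  obtain ⟨s, hs, hsu⟩ := hS u hu.le
  have hlt : v (u - s) < 1 := hsu.trans_lt (pow_lt_one₀ zero_le h.lt_one hN0.ne')
  have hvs : v s = 1 := by
    have e : s = u - (u - s) := by ring
    rw [e, ← hu]
    apply Valuation.map_sub_eq_of_lt_left
    rwa [hu]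
  have hs0 : s ≠ 0 := by rintro rfl; simp at hvs
  obtain ⟨z, hz⟩ := h.hens.power hn.ne' ((u - s) / s) (by
    rw [map_div₀, hvs, div_one]; exact hsu.trans_lt hN)
  have hzu : u = s * z ^ n := by rw [hz]; field_simp; ring
  have hu0 : u ≠ 0 := by rintro h0; rw [h0] at hu; simp at hu
  have hz0 : z ≠ 0 := by
    rintro rfl
    rw [zero_pow hn.ne', mul_zero] at hzu
    exact hu0 hzu
  refine ⟨π ^ i * s, Finset.mem_filter.2 ⟨Finset.mem_image.2 ⟨(i, s), Finset.mem_product.2 ⟨Finset.mem_range.2 hi, hs⟩, rfl⟩,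
    mul_ne_zero hπ hs0⟩, y * z, mul_ne_zero hy hz0, ?_⟩
  have : x = u * (π ^ i * y ^ n) := by rw [hudef]; field_simp
  rw [this, hzu, mul_pow]; ring

end val
end PAC
end Part12

section Part13
open Polynomial
open scoped IntermediateField

namespace PAC
set_option linter.unusedSectionVars false

section A
variable {K F Γ : Type*} [Field K] [Field F] [Algebra K F] [CharZero F] [LinearOrderedCommGroupWithZero Γ]
  {v : Valuation F Γ} {π : K} {p e : ℕ}

lemma unit_of_pow (hp : p ≠ 0) {x : F} (h : v (x ^ p) = 1) : v x = 1 := by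
  rw [map_pow] at h
  exact (pow_eq_one_iff_of_nonneg zero_le hp).1 h

lemma v_sub_one (hp : p.Prime) (hvp : v (p : F) < 1) {s : F} (hs : v s ≤ 1) (h1 : v (s ^ p - 1) < 1)
    (h2 : v (p : F) ≤ v (s ^ p - 1)) : ∃ r, v r ≤ 1 ∧ s ^ p - 1 = (s - 1) ^ p + p * (s - 1) * r ∧
      v (s - 1) < 1 ∧ v (s - 1) ^ p = v (s ^ p - 1) := by
  have hh : v (s - 1) ≤ 1 := (v.map_sub _ _).trans (max_le hs (map_one v).le)
  obtain ⟨r, hr, e⟩ := v_add_pow (v := v) hp (s - 1) 1 hh (map_one v).le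
  rw [sub_add_cancel, one_pow, mul_one] at e
  have e' : s ^ p - 1 = (s - 1) ^ p + p * (s - 1) * r := by rw [e]; ring
  have hp0 : 0 < v (p : F) := zero_lt_iff.2 (by simpa using hp.ne_zero)
  have hle : v (p * (s - 1) * r) ≤ v (p : F) := by
    rw [map_mul, map_mul, mul_assoc]
    exact mul_le_of_le_one_right zero_le (mul_le_one' hh hr)
  have hlt : v (s - 1) < 1 := by
    apply lt_of_le_of_ne hh
    intro h3
    have : v (s ^ p - 1) = 1 := by
      rw [e', Valuation.map_add_eq_of_lt_left, map_pow, h3, one_pow]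
      rw [map_pow, h3, one_pow]
      exact hle.trans_lt hvp
    rw [this] at h1
    exact lt_irrefl _ h1
  refine ⟨r, hr, e', hlt, ?_⟩
  have hle2 : v (p * (s - 1) * r) < v (p : F) := by
    rw [map_mul, map_mul, mul_assoc]
    exact mul_lt_of_lt_one_right hp0 (mul_lt_one_of_lt_of_le hlt hr)
  have e2 : (s - 1) ^ p = (s ^ p - 1) - p * (s - 1) * r := by rw [e']; ring
  rw [← map_pow, e2]
  exact Valuation.map_sub_eq_of_lt_left _ (hle2.trans_le h2)

lemma close (hp : p.Prime) (hvp : v (p : F) < 1) {a b s : F} (ha : v a < 1) (hb : v b < 1)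
    (hab : v (p : F) ≤ v (a - b)) (h : 1 + a = (1 + b) * s ^ p) : ∃ h, v (a - b) = v h ^ p := by
  have h1a : v (1 + a) = 1 := v.map_one_add_of_lt ha
  have h1b : v (1 + b) = 1 := v.map_one_add_of_lt hb
  have hb0 : 1 + b ≠ 0 := by intro h0; rw [h0] at h1b; simp at h1b
  have hs : v s = 1 := by
    apply unit_of_pow hp.ne_zero
    have := congrArg v h
    rw [map_mul, h1a, h1b, one_mul] at this
    exact this.symm
  have e : s ^ p - 1 = (a - b) / (1 + b) := by
    rw [eq_div_iff hb0]
    linear_combination -h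
  have e' : v (s ^ p - 1) = v (a - b) := by rw [e, map_div₀, h1b, div_one]
  have hlt : v (a - b) < 1 := (v.map_sub _ _).trans_lt (max_lt ha hb)
  obtain ⟨r, -, -, -, h4⟩ := v_sub_one hp hvp hs.le (by rwa [e']) (by rwa [e'])
  exact ⟨s - 1, by rw [h4, e']⟩

lemma step2a (hp : p.Prime) (hvp : v (p : F) < 1) {u a b s : F} (hu : v u = 1) (hab : v a < v b) (hb : v b < 1)
    (hpb : v (p : F) < v b ^ p) (h : 1 + u * a ^ p = (1 + u * b ^ p) * s ^ p) :
    ∃ β m, v m < 1 ∧ u = β ^ p * (1 + m) := by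
  have hb0' : 0 < v b := zero_le.trans_lt hab
  have hb0 : b ≠ 0 := by rintro rfl; simp at hb0'
  have hubp : v (u * b ^ p) < 1 := by
    rw [map_mul, map_pow, hu, one_mul]; exact pow_lt_one₀ zero_le hb hp.ne_zero
  have huap : v (u * a ^ p) < 1 := by
    rw [map_mul, map_pow, hu, one_mul]; exact pow_lt_one₀ zero_le (hab.trans hb) hp.ne_zero
  have h1a : v (1 + u * a ^ p) = 1 := v.map_one_add_of_lt huap
  have h1b : v (1 + u * b ^ p) = 1 := v.map_one_add_of_lt hubp
  have hs : v s = 1 := by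
    apply unit_of_pow hp.ne_zero
    have := congrArg v h
    rw [map_mul, h1a, h1b, one_mul] at this
    exact this.symm
  have e : s ^ p - 1 = u * (a ^ p - b ^ p * s ^ p) := by linear_combination -h
  have e' : v (s ^ p - 1) = v b ^ p := by
    rw [e, map_mul, hu, one_mul, Valuation.map_sub_eq_of_lt_right, map_mul, map_pow, map_pow, hs, one_pow, mul_one]
    rw [map_mul, map_pow, map_pow, map_pow, hs, one_pow, mul_one]
    exact pow_lt_pow_left₀ hab zero_le hp.ne_zero
  obtain ⟨r, hr, h2, h3, h4⟩ := v_sub_one hp hvp hs.le (by rw [e']; exact pow_lt_one₀ zero_le hb hp.ne_zero) (by rw [e']; exact hpb.le)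
  rw [e'] at h4
  have hvh : v (s - 1) = v b := (pow_left_inj₀ zero_le zero_le hp.ne_zero).1 h4
  have hA : v (a / b) < 1 := by rw [map_div₀]; exact (div_lt_one₀ hb0').2 hab
  have hx : v (a / b - s) = 1 := by
    rw [Valuation.map_sub_eq_of_lt_right, hs]; rwa [hs]
  obtain ⟨r2, hr2, e2⟩ := v_add_pow (v := v) hp (a / b - s) s hx.le hs.le
  rw [sub_add_cancel] at e2
  have hx0 : a / b - s ≠ 0 := by intro h0; rw [h0] at hx; simp at hx
  have hh0 : s - 1 ≠ 0 := by intro h0; rw [h0, map_zero] at hvh; exact hb0'.ne hvh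
  set x := a / b - s with hxdef
  set t := s - 1 with ht
  have hbp : b ^ p ≠ 0 := pow_ne_zero _ hb0
  have hxp : x ^ p ≠ 0 := pow_ne_zero _ hx0
  have htp : t ^ p ≠ 0 := pow_ne_zero _ hh0
  set m1 := p * t * r / b ^ p - u * (p * x * s * r2) with hm1
  have e3 : u * x ^ p = (t / b) ^ p + m1 := by
    have e4 : a ^ p = b ^ p * (x ^ p + s ^ p + p * x * s * r2) := by
      rw [← e2, div_pow]; field_simp
    have e5 : t ^ p = u * (a ^ p - b ^ p * s ^ p) - p * t * r := by rw [← e, h2]; ring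
    rw [div_pow, e5, e4, hm1]
    field_simp
    ring
  have hvm1 : v m1 < 1 := by
    refine (v.map_sub _ _).trans_lt (max_lt ?_ ?_)
    · rw [map_div₀, div_lt_one₀ (by rw [map_pow]; exact pow_pos hb0' _), map_mul, map_mul, mul_assoc, map_pow]
      refine lt_of_le_of_lt (mul_le_of_le_one_right zero_le (mul_le_one' h3.le hr)) hpb
    · rw [map_mul, hu, one_mul, map_mul, map_mul, map_mul, hx, hs, mul_one, mul_one]
      exact mul_lt_one_of_lt_of_le hvp hr2
  refine ⟨t / b / x, m1 * (b / t) ^ p, ?_, ?_⟩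
  · rw [map_mul, map_pow, map_div₀, hvh, div_self hb0'.ne', one_pow, mul_one]; exact hvm1
  · have : u = ((t / b) ^ p + m1) / x ^ p := by rw [← e3]; field_simp
    rw [this]
    simp only [div_pow]
    field_simp

/-- pigeonhole for power classes -/
lemma pigeon {C : Finset F} (hC : ∀ x : F, x ≠ 0 → ∃ c ∈ C, c ≠ 0 ∧ ∃ y, y ≠ 0 ∧ x = c * y ^ p) {ι : Type*} [Infinite ι]
    (f : ι → F) (hf : ∀ i, f i ≠ 0) : ∃ i j, i ≠ j ∧ ∃ s, f i = f j * s ^ p := by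
  choose c hc hc0 y hy e using fun i => hC (f i) (hf i)
  obtain ⟨i, j, hij, h⟩ := Finite.exists_ne_map_eq_of_infinite (fun i => (⟨c i, hc i⟩ : C))
  refine ⟨i, j, hij, y i / y j, ?_⟩
  have h' : c i = c j := congrArg Subtype.val h
  have := pow_ne_zero p (hy j)
  rw [e i, e j, h', div_pow]
  field_simp

set_option maxHeartbeats 1000000 in
/-- everything after `π` is not a `p`-th power in value -/
theorem finish (hA : PA (v.comap (algebraMap K F)) π p e) (hH : Hens v)
    (hdec : ∀ x : F, x ≠ 0 → ∀ n : ℕ, 0 < n → ∃ (c : K) (t : F), c ≠ 0 ∧ t ≠ 0 ∧ x = algebraMap K F c * t ^ n)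
    (hmem : ∀ x : F, IsIntegral K x → ∃ a, algebraMap K F a = x)
    {C : Finset F} (hC : ∀ x : F, x ≠ 0 → ∃ c ∈ C, c ≠ 0 ∧ ∃ y, y ≠ 0 ∧ x = c * y ^ p)
    (h2 : ∀ y, v (algebraMap K F π) ≠ v y ^ p) :
    PA v (algebraMap K F π) p e ∧ ∀ x, v x ≤ 1 → ∃ a : K, v (x - algebraMap K F a) < 1 := by
  have hp := hA.prime
  set ϖ := algebraMap K F π with hϖ
  have hvp : v (p : F) < 1 := by simpa using hA.lt
  have hπlt : v ϖ < 1 := hA.lt_one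
  have hπ0 : ϖ ≠ 0 := by simpa [hϖ] using hA.π0
  have hπpos : 0 < v ϖ := zero_lt_iff.2 (by simpa using hπ0)
  have hram : v (p : F) = v ϖ ^ e := by simpa using hA.ram
  have hpπ : v (p : F) ≤ v ϖ := by
    rw [hram]; exact pow_le_of_le_one zero_le hπlt.le hA.epos.ne'
  have hinj := (algebraMap K F).injective
  -- Q
  have hQ : ∀ f : ℕ → F, (∀ i j, i < j → v (f i) < v (f j) ∨ v (f j) < v (f i)) → ∃ i, ¬ (v ϖ ≤ v (f i) ∧ v (f i) < 1 ∧ ∀ y, v (f i) ≠ v y ^ p) := by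
    intro f hf
    by_contra hcon
    push Not at hcon
    obtain ⟨i, j, hij, s, hs⟩ := pigeon hC (fun i => 1 + f i) (by
      intro i h0
      have := v.map_one_add_of_lt (hcon i).2.1
      rw [h0] at this; simp at this)
    have hne : v (f i) ≠ v (f j) := by
      rcases lt_or_gt_of_ne hij with h | h
      · rcases hf i j h with h | h
        · exact h.ne
        · exact h.ne'
      · rcases hf j i h with h | h
        · exact h.ne'
        · exact h.ne
    have hval : v (f i - f j) = v (f i) ∨ v (f i - f j) = v (f j) := by
      rcases lt_or_gt_of_ne hne with h | h
      · right; exact Valuation.map_sub_eq_of_lt_right _ h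
      · left; exact Valuation.map_sub_eq_of_lt_left _ h
    obtain ⟨y, hy⟩ := close hp hvp (hcon i).2.1 (hcon j).2.1 (by
      rcases hval with h | h <;> rw [h]
      · exact hpπ.trans (hcon i).1
      · exact hpπ.trans (hcon j).1) hs
    rcases hval with h | h
    · exact (hcon i).2.2 y (by rw [← h, hy])
    · exact (hcon j).2.2 y (by rw [← h, hy])
  -- the maximal element
  obtain ⟨d, hd1, hd2, hd3, hdmax⟩ : ∃ d, v ϖ ≤ v d ∧ v d < 1 ∧ (∀ y, v d ≠ v y ^ p) ∧
      ∀ x, v ϖ ≤ v x → v x < 1 → (∀ y, v x ≠ v y ^ p) → v x ≤ v d := by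
    by_contra hcon
    push Not at hcon
    choose! g hg1 hg2 hg3 hg4 using hcon
    let f : ℕ → F := fun n => g^[n] ϖ
    have hfs : ∀ n, f (n + 1) = g (f n) := fun n => Function.iterate_succ_apply' g n ϖ
    have hf : ∀ n, v ϖ ≤ v (f n) ∧ v (f n) < 1 ∧ ∀ y, v (f n) ≠ v y ^ p := by
      intro n
      induction n with
      | zero => exact ⟨le_rfl, hπlt, h2⟩
      | succ n ih =>
        rw [hfs]
        exact ⟨hg1 _ ih.1 ih.2.1 ih.2.2, hg2 _ ih.1 ih.2.1 ih.2.2, hg3 _ ih.1 ih.2.1 ih.2.2⟩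
    have hmono : StrictMono (fun n => v (f n)) := strictMono_nat_of_lt_succ (fun n => by
      show v (f n) < v (f (n + 1))
      rw [hfs]; exact hg4 _ (hf n).1 (hf n).2.1 (hf n).2.2)
    obtain ⟨i, hi⟩ := hQ f (fun i j hij => Or.inl (hmono hij))
    exact hi (hf i)
  have hdpos : 0 < v d := hπpos.trans_le hd1
  have hd0 : d ≠ 0 := by rintro rfl; simp at hdpos
  have hmax : ∀ x, v x < 1 → v x ≤ v d := by
    intro x hx
    by_contra hcon
    rw [not_le] at hcon
    have hx0 : 0 < v x := hdpos.trans hcon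
    have hxQ : ∃ y, v x = v y ^ p := by
      by_contra hn
      push Not at hn
      exact absurd (hdmax x (hd1.trans hcon.le) hx hn) (not_le.2 hcon)
    obtain ⟨y, hy⟩ := hxQ
    have hlt : v d < v (d / x) := by
      rw [map_div₀, lt_div_iff₀ hx0]
      exact mul_lt_of_lt_one_right hdpos hx
    have := hdmax (d / x) (hd1.trans hlt.le) (by rw [map_div₀]; exact (div_lt_one₀ hx0).2 hcon) (by
      intro z hz
      apply hd3 (z * y)
      rw [map_mul, mul_pow, ← hy, ← hz, map_div₀, div_mul_cancel₀ _ hx0.ne'])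
    exact absurd this (not_le.2 hlt)
  -- archimedean
  have hk : ∃ k, v d ^ k ≤ v ϖ := by
    by_contra hcon
    push Not at hcon
    obtain ⟨i, hi⟩ := hQ (fun n => d ^ (p * n + 1)) (by
      intro i j hij
      right
      rw [map_pow, map_pow]
      apply pow_lt_pow_right_of_lt_one₀ hdpos hd2
      have := Nat.mul_lt_mul_of_pos_left hij hp.pos
      omega)
    apply hi
    refine ⟨by rw [map_pow]; exact (hcon _).le, by rw [map_pow]; exact pow_lt_one₀ zero_le hd2 (by omega), ?_⟩
    intro y hy
    apply hd3 (y / d ^ i)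
    rw [map_div₀, div_pow, ← hy, map_pow, map_pow, pow_succ, ← pow_mul, mul_comm p i,
      mul_div_cancel_left₀ _ (pow_ne_zero _ hdpos.ne')]
  obtain ⟨m, hm⟩ : ∃ m, v ϖ = v d ^ m := by
    classical
    refine ⟨Nat.find hk, le_antisymm ?_ (Nat.find_spec hk)⟩
    rcases hn : Nat.find hk with _ | k
    · simpa using hπlt.le
    · have := Nat.find_min hk (m := k) (by omega)
      rw [not_le] at this
      have hdk : 0 < v (d ^ k) := by rw [map_pow]; exact pow_pos hdpos _
      have h3 := hmax (ϖ / d ^ k) (by rw [map_div₀, div_lt_one₀ hdk, map_pow]; exact this)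
      rw [map_div₀, div_le_iff₀ hdk, map_pow] at h3
      rw [pow_succ']; exact h3
  -- residue field finite
  have hfin : Finite (kk v) := by
    by_contra hinf
    rw [not_finite_iff_infinite] at hinf
    choose x hx hxa using fun a : kk v => rs_surj (v := v) a
    have hdx : ∀ a, v (d * x a) < 1 := fun a => by rw [map_mul]; exact mul_lt_one_of_lt_of_le hd2 (hx a)
    obtain ⟨i, j, hij, s, hs⟩ := pigeon hC (fun a => 1 + d * x a) (by
      intro i h0
      have := v.map_one_add_of_lt (hdx i)
      rw [h0] at this; simp at this)
    have hne : v (x i - x j) = 1 := by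
      apply le_antisymm ((v.map_sub _ _).trans (max_le (hx i) (hx j)))
      by_contra hcon
      rw [not_le] at hcon
      apply hij
      rw [← hxa i, ← hxa j, rs_eq]; exact hcon
    have hval : v (d * x i - d * x j) = v d := by rw [← mul_sub, map_mul, hne, mul_one]
    obtain ⟨y, hy⟩ := close hp hvp (hdx i) (hdx j) (by rw [hval]; exact hpπ.trans hd1) hs
    exact hd3 y (by rw [← hval, hy])
  have hres : ∀ x, v x ≤ 1 → ∃ a : K, v (x - algebraMap K F a) < 1 := by
    intro x hx
    have := Fintype.ofFinite (kk v)
    set q := Fintype.card (kk v) with hq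
    have hq1 : 1 < q := Fintype.one_lt_card
    have hxq : v (x ^ q - x) < 1 := by
      have h3 : (rs v x hx) ^ q = rs v x hx := FiniteField.pow_card _
      have h4 : rs v (x ^ q) (by rw [map_pow]; exact pow_le_one₀ zero_le hx) = rs v x hx := by
        rw [← h3]
        exact map_pow (IsLocalRing.residue v.valuationSubring) ⟨x, hx⟩ q
      rwa [rs_eq] at h4
    have hvq : v (q : F) < 1 := by
      have : (q : kk v) = 0 := FiniteField.cast_card_eq_zero (kk v)
      have h5 : rs v (q : F) (v_nat_le v q) = 0 := by
        rw [← this, rs, ← map_natCast (IsLocalRing.residue v.valuationSubring)]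
        rfl
      rwa [rs_zero] at h5
    have hg : (X ^ q - X : F[X]).Monic := monic_X_pow_sub (by rw [degree_X]; exact_mod_cast hq1)
    obtain ⟨b, hb, hbx⟩ := hH.root hg (by
      intro i
      rw [coeff_sub, coeff_X_pow, coeff_X]
      refine (v.map_sub _ _).trans (max_le ?_ ?_) <;> split_ifs <;> simp) x hx (by simpa using hxq) (by
      simp only [derivative_sub, derivative_X_pow, derivative_X, eval_sub, eval_mul, eval_C, eval_pow, eval_X, eval_one]
      rw [v.map_sub_swap]
      apply Valuation.map_one_sub_of_lt
      rw [map_mul, map_pow]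
      exact mul_lt_one_of_lt_of_le hvq (pow_le_one₀ zero_le hx))
    have hbi : IsIntegral K b := ⟨X ^ q - X, monic_X_pow_sub (by rw [degree_X]; exact_mod_cast hq1), by simpa using hb⟩
    obtain ⟨a, ha⟩ := hmem b hbi
    exact ⟨a, by rw [ha, v.map_sub_swap]; exact hbx⟩
  -- m = 1
  have hm1 : m = 1 := by
    by_contra hne
    obtain ⟨r, hr, k, rfl⟩ := Nat.exists_prime_and_dvd hne
    by_cases hrp : r = p
    · subst hrp
      exact h2 (d ^ k) (by rw [hm, map_pow, ← pow_mul, mul_comm])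
    have hvr : v (r : F) = 1 := v_nat_eq_one hp hvp (fun h => hrp ((Nat.prime_dvd_prime_iff_eq hp hr).1 h).symm)
    have hdk : (d ^ k) ^ r ≠ 0 := pow_ne_zero _ (pow_ne_zero _ hd0)
    have hu : v (ϖ / (d ^ k) ^ r) = 1 := by
      rw [map_div₀, map_pow, map_pow, ← pow_mul, hm, mul_comm]
      exact div_self (pow_ne_zero _ hdpos.ne')
    set u := ϖ / (d ^ k) ^ r with hudef
    obtain ⟨a, ha⟩ := hres u hu.le
    have hva : v (algebraMap K F a) = 1 := by
      have e : algebraMap K F a = u - (u - algebraMap K F a) := by ring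
      rw [e, ← hu]
      apply Valuation.map_sub_eq_of_lt_left
      rwa [hu]
    have ha0 : algebraMap K F a ≠ 0 := by intro h0; rw [h0] at hva; simp at hva
    obtain ⟨s, hs, -⟩ := hH.one_add_pow hr.pos hvr ((u - algebraMap K F a) / algebraMap K F a) (by
      rw [map_div₀, hva, div_one]; exact ha)
    have e : ϖ = algebraMap K F a * (s * d ^ k) ^ r := by
      rw [mul_pow, hs]
      have : ϖ = u * (d ^ k) ^ r := by rw [hudef]; field_simp
      rw [this]; field_simp; ring
    obtain ⟨b, hb⟩ := hmem (s * d ^ k) ⟨X ^ r - Polynomial.C (π / a), monic_X_pow_sub_C _ hr.ne_zero, by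
      simp only [eval₂_sub, eval₂_X_pow, eval₂_C, map_div₀]
      rw [← hϖ, e]; field_simp; ring⟩
    refine hA.not_pow hr.one_lt b a hva (hinj ?_)
    rw [map_mul, map_pow, hb, ← e]
  rw [hm1, pow_one] at hm
  refine ⟨⟨⟨hπ0, fun x => ⟨fun h => by rw [hm]; exact hmax x h, fun h => h.trans_lt hπlt⟩, ?_, hH⟩, hp, hA.epos, hram, ?_⟩, hres⟩
  · classical
    obtain ⟨R, hR⟩ := hA.fin
    refine ⟨R.image (algebraMap K F), fun x hx => ?_⟩
    obtain ⟨a, ha⟩ := hres x hx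
    have hva : v (algebraMap K F a) ≤ 1 := by
      have e : algebraMap K F a = x - (x - algebraMap K F a) := by ring
      rw [e]
      exact (v.map_sub _ _).trans (max_le hx ha.le)
    obtain ⟨r, hr, hra⟩ := hR a hva
    refine ⟨_, Finset.mem_image_of_mem _ hr, ?_⟩
    have e : x - algebraMap K F r = (x - algebraMap K F a) + algebraMap K F (a - r) := by rw [map_sub]; ring
    rw [e]
    exact (v.map_add _ _).trans_lt (max_lt ha hra)
  · intro n hn x hx
    obtain ⟨c, t, hc, ht, rfl⟩ := hdec x hx n hn
    obtain ⟨y, hy, i, hi, hcy⟩ := hA.zgrp n hn c hc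
    refine ⟨algebraMap K F y * t, mul_ne_zero (by simpa using hy) ht, i, hi, ?_⟩
    simp only [Valuation.comap_apply] at hcy
    rw [map_mul, hcy, map_mul, map_pow, mul_pow, mul_assoc]

end A
end PAC
end Part13

section Part14
open Polynomial
open scoped IntermediateField

namespace PAC
set_option linter.unusedSectionVars false

lemma PA.of_equiv {K Γ Γ' : Type*} [Field K] [LinearOrderedCommGroupWithZero Γ] [LinearOrderedCommGroupWithZero Γ']
    {v : Valuation K Γ} {v' : Valuation K Γ'} {π : K} {p e : ℕ} (h : PA v π p e) (he : v.IsEquiv v') : PA v' π p e where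
  toPA0 := PA0.of_equiv he h.toPA0
  prime := h.prime
  epos := h.epos
  ram := by
    have := h.ram
    rw [← map_pow] at this ⊢
    exact he.val_eq.1 this
  zgrp := by
    intro n hn x hx
    obtain ⟨y, hy, i, hi, hxy⟩ := h.zgrp n hn x hx
    refine ⟨y, hy, i, hi, ?_⟩
    rw [← map_pow, ← map_pow, ← map_mul] at hxy ⊢
    exact he.val_eq.1 hxy

lemma int_of_frob {k : Type*} [Field k] {p : ℕ} (hp : p.Prime) (h0 : (p : k) = 0) (x : k) (hx : x ^ p = x) :
    ∃ j : ℕ, x = j := by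
  classical
  have : Fact p.Prime := ⟨hp⟩
  have hc : CharP k p := by
    rcases CharP.exists k with ⟨q, hq⟩
    have h1 : q ∣ p := (CharP.cast_eq_zero_iff k q p).1 h0
    rcases (Nat.dvd_prime hp).1 h1 with rfl | rfl
    · exact absurd rfl (CharP.char_ne_one k 1)
    · exact hq
  letI := ZMod.algebra k p
  by_contra hcon
  push Not at hcon
  set f : k[X] := X ^ p - X with hf
  have hf0 : f ≠ 0 := (monic_X_pow_sub (by rw [degree_X]; exact_mod_cast hp.one_lt)).ne_zero
  have hdeg : f.natDegree ≤ p := by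
    rw [hf]; refine (natDegree_sub_le _ _).trans (max_le (natDegree_X_pow_le p) (natDegree_X_le.trans hp.one_lt.le))
  let s : Finset k := insert x (Finset.univ.image (algebraMap (ZMod p) k))
  have hs : s.card = p + 1 := by
    rw [Finset.card_insert_of_notMem, Finset.card_image_of_injective _ (algebraMap (ZMod p) k).injective, Finset.card_univ, ZMod.card]
    intro h
    obtain ⟨a, -, ha⟩ := Finset.mem_image.1 h
    apply hcon a.val
    rw [← ha, ← map_natCast (algebraMap (ZMod p) k), ZMod.natCast_zmod_val]
  have hsub : s.val ⊆ f.roots := by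
    intro y hy
    rw [mem_roots hf0, IsRoot.def, hf, eval_sub, eval_pow, eval_X, sub_eq_zero]
    rcases Finset.mem_insert.1 hy with rfl | h
    · exact hx
    · obtain ⟨a, -, rfl⟩ := Finset.mem_image.1 h
      rw [← map_pow, ZMod.pow_card]
  have := card_le_degree_of_subset_roots hsub
  omega

section ext
variable {K Ω Γ : Type*} [Field K] [Field Ω] [Algebra K Ω] [IsAlgClosed Ω] [CharZero K]
  [LinearOrderedCommGroupWithZero Γ] {w : Valuation Ω Γ} {π : K} {p e : ℕ}

lemma res_int (hp : p.Prime) (hvp : w (p : Ω) < 1) (δ : Ω) (hδ : w δ ≤ 1) (h : w (δ ^ p - δ) < 1) : ∃ j : ℕ, w (δ - j) < 1 := by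
  have h1 : (rs w δ hδ) ^ p = rs w δ hδ := by
    have h4 : rs w (δ ^ p) (by rw [map_pow]; exact pow_le_one₀ zero_le hδ) = rs w δ hδ := by rwa [rs_eq]
    exact (map_pow (IsLocalRing.residue w.valuationSubring) ⟨δ, hδ⟩ p).symm.trans h4
  have hnat : ∀ n : ℕ, rs w (n : Ω) (v_nat_le w n) = n := by
    intro n
    rw [rs, ← map_natCast (IsLocalRing.residue w.valuationSubring)]
    rfl
  obtain ⟨j, hj⟩ := int_of_frob hp (by rw [← hnat, rs_zero]; exact hvp) _ h1
  refine ⟨j, ?_⟩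
  rwa [← hnat, rs_eq] at hj

lemma g_close (hp : p.Prime) (hvp : w (p : Ω) < 1) {x δ : Ω} (hx : w x ≤ 1) (hδ : w δ < 1) :
    w ((x + δ) ^ p - (x + δ) - (x ^ p - x)) < 1 := by
  obtain ⟨r, hr, er⟩ := v_add_pow (v := w) hp x δ hx hδ.le
  have : (x + δ) ^ p - (x + δ) - (x ^ p - x) = δ ^ p - δ + p * x * δ * r := by rw [er]; ring
  rw [this]
  refine (w.map_add _ _).trans_lt (max_lt ((w.map_sub _ _).trans_lt (max_lt ?_ hδ)) ?_)
  · rw [map_pow]; exact pow_lt_one₀ zero_le hδ hp.ne_zero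
  · rw [map_mul, map_mul, map_mul, mul_assoc, mul_assoc]
    exact mul_lt_one_of_lt_of_le hvp (mul_le_one' hx (mul_le_one' hδ.le hr))

lemma exists_as {v : Valuation K Γ} (h : PA v π p e) : ∃ a, v a = 1 ∧ ∀ b, v b ≤ 1 → v (b ^ p - b - a) = 1 := by
  have := h.finite
  have hns : ¬ Function.Surjective (fun x : kk v => x ^ p - x) := by
    rw [← Finite.injective_iff_surjective]
    intro hi
    have : (0 : kk v) = 1 := hi (by simp [h.prime.ne_zero])
    exact zero_ne_one this
  rw [Function.Surjective] at hns
  push Not at hns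
  obtain ⟨a', ha'⟩ := hns
  obtain ⟨a, ha, rfl⟩ := rs_surj a'
  have key : ∀ b, v b ≤ 1 → v (b ^ p - b - a) = 1 := by
    intro b hb
    have hle : v (b ^ p - b) ≤ 1 := (v.map_sub _ _).trans (max_le (by rw [map_pow]; exact pow_le_one₀ zero_le hb) hb)
    apply le_antisymm ((v.map_sub _ _).trans (max_le hle ha))
    by_contra hcon
    rw [not_le] at hcon
    apply ha' (rs v b hb)
    rw [← rs_eq _ _ hle ha] at hcon
    rw [← hcon]
    have := map_sub (IsLocalRing.residue v.valuationSubring) (⟨b, hb⟩ ^ p) ⟨b, hb⟩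
    rw [map_pow] at this
    exact this.symm
  refine ⟨a, ?_, key⟩
  have := key 0 (by simp)
  simpa [h.prime.ne_zero] using this

variable {a : K} {θ : Ω}

lemma as_le (hp : p.Prime) (ha : w (algebraMap K Ω a) = 1) (hθ : θ ^ p - θ - algebraMap K Ω a = 0) : w θ ≤ 1 := by
  by_contra h
  rw [not_le] at h
  have e : θ ^ p = θ + algebraMap K Ω a := by linear_combination hθ
  have h1 : w (θ ^ p) ≤ w θ := by
    rw [e]; exact (w.map_add _ _).trans (max_le le_rfl (by rw [ha]; exact h.le))
  rw [map_pow] at h1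
  exact absurd h1 (not_le.2 (lt_self_pow₀ h hp.one_lt))

lemma as_far (h : PA (w.comap (algebraMap K Ω)) π p e) (ha : w (algebraMap K Ω a) = 1)
    (hab : ∀ b : K, w (algebraMap K Ω b) ≤ 1 → w (algebraMap K Ω (b ^ p - b - a)) = 1)
    (hθ : θ ^ p - θ - algebraMap K Ω a = 0) (b : K) : 1 ≤ w (θ - algebraMap K Ω b) := by
  by_contra hcon
  rw [not_le] at hcon
  have hp := h.prime
  have hvp : w (p : Ω) < 1 := by simpa using h.lt
  have hθ1 := as_le hp ha hθ
  rw [w.map_sub_swap] at hcon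
  have hb : w (algebraMap K Ω b) ≤ 1 := by
    have : algebraMap K Ω b = (algebraMap K Ω b - θ) + θ := by ring
    rw [this]
    exact (w.map_add _ _).trans (max_le hcon.le hθ1)
  have h1 := g_close hp hvp hθ1 hcon
  rw [add_sub_cancel] at h1
  have h2 := hab b hb
  have e : algebraMap K Ω (b ^ p - b - a) = algebraMap K Ω b ^ p - algebraMap K Ω b - (θ ^ p - θ) := by
    rw [map_sub, map_sub, map_pow]; linear_combination hθ
  rw [e] at h2
  exact h1.ne h2

lemma as_minpoly (h : PA (w.comap (algebraMap K Ω)) π p e) (ha : w (algebraMap K Ω a) = 1)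
    (hab : ∀ b : K, w (algebraMap K Ω b) ≤ 1 → w (algebraMap K Ω (b ^ p - b - a)) = 1)
    (hθ : θ ^ p - θ - algebraMap K Ω a = 0) : minpoly K θ = X ^ p - X - C a := by
  have hp := h.prime
  have hvp : w (p : Ω) < 1 := by simpa using h.lt
  have hθ1 := as_le hp ha hθ
  have hg1 : (X + C a : K[X]).degree < p := by
    rw [degree_X_add_C]; exact_mod_cast hp.one_lt
  have hg : (X ^ p - X - C a : K[X]).Monic := by
    rw [sub_sub]; exact monic_X_pow_sub hg1
  have hgd : (X ^ p - X - C a : K[X]).natDegree = p := by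
    rw [sub_sub]; exact natDegree_eq_of_degree_eq_some (by rw [degree_sub_eq_left_of_degree_lt, degree_X_pow]; rwa [degree_X_pow])
  have hgθ : aeval θ (X ^ p - X - C a : K[X]) = 0 := by simpa using hθ
  have hint : IsIntegral K θ := ⟨_, hg, by rw [← aeval_def]; exact hgθ⟩
  have hdvd := minpoly.dvd K θ hgθ
  set q := minpoly K θ with hq
  have hqm : q.Monic := minpoly.monic hint
  by_cases hd : p ≤ q.natDegree
  · exact (eq_of_monic_of_dvd_of_natDegree_le hqm hg hdvd (by rw [hgd]; exact hd)).symm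
  exfalso
  rw [not_le] at hd
  have hdpos : 0 < q.natDegree := minpoly.natDegree_pos hint
  have hvd : w ((q.natDegree : ℕ) : Ω) = 1 := v_nat_eq_one hp hvp (Nat.not_dvd_of_pos_of_lt hdpos hd)
  have hroots : ∀ ρ ∈ (q.map (algebraMap K Ω)).roots, ∃ j : ℕ, w (ρ - θ - j) < 1 := by
    intro ρ hρ
    rw [mem_roots (hqm.map _).ne_zero, IsRoot.def, eval_map_algebraMap] at hρ
    have hρ' : ρ ^ p - ρ - algebraMap K Ω a = 0 := by
      obtain ⟨r, hr⟩ := hdvd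
      have : aeval ρ (X ^ p - X - C a : K[X]) = 0 := by rw [hr, map_mul, hρ, zero_mul]
      simpa using this
    have hρ1 := as_le hp ha hρ'
    have hδ : w (ρ - θ) ≤ 1 := (w.map_sub _ _).trans (max_le hρ1 hθ1)
    apply res_int hp hvp _ hδ
    obtain ⟨r, hr, er⟩ := v_add_pow (v := w) hp (ρ - θ) θ hδ hθ1
    rw [sub_add_cancel] at er
    have : (ρ - θ) ^ p - (ρ - θ) = - (p * ((ρ - θ) * θ * r)) := by linear_combination hρ' - hθ - er
    rw [this, w.map_neg, map_mul]
    refine mul_lt_one_of_lt_of_le hvp ?_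
    rw [map_mul, map_mul]
    exact mul_le_one' (mul_le_one' hδ hθ1) hr
  have hsum : ∀ s : Multiset Ω, (∀ ρ ∈ s, ∃ j : ℕ, w (ρ - θ - j) < 1) → ∃ n : ℕ, w (s.sum - Multiset.card s * θ - n) < 1 := by
    intro s
    induction s using Multiset.induction_on with
    | empty => intro _; exact ⟨0, by simp⟩
    | cons x s ih =>
      intro hs
      obtain ⟨n, hn⟩ := ih (fun ρ hρ => hs ρ (Multiset.mem_cons_of_mem hρ))
      obtain ⟨j, hj⟩ := hs x (Multiset.mem_cons_self _ _)
      refine ⟨j + n, ?_⟩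
      have : (x ::ₘ s).sum - (Multiset.card (x ::ₘ s) : ℕ) * θ - ((j + n : ℕ) : Ω) = (x - θ - j) + (s.sum - Multiset.card s * θ - n) := by
        rw [Multiset.sum_cons, Multiset.card_cons]; push_cast; ring
      rw [this]
      exact (w.map_add _ _).trans_lt (max_lt hj hn)
  obtain ⟨n, hn⟩ := hsum _ hroots
  have hsp := IsAlgClosed.splits (q.map (algebraMap K Ω))
  rw [← hsp.natDegree_eq_card_roots, natDegree_map] at hn
  have h3 := hsp.nextCoeff_eq_neg_sum_roots_of_monic (hqm.map _)
  rw [nextCoeff_map (algebraMap K Ω).injective] at h3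
  have h4 : ((q.map (algebraMap K Ω)).roots).sum = algebraMap K Ω (-q.nextCoeff) := by rw [map_neg, h3, neg_neg]
  rw [h4] at hn
  have hd0 : ((q.natDegree : ℕ) : Ω) ≠ 0 := by intro h0; rw [h0] at hvd; simp at hvd
  have := as_far h ha hab hθ ((-q.nextCoeff - n) / q.natDegree)
  have e2 : θ - algebraMap K Ω ((-q.nextCoeff - n) / q.natDegree) =
      - (algebraMap K Ω (-q.nextCoeff) - q.natDegree * θ - n) / q.natDegree := by
    rw [map_div₀, map_sub, map_natCast, map_natCast]
    field_simp
    ring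
  rw [e2, map_div₀, w.map_neg, hvd, div_one] at this
  exact absurd hn (not_lt.2 this)

lemma PA.not_pow' (h : PA (w.comap (algebraMap K Ω)) π p e) {i : ℕ} (hi : ¬ p ∣ i) (b : K) :
    w (algebraMap K Ω π) ^ i ≠ w (algebraMap K Ω b) ^ p := by
  intro hcon
  have hπ : w (algebraMap K Ω π) ≠ 0 := by simpa using h.π0
  have hb : b ≠ 0 := by
    rintro rfl
    rw [map_zero, map_zero, zero_pow h.prime.ne_zero] at hcon
    exact pow_ne_zero _ hπ hcon
  obtain ⟨y, hy, e⟩ := val_coprime (w.comap (algebraMap K Ω)) h.π0 hb ((Nat.Prime.coprime_iff_not_dvd h.prime).2 hi).symm hcon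
  refine h.not_pow h.prime.one_lt y (π / y ^ p) ?_ ?_
  · rw [map_div₀, map_pow, ← e]
    exact div_self hπ
  · have := pow_ne_zero p hy
    field_simp

lemma as_unram (h : PA (w.comap (algebraMap K Ω)) π p e) (ha : w (algebraMap K Ω a) = 1)
    (hab : ∀ b : K, w (algebraMap K Ω b) ≤ 1 → w (algebraMap K Ω (b ^ p - b - a)) = 1)
    (hθ : θ ^ p - θ - algebraMap K Ω a = 0) (c : Ω) (hc : c ∈ K⟮θ⟯) (hc0 : c ≠ 0) : ∃ c0 : K, w c = w (algebraMap K Ω c0) := by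
  have hp := h.prime
  have hvp : w (p : Ω) < 1 := by simpa using h.lt
  have hθ1 := as_le hp ha hθ
  have hmin := as_minpoly h ha hab hθ
  have hgd : (minpoly K θ).natDegree = p := by
    rw [hmin, sub_sub]
    exact natDegree_eq_of_degree_eq_some (by
      rw [degree_sub_eq_left_of_degree_lt, degree_X_pow]; rw [degree_X_pow, degree_X_add_C]; exact_mod_cast hp.one_lt)
  have hint : IsIntegral K θ := by
    by_contra hni
    rw [minpoly.eq_zero hni] at hgd
    simp at hgd; exact hp.ne_zero hgd.symm
  have hfr : Module.finrank K K⟮θ⟯ = p := by rw [IntermediateField.adjoin.finrank hint, hgd]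
  have : FiniteDimensional K K⟮θ⟯ := IntermediateField.adjoin.finiteDimensional hint
  have hdeg : ∀ x ∈ K⟮θ⟯, IsIntegral K x ∧ (minpoly K x).natDegree ∣ p := by
    intro x hx
    have h1 : IsIntegral K (⟨x, hx⟩ : K⟮θ⟯) := Algebra.IsIntegral.isIntegral _
    have h2 := minpoly.degree_dvd h1
    rw [← minpoly.algebraMap_eq (algebraMap K⟮θ⟯ Ω).injective, hfr] at h2
    exact ⟨h1.algebraMap, h2⟩
  obtain ⟨c2, hc2⟩ : ∃ c2 : K, w c ^ p = w (algebraMap K Ω c2) := by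
    obtain ⟨hi, k, hk⟩ := hdeg c hc
    refine ⟨(minpoly K c).coeff 0 ^ k, ?_⟩
    rw [map_pow, map_pow, ← h.hens.pow_eq c hi, ← pow_mul, ← hk]
  have hc20 : c2 ≠ 0 := by
    rintro rfl
    rw [map_zero, map_zero] at hc2
    exact pow_ne_zero _ (by simpa using hc0) hc2
  obtain ⟨y, hy, i, hi, hcy⟩ := h.zgrp p hp.pos c2 hc20
  simp only [Valuation.comap_apply] at hcy
  rcases Nat.eq_zero_or_pos i with rfl | hi0
  · refine ⟨y, (pow_left_inj₀ zero_le zero_le hp.ne_zero).1 ?_⟩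
    rw [hc2, hcy, pow_zero, one_mul]
  exfalso
  have hip : ¬ p ∣ i := Nat.not_dvd_of_pos_of_lt hi0 hi
  have hy' : algebraMap K Ω y ≠ 0 := by simpa using hy
  have hwy : w (algebraMap K Ω y) ≠ 0 := by simpa using hy
  set s := c / algebraMap K Ω y with hs
  have hsm : s ∈ K⟮θ⟯ := div_mem hc (K⟮θ⟯.algebraMap_mem y)
  have hsp : w s ^ p = w (algebraMap K Ω (π ^ i)) := by
    rw [hs, map_div₀, div_pow, hc2, hcy, mul_div_cancel_right₀ _ (pow_ne_zero _ hwy), map_pow, map_pow]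
  obtain ⟨hsi, hsd⟩ := hdeg s hsm
  have hsdeg : (minpoly K s).natDegree = p := by
    rcases (Nat.dvd_prime hp).1 hsd with h1 | h1
    · exfalso
      obtain ⟨b, hb⟩ := minpoly.natDegree_eq_one_iff.1 h1
      rw [← hb, map_pow, map_pow] at hsp
      exact h.not_pow' hip b hsp.symm
    · exact h1
  have hEq : K⟮s⟯ = K⟮θ⟯ := by
    apply IntermediateField.eq_of_le_of_finrank_eq
    · exact IntermediateField.adjoin_simple_le_iff.2 hsm
    · rw [IntermediateField.adjoin.finrank hsi, hsdeg, hfr]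
  obtain ⟨P, hPd, hP⟩ := mem_adjoin_poly s hsi θ (by rw [hEq]; exact IntermediateField.mem_adjoin_simple_self K θ)
  rw [hsdeg] at hPd
  set a0 := P.coeff 0 with ha0
  have hfar := as_far h ha hab hθ a0
  have hPθ : aeval s (P - C a0) = θ - algebraMap K Ω a0 := by rw [map_sub, hP, aeval_C]
  have hQ0 : P - C a0 ≠ 0 := by
    intro h0
    rw [h0, map_zero] at hPθ
    rw [← hPθ, map_zero] at hfar
    exact absurd hfar (by simp)
  have hnp : ∀ b : K, b ≠ 0 → w (algebraMap K Ω (π ^ i)) ≠ w (algebraMap K Ω b) ^ p := by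
    intro b _; rw [map_pow, map_pow]; exact h.not_pow' hip b
  obtain ⟨j, hj, hj0, hjw⟩ := dominant w hp s (π ^ i) (pow_ne_zero _ h.π0) hsp hnp (P - C a0) hQ0 (by
    exact lt_of_le_of_lt ((natDegree_sub_C (a := a0) (p := P)).le) hPd)
  have hjne : j ≠ 0 := by
    rintro rfl
    rw [coeff_sub, coeff_C_zero, ← ha0, sub_self] at hj0
    exact hj0 rfl
  set b := (P - C a0).coeff j with hb
  have hwb : w (algebraMap K Ω b) ≠ 0 := by simpa using hj0
  have hs0 : w s ≠ 0 := by
    intro h0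
    rw [h0, zero_pow hp.ne_zero, eq_comm, map_pow, map_pow] at hsp
    exact pow_ne_zero _ (by simpa using h.π0) hsp
  have hval : w (θ - algebraMap K Ω a0) = w (algebraMap K Ω b) * w s ^ j := by
    have h1 : w (aeval s (P - C a0) / (algebraMap K Ω b * s ^ j)) = 1 := by
      have e : aeval s (P - C a0) / (algebraMap K Ω b * s ^ j) = 1 + (aeval s (P - C a0) / (algebraMap K Ω b * s ^ j) - 1) := by ring
      rw [e]; exact w.map_one_add_of_lt hjw
    rw [hPθ, map_div₀, map_mul, map_pow, div_eq_one_iff_eq (mul_ne_zero hwb (pow_ne_zero _ hs0))] at h1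
    exact h1
  have hno : ∀ k : K, w (θ - algebraMap K Ω a0) ≠ w (algebraMap K Ω k) := by
    intro k hk
    rw [hval] at hk
    apply h.not_pow' (i := i * j) (b := k / b)
    · intro hd
      rcases hp.dvd_mul.1 hd with h1 | h1
      · exact hip h1
      · exact Nat.not_dvd_of_pos_of_lt (Nat.pos_of_ne_zero hjne) hj h1
    · rw [map_div₀, map_div₀, ← hk, mul_div_cancel_left₀ _ hwb]
      have e1 : (w s ^ j) ^ p = (w s ^ p) ^ j := by rw [← pow_mul, ← pow_mul, mul_comm]
      rw [e1, hsp, map_pow, map_pow, ← pow_mul]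
  rcases hfar.eq_or_lt with h1 | h1
  · exact hno 1 (by rw [map_one, map_one]; exact h1.symm)
  · apply hno a0
    have : θ - algebraMap K Ω a0 = -(algebraMap K Ω a0 - θ) := by ring
    have h2 : w (algebraMap K Ω a0) = w (θ - (θ - algebraMap K Ω a0)) := by congr 1; ring
    rw [h2]
    exact (Valuation.map_sub_eq_of_lt_right _ (hθ1.trans_lt h1)).symm
end ext

section main
variable {K F Ω : Type*} [Field K] [Field F] [Field Ω] [Algebra K F] [Algebra F Ω]
    [Algebra K Ω] [IsScalarTower K F Ω] [IsAlgClosed Ω] [Algebra.IsAlgebraic F Ω] [CharZero K]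
    {Γ : Type*} [LinearOrderedCommGroupWithZero Γ] {w : Valuation Ω Γ} {π : K} {p e : ℕ}

lemma ResData.as_no (R : ResData K F Ω) (h : PA (w.comap (algebraMap K Ω)) π p e) (hH : Hens (w.comap (algebraMap F Ω)))
    (m y : F) (hm : w (algebraMap F Ω m) < 1) (hy : algebraMap K F π = (1 + m) * y ^ p) : False := by
  have hp := h.prime
  obtain ⟨a, ha, hab⟩ := exists_as h
  rw [Valuation.comap_apply] at ha
  have ha0 : a ≠ 0 := by rintro rfl; simp at ha
  have ha0' : algebraMap K F a ≠ 0 := by simpa using ha0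
  have htow : ∀ b : K, algebraMap F Ω (algebraMap K F b) = algebraMap K Ω b := fun b => (IsScalarTower.algebraMap_apply K F Ω b).symm
  obtain ⟨θ, hθ⟩ : ∃ θ : Ω, θ ^ p - θ - algebraMap K Ω a = 0 := by
    have hd : (X ^ p - (X + C (algebraMap K Ω a)) : Polynomial Ω).degree = p := by
      rw [degree_sub_eq_left_of_degree_lt, degree_X_pow]; rw [degree_X_pow, degree_X_add_C]; exact_mod_cast hp.one_lt
    obtain ⟨θ, hθ⟩ := IsAlgClosed.exists_root (X ^ p - (X + C (algebraMap K Ω a)) : Polynomial Ω) (by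
      rw [hd]; exact_mod_cast hp.ne_zero)
    refine ⟨θ, ?_⟩
    rw [IsRoot.def, eval_sub, eval_pow, eval_add, eval_X, eval_C] at hθ
    linear_combination hθ
  have hmin := as_minpoly h ha hab hθ
  have hgd : (minpoly K θ).natDegree = p := by
    rw [hmin, sub_sub]
    exact natDegree_eq_of_degree_eq_some (by
      rw [degree_sub_eq_left_of_degree_lt, degree_X_pow]; rw [degree_X_pow, degree_X_add_C]; exact_mod_cast hp.one_lt)
  have hint : IsIntegral K θ := by
    by_contra hni
    rw [minpoly.eq_zero hni] at hgd
    simp at hgd; exact hp.ne_zero hgd.symm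
  have h1m : w (algebraMap F Ω (1 + m)) = 1 := by rw [map_add, map_one]; exact w.map_one_add_of_lt hm
  have h1m0 : 1 + m ≠ 0 := by intro h0; rw [h0] at h1m; simp at h1m
  -- Hensel
  have ham : w (algebraMap F Ω (algebraMap K F a * m)) < 1 := by rw [map_mul, map_mul, htow, ha, one_mul]; exact hm
  obtain ⟨s, hs, -⟩ := hH.root_zero (g := X ^ p - (X - C (algebraMap K F a * m)))
    (monic_X_pow_sub (by rw [degree_X_sub_C]; exact_mod_cast hp.one_lt)) (by
      intro i
      rw [coeff_sub, coeff_sub, coeff_X_pow, coeff_X, coeff_C]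
      refine ((w.comap (algebraMap F Ω)).map_sub _ _).trans (max_le ?_ (((w.comap (algebraMap F Ω)).map_sub _ _).trans (max_le ?_ ?_)))
      · split_ifs <;> simp
      · split_ifs <;> simp
      · split_ifs
        · exact ham.le
        · simp) (by
      rw [Valuation.comap_apply]
      simp only [coeff_sub, coeff_X_pow, coeff_X_zero, coeff_C_zero, hp.ne_zero.symm, if_false, zero_sub, neg_neg, sub_neg_eq_add, zero_add]
      exact ham) (by
      rw [Valuation.comap_apply]
      simp only [coeff_sub, coeff_X_pow, coeff_X_one, coeff_C_succ, hp.one_lt.ne, if_false, zero_sub, sub_zero, coeff_C_ne_zero one_ne_zero]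
      rw [map_neg, w.map_neg, map_one, map_one])
  simp only [eval_sub, eval_pow, eval_X, eval_C] at hs
  obtain ⟨Nm, n1, n2, n3, n4, n5⟩ := R.exists_norm θ hint.isAlgebraic
  have hNx : Nm (algebraMap F Ω s - θ) = algebraMap F Ω (- (algebraMap K F a * (1 + m))) := by
    rw [n2, hmin]
    simp only [map_sub, map_pow, aeval_X, aeval_C]
    rw [← htow, ← map_pow, ← map_sub, ← map_sub]
    congr 1
    linear_combination hs
  have hL : K⟮θ⟯ ≤ algebraicClosure K Ω := by
    rw [IntermediateField.adjoin_simple_le_iff]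
    exact mem_algebraicClosure_iff.2 hint.isAlgebraic
  have hx0 : algebraMap F Ω s - θ ≠ 0 := by
    intro h0
    have e1 : θ = algebraMap F Ω s := by linear_combination -h0
    rw [e1, ← htow, ← map_pow, ← map_sub, ← map_sub, map_eq_zero] at hθ
    apply mul_ne_zero ha0' h1m0
    linear_combination hs - hθ
  obtain ⟨c, hc, t, hc0, ht0, ht, hxe⟩ := R.r2 K⟮θ⟯ hL (algebraMap F Ω s - θ) hx0 (by
    intro σ hσ
    rw [map_sub, σ.commutes, hσ θ (IntermediateField.mem_adjoin_simple_self K θ)]) p hp.pos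
  obtain ⟨c0, hwc⟩ := as_unram h ha hab hθ c hc hc0
  obtain ⟨f, hf⟩ := n1 t ht
  have hcalg : IsAlgebraic K c := mem_algebraicClosure_iff.1 (hL hc)
  rw [hxe, map_mul, map_pow, hf] at hNx
  have hne : algebraMap F Ω (- (algebraMap K F a * (1 + m))) ≠ 0 := by
    exact (_root_.map_ne_zero _).2 (neg_ne_zero.2 (mul_ne_zero ha0' h1m0))
  have hf0 : f ≠ 0 := by
    rintro rfl
    rw [map_zero, zero_pow hp.ne_zero, mul_zero] at hNx
    exact hne hNx.symm
  have hfp : f ^ p ≠ 0 := pow_ne_zero _ hf0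
  have hfp' : algebraMap F Ω f ^ p ≠ 0 := pow_ne_zero _ (by simpa using hf0)
  have hNc : Nm c = algebraMap F Ω (- (algebraMap K F a * (1 + m)) / f ^ p) := by
    rw [map_div₀, map_pow, ← hNx]; field_simp
  obtain ⟨k, hk⟩ := R.mem_K (- (algebraMap K F a * (1 + m)) / f ^ p) (by rw [← hNc]; exact n4 c hcalg)
  have hwk : w (algebraMap K Ω k) = w (algebraMap K Ω c0) ^ p := by
    rw [← htow, hk, ← hNc, (n5 w h.hens c hcalg).1, hgd, hwc]
  have hk0 : k ≠ 0 := by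
    rintro rfl
    rw [← htow, hk, ← hNc, hNc, map_div₀] at hwk
    rw [map_zero, eq_comm, div_eq_zero_iff] at hk
    rcases hk with hk | hk
    · rw [hk] at hne; simp at hne
    · exact hfp hk
  have hk0' : algebraMap K F k ≠ 0 := by simpa using hk0
  have e1 : 1 + m = - (algebraMap K F k * f ^ p) / algebraMap K F a := by
    rw [hk]; field_simp
  have e2 : algebraMap K F π = - (algebraMap K F k / algebraMap K F a) * (f * y) ^ p := by
    rw [hy, e1, mul_pow]; field_simp
  have e3 : (f * y) ^ p = algebraMap K F (- (π * a / k)) := by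
    rw [map_neg, map_div₀, map_mul, e2]; field_simp
  obtain ⟨b, hb⟩ := R.mem_K (f * y) (by
    apply IsIntegral.isAlgebraic
    refine ⟨X ^ p - C (- (π * a / k)), monic_X_pow_sub_C _ hp.ne_zero, ?_⟩
    rw [eval₂_sub, eval₂_X_pow, eval₂_C, ← map_pow, e3, htow, sub_self])
  have e4 : π = - (k / a) * b ^ p := by
    apply (algebraMap K F).injective
    rw [e2, ← hb]; simp
  have e5 := congrArg (fun x => w (algebraMap K Ω x)) e4
  simp only [map_mul, map_neg, map_div₀, map_pow, w.map_neg, ha, div_one, hwk] at e5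
  refine h.not_pow' (i := 1) (b := c0 * b) (by simpa using hp.one_lt.ne') ?_
  rw [pow_one, map_mul, map_mul, mul_pow, e5]

lemma ResData.step2 (R : ResData K F Ω) (h : PA (w.comap (algebraMap K Ω)) π p e) (hH : Hens (w.comap (algebraMap F Ω)))
    {C : Finset F} (hC : ∀ x : F, x ≠ 0 → ∃ c ∈ C, c ≠ 0 ∧ ∃ y, y ≠ 0 ∧ x = c * y ^ p) (y : F) :
    (w.comap (algebraMap F Ω)) (algebraMap K F π) ≠ (w.comap (algebraMap F Ω)) y ^ p := by
  intro hy
  set v := w.comap (algebraMap F Ω) with hv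
  have hp := h.prime
  have : CharZero F := charZero_of_injective_algebraMap (algebraMap K F).injective
  have htow : ∀ b : K, v (algebraMap K F b) = w.comap (algebraMap K Ω) b := fun b => by
    rw [hv, Valuation.comap_apply, Valuation.comap_apply, IsScalarTower.algebraMap_apply K F Ω b]
  have hvp : v (p : F) < 1 := by
    have := h.lt
    rwa [← htow, map_natCast] at this
  set ϖ := algebraMap K F π with hϖ
  have hπ0 : ϖ ≠ 0 := by simpa [hϖ] using h.π0
  have hπlt : v ϖ < 1 := by rw [htow]; exact h.lt_one
  have hpπ : v (p : F) ≤ v ϖ := by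
    have := h.ram
    rw [← htow, ← htow, map_natCast] at this
    rw [this]; exact pow_le_of_le_one zero_le hπlt.le h.epos.ne'
  have hvπ0 : v ϖ ≠ 0 := by simpa using hπ0
  have hy0 : y ≠ 0 := by
    rintro rfl
    rw [map_zero, zero_pow hp.ne_zero] at hy
    exact hvπ0 hy
  have hdiv : ∀ x : F, x ≠ 0 → ∃ z, z ≠ 0 ∧ v x = v z ^ p := by
    intro x hx
    obtain ⟨c, t, hc, ht, rfl⟩ := R.decomp x hx hp.pos
    obtain ⟨b, hb, i, -, hcb⟩ := h.zgrp p hp.pos c hc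
    rw [← htow, ← htow, ← htow, hy] at hcb
    refine ⟨y ^ i * algebraMap K F b * t, mul_ne_zero (mul_ne_zero (pow_ne_zero _ hy0) (by simpa using hb)) ht, ?_⟩
    rw [map_mul, hcb, map_mul, map_mul, map_pow, map_pow, mul_pow, mul_pow, ← pow_mul, ← pow_mul, mul_comm p i]
  choose! g hg0 hg using hdiv
  let f : ℕ → F := fun n => g^[n] y
  have hfs : ∀ n, f (n + 1) = g (f n) := fun n => Function.iterate_succ_apply' g n y
  have hf0 : ∀ n, f n ≠ 0 := by
    intro n
    induction n with
    | zero => exact hy0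
    | succ n ih => rw [hfs]; exact hg0 _ ih
  have hfp : ∀ n, v (f (n + 1)) ^ p = v (f n) := by
    intro n; rw [hfs]; exact (hg _ (hf0 n)).symm
  have hf1 : ∀ n, v (f n) < 1 := by
    intro n
    induction n with
    | zero => exact (pow_lt_one_iff_of_nonneg zero_le hp.ne_zero).1 (by show v y ^ p < 1; rw [← hy]; exact hπlt)
    | succ n ih =>
      rw [← hfp] at ih
      exact (pow_lt_one_iff_of_nonneg zero_le hp.ne_zero).1 ih
  have hmono : StrictMono (fun n => v (f n)) := strictMono_nat_of_lt_succ (fun n => by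
    show v (f n) < v (f (n + 1))
    rw [← hfp n]
    exact pow_lt_self_of_lt_one₀ (zero_lt_iff.2 (by simpa using hf0 (n+1))) (hf1 _) hp.one_lt)
  have hfpi : ∀ n, v (p : F) < v (f n) := by
    intro n
    refine hpπ.trans_lt (lt_of_lt_of_le ?_ (hmono.monotone (Nat.zero_le n)))
    show v ϖ < v y
    rw [hy]
    exact pow_lt_self_of_lt_one₀ (zero_lt_iff.2 (by simpa using hy0)) (hf1 0) hp.one_lt
  have hyp : y ^ p ≠ 0 := pow_ne_zero _ hy0
  have hu : v (ϖ / y ^ p) = 1 := by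
    rw [map_div₀, map_pow, ← hy]; exact div_self hvπ0
  set u := ϖ / y ^ p with hudef
  have hne : ∀ n, 1 + u * f (n + 1) ^ p ≠ 0 := by
    intro n h0
    have : v (u * f (n + 1) ^ p) < 1 := by rw [map_mul, hu, one_mul, map_pow, hfp]; exact hf1 n
    have := v.map_one_add_of_lt this
    rw [h0] at this; simp at this
  obtain ⟨i, j, hij, s, hs⟩ := pigeon hC (fun n => 1 + u * f (n + 1) ^ p) hne
  have hfin : ∃ β m, v m < 1 ∧ u = β ^ p * (1 + m) := by
    rcases lt_or_gt_of_ne hij with hlt | hlt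
    · exact step2a hp hvp hu (hmono (by omega : i + 1 < j + 1)) (hf1 _) (by rw [hfp]; exact hfpi j) hs
    · refine step2a hp hvp hu (hmono (by omega : j + 1 < i + 1)) (hf1 _) (by rw [hfp]; exact hfpi i) (s := s⁻¹) ?_
      have hs0 : s ≠ 0 := by
        rintro rfl
        simp only [zero_pow hp.ne_zero, mul_zero] at hs
        exact hne i hs
      have := pow_ne_zero p hs0
      have hs' : 1 + u * f (i + 1) ^ p = (1 + u * f (j + 1) ^ p) * s ^ p := hs
      rw [hs', inv_pow]; field_simp
  obtain ⟨β, m, hm, hum⟩ := hfin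
  refine R.as_no h hH m (β * y) hm ?_
  rw [← hϖ, mul_pow]
  have : ϖ = u * y ^ p := by rw [hudef]; field_simp
  rw [this, hum]; ring

/-- Part II: the valuation on `F` -/
theorem ResData.transfer (R : ResData K F Ω) {v : Valuation K Γ} (h : PA v π p e) :
    ∃ V : ValuationSubring F, (V.valuation.comap (algebraMap K F)).IsEquiv v ∧ PA V.valuation (algebraMap K F π) p e ∧
      ∀ x, V.valuation x ≤ 1 → ∃ a : K, V.valuation (x - algebraMap K F a) < 1 := by
  obtain ⟨V0, hV0⟩ := exists_extension (Ω := Ω) v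
  have h0 : PA (V0.valuation.comap (algebraMap K Ω)) π p e := h.of_equiv hV0.symm
  obtain ⟨V, hV, hinv⟩ := R.exists_hens V0.valuation h0.toPA0
  set w := V.valuation with hw
  have h1 : PA (w.comap (algebraMap K Ω)) π p e := h0.of_equiv hV.symm
  have hF : CharZero F := charZero_of_injective_algebraMap (algebraMap K F).injective
  have hH : Hens (w.comap (algebraMap F Ω)) := hinv.hens
  have hcc : (w.comap (algebraMap F Ω)).comap (algebraMap K F) = w.comap (algebraMap K Ω) := by
    ext x
    simp only [Valuation.comap_apply, IsScalarTower.algebraMap_apply K F Ω x]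
  have hA : PA ((w.comap (algebraMap F Ω)).comap (algebraMap K F)) π p e := by rw [hcc]; exact h1
  obtain ⟨C, hC0, hC⟩ := h1.cl h1.prime.pos
  classical
  have hC' : ∀ x : F, x ≠ 0 → ∃ c ∈ C.image (algebraMap K F), c ≠ 0 ∧ ∃ y, y ≠ 0 ∧ x = c * y ^ p := by
    intro x hx
    obtain ⟨c, t, hc, ht, rfl⟩ := R.decomp x hx h1.prime.pos
    obtain ⟨d, hd, y, hy, rfl⟩ := hC c hc
    refine ⟨algebraMap K F d, Finset.mem_image_of_mem _ hd, by simpa using hC0 d hd, algebraMap K F y * t, mul_ne_zero (by simpa using hy) ht, ?_⟩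
    rw [map_mul, map_pow, mul_pow]; ring
  have h2 := R.step2 h1 hH hC'
  obtain ⟨f1, f2⟩ := finish hA hH (fun x hx n hn => R.decomp x hx hn) (fun x hx => by
    obtain ⟨k, hk⟩ := R.mem_K x (hx.isAlgebraic.algebraMap)
    exact ⟨k, hk⟩) hC' h2
  set u := w.comap (algebraMap F Ω) with hu
  have he : u.IsEquiv u.valuationSubring.valuation := Valuation.isEquiv_valuation_valuationSubring u
  refine ⟨u.valuationSubring, ?_, f1.of_equiv he, ?_⟩
  · have e1 : (u.valuationSubring.valuation.comap (algebraMap K F)).IsEquiv (u.comap (algebraMap K F)) := (he.comap _).symm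
    rw [hcc] at e1
    exact (e1.trans hV).trans hV0
  · intro x hx
    obtain ⟨a, ha⟩ := f2 x (he.le_one_iff_le_one.2 hx)
    exact ⟨a, he.lt_one_iff_lt_one.1 ha⟩
end main
end PAC
end Part14

section Part15
open Polynomial FirstOrder
open scoped IntermediateField

namespace PAC
set_option linter.unusedSectionVars false
set_option linter.unusedVariables false
set_option linter.style.haveILetI false

section tr
variable {K K' : Type*} [Field K] [Field K'] {α : Type}

/-- realization of a formula of the language of rings in a field -/
def Rz (K : Type*) [Field K] {α : Type} (φ : Language.ring.Formula α) (v : α → K) : Prop :=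
  letI := Ring.compatibleRingOfRing K; φ.Realize v

/-- realization of a term of the language of rings in a field -/
def Tz {K : Type*} [Field K] {α : Type} (t : Language.ring.Term α) (v : α → K) : K :=
  letI := Ring.compatibleRingOfRing K; t.realize v

/-- two predicates are defined by the same formula -/
def Tr (P : (α → K) → Prop) (P' : (α → K') → Prop) : Prop :=
  ∃ φ : Language.ring.Formula α, (∀ v, Rz K φ v ↔ P v) ∧ ∀ v, Rz K' φ v ↔ P' v


def Tm (t : (α → K) → K) (t' : (α → K') → K') : Prop :=
  ∃ τ : Language.ring.Term α, (∀ v, Tz τ v = t v) ∧ ∀ v, Tz τ v = t' v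

lemma Tm.var (i : α) : Tm (fun v : α → K => v i) (fun v : α → K' => v i) :=
  ⟨Language.Term.var i, fun _ => rfl, fun _ => rfl⟩

lemma Tm.zero : Tm (fun _ : α → K => 0) (fun _ : α → K' => 0) := by
  refine ⟨0, fun v => ?_, fun v => ?_⟩
  · let _ := Ring.compatibleRingOfRing K; exact Ring.realize_zero v
  · let _ := Ring.compatibleRingOfRing K'; exact Ring.realize_zero v

lemma Tm.one : Tm (fun _ : α → K => 1) (fun _ : α → K' => 1) := by
  refine ⟨1, fun v => ?_, fun v => ?_⟩
  · let _ := Ring.compatibleRingOfRing K; exact Ring.realize_one v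
  · let _ := Ring.compatibleRingOfRing K'; exact Ring.realize_one v

lemma Tm.add {s t : (α → K) → K} {s' t' : (α → K') → K'} (h : Tm s s') (h' : Tm t t') :
    Tm (fun v => s v + t v) (fun v => s' v + t' v) := by
  obtain ⟨σ, h1, h2⟩ := h
  obtain ⟨τ, h3, h4⟩ := h'
  refine ⟨σ + τ, fun v => ?_, fun v => ?_⟩
  · beta_reduce; rw [← h1, ← h3]; let _ := Ring.compatibleRingOfRing K; exact Ring.realize_add _ _ _
  · beta_reduce; rw [← h2, ← h4]; let _ := Ring.compatibleRingOfRing K'; exact Ring.realize_add _ _ _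

lemma Tm.mul {s t : (α → K) → K} {s' t' : (α → K') → K'} (h : Tm s s') (h' : Tm t t') :
    Tm (fun v => s v * t v) (fun v => s' v * t' v) := by
  obtain ⟨σ, h1, h2⟩ := h
  obtain ⟨τ, h3, h4⟩ := h'
  refine ⟨σ * τ, fun v => ?_, fun v => ?_⟩
  · beta_reduce; rw [← h1, ← h3]; let _ := Ring.compatibleRingOfRing K; exact Ring.realize_mul _ _ _
  · beta_reduce; rw [← h2, ← h4]; let _ := Ring.compatibleRingOfRing K'; exact Ring.realize_mul _ _ _

lemma Tm.neg {s : (α → K) → K} {s' : (α → K') → K'} (h : Tm s s') :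
    Tm (fun v => - s v) (fun v => - s' v) := by
  obtain ⟨σ, h1, h2⟩ := h
  refine ⟨-σ, fun v => ?_, fun v => ?_⟩
  · beta_reduce; rw [← h1]; let _ := Ring.compatibleRingOfRing K; exact Ring.realize_neg _ _
  · beta_reduce; rw [← h2]; let _ := Ring.compatibleRingOfRing K'; exact Ring.realize_neg _ _

lemma Tm.pow {s : (α → K) → K} {s' : (α → K') → K'} (h : Tm s s') (n : ℕ) :
    Tm (fun v => s v ^ n) (fun v => s' v ^ n) := by
  induction n with
  | zero => simpa using Tm.one
  | succ n ih => simpa [pow_succ] using ih.mul h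

lemma Tm.natCast (n : ℕ) : Tm (fun _ : α → K => (n : K)) (fun _ : α → K' => (n : K')) := by
  induction n with
  | zero => simpa using Tm.zero
  | succ n ih => simpa using ih.add Tm.one

lemma Tm.sum {ι : Type} (S : Finset ι) {s : ι → (α → K) → K} {s' : ι → (α → K') → K'} (h : ∀ i, Tm (s i) (s' i)) :
    Tm (fun v => ∑ i ∈ S, s i v) (fun v => ∑ i ∈ S, s' i v) := by
  classical
  induction S using Finset.induction_on with
  | empty => simpa using Tm.zero
  | insert a S ha ih => simpa [Finset.sum_insert ha] using (h a).add ih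

lemma Tr.eq {s t : (α → K) → K} {s' t' : (α → K') → K'} (h : Tm s s') (h' : Tm t t') :
    Tr (fun v => s v = t v) (fun v => s' v = t' v) := by
  obtain ⟨σ, h1, h2⟩ := h
  obtain ⟨τ, h3, h4⟩ := h'
  refine ⟨σ.equal τ, fun v => ?_, fun v => ?_⟩
  · beta_reduce; rw [← h1, ← h3]; let _ := Ring.compatibleRingOfRing K; exact Language.Formula.realize_equal
  · beta_reduce; rw [← h2, ← h4]; let _ := Ring.compatibleRingOfRing K'; exact Language.Formula.realize_equal

lemma Tr.not {P : (α → K) → Prop} {P' : (α → K') → Prop} (h : Tr P P') : Tr (fun v => ¬ P v) (fun v => ¬ P' v) := by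
  obtain ⟨φ, h1, h2⟩ := h
  refine ⟨φ.not, fun v => ?_, fun v => ?_⟩
  · beta_reduce; rw [← h1]; let _ := Ring.compatibleRingOfRing K; exact Language.Formula.realize_not
  · beta_reduce; rw [← h2]; let _ := Ring.compatibleRingOfRing K'; exact Language.Formula.realize_not

lemma Tr.imp {P Q : (α → K) → Prop} {P' Q' : (α → K') → Prop} (h : Tr P P') (h' : Tr Q Q') :
    Tr (fun v => P v → Q v) (fun v => P' v → Q' v) := by
  obtain ⟨φ, h1, h2⟩ := h
  obtain ⟨ψ, h3, h4⟩ := h'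
  refine ⟨φ.imp ψ, fun v => ?_, fun v => ?_⟩
  · beta_reduce; rw [← h1, ← h3]; let _ := Ring.compatibleRingOfRing K; exact Language.Formula.realize_imp
  · beta_reduce; rw [← h2, ← h4]; let _ := Ring.compatibleRingOfRing K'; exact Language.Formula.realize_imp

lemma Tr.congr {P Q : (α → K) → Prop} {P' Q' : (α → K') → Prop} (h : Tr P P') (h1 : ∀ v, P v ↔ Q v) (h2 : ∀ v, P' v ↔ Q' v) :
    Tr Q Q' := by
  have e1 : P = Q := funext fun v => propext (h1 v)
  have e2 : P' = Q' := funext fun v => propext (h2 v)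
  rwa [← e1, ← e2]

lemma Tr.and {P Q : (α → K) → Prop} {P' Q' : (α → K') → Prop} (h : Tr P P') (h' : Tr Q Q') :
    Tr (fun v => P v ∧ Q v) (fun v => P' v ∧ Q' v) :=
  (h.imp h'.not).not.congr (fun v => by tauto) (fun v => by tauto)

lemma Tr.or {P Q : (α → K) → Prop} {P' Q' : (α → K') → Prop} (h : Tr P P') (h' : Tr Q Q') :
    Tr (fun v => P v ∨ Q v) (fun v => P' v ∨ Q' v) :=
  (h.not.imp h').congr (fun v => by tauto) (fun v => by tauto)

lemma Tr.iff {P Q : (α → K) → Prop} {P' Q' : (α → K') → Prop} (h : Tr P P') (h' : Tr Q Q') :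
    Tr (fun v => P v ↔ Q v) (fun v => P' v ↔ Q' v) :=
  ((h.imp h').and (h'.imp h)).congr (fun v => by tauto) (fun v => by tauto)

lemma Tr.allF {β : Type} [Finite β] {P : (α → K) → (β → K) → Prop} {P' : (α → K') → (β → K') → Prop}
    (h : Tr (fun v : α ⊕ β → K => P (v ∘ Sum.inl) (v ∘ Sum.inr)) (fun v : α ⊕ β → K' => P' (v ∘ Sum.inl) (v ∘ Sum.inr))) :
    Tr (fun v => ∀ x, P v x) (fun v => ∀ x, P' v x) := by
  obtain ⟨φ, h1, h2⟩ := h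
  refine ⟨φ.iAlls β, fun v => ?_, fun v => ?_⟩
  · letI := Ring.compatibleRingOfRing K
    exact Language.Formula.realize_iAlls.trans (forall_congr' fun x => (h1 _).trans (by simp))
  · letI := Ring.compatibleRingOfRing K'
    exact Language.Formula.realize_iAlls.trans (forall_congr' fun x => (h2 _).trans (by simp))

lemma Tr.all {P : (α → K) → K → Prop} {P' : (α → K') → K' → Prop}
    (h : Tr (fun v : α ⊕ Unit → K => P (v ∘ Sum.inl) (v (Sum.inr ()))) (fun v : α ⊕ Unit → K' => P' (v ∘ Sum.inl) (v (Sum.inr ())))) :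
    Tr (fun v => ∀ x, P v x) (fun v => ∀ x, P' v x) :=
  (Tr.allF (β := Unit) (P := fun v x => P v (x ())) (P' := fun v x => P' v (x ())) h).congr
    (fun v => ⟨fun h x => h (fun _ => x), fun h x => h _⟩) (fun v => ⟨fun h x => h (fun _ => x), fun h x => h _⟩)

lemma Tr.ex {P : (α → K) → K → Prop} {P' : (α → K') → K' → Prop}
    (h : Tr (fun v : α ⊕ Unit → K => P (v ∘ Sum.inl) (v (Sum.inr ()))) (fun v : α ⊕ Unit → K' => P' (v ∘ Sum.inl) (v (Sum.inr ())))) :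
    Tr (fun v => ∃ x, P v x) (fun v => ∃ x, P' v x) :=
  (Tr.all (P := fun v x => ¬ P v x) (P' := fun v x => ¬ P' v x) h.not).not.congr (fun v => by push Not; rfl) (fun v => by push Not; rfl)

lemma Tr.exF {β : Type} [Finite β] {P : (α → K) → (β → K) → Prop} {P' : (α → K') → (β → K') → Prop}
    (h : Tr (fun v : α ⊕ β → K => P (v ∘ Sum.inl) (v ∘ Sum.inr)) (fun v : α ⊕ β → K' => P' (v ∘ Sum.inl) (v ∘ Sum.inr))) :
    Tr (fun v => ∃ x, P v x) (fun v => ∃ x, P' v x) :=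
  (Tr.allF (P := fun v x => ¬ P v x) (P' := fun v x => ¬ P' v x) h.not).not.congr (fun v => by push Not; rfl) (fun v => by push Not; rfl)

lemma Tr.true : Tr (fun _ : α → K => True) (fun _ : α → K' => True) :=
  (Tr.eq Tm.zero Tm.zero).congr (by simp) (by simp)

lemma Tr.fin {ι : Type} [Finite ι] {P : ι → (α → K) → Prop} {P' : ι → (α → K') → Prop} (h : ∀ i, Tr (P i) (P' i)) :
    Tr (fun v => ∀ i, P i v) (fun v => ∀ i, P' i v) := by
  classical
  have := Fintype.ofFinite ι
  have key : ∀ S : Finset ι, Tr (fun v => ∀ i ∈ S, P i v) (fun v => ∀ i ∈ S, P' i v) := by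
    intro S
    induction S using Finset.induction_on with
    | empty => exact Tr.true.congr (by simp) (by simp)
    | insert a S ha ih => exact ((h a).and ih).congr (by simp) (by simp)
  exact (key Finset.univ).congr (by simp) (by simp)

lemma Tr.exfin {ι : Type} [Finite ι] {P : ι → (α → K) → Prop} {P' : ι → (α → K') → Prop} (h : ∀ i, Tr (P i) (P' i)) :
    Tr (fun v => ∃ i, P i v) (fun v => ∃ i, P' i v) :=
  (Tr.fin fun i => (h i).not).not.congr (fun v => by push Not; rfl) (fun v => by push Not; rfl)

end tr

section fo
variable (p e : ℕ) {K : Type*} [Field K]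

/-- the definable valuation ring -/
def Ov (x : K) : Prop := ∃ y, y ^ (p * e + 1) = 1 + p * x ^ (p * e + 1)

/-- definable units -/
def Ou (u : K) : Prop := ∃ w, Ov p e u ∧ Ov p e w ∧ u * w = 1

variable (K) in
/-- `Ov` is a valuation ring -/
def fA : Prop := (∀ x y : K, Ov p e x → Ov p e y → Ov p e (x + y)) ∧ (∀ x y : K, Ov p e x → Ov p e y → Ov p e (x * y)) ∧
  Ov p e (0 : K) ∧ Ov p e (1 : K) ∧ Ov p e (-1 : K) ∧ ∀ x y : K, x * y = 1 → Ov p e x ∨ Ov p e y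

/-- `π` is a uniformizer -/
def Un (π : K) : Prop := π ≠ 0 ∧ ∀ x, (Ov p e x ∧ ∀ y, x * y = 1 → ¬ Ov p e y) ↔ ∃ y, Ov p e y ∧ x = π * y

/-- uniformizer and residue representatives -/
def Gd (q : ℕ) (π : K) (r : Fin q → K) : Prop := Un p e π ∧ (∃ u, Ou p e u ∧ (p : K) = u * π ^ e) ∧ (∀ j, Ov p e (r j)) ∧
  ∀ x, Ov p e x → ∃ j, ∃ y, Ov p e y ∧ x = r j + π * y

variable (K) in
/-- the value group is a `ℤ`-group -/
def fS (m : ℕ) : Prop := ∀ π : K, Un p e π → ∀ x : K, x ≠ 0 → ∃ y, y ≠ 0 ∧ ∃ i : Fin m, ∃ u, Ou p e u ∧ x = u * π ^ (i : ℕ) * y ^ m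

/-- monic polynomial function -/
def pev {d : ℕ} (c : Fin d → K) (x : K) : K := x ^ d + ∑ i, c i * x ^ (i : ℕ)

variable (K) in
/-- henselianity in degree `d+1` -/
def fH (d : ℕ) : Prop := ∀ c : Fin (d + 1) → K,
  (∀ k : Fin d, ∀ a : Fin (k + 1) → K, ∀ b : Fin (d - k) → K, ¬ ∀ x, pev c x = pev a x * pev b x) → Ov p e (c 0) → ∀ i, Ov p e (c i)

variable {K' : Type*} [Field K'] {α : Type} {p e}

lemma trOv {s : (α → K) → K} {s' : (α → K') → K'} (h : Tm s s') : Tr (fun v => Ov p e (s v)) (fun v => Ov p e (s' v)) := by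
  obtain ⟨τ, h1, h2⟩ := h
  refine Tr.ex (Tr.eq ((Tm.var _).pow _) (Tm.one.add ((Tm.natCast _).mul (Tm.pow ?_ _))))
  refine ⟨τ.relabel Sum.inl, fun v => ?_, fun v => ?_⟩
  · beta_reduce; rw [← h1]; let _ := Ring.compatibleRingOfRing K; exact Language.Term.realize_relabel
  · beta_reduce; rw [← h2]; let _ := Ring.compatibleRingOfRing K'; exact Language.Term.realize_relabel

lemma Tm.inl {β : Type} {s : (α → K) → K} {s' : (α → K') → K'} (h : Tm s s') :
    Tm (fun v : α ⊕ β → K => s (v ∘ Sum.inl)) (fun v : α ⊕ β → K' => s' (v ∘ Sum.inl)) := by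
  obtain ⟨τ, h1, h2⟩ := h
  refine ⟨τ.relabel Sum.inl, fun v => ?_, fun v => ?_⟩
  · beta_reduce; rw [← h1]; let _ := Ring.compatibleRingOfRing K; exact Language.Term.realize_relabel
  · beta_reduce; rw [← h2]; let _ := Ring.compatibleRingOfRing K'; exact Language.Term.realize_relabel

lemma trOu {s : (α → K) → K} {s' : (α → K') → K'} (h : Tm s s') : Tr (fun v => Ou p e (s v)) (fun v => Ou p e (s' v)) :=
  Tr.ex ((trOv h.inl).and ((trOv (Tm.var _)).and (Tr.eq (h.inl.mul (Tm.var _)) Tm.one)))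

lemma trUn {s : (α → K) → K} {s' : (α → K') → K'} (h : Tm s s') : Tr (fun v => Un p e (s v)) (fun v => Un p e (s' v)) :=
  (Tr.eq h Tm.zero).not.and (Tr.all (((trOv (Tm.var _)).and (Tr.all ((Tr.eq ((Tm.var _).mul (Tm.var _)) Tm.one).imp (trOv (Tm.var _)).not))).iff
    (Tr.ex ((trOv (Tm.var _)).and (Tr.eq (Tm.var _) (h.inl.inl.mul (Tm.var _)))))))

lemma trA : Tr (fun _ : α → K => fA p e K) (fun _ : α → K' => fA p e K') := by
  refine (Tr.all (Tr.all ?_)).and ((Tr.all (Tr.all ?_)).and ((trOv Tm.zero).and ((trOv Tm.one).and ((trOv Tm.one.neg).and (Tr.all (Tr.all ?_))))))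
  · exact (trOv (Tm.var _)).imp ((trOv (Tm.var _)).imp (trOv ((Tm.var _).add (Tm.var _))))
  · exact (trOv (Tm.var _)).imp ((trOv (Tm.var _)).imp (trOv ((Tm.var _).mul (Tm.var _))))
  · exact (Tr.eq ((Tm.var _).mul (Tm.var _)) Tm.one).imp ((trOv (Tm.var _)).or (trOv (Tm.var _)))

lemma trGd {q : ℕ} {s : (α → K) → K} {s' : (α → K') → K'} (h : Tm s s') {r : Fin q → (α → K) → K} {r' : Fin q → (α → K') → K'}
    (hr : ∀ j, Tm (r j) (r' j)) : Tr (fun v => Gd p e q (s v) (fun j => r j v)) (fun v => Gd p e q (s' v) (fun j => r' j v)) :=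
  (trUn h).and ((Tr.ex ((trOu (Tm.var _)).and (Tr.eq (Tm.natCast _) ((Tm.var _).mul (h.inl.pow _))))).and ((Tr.fin fun j => trOv (hr j)).and
    (Tr.all ((trOv (Tm.var _)).imp (Tr.exfin fun j => Tr.ex ((trOv (Tm.var _)).and (Tr.eq (Tm.var _) ((hr j).inl.inl.add (h.inl.inl.mul (Tm.var _))))))))))

lemma trS (m : ℕ) : Tr (fun _ : α → K => fS p e K m) (fun _ : α → K' => fS p e K' m) :=
  Tr.all ((trUn (Tm.var _)).imp (Tr.all ((Tr.eq (Tm.var _) Tm.zero).not.imp (Tr.ex ((Tr.eq (Tm.var _) Tm.zero).not.and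
    (Tr.exfin fun i => Tr.ex ((trOu (Tm.var _)).and (Tr.eq (Tm.var _) (((Tm.var _).mul ((Tm.var _).pow _)).mul ((Tm.var _).pow _))))))))))

lemma tmPev {d : ℕ} {c : Fin d → (α → K) → K} {c' : Fin d → (α → K') → K'} (hc : ∀ j, Tm (c j) (c' j)) {s : (α → K) → K} {s' : (α → K') → K'} (h : Tm s s') :
    Tm (fun v => pev (fun j => c j v) (s v)) (fun v => pev (fun j => c' j v) (s' v)) :=
  (h.pow _).add (Tm.sum _ fun i => (hc i).mul (h.pow _))

lemma trH (d : ℕ) : Tr (fun _ : α → K => fH p e K d) (fun _ : α → K' => fH p e K' d) := by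
  refine Tr.allF (Tr.imp (Tr.fin fun k => Tr.allF (Tr.allF (Tr.not (Tr.all (Tr.eq ?_ (Tm.mul ?_ ?_)))))) ((trOv (Tm.var _)).imp (Tr.fin fun i => trOv (Tm.var _))))
  · exact tmPev (fun j => Tm.var (Sum.inl (Sum.inl (Sum.inl (Sum.inr j))))) (Tm.var _)
  · exact tmPev (fun j => Tm.var (Sum.inl (Sum.inl (Sum.inr j)))) (Tm.var _)
  · exact tmPev (fun j => Tm.var (Sum.inl (Sum.inr j))) (Tm.var _)

end fo
end PAC
end Part15

section Part16
open Polynomial FirstOrder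
open scoped IntermediateField

namespace PAC
set_option linter.unusedSectionVars false

section
variable {K Γ : Type*} [Field K] [LinearOrderedCommGroupWithZero Γ] {v : Valuation K Γ} {π : K} {p e : ℕ}

lemma PA.ov_iff (h : PA v π p e) (x : K) : v x ≤ 1 ↔ Ov p e x := by
  have hp := h.prime
  have hnd : ¬ p ∣ p * e + 1 := by
    intro hd
    have := (Nat.dvd_add_right (Dvd.intro e rfl)).1 hd
    exact hp.one_lt.ne' (Nat.dvd_one.1 this)
  have hvn := v_nat_eq_one hp h.lt hnd
  constructor
  · intro hx
    obtain ⟨z, hz, -⟩ := h.hens.one_add_pow (Nat.succ_pos _) hvn (p * x ^ (p * e + 1)) (by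
      rw [map_mul, map_pow]; exact mul_lt_one_of_lt_of_le h.lt (pow_le_one₀ zero_le hx))
    exact ⟨z, hz⟩
  · rintro ⟨y, hy⟩
    by_contra hx
    rw [not_le] at hx
    have hπ0 : v π ≠ 0 := by simpa using h.π0
    have hx0 : x ≠ 0 := by rintro rfl; simp at hx
    have hvx0 : v x ≠ 0 := by simpa using hx0
    have hinv : v x⁻¹ ≤ v π := (h.unif _).1 (by rw [map_inv₀]; exact inv_lt_one_of_one_lt₀ hx)
    have h1 : 1 ≤ v π * v x := by
      rw [map_inv₀] at hinv
      calc (1 : Γ) = (v x)⁻¹ * v x := (inv_mul_cancel₀ hvx0).symm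
        _ ≤ _ := mul_le_mul_left hinv _
    have h2 : 1 < v (p * x ^ (p * e + 1)) := by
      have e1 : v (p * x ^ (p * e + 1)) = (v π * v x) ^ e * v x ^ (p * e + 1 - e) := by
        rw [map_mul, map_pow, h.ram, mul_pow, mul_assoc, ← pow_add]
        congr 2
        have : e ≤ p * e := Nat.le_mul_of_pos_left _ hp.pos
        omega
      rw [e1]
      have h3 : 1 ≤ (v π * v x) ^ e := one_le_pow₀ h1
      have h4 : 1 < v x ^ (p * e + 1 - e) := one_lt_pow₀ hx (by
        have : e ≤ p * e := Nat.le_mul_of_pos_left _ hp.pos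
        omega)
      exact lt_of_lt_of_le h4 (le_mul_of_one_le_left zero_le h3)
    have h3 : v y ^ (p * e + 1) = v (p * x ^ (p * e + 1)) := by
      rw [← map_pow, hy]
      have h2' : v 1 < v (p * x ^ (p * e + 1)) := by rw [map_one]; exact h2
      exact v.map_add_eq_of_lt_right h2'
    have hy0 : y ≠ 0 := by
      rintro rfl
      rw [map_zero, zero_pow (Nat.succ_ne_zero _)] at h3; rw [← h3] at h2
      exact absurd h2 (by simp)
    have h4 : v π ^ e = v (y / x) ^ (p * e + 1) := by
      rw [map_div₀, div_pow, h3, map_mul, map_pow, h.ram, mul_div_cancel_right₀ _ (pow_ne_zero _ hvx0)]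
    have hcop : Nat.Coprime e (p * e + 1) := by simp
    obtain ⟨z, hz, ez⟩ := val_coprime v h.π0 (div_ne_zero hy0 hx0) hcop h4
    refine h.not_pow (n := p * e + 1) (by have := Nat.mul_pos hp.pos h.epos; omega) z (π / z ^ (p * e + 1)) ?_ ?_
    · rw [map_div₀, map_pow, ← ez, div_self hπ0]
    · have := pow_ne_zero (p * e + 1) hz
      field_simp

lemma PA.ou_iff (h : PA v π p e) (u : K) : v u = 1 ↔ Ou p e u := by
  constructor
  · intro hu
    refine ⟨u⁻¹, (h.ov_iff _).1 hu.le, (h.ov_iff _).1 (by rw [map_inv₀, hu, inv_one]), mul_inv_cancel₀ ?_⟩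
    rintro rfl; simp at hu
  · rintro ⟨w, h1, h2, h3⟩
    rw [← h.ov_iff] at h1 h2
    apply le_antisymm h1
    have := congrArg v h3
    rw [map_mul, map_one] at this
    rw [← this]
    exact mul_le_of_le_one_right' h2

lemma PA.un_iff (h : PA v π p e) (ϖ : K) : v ϖ = v π ↔ Un p e ϖ := by
  have hπ0 : v π ≠ 0 := by simpa using h.π0
  have hnon : ∀ x, (Ov p e x ∧ ∀ y, x * y = 1 → ¬ Ov p e y) ↔ v x < 1 := by
    intro x
    simp only [← h.ov_iff]
    constructor
    · rintro ⟨h1, h2⟩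
      by_contra h3
      have hx0 : x ≠ 0 := by rintro rfl; simp at h3
      refine h2 x⁻¹ (mul_inv_cancel₀ hx0) ?_
      rw [map_inv₀]
      exact inv_le_one_of_one_le₀ (not_lt.1 h3)
    · intro h1
      refine ⟨h1.le, fun y hy hy1 => ?_⟩
      have := congrArg v hy
      rw [map_mul, map_one] at this
      exact absurd this (mul_lt_one_of_lt_of_le h1 hy1).ne
  have hdiv : ∀ ϖ : K, ϖ ≠ 0 → ∀ x, (∃ y, Ov p e y ∧ x = ϖ * y) ↔ v x ≤ v ϖ := by
    intro ϖ h0 x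
    have hv0 : v ϖ ≠ 0 := by simpa using h0
    constructor
    · rintro ⟨y, hy, rfl⟩
      rw [← h.ov_iff] at hy
      rw [map_mul]; exact mul_le_of_le_one_right' hy
    · intro hx
      refine ⟨x / ϖ, (h.ov_iff _).1 ?_, by field_simp⟩
      rw [map_div₀]
      exact div_le_one_of_le₀ hx zero_le
  constructor
  · intro he
    have h0 : ϖ ≠ 0 := by rintro rfl; simp at he; exact hπ0 he.symm
    refine ⟨h0, fun x => ?_⟩
    rw [hnon, hdiv _ h0, he, h.unif]
  · rintro ⟨h0, h1⟩
    simp only [hnon, hdiv _ h0] at h1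
    exact le_antisymm ((h.unif _).1 ((h1 _).2 le_rfl)) ((h1 _).1 h.lt_one)

end

section poly
variable {K : Type*} [Field K]

/-- monic polynomial with given coefficients -/
noncomputable def pp {d : ℕ} (c : Fin d → K) : K[X] := X ^ d + ∑ i, C (c i) * X ^ (i : ℕ)

lemma pp_eval {d : ℕ} (c : Fin d → K) (x : K) : (pp c).eval x = pev c x := by
  simp [pp, pev, eval_finset_sum]

lemma pp_deg_lt {d : ℕ} (c : Fin d → K) : (∑ i, C (c i) * X ^ (i : ℕ)).degree < (d : WithBot ℕ) := degree_sum_fin_lt c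

lemma pp_monic {d : ℕ} (c : Fin d → K) : (pp c).Monic := monic_X_pow_add (pp_deg_lt c)

lemma pp_natDegree {d : ℕ} (c : Fin d → K) : (pp c).natDegree = d := by
  apply natDegree_eq_of_degree_eq_some
  rw [pp, degree_add_eq_left_of_degree_lt, degree_X_pow]
  rw [degree_X_pow]; exact pp_deg_lt c

lemma pp_coeff {d : ℕ} (c : Fin d → K) (i : Fin d) : (pp c).coeff i = c i := by
  rw [pp, coeff_add, coeff_X_pow, if_neg i.2.ne, zero_add, finset_sum_coeff, Finset.sum_eq_single i]
  · simp
  · intro j _ hj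
    rw [coeff_C_mul_X_pow, if_neg]
    exact fun h => hj (Fin.ext h.symm)
  · simp

lemma eq_pp {d : ℕ} {g : K[X]} (hg : g.Monic) (hd : g.natDegree = d) : g = pp (fun i : Fin d => g.coeff i) := by
  conv_lhs => rw [hg.as_sum, hd]
  rw [pp, Finset.sum_range]

lemma irr_iff [Infinite K] {d : ℕ} (c : Fin (d + 1) → K) :
    (∀ k : Fin d, ∀ a : Fin (k + 1) → K, ∀ b : Fin (d - k) → K, ¬ ∀ x, pev c x = pev a x * pev b x) ↔ Irreducible (pp c) := by
  constructor
  · intro h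
    rw [(pp_monic c).irreducible_iff_natDegree]
    refine ⟨fun h1 => ?_, fun f g hf hg hfg => ?_⟩
    · have := pp_natDegree c
      rw [h1, natDegree_one] at this
      omega
    · by_contra hcon
      push Not at hcon
      have hdeg := pp_natDegree c
      rw [← hfg, hf.natDegree_mul hg] at hdeg
      have e1 := eq_pp hf (d := (f.natDegree - 1) + 1) (by omega)
      have e2 := eq_pp hg (d := d - (f.natDegree - 1)) (by omega)
      refine h ⟨f.natDegree - 1, by omega⟩ (fun i => f.coeff i) (fun i => g.coeff i) (fun x => ?_)
      rw [← pp_eval, ← hfg, eval_mul, ← pp_eval, ← pp_eval]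
      congr 1
      · rw [← e1]
      · rw [← e2]
  · intro h k a b hab
    have : pp c = pp a * pp b := Polynomial.funext fun x => by rw [eval_mul, pp_eval, pp_eval, pp_eval, hab]
    rw [this] at h
    have := ((pp_monic a).mul (pp_monic b)).irreducible_iff_natDegree.1 h
    rcases this.2 _ _ (pp_monic a) (pp_monic b) rfl with h1 | h1
    · rw [pp_natDegree] at h1; omega
    · rw [pp_natDegree] at h1; have := k.2; omega
end poly

/-- first order version of `PA` -/
structure FO (p e q : ℕ) {K : Type*} [Field K] (π : K) (r : Fin q → K) : Prop where
  prime : p.Prime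
  epos : 0 < e
  A : fA p e K
  G : Gd p e q π r
  S : ∀ m, 0 < m → fS p e K m
  H : ∀ d, fH p e K d

section
variable {K Γ : Type*} [Field K] [CharZero K] [LinearOrderedCommGroupWithZero Γ] {v : Valuation K Γ} {π : K} {p e q : ℕ}

lemma PA.toFO (h : PA v π p e) : ∃ q, ∃ r : Fin q → K, FO p e q π r := by
  classical
  obtain ⟨R, hR⟩ := h.fin
  set R' := R.filter (fun x => v x ≤ 1) with hR'
  refine ⟨R'.card, fun i => (R'.equivFin.symm i : K), ?_⟩
  have hπ0 : v π ≠ 0 := by simpa using h.π0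
  refine ⟨h.prime, h.epos, ?_, ?_, ?_, ?_⟩
  · simp only [fA, ← h.ov_iff]
    refine ⟨fun x y hx hy => (v.map_add _ _).trans (max_le hx hy), fun x y hx hy => ?_, by simp, by simp, by simp [v.map_neg], fun x y hxy => ?_⟩
    · rw [map_mul]; exact mul_le_one' hx hy
    · by_contra hcon
      push Not at hcon
      have := congrArg v hxy
      rw [map_mul, map_one] at this
      exact absurd this (one_lt_mul'' hcon.1 hcon.2).ne'
  · refine ⟨(h.un_iff π).1 rfl, ⟨p / π ^ e, (h.ou_iff _).1 ?_, ?_⟩, fun j => ?_, fun x hx => ?_⟩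
    · rw [map_div₀, map_pow, h.ram, div_self (pow_ne_zero _ hπ0)]
    · have := pow_ne_zero e h.π0
      field_simp
    · exact (h.ov_iff _).1 (Finset.mem_filter.1 (R'.equivFin.symm j).2).2
    · rw [← h.ov_iff] at hx
      obtain ⟨r, hr, hxr⟩ := hR x hx
      have hr1 : v r ≤ 1 := by
        have : r = x - (x - r) := by ring
        rw [this]
        exact (v.map_sub _ _).trans (max_le hx hxr.le)
      refine ⟨R'.equivFin ⟨r, Finset.mem_filter.2 ⟨hr, hr1⟩⟩, (x - r) / π, (h.ov_iff _).1 ?_, ?_⟩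
      · rw [map_div₀]; exact div_le_one_of_le₀ ((h.unif _).1 hxr) zero_le
      · have := h.π0
        simp only [Equiv.symm_apply_apply]
        field_simp
        ring
  · intro m hm ϖ hϖ x hx
    rw [← h.un_iff] at hϖ
    obtain ⟨y, hy, i, hi, hxy⟩ := h.zgrp m hm x hx
    have h0 : ϖ ≠ 0 := by rintro rfl; simp at hϖ; exact hπ0 hϖ.symm
    have := mul_ne_zero (pow_ne_zero i h0) (pow_ne_zero m hy)
    refine ⟨y, hy, ⟨i, hi⟩, x / (ϖ ^ i * y ^ m), (h.ou_iff _).1 ?_, ?_⟩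
    · rw [map_div₀, map_mul, map_pow, map_pow, hϖ, hxy, div_self]
      have : v x ≠ 0 := by simpa using hx
      rwa [hxy] at this
    · rw [mul_assoc]; field_simp
  · intro d c hc h0 i
    rw [irr_iff] at hc
    rw [← h.ov_iff] at h0 ⊢
    rw [← pp_coeff c i]
    refine h.hens _ (pp_monic c) hc ?_ _
    have := pp_coeff c 0
    rw [Fin.val_zero] at this
    rwa [this]

lemma FO.toPA {r : Fin q → K} (h : FO p e q π r) : ∃ V : ValuationSubring K, (∀ x, x ∈ V ↔ Ov p e x) ∧ PA V.valuation π p e ∧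
    ∀ x ∈ V, ∃ j, V.valuation (x - r j) < 1 := by
  obtain ⟨hp, he, ⟨A1, A2, A3, A4, A5, A6⟩, ⟨⟨hπ0, G1⟩, ⟨u, hu, hup⟩, G2, G3⟩, S, H⟩ := h
  let V : ValuationSubring K := {
    carrier := {x | Ov p e x}
    mul_mem' := fun {a b} ha hb => A2 a b ha hb
    one_mem' := A4
    add_mem' := fun {a b} ha hb => A1 a b ha hb
    zero_mem' := A3
    neg_mem' := fun {a} ha => by
      have := A2 _ _ A5 ha
      rw [neg_one_mul] at this
      exact this
    mem_or_inv_mem' := fun x => by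
      by_cases hx : x = 0
      · subst hx; left; exact A3
      · exact A6 x x⁻¹ (mul_inv_cancel₀ hx) }
  have hV : ∀ x, x ∈ V ↔ Ov p e x := fun x => Iff.rfl
  have hle : ∀ x, V.valuation x ≤ 1 ↔ Ov p e x := fun x => (V.valuation_le_one_iff x).trans (hV x)
  set w := V.valuation with hw
  have hou : ∀ u, Ou p e u → w u = 1 := by
    rintro u ⟨z, h1, h2, h3⟩
    rw [← hle] at h1 h2
    apply le_antisymm h1
    have := congrArg w h3
    rw [map_mul, map_one] at this
    rw [← this]
    exact mul_le_of_le_one_right' h2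
  have hlt : ∀ x, w x < 1 ↔ ∃ y, Ov p e y ∧ x = π * y := by
    intro x
    rw [← G1, ← hle]
    simp only [← hle]
    constructor
    · intro h1
      refine ⟨h1.le, fun y hy hy1 => ?_⟩
      have := congrArg w hy
      rw [map_mul, map_one] at this
      exact absurd this (mul_lt_one_of_lt_of_le h1 hy1).ne
    · rintro ⟨h1, h2⟩
      by_contra h3
      have hx0 : x ≠ 0 := by rintro rfl; simp at h3
      refine h2 x⁻¹ (mul_inv_cancel₀ hx0) ?_
      rw [map_inv₀]
      exact inv_le_one_of_one_le₀ (not_lt.1 h3)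
  have hG3 : ∀ x ∈ V, ∃ j, w (x - r j) < 1 := by
    intro x hx
    obtain ⟨j, y, hy, hxy⟩ := G3 x hx
    exact ⟨j, (hlt _).2 ⟨y, hy, by rw [hxy]; ring⟩⟩
  have hwπ : w π ≠ 0 := by simpa using hπ0
  refine ⟨V, hV, ⟨⟨hπ0, fun x => ?_, ?_, ?_⟩, hp, he, ?_, ?_⟩, hG3⟩
  · rw [hlt]
    constructor
    · rintro ⟨y, hy, rfl⟩
      rw [← hle] at hy
      rw [map_mul]; exact mul_le_of_le_one_right' hy
    · intro hx
      refine ⟨x / π, (hle _).1 ?_, by field_simp⟩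
      rw [map_div₀]; exact div_le_one_of_le₀ hx zero_le
  · classical
    refine ⟨Finset.univ.image r, fun x hx => ?_⟩
    obtain ⟨j, hj⟩ := hG3 x ((V.valuation_le_one_iff x).1 hx)
    exact ⟨r j, Finset.mem_image_of_mem _ (Finset.mem_univ _), hj⟩
  · intro g hg hirr h0 i
    have hpos : 0 < g.natDegree := hirr.natDegree_pos
    obtain ⟨d, hd⟩ : ∃ d, g.natDegree = d + 1 := ⟨g.natDegree - 1, by omega⟩
    have eg := eq_pp hg hd
    have h1 := H d (fun i => g.coeff i) ((irr_iff _).2 (by rw [← eg]; exact hirr)) ((hle _).1 (by beta_reduce; rw [Fin.val_zero]; exact h0))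
    rcases lt_trichotomy i (d + 1) with hi | hi | hi
    · exact (hle _).2 (h1 ⟨i, hi⟩)
    · have : g.coeff i = 1 := by rw [hi, ← hd]; exact hg
      rw [this, map_one]
    · rw [coeff_eq_zero_of_natDegree_lt (by omega), map_zero]; exact zero_le
  · rw [hup, map_mul, map_pow, hou u hu, one_mul]
  · intro n hn x hx
    obtain ⟨y, hy, i, u, hu, hxy⟩ := S n hn π ⟨hπ0, G1⟩ x hx
    refine ⟨y, hy, i, i.2, ?_⟩
    rw [hxy, map_mul, map_mul, map_pow, map_pow, hou u hu, one_mul]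

end
end PAC
end Part16

section Part17
open Polynomial FirstOrder
open scoped IntermediateField

namespace PAC
set_option linter.unusedSectionVars false

section los
variable {ι : Type*} {K : Type*} [Field K] (U : Ultrafilter ι) {α : Type}

/-- the ultrapower -/
abbrev Ult (U : Ultrafilter ι) (K : Type*) := Filter.Germ (U : Filter ι) K

noncomputable instance : Field (Ult U K) := inferInstance

lemma los_term (t : Language.ring.Term α) (x : α → ι → K) :
    Tz (K := Ult U K) t (fun a => (↑(x a) : Ult U K)) = ((fun i => Tz t (fun a => x a i) : ι → K) : Ult U K) := by
  letI := Ring.compatibleRingOfRing K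
  letI := Ring.compatibleRingOfRing (Ult U K)
  induction t with
  | var a => rfl
  | func f ts ih =>
    unfold Tz at *
    cases f with
    | add =>
      have h1 := ih 0
      have h2 := ih 1
      simp only [Language.Term.realize]
      erw [Ring.CompatibleRing.funMap_add]
      rw [h1, h2, ← Filter.Germ.coe_add]
      rfl
    | mul =>
      have h1 := ih 0
      have h2 := ih 1
      simp only [Language.Term.realize]
      erw [Ring.CompatibleRing.funMap_mul]
      rw [h1, h2, ← Filter.Germ.coe_mul]
      rfl
    | neg =>
      have h1 := ih 0
      simp only [Language.Term.realize]
      erw [Ring.CompatibleRing.funMap_neg]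
      rw [h1, ← Filter.Germ.coe_neg]
      rfl
    | zero =>
      simp only [Language.Term.realize]
      erw [Ring.CompatibleRing.funMap_zero]
      rw [← Filter.Germ.coe_zero]
      rfl
    | one =>
      simp only [Language.Term.realize]
      erw [Ring.CompatibleRing.funMap_one]
      rw [← Filter.Germ.coe_one]
      rfl

lemma los_bd {n : ℕ} (φ : Language.ring.BoundedFormula α n) (x : α → ι → K) (y : Fin n → ι → K) :
    (letI := Ring.compatibleRingOfRing (Ult U K); φ.Realize (fun a => (↑(x a) : Ult U K)) (fun k => (↑(y k) : Ult U K))) ↔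
      ∀ᶠ i in U, (letI := Ring.compatibleRingOfRing K; φ.Realize (fun a => x a i) (fun k => y k i)) := by
  letI := Ring.compatibleRingOfRing K
  letI := Ring.compatibleRingOfRing (Ult U K)
  have key : ∀ {n : ℕ} (y : Fin n → ι → K) , Sum.elim (fun a => (↑(x a) : Ult U K)) (fun k => (↑(y k) : Ult U K)) = fun s => ↑(Sum.elim x y s) := by
    intro n y
    funext s; cases s <;> rfl
  have key2 : ∀ {n : ℕ} (y : Fin n → ι → K) i, Sum.elim (fun a => x a i) (fun k => y k i) = fun s => Sum.elim x y s i := by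
    intro n y i
    funext s; cases s <;> rfl
  induction φ with
  | falsum => simpa [Language.BoundedFormula.Realize] using U.neBot.ne
  | equal t₁ t₂ =>
    simp only [Language.BoundedFormula.Realize]
    rw [key]
    have h1 := los_term U t₁ (Sum.elim x y)
    have h2 := los_term U t₂ (Sum.elim x y)
    unfold Tz at h1 h2
    erw [h1, h2, Filter.Germ.coe_eq]
    simp only [key2]
    rfl
  | rel R => exact R.elim
  | imp f g ihf ihg =>
    simp only [Language.BoundedFormula.Realize]
    exact (imp_congr (ihf y) (ihg y)).trans Ultrafilter.eventually_imp.symm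
  | all f ih =>
    simp only [Language.BoundedFormula.Realize]
    have snoc1 : ∀ z : ι → K, (Fin.snoc (fun k => (↑(y k) : Ult U K)) (↑z : Ult U K) : Fin _ → Ult U K) = fun k => (↑((Fin.snoc y z : Fin _ → ι → K) k) : Ult U K) := by
      intro z
      funext k
      refine Fin.lastCases ?_ (fun j => ?_) k
      · simp
      · simp
    have snoc2 : ∀ (z : ι → K) i, (Fin.snoc (fun k => y k i) (z i) : Fin _ → K) = fun k => (Fin.snoc y z : Fin _ → ι → K) k i := by
      intro z i
      funext k
      refine Fin.lastCases ?_ (fun j => ?_) k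
      · simp
      · simp
    constructor
    · intro h
      by_contra hcon
      rw [← Ultrafilter.eventually_not] at hcon
      push Not at hcon
      have hcon' : ∀ᶠ i in U, ∃ a : K, ¬ f.Realize (fun a => x a i) (Fin.snoc (fun k => y k i) a) := hcon
      classical
      let z : ι → K := fun i => if h : ∃ a : K, ¬ f.Realize (fun a => x a i) (Fin.snoc (fun k => y k i) a) then h.choose else 0
      have hz := h (z : Ult U K)
      rw [snoc1] at hz
      replace hz := (ih _).1 hz
      obtain ⟨i, h1, h2⟩ := (hcon'.and hz).exists
      rw [← snoc2] at h2
      have : z i = h1.choose := dif_pos h1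
      rw [this] at h2
      exact h1.choose_spec h2
    · intro h z
      induction z using Filter.Germ.inductionOn with
      | _ z =>
      rw [snoc1]
      refine (ih _).2 ?_
      filter_upwards [h] with i hi
      rw [← snoc2]
      exact hi _

/-- Łoś -/
lemma los (φ : Language.ring.Formula α) (x : α → ι → K) :
    Rz (Ult U K) φ (fun a => (↑(x a) : Ult U K)) ↔ ∀ᶠ i in U, Rz K φ (fun a => x a i) := by
  have := los_bd U φ x (default : Fin 0 → ι → K)
  unfold Rz Language.Formula.Realize
  convert this using 4
  all_goals first | exact Subsingleton.elim _ _ | skip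

lemma los_const (φ : Language.ring.Formula α) (x : α → K) :
    Rz (Ult U K) φ (fun a => (↑(x a) : Ult U K)) ↔ Rz K φ x := by
  have := los U φ (fun a _ => x a)
  rw [Filter.eventually_const] at this
  exact this

end los
end PAC
end Part17

section Part18
open Polynomial FirstOrder
open scoped IntermediateField

namespace PAC
set_option linter.unusedSectionVars false

section conj
variable {M N Γ Γ' : Type*} [Field M] [Field N] [Algebra M N]
  [LinearOrderedCommGroupWithZero Γ] [LinearOrderedCommGroupWithZero Γ']

lemma v_sum_le (u : Valuation N Γ) (m : ℕ) (f : ℕ → N) (h : ∀ i < m, u (f i) ≤ 1) : u (∑ i ∈ Finset.range m, f i) ≤ 1 :=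
  u.map_sum_le fun i hi => h i (Finset.mem_range.1 hi)

lemma conj_poly (v : Valuation M Γ) (x : N) (hx : IsIntegral M x) : ∃ (j m : ℕ) (a b : ℕ → M), (∀ i, v (a i) ≤ 1) ∧ v (b 0) = 1 ∧
    (∀ i, v (b (i + 1)) < 1) ∧
    ∑ i ∈ Finset.range j, algebraMap M N (a i) * x ^ i + x ^ j * ∑ i ∈ Finset.range (m + 1), algebraMap M N (b i) * x ^ i = 0 := by
  classical
  set f := minpoly M x
  have hf : f ≠ 0 := minpoly.ne_zero hx
  obtain ⟨i0, hi0, hmax⟩ := f.support.exists_max_image (fun i => v (f.coeff i)) (by simpa using hf)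
  have hc0 : f.coeff i0 ≠ 0 := mem_support_iff.1 hi0
  have hvc0 : v (f.coeff i0) ≠ 0 := by simpa using hc0
  set a : ℕ → M := fun i => f.coeff i / f.coeff i0 with ha
  have hva : ∀ i, v (a i) ≤ 1 := by
    intro i
    by_cases hi : f.coeff i = 0
    · simp [ha, hi]
    · rw [map_div₀]; exact div_le_one_of_le₀ (hmax i (mem_support_iff.2 hi)) zero_le
  set T := f.support.filter (fun i => v (a i) = 1)
  have hT : T.Nonempty := ⟨i0, Finset.mem_filter.2 ⟨hi0, by simp [ha, hc0]⟩⟩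
  set j := T.max' hT
  have hj := Finset.mem_filter.1 (T.max'_mem hT)
  have hjn : j ≤ f.natDegree := le_natDegree_of_mem_supp _ hj.1
  refine ⟨j, f.natDegree - j, a, fun i => a (j + i), hva, hj.2, fun i => lt_of_le_of_ne (hva _) fun h => ?_, ?_⟩
  · have hm : j + (i + 1) ∈ T := by
      refine Finset.mem_filter.2 ⟨mem_support_iff.2 fun h0 => ?_, h⟩
      simp [ha, h0] at h
    have := T.le_max' _ hm
    change _ ≤ j at this
    omega
  · have h1 : aeval x f = 0 := minpoly.aeval _ _
    rw [aeval_eq_sum_range, show f.natDegree + 1 = j + (f.natDegree - j + 1) by omega, Finset.sum_range_add] at h1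
    have h2 := congrArg (fun z => (algebraMap M N (f.coeff i0))⁻¹ * z) h1
    simp only [mul_zero, mul_add, Finset.mul_sum, Algebra.smul_def] at h2
    rw [← h2, Finset.mul_sum]
    congr 1
    · refine Finset.sum_congr rfl fun i _ => ?_
      simp only [ha, map_div₀]; ring
    · refine Finset.sum_congr rfl fun i _ => ?_
      simp only [ha, map_div₀]; ring

lemma conj_poly_le (u : Valuation N Γ) {x : N} {j m : ℕ} {a b : ℕ → M} (ha : ∀ i, u (algebraMap M N (a i)) ≤ 1)
    (hb : ∀ i, u (algebraMap M N (b i)) ≤ 1)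
    (h : ∑ i ∈ Finset.range j, algebraMap M N (a i) * x ^ i + x ^ j * ∑ i ∈ Finset.range (m + 1), algebraMap M N (b i) * x ^ i = 0) :
    u (∑ i ∈ Finset.range (m + 1), algebraMap M N (b i) * x ^ i) ≤ 1 ∧
      u (x * ∑ i ∈ Finset.range (m + 1), algebraMap M N (b i) * x ^ i) ≤ 1 := by
  set s := ∑ i ∈ Finset.range (m + 1), algebraMap M N (b i) * x ^ i
  by_cases hx : u x ≤ 1
  · have hs : u s ≤ 1 := v_sum_le _ _ _ fun i _ => by
      rw [map_mul, map_pow]; exact mul_le_one' (hb i) (pow_le_one₀ zero_le hx)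
    exact ⟨hs, by rw [map_mul]; exact mul_le_one' hx hs⟩
  · rw [not_le] at hx
    have hx0 : x ≠ 0 := by rintro rfl; simp at hx
    have hy : u x⁻¹ ≤ 1 := by rw [map_inv₀]; exact inv_le_one_of_one_le₀ hx.le
    have h1 : x * s = - ∑ i ∈ Finset.range j, algebraMap M N (a i) * (x⁻¹ ^ (j - 1 - i)) := by
      rcases Nat.eq_zero_or_pos j with rfl | hj
      · simp at h ⊢; right; exact h
      · have h2 : x ^ j * s = - ∑ i ∈ Finset.range j, algebraMap M N (a i) * x ^ i := by linear_combination h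
        have h3 : x ^ (j - 1) * (x * s) = x ^ (j - 1) * (- ∑ i ∈ Finset.range j, algebraMap M N (a i) * (x⁻¹ ^ (j - 1 - i))) := by
          rw [← mul_assoc, ← pow_succ, Nat.sub_add_cancel hj, h2, mul_neg, Finset.mul_sum]
          congr 1
          refine Finset.sum_congr rfl fun i hi => ?_
          have hi' := Finset.mem_range.1 hi
          have : x ^ (j - 1) = x ^ i * x ^ (j - 1 - i) := by rw [← pow_add]; congr 1; omega
          rw [this, inv_pow]
          have := pow_ne_zero (j - 1 - i) hx0
          field_simp
        exact mul_left_cancel₀ (pow_ne_zero _ hx0) h3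
    have h2 : u (x * s) ≤ 1 := by
      rw [h1, Valuation.map_neg]
      exact v_sum_le _ _ _ fun i _ => by
        rw [map_mul, map_pow]; exact mul_le_one' (ha i) (pow_le_one₀ zero_le hy)
    refine ⟨?_, h2⟩
    have : s = x⁻¹ * (x * s) := by field_simp
    rw [this, map_mul]; exact mul_le_one' hy h2

lemma conj_poly_eq (u : Valuation N Γ) {x : N} {m : ℕ} {b : ℕ → M} (hx : u x ≤ 1)
    (hb0 : u (algebraMap M N (b 0)) = 1) (hb : ∀ i, u (algebraMap M N (b (i + 1))) < 1) :
    u (∑ i ∈ Finset.range (m + 1), algebraMap M N (b i) * x ^ i) = 1 := by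
  rw [Finset.sum_range_succ', pow_zero, mul_one, ← hb0]
  apply Valuation.map_add_eq_of_lt_right
  rw [hb0]
  refine u.map_sum_lt one_ne_zero fun i _ => ?_
  rw [map_mul, map_pow]; exact mul_lt_one_of_lt_of_le (hb i) (pow_le_one₀ zero_le hx)

/-- center of a valuation -/
lemma ctr (B : Subring N) (u : Valuation N Γ) (h : ∀ x ∈ B, u x ≤ 1) : ∃ I : Ideal B, I.IsPrime ∧ ∀ x, x ∈ I ↔ u x < 1 := by
  let I : Ideal B := {
    carrier := {x | u (x : N) < 1}
    zero_mem' := by simp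
    add_mem' := fun {a b} ha hb => lt_of_le_of_lt (u.map_add _ _) (max_lt ha hb)
    smul_mem' := fun c x hx => by
      change u ((c * x : B) : N) < 1
      rw [Subring.coe_mul, map_mul, mul_comm]; exact mul_lt_one_of_lt_of_le hx (h _ c.2) }
  have hI : ∀ x, x ∈ I ↔ u (x : N) < 1 := fun x => Iff.rfl
  refine ⟨I, ⟨?_, ?_⟩, hI⟩
  · rw [Ideal.ne_top_iff_one, hI]; simp
  · intro x y hxy
    rw [hI, hI]
    by_contra hcon
    push Not at hcon
    rw [hI, Subring.coe_mul, map_mul, le_antisymm (h _ x.2) hcon.1, le_antisymm (h _ y.2) hcon.2] at hxy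
    simp at hxy

/-- conjugacy of extensions of a valuation -/
lemma conj_val [FiniteDimensional M N] [IsGalois M N] (w : Valuation N Γ) (w' : Valuation N Γ')
    (he : (w.comap (algebraMap M N)).IsEquiv (w'.comap (algebraMap M N))) :
    ∃ g : N ≃ₐ[M] N, ∀ x, w (g x) ≤ 1 ↔ w' x ≤ 1 := by
  classical
  let B : Subring N := {
    carrier := {x | ∀ g : N ≃ₐ[M] N, w (g x) ≤ 1 ∧ w' (g x) ≤ 1}
    mul_mem' := fun {a b} ha hb g => by
      rw [map_mul, map_mul, map_mul]
      exact ⟨mul_le_one' (ha g).1 (hb g).1, mul_le_one' (ha g).2 (hb g).2⟩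
    one_mem' := fun g => by simp
    add_mem' := fun {a b} ha hb g => by
      rw [map_add]
      exact ⟨(w.map_add _ _).trans (max_le (ha g).1 (hb g).1), (w'.map_add _ _).trans (max_le (ha g).2 (hb g).2)⟩
    zero_mem' := fun g => by simp
    neg_mem' := fun {a} ha g => by rw [map_neg, Valuation.map_neg, Valuation.map_neg]; exact ha g }
  have hB : ∀ x ∈ B, ∀ g : N ≃ₐ[M] N, w (g x) ≤ 1 ∧ w' (g x) ≤ 1 := fun x hx => hx
  obtain ⟨P', hP', hP'm⟩ := ctr B w' (fun x hx => (hB x hx 1).2)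
  choose P hP hPm using fun g : N ≃ₐ[M] N => ctr B (w.comap (g : N →+* N)) (fun x hx => (hB x hx g).1)
  have hsub : (P' : Set B) ⊆ ⋃ g ∈ (Finset.univ : Finset (N ≃ₐ[M] N)), P g := by
    intro x hx
    by_contra hcon
    simp only [Set.mem_iUnion, not_exists, SetLike.mem_coe, hPm, Valuation.comap_apply, not_lt] at hcon
    have h1 : ∀ g : N ≃ₐ[M] N, w (g x) = 1 := fun g => le_antisymm (hB x x.2 g).1 (hcon g (Finset.mem_univ _))
    have h2 := Algebra.norm_eq_prod_automorphisms M (x : N)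
    have h3 : w (algebraMap M N (Algebra.norm M (x : N))) = 1 := by
      rw [h2, map_prod]; exact Finset.prod_eq_one fun g _ => h1 g
    have h4 : w' (algebraMap M N (Algebra.norm M (x : N))) < 1 := by
      rw [h2, map_prod, ← Finset.mul_prod_erase _ _ (Finset.mem_univ (1 : N ≃ₐ[M] N))]
      exact mul_lt_one_of_lt_of_le ((hP'm x).1 hx) (Finset.prod_le_one' fun g _ => (hB x x.2 g).2)
    exact absurd h3 ((he.lt_one_iff_lt_one).2 h4).ne
  obtain ⟨g, -, hg⟩ := (Ideal.subset_union_prime 1 1 (fun i _ _ _ => hP i)).1 hsub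
  refine ⟨g, fun x => ?_⟩
  have key : ∀ x, w (g x) ≤ 1 → w' x ≤ 1 := by
    intro x hx
    obtain ⟨j, m, a, b, h1, h2, h3, h4⟩ := conj_poly (w.comap (algebraMap M N)) x (Algebra.IsIntegral.isIntegral x)
    have hb' : ∀ i, w (algebraMap M N (b i)) ≤ 1 := by
      intro i; rcases i with _ | i
      · exact h2.le
      · exact (h3 i).le
    have hw : ∀ c : M, w (algebraMap M N c) ≤ 1 → ∀ σ : N ≃ₐ[M] N, w (σ (algebraMap M N c)) ≤ 1 ∧ w' (σ (algebraMap M N c)) ≤ 1 := by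
      intro c hc σ
      rw [σ.commutes]
      exact ⟨hc, he.le_one_iff_le_one.1 hc⟩
    set s := ∑ i ∈ Finset.range (m + 1), algebraMap M N (b i) * x ^ i with hs
    have hsB : s ∈ B := fun σ =>
      ⟨(conj_poly_le (w.comap (σ : N →+* N)) (fun i => (hw _ (h1 i) σ).1) (fun i => (hw _ (hb' i) σ).1) h4).1,
       (conj_poly_le (w'.comap (σ : N →+* N)) (fun i => (hw _ (h1 i) σ).2) (fun i => (hw _ (hb' i) σ).2) h4).1⟩
    have hxs : w' (x * s) ≤ 1 :=
      (conj_poly_le w' (fun i => (hw _ (h1 i) 1).2) (fun i => (hw _ (hb' i) 1).2) h4).2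
    have hws : w (g s) = 1 := conj_poly_eq (w.comap (g : N →+* N)) hx
      (by rw [Valuation.comap_apply]; exact (congrArg w (g.commutes _)).trans h2)
      (fun i => by rw [Valuation.comap_apply]; exact (congrArg w (g.commutes _)).trans_lt (h3 i))
    have hs1 : w' s = 1 := by
      apply le_antisymm (hB s hsB 1).2
      by_contra hcon
      have : (⟨s, hsB⟩ : B) ∈ P' := (hP'm _).2 (not_le.1 hcon)
      exact absurd hws ((hPm g _).1 (hg this)).ne
    rwa [map_mul, hs1, mul_one] at hxs
  refine ⟨key x, fun hx => ?_⟩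
  by_contra hcon
  rw [not_le] at hcon
  have hx0 : x ≠ 0 := by rintro rfl; simp at hcon
  obtain ⟨n, hn, -, m, hm, hxm⟩ := exists_pow_eq (K := M) (w.comap (g : N →+* N)) (minpoly.ne_zero (Algebra.IsIntegral.isIntegral x))
    hx0 (minpoly.aeval M x)
  have hgm : g (algebraMap M N m) = algebraMap M N m := g.commutes m
  change w (g x) ^ n = w (g (algebraMap M N m)) at hxm
  rw [hgm] at hxm
  have h1 : 1 < w (algebraMap M N m) := by rw [← hxm]; exact one_lt_pow₀ hcon hn.ne'
  have h2 : 1 < w' (algebraMap M N m) := by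
    by_contra h; exact absurd (he.le_one_iff_le_one.2 (not_lt.1 h)) (not_le.2 h1)
  have h3 : w' (algebraMap M N m / x ^ n) ≤ 1 := key _ (by
    rw [map_div₀, map_pow, hgm, map_div₀, map_pow, hxm, div_self]
    exact (zero_lt_one.trans h1).ne')
  rw [map_div₀, map_pow] at h3
  have h4 : w' (algebraMap M N m) ≤ w' x ^ n := by
    have : w' x ^ n ≠ 0 := pow_ne_zero _ (by simpa using hx0)
    calc _ = w' (algebraMap M N m) / w' x ^ n * w' x ^ n := by rw [div_mul_cancel₀ _ this]
      _ ≤ 1 * w' x ^ n := mul_le_mul_left h3 _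
      _ = _ := one_mul _
  exact absurd (h4.trans (pow_le_one₀ zero_le hx)) (not_le.2 h2)

end conj
end PAC
end Part18

section Part19
open Polynomial FirstOrder
open scoped IntermediateField

namespace PAC
set_option linter.unusedSectionVars false

section fixD
variable {M N B Ω Γ : Type*} [Field M] [Field N] [Field B] [Field Ω] [Algebra M N] [Algebra M B] [Algebra B Ω] [Algebra M Ω]
  [IsScalarTower M B Ω] [IsAlgClosed Ω] [Algebra.IsAlgebraic B Ω] [CharZero B] [Normal M N] [LinearOrderedCommGroupWithZero Γ]

lemma fix_restrict (τ : N →ₐ[M] Ω) (s : Ω ≃ₐ[B] Ω) : ∃ d : N ≃ₐ[M] N, ∀ x, τ (d x) = s (τ x) := by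
  letI := τ.toRingHom.toAlgebra
  haveI : IsScalarTower M N Ω := IsScalarTower.of_algebraMap_eq fun x => (τ.commutes x).symm
  exact ⟨AlgEquiv.restrictNormal (s.restrictScalars M) N, fun x => AlgEquiv.restrictNormal_commutes (s.restrictScalars M) N x⟩

lemma fix_of_D (W : Valuation Ω Γ) (hH : Hens (W.comap (algebraMap B Ω))) (τ : N →ₐ[M] Ω) (b : N)
    (hb : ∀ d : N ≃ₐ[M] N, (∀ x, W (τ (d x)) = W (τ x)) → d b = b) : ∃ f : B, algebraMap B Ω f = τ b := by
  refine mem_F_of_fixed B (F := B) (τ b) fun s => ?_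
  obtain ⟨d, hd⟩ := fix_restrict τ s
  have := hb d (fun x => by rw [hd]; exact hH.toInv s _)
  rw [← hd, this]
end fixD

section H
variable {M F L Γ Γ' : Type*} [Field M] [Field F] [Field L] [Algebra M F] [Algebra M L] [CharZero M]
  [LinearOrderedCommGroupWithZero Γ] [LinearOrderedCommGroupWithZero Γ']

theorem lemmaH (wF : Valuation F Γ) (wL : Valuation L Γ') (hF : Hens wF) (hL : Hens wL)
    (he : (wF.comap (algebraMap M F)).IsEquiv (wL.comap (algebraMap M L)))
    (imm : ∀ x : F, IsIntegral M x → x ≠ 0 → ∀ k : ℕ, k ≠ 0 → ∃ m : M, wF (x - algebraMap M F m) < wF x * wF (k : F))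
    (y : F) (hy : IsIntegral M y) : ∃ y' : L, aeval y' (minpoly M y) = 0 := by
  classical
  haveI : CharZero F := charZero_of_injective_algebraMap (algebraMap M F).injective
  haveI : CharZero L := charZero_of_injective_algebraMap (algebraMap M L).injective
  let Ω := AlgebraicClosure F
  let Ω' := AlgebraicClosure L
  obtain ⟨V, hV⟩ := exists_extension (Ω := Ω) wF
  obtain ⟨V', hV'⟩ := exists_extension (Ω := Ω') wL
  let W := V.valuation
  let W' := V'.valuation
  have hHF : Hens (W.comap (algebraMap F Ω)) := hF.of_equiv hV.symm
  have hHL : Hens (W'.comap (algebraMap L Ω')) := hL.of_equiv hV'.symm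
  set P := minpoly M y with hP
  let N := P.SplittingField
  haveI : IsGalois M N := IsGalois.of_separable_splitting_field (p := P) (minpoly.irreducible hy).separable
  let ι : N →ₐ[M] Ω := IsAlgClosed.lift
  let τ0 : N →ₐ[M] Ω' := IsAlgClosed.lift
  have hy1 : aeval (algebraMap F Ω y) P = 0 := by rw [aeval_algebraMap_apply, minpoly.aeval, map_zero]
  obtain ⟨yN, hyN⟩ : ∃ yN : N, ι yN = algebraMap F Ω y := by
    have hs := SplittingField.splits P
    have h1 := hs.roots_map (ι : N →+* Ω)
    have h2 : algebraMap F Ω y ∈ ((P.map (algebraMap M N)).map (ι : N →+* Ω)).roots := by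
      rw [mem_roots (((minpoly.monic hy).map _).map _).ne_zero, Polynomial.map_map, ι.comp_algebraMap, IsRoot.def, eval_map_algebraMap, hy1]
    rw [h1] at h2
    obtain ⟨z, -, hz⟩ := Multiset.mem_map.1 h2
    exact ⟨z, hz⟩
  have hιM : ∀ m : M, ι (algebraMap M N m) = algebraMap F Ω (algebraMap M F m) := fun m => by
    rw [ι.commutes]; exact IsScalarTower.algebraMap_apply M F Ω m
  have hτM : ∀ m : M, τ0 (algebraMap M N m) = algebraMap L Ω' (algebraMap M L m) := fun m => by
    rw [τ0.commutes]; exact IsScalarTower.algebraMap_apply M L Ω' m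
  obtain ⟨g, hg⟩ := conj_val (M := M) (W.comap (ι : N →+* Ω)) (W'.comap (τ0 : N →+* Ω')) (by
    intro a b
    simp only [Valuation.comap_apply, RingHom.coe_coe, hιM, hτM]
    exact (hV _ _).trans ((he a b).trans (hV' _ _).symm))
  let τ : N →ₐ[M] Ω' := τ0.comp (g.symm : N →ₐ[M] N)
  have hτ : (W.comap (ι : N →+* Ω)).IsEquiv (W'.comap (τ : N →+* Ω')) := by
    apply Valuation.isEquiv_of_val_le_one
    intro x
    have := hg (g.symm x)
    rw [g.apply_symm_apply] at this
    exact this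
  -- the decomposition group
  let D : Subgroup (N ≃ₐ[M] N) := {
    carrier := {d | ∀ x, W (ι (d x)) = W (ι x)}
    mul_mem' := fun {a b} ha hb x => (ha (b x)).trans (hb x)
    one_mem' := fun x => rfl
    inv_mem' := fun {a} ha x => by
      have := ha (a⁻¹ x)
      rw [← AlgEquiv.mul_apply, mul_inv_cancel, AlgEquiv.one_apply] at this
      exact this.symm }
  have hD : ∀ d ∈ D, ∀ x, W (ι (d x)) = W (ι x) := fun d hd => hd
  set k := Fintype.card D
  have hk : k ≠ 0 := Fintype.card_ne_zero
  have hkN : (k : N) ≠ 0 := by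
    haveI : CharZero N := charZero_of_injective_algebraMap (algebraMap M N).injective
    exact_mod_cast hk
  let av : N → N := fun x => ∑ d : D, (d : N ≃ₐ[M] N) x
  have hav : ∀ x, ∀ d ∈ D, d (av x) = av x := by
    intro x d hd
    simp only [av]
    rw [map_sum]
    exact Fintype.sum_equiv (Equiv.mulLeft (⟨d, hd⟩ : D)) _ _ fun d' => rfl
  set b := av yN / k with hb
  have hbD : ∀ d ∈ D, d b = b := fun d hd => by rw [hb, map_div₀, hav _ d hd, map_natCast]
  obtain ⟨f, hf⟩ := fix_of_D W hHF ι b (fun d hd => hbD d hd)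
  have hιk : ∀ n : ℕ, ι (n : N) = algebraMap F Ω (n : F) := fun n => by rw [map_natCast, map_natCast]
  have hyb : y = f := by
    by_contra hne
    have hx0 : y - f ≠ 0 := sub_ne_zero.2 hne
    have hxint : IsIntegral M (y - f) := by
      refine hy.sub ?_
      have h1 : IsIntegral M (algebraMap F Ω f) := by
        rw [hf]; exact (Algebra.IsIntegral.isIntegral b).map ι
      exact (isIntegral_algebraMap_iff (algebraMap F Ω).injective).1 h1
    obtain ⟨m, hm⟩ := imm _ hxint hx0 k hk
    set x := y - f with hx
    rw [← map_mul] at hm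
    replace hm : W (algebraMap F Ω (x - algebraMap M F m)) < W (algebraMap F Ω (x * k)) := hV.lt_iff_lt.2 hm
    have hxN : algebraMap F Ω x = ι (yN - b) := by rw [map_sub, map_sub, hyN, hf]
    have hk1 : W (ι (k : N)) ≤ 1 := by rw [map_natCast]; exact v_nat_le _ _
    have e1 : algebraMap F Ω (x - algebraMap M F m) = ι (yN - b - algebraMap M N m) := by
      rw [map_sub, hxN, map_sub ι (yN - b), hιM]
    rw [map_mul, map_mul, ← hιk, e1, hxN] at hm
    set X := yN - b
    have hsum : ∑ d : D, (d : N ≃ₐ[M] N) (X - algebraMap M N m) = - ((k : N) * algebraMap M N m) := by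
      have h1 : ∀ d : D, (d : N ≃ₐ[M] N) (X - algebraMap M N m) = (d : N ≃ₐ[M] N) yN - b - algebraMap M N m := fun d => by
        rw [map_sub, AlgEquiv.commutes, map_sub, hbD d d.2]
      simp only [h1, Finset.sum_sub_distrib, Finset.sum_const, Finset.card_univ, nsmul_eq_mul]
      change av yN - k * b - k * _ = _
      rw [hb, mul_div_cancel₀ _ hkN]; ring
    have h2 : W (ι (k : N)) * W (ι (algebraMap M N m)) ≤ W (ι (X - algebraMap M N m)) := by
      rw [← map_mul, ← map_mul, ← Valuation.map_neg, ← map_neg, ← hsum, map_sum]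
      exact W.map_sum_le fun d _ => (hD d d.2 _).le
    have h3 : W (ι (X - algebraMap M N m)) < W (ι X) := hm.trans_le (mul_le_of_le_one_right' hk1)
    have h4 : W (ι (algebraMap M N m)) = W (ι X) := by
      have : ι (algebraMap M N m) = ι X - ι (X - algebraMap M N m) := by rw [← map_sub]; congr 1; ring
      rw [this]; exact Valuation.map_sub_eq_of_lt_left _ h3
    rw [h4, mul_comm] at h2
    exact absurd (h2.trans_lt hm) (lt_irrefl _)
  have hyNb : yN = b := (ι : N →+* Ω).injective (show ι yN = ι b by rw [hyN, hyb, hf])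
  obtain ⟨y', hy'⟩ := fix_of_D W' hHL τ b (fun d hd => hbD d fun x => by
    have := hd x
    exact (hτ.val_eq (r := d x) (s := x)).2 this)
  refine ⟨y', (algebraMap L Ω').injective ?_⟩
  rw [map_zero, ← aeval_algebraMap_apply, hy', ← hyNb, aeval_algHom_apply]
  have : aeval yN P = 0 := (ι : N →+* Ω).injective (show ι _ = ι 0 by rw [← aeval_algHom_apply, hyN, hy1, map_zero])
  rw [this, map_zero]
end H
end PAC
end Part19

section Part20
open Polynomial FirstOrder
open scoped IntermediateField

namespace PAC
set_option linter.unusedSectionVars false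

/-- a compatible pair -/
structure CV {K F Γ : Type*} [Field K] [Field F] [Algebra K F] [LinearOrderedCommGroupWithZero Γ] (w : Valuation F Γ) (π : K) (p e : ℕ) : Prop where
  pK : PA (w.comap (algebraMap K F)) π p e
  pF : PA w (algebraMap K F π) p e
  res : ∀ x, w x ≤ 1 → ∃ a : K, w (x - algebraMap K F a) < 1

section CV
variable {K M F Γ : Type*} [Field K] [Field M] [Field F] [Algebra K F] [LinearOrderedCommGroupWithZero Γ] {w : Valuation F Γ} {π : K} {p e : ℕ}
  [Algebra K M] [Algebra M F] [IsScalarTower K M F] [CharZero K]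

lemma CV.pur (h : CV w π p e) {x : F} (hx : x ≠ 0) {n : ℕ} (hn : 0 < n) {m : K} (hm : m ≠ 0) (hxm : w x ^ n = w (algebraMap K F m)) :
    ∃ y : K, y ≠ 0 ∧ w x = w (algebraMap K F y) := by
  obtain ⟨y, hy, i, hi, hmy⟩ := h.pK.zgrp n hn m hm
  simp only [Valuation.comap_apply] at hmy
  have hy0 : w (algebraMap K F y) ≠ 0 := by simpa using hy
  refine ⟨y, hy, ?_⟩
  have h1 : w (x / algebraMap K F y) ^ n = w (algebraMap K F π) ^ i := by
    rw [map_div₀, div_pow, hxm, hmy, mul_div_cancel_right₀ _ (pow_ne_zero _ hy0)]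
  have hπ1 := h.pF.lt_one
  have hπ0 : w (algebraMap K F π) ≠ 0 := by simpa using h.pF.π0
  have hi0 : i = 0 := by
    by_contra hi0
    have h2 : w (x / algebraMap K F y) < 1 := by
      by_contra h3
      have := one_le_pow₀ (not_lt.1 h3) (n := n)
      rw [h1] at this
      exact absurd (pow_lt_one₀ zero_le hπ1 hi0) (not_lt.2 this)
    have h3 := pow_le_pow_left₀ zero_le ((h.pF.unif _).1 h2) n
    rw [h1] at h3
    exact absurd (pow_lt_pow_right_of_lt_one₀ (zero_lt_iff.2 hπ0) hπ1 hi) (not_lt.2 h3)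
  rw [hi0, pow_zero, pow_eq_one_iff_of_nonneg zero_le hn.ne', map_div₀] at h1
  exact (div_eq_one_iff_eq hy0).1 h1

lemma CV.near (h : CV w π p e) {x : F} (hx : x ≠ 0) {m : M} (hm : w x = w (algebraMap M F m)) : ∃ m : M, w (x - algebraMap M F m) < w x := by
  have hx0 : w x ≠ 0 := by simpa using hx
  have hm0 : algebraMap M F m ≠ 0 := by intro h0; rw [h0, map_zero] at hm; exact hx0 hm
  obtain ⟨a, ha⟩ := h.res (x / algebraMap M F m) (by rw [map_div₀, hm, div_self (hm ▸ hx0)])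
  refine ⟨m * algebraMap K M a, ?_⟩
  have : x - algebraMap M F (m * algebraMap K M a) = algebraMap M F m * (x / algebraMap M F m - algebraMap K F a) := by
    rw [map_mul, ← IsScalarTower.algebraMap_apply K M F]; field_simp
  rw [this, map_mul, hm]
  have hm' : 0 < w (algebraMap M F m) := zero_lt_iff.2 (hm ▸ hx0)
  exact mul_lt_of_lt_one_right hm' ha

lemma CV.immN (h : CV w π p e) (hM : ∀ x : F, IsIntegral M x → x ≠ 0 → ∃ m : M, w x = w (algebraMap M F m)) (N : ℕ) {x : F} (hx : IsIntegral M x) :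
    ∃ m : M, w (x - algebraMap M F m) ≤ w x * w (algebraMap K F π) ^ N := by
  induction N with
  | zero => exact ⟨0, by simp⟩
  | succ N ih =>
    obtain ⟨m, hm⟩ := ih
    by_cases h0 : x - algebraMap M F m = 0
    · exact ⟨m, by rw [h0, map_zero]; exact zero_le⟩
    obtain ⟨m1, hm1⟩ := hM _ (hx.sub isIntegral_algebraMap) h0
    obtain ⟨m', hm'⟩ := h.near (M := M) h0 hm1
    refine ⟨m + m', ?_⟩
    set y := x - algebraMap M F m
    have hy0 : w y ≠ 0 := by simpa using h0
    have e1 : x - algebraMap M F (m + m') = y * ((y - algebraMap M F m') / y) := by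
      rw [mul_div_cancel₀ _ h0, map_add]; ring
    have h1 : w ((y - algebraMap M F m') / y) ≤ w (algebraMap K F π) := (h.pF.unif _).1 (by
      rw [map_div₀]; exact (div_lt_one₀ (zero_lt_iff.2 hy0)).2 hm')
    rw [e1, map_mul, pow_succ, ← mul_assoc]
    exact mul_le_mul' hm h1

lemma CV.charZero (h : CV w π p e) : CharZero F := charZero_of_injective_algebraMap (algebraMap K F).injective

lemma CV.imm (h : CV w π p e) (hM : ∀ x : F, IsIntegral M x → x ≠ 0 → ∃ m : M, w x = w (algebraMap M F m)) (x : F) (hx : IsIntegral M x) (hx0 : x ≠ 0)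
    (k : ℕ) (hk : k ≠ 0) : ∃ m : M, w (x - algebraMap M F m) < w x * w (k : F) := by
  haveI := h.charZero
  obtain ⟨N, hN⟩ := h.pF.v_nat hk
  obtain ⟨m, hm⟩ := h.immN (M := M) hM (N + 1) hx
  refine ⟨m, hm.trans_lt ?_⟩
  have hπ0 : w (algebraMap K F π) ≠ 0 := by simpa using h.pF.π0
  have hx0' : 0 < w x := zero_lt_iff.2 (by simpa using hx0)
  rw [hN]
  exact (mul_lt_mul_iff_right₀ hx0').2 (pow_lt_pow_right_of_lt_one₀ (zero_lt_iff.2 hπ0) h.pF.lt_one (Nat.lt_succ_self _))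

lemma CV.val_alg (h : CV w π p e) (x : F) (hx : IsIntegral K x) (hx0 : x ≠ 0) : ∃ m : K, w x = w (algebraMap K F m) := by
  obtain ⟨n, hn, -, m, hm, hxm⟩ := exists_pow_eq (K := K) w (minpoly.ne_zero hx) hx0 (minpoly.aeval K x)
  obtain ⟨y, -, hy⟩ := h.pur hx0 hn hm hxm
  exact ⟨y, hy⟩

/-- `K` is relatively algebraically closed in `F` -/
lemma CV.base (h : CV w π p e) (y : F) (hy : IsIntegral K y) : ∃ a : K, algebraMap K F a = y := by
  obtain ⟨a, ha⟩ := lemmaH (M := K) w (w.comap (algebraMap K F)) h.pF.hens h.pK.hens Valuation.IsEquiv.refl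
    (fun x hx hx0 k hk => h.imm h.val_alg x hx hx0 k hk) y hy
  have hirr := minpoly.irreducible hy
  have h1 : (minpoly K y).IsRoot a := ha
  have h2 := (degree_eq_one_of_irreducible_of_root hirr h1)
  exact minpoly.mem_range_of_degree_eq_one K y h2

lemma CV.approx (h : CV w π p e) (N : ℕ) {x : F} (hx : w x ≤ 1) : ∃ a : K, w (x - algebraMap K F a) ≤ w (algebraMap K F π) ^ N := by
  induction N with
  | zero => exact ⟨0, by simpa using hx⟩
  | succ N ih =>
    obtain ⟨a, ha⟩ := ih
    have hπ := h.pF.π0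
    have hπ0 : w (algebraMap K F π) ^ N ≠ 0 := pow_ne_zero _ (by simpa using hπ)
    obtain ⟨b, hb⟩ := h.res ((x - algebraMap K F a) / algebraMap K F π ^ N) (by
      rw [map_div₀, map_pow]; exact div_le_one_of_le₀ ha zero_le)
    refine ⟨a + π ^ N * b, ?_⟩
    have e1 : x - algebraMap K F (a + π ^ N * b) = algebraMap K F π ^ N * ((x - algebraMap K F a) / algebraMap K F π ^ N - algebraMap K F b) := by
      rw [mul_sub, mul_div_cancel₀ _ (pow_ne_zero _ hπ), map_add, map_mul, map_pow]; ring
    rw [e1, map_mul, map_pow, pow_succ]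
    exact mul_le_mul_right ((h.pF.unif _).1 hb) _

lemma CV.npow (h : CV w π p e) {x : F} (hx : x ≠ 0) {n : ℕ} (hn : 0 < n) : ∃ c : K, c ≠ 0 ∧ ∃ y : F, y ≠ 0 ∧ x = algebraMap K F c * y ^ n := by
  haveI := h.charZero
  have hπ := h.pF.π0
  have hx0 : w x ≠ 0 := by simpa using hx
  obtain ⟨y, hy, i, hi, hxy⟩ := h.pF.zgrp n hn x hx
  have hq : algebraMap K F π ^ i * y ^ n ≠ 0 := mul_ne_zero (pow_ne_zero _ hπ) (pow_ne_zero _ hy)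
  set u := x / (algebraMap K F π ^ i * y ^ n) with hu
  have hu1 : w u = 1 := by rw [hu, map_div₀, map_mul, map_pow, map_pow, ← hxy, div_self hx0]
  obtain ⟨N, hN, hsm⟩ := h.pF.small hn.ne'
  obtain ⟨a, ha⟩ := h.approx N hu1.le
  have hlt : w (u - algebraMap K F a) < w (n : F) ^ n := ha.trans_lt hsm
  have ha1 : w (algebraMap K F a) = 1 := by
    have h1 : w (u - algebraMap K F a) < w u := by
      rw [hu1]; exact hlt.trans_le (pow_le_one₀ zero_le (v_nat_le _ _))
    have : algebraMap K F a = u - (u - algebraMap K F a) := by ring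
    rw [this, Valuation.map_sub_eq_of_lt_left _ h1, hu1]
  have ha0 : algebraMap K F a ≠ 0 := by intro h0; rw [h0, map_zero] at ha1; exact zero_ne_one ha1
  obtain ⟨z, hz⟩ := h.pF.hens.power hn.ne' (u / algebraMap K F a - 1) (by
    have : u / algebraMap K F a - 1 = (u - algebraMap K F a) / algebraMap K F a := by field_simp
    rw [this, map_div₀, ha1, div_one]; exact hlt)
  have hz' : z ^ n = u / algebraMap K F a := by rw [hz]; ring
  have hu0 : u ≠ 0 := div_ne_zero hx hq
  have hz0 : z ≠ 0 := by
    rintro rfl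
    rw [zero_pow hn.ne'] at hz'
    exact div_ne_zero hu0 ha0 hz'.symm
  refine ⟨a * π ^ i, mul_ne_zero (fun h0 => ha0 (by rw [h0, map_zero])) (pow_ne_zero _ h.pK.π0), z * y, mul_ne_zero hz0 hy, ?_⟩
  rw [map_mul, map_pow, mul_pow, hz', hu]
  field_simp

/-- relatively algebraically closed subfields -/
lemma CV.sub (h : CV w π p e) (hM : ∀ x : F, IsIntegral M x → ∃ m : M, algebraMap M F m = x) :
    CV w (algebraMap K M π) p e := by
  have hMF : ∀ a : K, algebraMap M F (algebraMap K M a) = algebraMap K F a := fun a => (IsScalarTower.algebraMap_apply K M F a).symm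
  have hinj := (algebraMap M F).injective
  refine ⟨⟨⟨?_, ?_, ?_, ?_⟩, h.pF.prime, h.pF.epos, ?_, ?_⟩, ?_, ?_⟩
  · intro h0; exact h.pK.π0 ((algebraMap K M).injective (by rw [h0, map_zero]))
  · intro x
    simp only [Valuation.comap_apply, hMF]
    exact h.pF.unif _
  · obtain ⟨R, hR⟩ := h.pK.fin
    classical
    refine ⟨R.image (algebraMap K M), fun x hx => ?_⟩
    obtain ⟨a, ha⟩ := h.res _ hx
    have ha1 : w (algebraMap K F a) ≤ 1 := by
      have : algebraMap K F a = algebraMap M F x - (algebraMap M F x - algebraMap K F a) := by ring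
      rw [this]; exact (w.map_sub _ _).trans (max_le hx ha.le)
    obtain ⟨r, hr, har⟩ := hR a ha1
    refine ⟨algebraMap K M r, Finset.mem_image_of_mem _ hr, ?_⟩
    have : algebraMap M F (x - algebraMap K M r) = (algebraMap M F x - algebraMap K F a) + algebraMap K F (a - r) := by
      rw [map_sub, map_sub, hMF]; ring
    rw [Valuation.comap_apply, this]
    exact (w.map_add _ _).trans_lt (max_lt ha har)
  · intro g hg hirr h0 i
    have hcl : Irreducible (g.map (algebraMap M F)) := by
      rw [(hg.map _).irreducible_iff_natDegree]
      refine ⟨fun h1 => ?_, fun a b ha hb hab => ?_⟩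
      · have := natDegree_map_eq_of_injective hinj g
        rw [h1, natDegree_one] at this
        exact absurd hirr.natDegree_pos (by omega)
      · have lift : ∀ q : Polynomial F, q.Monic → q ∣ g.map (algebraMap M F) → ∃ q' : Polynomial M, q'.Monic ∧ q'.map (algebraMap M F) = q := by
          intro q hq hd
          have h1 : ∀ i, ∃ m : M, algebraMap M F m = q.coeff i := fun i => hM _
            (by
              obtain ⟨q', hq'⟩ := (lifts_iff_coeff_lifts _).1 (integralClosure.mem_lifts_of_monic_of_dvd_map F hg hq hd) i
              rw [← hq']; exact q'.2)
          have h2 : q ∈ Polynomial.lifts (algebraMap M F) := (lifts_iff_coeff_lifts _).2 fun i => by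
            obtain ⟨m, hm⟩ := h1 i; exact ⟨m, hm⟩
          obtain ⟨q', e1, -, e2⟩ := lifts_and_natDegree_eq_and_monic h2 hq
          exact ⟨q', e2, e1⟩
        obtain ⟨a', ha', ea⟩ := lift a ha ⟨b, hab.symm⟩
        obtain ⟨b', hb', eb⟩ := lift b hb ⟨a, by rw [← hab, mul_comm]⟩
        have h3 : a' * b' = g := Polynomial.map_injective _ hinj (by rw [Polynomial.map_mul, ea, eb, hab])
        have h4 := (hg.irreducible_iff_natDegree.1 hirr).2 a' b' ha' hb' h3
        rwa [← ea, ← eb, natDegree_map_eq_of_injective hinj, natDegree_map_eq_of_injective hinj]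
    have := h.pF.hens _ (hg.map _) hcl (by rw [coeff_map]; exact h0) i
    rwa [coeff_map] at this
  · have := h.pF.ram
    simp only [Valuation.comap_apply, hMF, map_natCast]
    exact this
  · intro n hn x hx
    obtain ⟨c, hc, y, hy, hxy⟩ := h.npow (x := algebraMap M F x) (by simpa using hx) hn
    obtain ⟨m, hm⟩ := hM y (by
      refine IsIntegral.of_pow hn ?_
      have : y ^ n = algebraMap M F (x / algebraMap K M c) := by
        have hc' : algebraMap K F c ≠ 0 := by simpa using hc
        rw [map_div₀, hMF, hxy]; field_simp
      rw [this]; exact isIntegral_algebraMap)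
    obtain ⟨z, hz, i, hi, hcz⟩ := h.pK.zgrp n hn c hc
    simp only [Valuation.comap_apply] at hcz
    have hm0 : m ≠ 0 := by rintro rfl; rw [map_zero] at hm; exact hy hm.symm
    refine ⟨algebraMap K M z * m, mul_ne_zero (by simpa using hz) hm0, i, hi, ?_⟩
    simp only [Valuation.comap_apply, hMF, map_mul]
    rw [hxy, map_mul, hcz, map_pow, hm, mul_pow, mul_assoc]
  · rw [hMF]; exact h.pF
  · intro x hx
    obtain ⟨a, ha⟩ := h.res x hx
    exact ⟨algebraMap K M a, by rwa [hMF]⟩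

end CV
end PAC
end Part20

section Part21
open Polynomial FirstOrder
open scoped IntermediateField

namespace PAC
set_option linter.unusedSectionVars false

section caseB
variable {K Ω Γ : Type*} [Field K] [Field Ω] [Algebra K Ω] [LinearOrderedCommGroupWithZero Γ] [CharZero K] [IsAlgClosed Ω]
  {W : Valuation Ω Γ} {z : Ω}

lemma map_multiset_sum_le (W : Valuation Ω Γ) (s : Multiset Ω) (c : Γ) (h : ∀ x ∈ s, W x ≤ c) : W s.sum ≤ c := by
  induction s using Multiset.induction_on with
  | empty => simp
  | cons a s ih =>
    rw [Multiset.sum_cons]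
    exact (W.map_add _ _).trans (max_le (h a (Multiset.mem_cons_self _ _)) (ih fun x hx => h x (Multiset.mem_cons_of_mem hx)))

lemma caseB_theta (hH : Hens (W.comap (algebraMap K Ω)))
    (hz : ∀ a : K, ∀ k : ℕ, k ≠ 0 → ∃ m : K, W (z - algebraMap K Ω m) < W (z - algebraMap K Ω a) * W (k : Ω))
    {θ : Ω} (hθ : IsIntegral K θ) : ∃ a : K, W (z - algebraMap K Ω a) < W (z - θ) := by
  by_contra! hcon
  set g := minpoly K θ with hg
  have hgm : g.Monic := minpoly.monic hθ
  have hd : g.natDegree ≠ 0 := (minpoly.natDegree_pos hθ).ne'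
  have hs := IsAlgClosed.splits (g.map (algebraMap K Ω))
  set s := (g.map (algebraMap K Ω)).roots with hs'
  have hcard : s.card = g.natDegree := by
    rw [hs', ← hs.natDegree_eq_card_roots, natDegree_map]
  set b : K := -g.nextCoeff / g.natDegree with hb
  have hdK : (g.natDegree : K) ≠ 0 := by exact_mod_cast hd
  have hsum : s.sum = algebraMap K Ω b * g.natDegree := by
    have h1 := hs.nextCoeff_eq_neg_sum_roots_of_monic (hgm.map _)
    rw [nextCoeff_map (algebraMap K Ω).injective] at h1
    have h2 : s.sum = - algebraMap K Ω g.nextCoeff := by rw [h1, neg_neg]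
    rw [h2, ← map_natCast (algebraMap K Ω), ← map_mul, hb, div_mul_cancel₀ _ hdK, map_neg]
  have key : ∀ m : K, W (algebraMap K Ω b - algebraMap K Ω m) * W (g.natDegree : Ω) ≤ W (z - algebraMap K Ω m) := by
    intro m
    have h1 : (algebraMap K Ω b - algebraMap K Ω m) * (g.natDegree : Ω) = (s.map (fun x => x - algebraMap K Ω m)).sum := by
      rw [Multiset.sum_map_sub, Multiset.map_id', Multiset.map_const', Multiset.sum_replicate, hsum, hcard, nsmul_eq_mul]; ring
    rw [← map_mul, h1]
    apply map_multiset_sum_le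
    intro x hx
    obtain ⟨θ', hθ', rfl⟩ := Multiset.mem_map.1 hx
    rw [hs', mem_roots (hgm.map _).ne_zero, IsRoot.def, eval_map_algebraMap] at hθ'
    have hm : minpoly K θ = minpoly K θ' := (minpoly.eq_of_irreducible_of_monic (minpoly.irreducible hθ) hθ' hgm)
    have h2 : W (θ - algebraMap K Ω m) = W (θ' - algebraMap K Ω m) := hH.conj (hθ.sub isIntegral_algebraMap) (by
      rw [minpoly.sub_algebraMap, minpoly.sub_algebraMap, hm])
    rw [← h2]
    have : θ - algebraMap K Ω m = (z - algebraMap K Ω m) - (z - θ) := by ring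
    rw [this]
    exact (W.map_sub _ _).trans (max_le le_rfl (hcon m))
  obtain ⟨m, hm⟩ := hz b _ hd
  have hlt : W (z - algebraMap K Ω m) < W (z - algebraMap K Ω b) := hm.trans_le (mul_le_of_le_one_right' (v_nat_le _ _))
  have : algebraMap K Ω b - algebraMap K Ω m = (z - algebraMap K Ω m) - (z - algebraMap K Ω b) := by ring
  have h3 := key m
  rw [this, Valuation.map_sub_swap, Valuation.map_sub_eq_of_lt_left _ hlt] at h3
  exact absurd hm (not_lt.2 h3)

lemma ev_fin {ι : Type*} (S : Finset ι) (Q : ι → K → Prop)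
    (h : ∀ i ∈ S, ∃ a0 : K, ∀ a : K, W (z - algebraMap K Ω a) ≤ W (z - algebraMap K Ω a0) → Q i a) :
    ∃ a0 : K, ∀ a : K, W (z - algebraMap K Ω a) ≤ W (z - algebraMap K Ω a0) → ∀ i ∈ S, Q i a := by
  classical
  induction S using Finset.induction_on with
  | empty => exact ⟨0, by simp⟩
  | insert i S hi ih =>
    obtain ⟨a1, h1⟩ := ih fun j hj => h j (Finset.mem_insert_of_mem hj)
    obtain ⟨a2, h2⟩ := h i (Finset.mem_insert_self _ _)
    rcases le_total (W (z - algebraMap K Ω a1)) (W (z - algebraMap K Ω a2)) with h3 | h3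
    · refine ⟨a1, fun a ha j hj => ?_⟩
      rcases Finset.mem_insert.1 hj with rfl | hj
      · exact h2 a (ha.trans h3)
      · exact h1 a ha j hj
    · refine ⟨a2, fun a ha j hj => ?_⟩
      rcases Finset.mem_insert.1 hj with rfl | hj
      · exact h2 a ha
      · exact h1 a (ha.trans h3) j hj

lemma caseB (hH : Hens (W.comap (algebraMap K Ω)))
    (hz : ∀ a : K, ∀ k : ℕ, k ≠ 0 → ∃ m : K, W (z - algebraMap K Ω m) < W (z - algebraMap K Ω a) * W (k : Ω))
    (P : Finset K[X]) : ∃ a : K, ∀ h ∈ P, W (aeval z h) = W (algebraMap K Ω (h.eval a)) := by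
  classical
  obtain ⟨a, ha⟩ := ev_fin (W := W) (z := z) P (fun h a => W (aeval z h) = W (algebraMap K Ω (h.eval a))) (by
    intro h _
    by_cases h0 : h = 0
    · exact ⟨0, by simp [h0]⟩
    have hs := IsAlgClosed.splits (h.map (algebraMap K Ω))
    obtain ⟨a0, ha0⟩ := ev_fin (W := W) (z := z) (h.map (algebraMap K Ω)).roots.toFinset
        (fun θ a => W (z - θ) = W (algebraMap K Ω a - θ)) (by
      intro θ hθ
      rw [Multiset.mem_toFinset, mem_roots ((Polynomial.map_ne_zero_iff (algebraMap K Ω).injective).2 h0), IsRoot.def, eval_map_algebraMap] at hθ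
      obtain ⟨a0, ha0⟩ := caseB_theta hH hz (θ := θ) (isAlgebraic_iff_isIntegral.1 ⟨h, h0, hθ⟩)
      refine ⟨a0, fun a ha => ?_⟩
      have : algebraMap K Ω a - θ = (z - θ) - (z - algebraMap K Ω a) := by ring
      rw [this, Valuation.map_sub_eq_of_lt_left _ (ha.trans_lt ha0)])
    refine ⟨a0, fun a ha => ?_⟩
    have ev : ∀ x : Ω, W (eval x (h.map (algebraMap K Ω))) =
        W (h.map (algebraMap K Ω)).leadingCoeff * ((h.map (algebraMap K Ω)).roots.map (fun θ => W (x - θ))).prod := by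
      intro x
      conv_lhs => rw [hs.eq_prod_roots]
      rw [eval_mul, eval_C, map_mul, eval_multiset_prod, map_multiset_prod, Multiset.map_map, Multiset.map_map]
      simp
    have e1 : algebraMap K Ω (h.eval a) = eval (algebraMap K Ω a) (h.map (algebraMap K Ω)) := by
      rw [eval_map_algebraMap, aeval_algebraMap_apply, coe_aeval_eq_eval]
    rw [e1, ← eval_map_algebraMap, ev, ev]
    congr 2
    exact Multiset.map_congr rfl fun θ hθ => ha0 a ha θ (Multiset.mem_toFinset.2 hθ))
  exact ⟨a, ha a le_rfl⟩
end caseB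

end PAC
end Part21

section Part22
open Polynomial FirstOrder
open scoped IntermediateField

namespace PAC
set_option linter.unusedSectionVars false

section caseA
variable {K F Γ : Type*} [Field K] [Field F] [Algebra K F] [LinearOrderedCommGroupWithZero Γ] [CharZero K]
  {w : Valuation F Γ} {π : K} {p e : ℕ} {t : F}

lemma domin (w : Valuation F Γ) (s : F) (h : K[X]) (i : ℕ) (h0 : w (algebraMap K F (h.coeff i) * s ^ i) ≠ 0)
    (hi : ∀ j ∈ h.support, j ≠ i → w (algebraMap K F (h.coeff j) * s ^ j) < w (algebraMap K F (h.coeff i) * s ^ i)) :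
    w (aeval s h) = w (algebraMap K F (h.coeff i) * s ^ i) := by
  classical
  have his : i ∈ h.support := by
    rw [mem_support_iff]; intro h1; simp [h1] at h0
  rw [aeval_eq_sum_range' (Nat.lt_succ_self _), Finset.sum_congr rfl fun j _ => Algebra.smul_def _ _,
    ← Finset.add_sum_erase _ _ (Finset.mem_range.2 (Nat.lt_succ_of_le (le_natDegree_of_mem_supp _ his)))]
  apply Valuation.map_add_eq_of_lt_left
  apply Valuation.map_sum_lt _ h0
  intro j hj
  by_cases hjs : j ∈ h.support
  · exact hi j hjs (Finset.ne_of_mem_erase hj)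
  · rw [notMem_support_iff.1 hjs, map_zero, zero_mul, map_zero]
    exact zero_lt_iff.2 h0

lemma CV.cut (h : CV w π p e) (ht0 : t ≠ 0) (hT : ∀ n : ℕ, 0 < n → ∀ c : K, c ≠ 0 → w t ^ n ≠ w (algebraMap K F c)) {N : ℕ} (hN : 0 < N)
    (Q : Finset K) (hQ : ∀ q ∈ Q, q ≠ 0) : ∃ a : K, a ≠ 0 ∧ ∀ q ∈ Q, (w (algebraMap K F q) < w t ^ N → w (algebraMap K F q) < w (algebraMap K F a) ^ N) ∧
      (w t ^ N < w (algebraMap K F q) → w (algebraMap K F a) ^ N < w (algebraMap K F q)) := by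
  classical
  have hπ1 := h.pF.lt_one
  have hπK := h.pK.π0
  have hπ0 : 0 < w (algebraMap K F π) := zero_lt_iff.2 (by simpa using h.pF.π0)
  by_cases hup : ∃ q ∈ Q, w t ^ N < w (algebraMap K F q)
  · obtain ⟨c, hc, hmin⟩ := Finset.exists_min_image (Q.filter fun q => w t ^ N < w (algebraMap K F q)) (fun q => w (algebraMap K F q)) (by
      obtain ⟨q, hq, hlt⟩ := hup; exact ⟨q, Finset.mem_filter.2 ⟨hq, hlt⟩⟩)
    obtain ⟨hcQ, hct⟩ := Finset.mem_filter.1 hc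
    obtain ⟨y, hy, i, hi, hcy⟩ := h.pK.zgrp N hN c (hQ c hcQ)
    simp only [Valuation.comap_apply] at hcy
    have hy0 : 0 < w (algebraMap K F y) := zero_lt_iff.2 (by simpa using hy)
    have ha : w (algebraMap K F (y * π)) = w (algebraMap K F y) * w (algebraMap K F π) := by rw [map_mul, map_mul]
    refine ⟨y * π, mul_ne_zero hy hπK, fun q hq => ⟨fun hqt => hqt.trans ?_, fun hqt => lt_of_lt_of_le ?_ (hmin q (Finset.mem_filter.2 ⟨hq, hqt⟩))⟩⟩
    · have h1 : w t < w (algebraMap K F y) := by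
        refine lt_of_pow_lt_pow_left₀ N zero_le (hct.trans_le ?_)
        rw [hcy]
        exact mul_le_of_le_one_left' (pow_le_one₀ zero_le hπ1.le)
      have h2 : w (t / algebraMap K F y) ≤ w (algebraMap K F π) := (h.pF.unif _).1 (by rw [map_div₀]; exact (div_lt_one₀ hy0).2 h1)
      have h3 : w t ≤ w (algebraMap K F (y * π)) := by
        rw [map_div₀, div_le_iff₀ hy0] at h2
        rw [ha, mul_comm]; exact h2
      refine pow_lt_pow_left₀ (lt_of_le_of_ne h3 ?_) zero_le hN.ne'
      have := hT 1 one_pos _ (mul_ne_zero hy hπK)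
      rwa [pow_one] at this
    · rw [ha, hcy, mul_pow, mul_comm]
      exact mul_lt_mul_of_pos_right (pow_lt_pow_right_of_lt_one₀ hπ0 hπ1 hi) (pow_pos hy0 _)
  · push Not at hup
    by_cases hne : Q.Nonempty
    · obtain ⟨c, hc, hmax⟩ := Finset.exists_max_image Q (fun q => w (algebraMap K F q)) hne
      obtain ⟨y, hy, i, hi, hcy⟩ := h.pK.zgrp N hN c (hQ c hc)
      simp only [Valuation.comap_apply] at hcy
      have hy0 : 0 < w (algebraMap K F y) := zero_lt_iff.2 (by simpa using hy)
      refine ⟨y / π, div_ne_zero hy hπK, fun q hq => ⟨fun _ => (hmax q hq).trans_lt ?_, fun hqt => absurd hqt (not_lt.2 (hup q hq))⟩⟩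
      rw [hcy, map_div₀, map_div₀, div_pow]
      calc w (algebraMap K F π) ^ i * w (algebraMap K F y) ^ N ≤ w (algebraMap K F y) ^ N := mul_le_of_le_one_left' (pow_le_one₀ zero_le hπ1.le)
        _ < w (algebraMap K F y) ^ N / w (algebraMap K F π) ^ N := by
          rw [lt_div_iff₀ (pow_pos hπ0 _)]
          exact mul_lt_of_lt_one_right (pow_pos hy0 _) (pow_lt_one₀ zero_le hπ1 hN.ne')
    · exact ⟨1, one_ne_zero, fun q hq => absurd ⟨q, hq⟩ hne⟩

lemma mono_ne (hT : ∀ n : ℕ, 0 < n → ∀ c : K, c ≠ 0 → w t ^ n ≠ w (algebraMap K F c)) (ht0 : t ≠ 0) {i j : ℕ} (hij : i < j) {c d : K}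
    (hc : c ≠ 0) (hd : d ≠ 0) : w (algebraMap K F d * t ^ j) ≠ w (algebraMap K F c * t ^ i) := by
  intro heq
  have hwt : w t ≠ 0 := by simpa using ht0
  obtain ⟨k, rfl⟩ := Nat.exists_eq_add_of_lt hij
  refine hT (k + 1) k.succ_pos (c / d) (div_ne_zero hc hd) ?_
  have hd' : w (algebraMap K F d) ≠ 0 := by simpa using hd
  rw [map_mul, map_mul, map_pow, map_pow] at heq
  rw [map_div₀, map_div₀, eq_div_iff hd']
  apply mul_right_cancel₀ (pow_ne_zero i hwt)
  rw [← heq, add_assoc, pow_add _ i, mul_comm (w t ^ i), ← mul_assoc, mul_comm (w t ^ (k + 1))]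

lemma CV.caseA_dom (hT : ∀ n : ℕ, 0 < n → ∀ c : K, c ≠ 0 → w t ^ n ≠ w (algebraMap K F c)) (ht0 : t ≠ 0) {f : K[X]} (hf : f ≠ 0) :
    ∃ i ∈ f.support, ∀ j ∈ f.support, j ≠ i → w (algebraMap K F (f.coeff j) * t ^ j) < w (algebraMap K F (f.coeff i) * t ^ i) := by
  obtain ⟨i, hi, hmax⟩ := Finset.exists_max_image f.support (fun i => w (algebraMap K F (f.coeff i) * t ^ i)) (by simpa using hf)
  refine ⟨i, hi, fun j hj hji => lt_of_le_of_ne (hmax j hj) fun heq => ?_⟩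
  rw [mem_support_iff] at hi hj
  rcases lt_or_gt_of_ne hji with h1 | h1
  · exact mono_ne hT ht0 h1 hj hi heq.symm
  · exact mono_ne hT ht0 h1 hi hj heq

lemma CV.caseA (h : CV w π p e) (ht0 : t ≠ 0) (hT : ∀ n : ℕ, 0 < n → ∀ c : K, c ≠ 0 → w t ^ n ≠ w (algebraMap K F c)) (P : Finset K[X]) :
    ∃ a : K, ∀ f ∈ P, ∀ g ∈ P, w (aeval t f) ≤ w (aeval t g) ↔ w (algebraMap K F (f.eval a)) ≤ w (algebraMap K F (g.eval a)) := by
  classical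
  have hwt : w t ≠ 0 := by simpa using ht0
  set D := P.sup natDegree with hD
  set C : Finset K := P.biUnion (fun f => f.support.image f.coeff) with hC
  have hC0 : ∀ c ∈ C, c ≠ 0 := by
    intro c hc
    simp only [hC, Finset.mem_biUnion, Finset.mem_image, mem_support_iff] at hc
    obtain ⟨f, -, i, hi, rfl⟩ := hc
    exact hi
  set N := D.factorial with hN
  have hN0 : 0 < N := Nat.factorial_pos _
  obtain ⟨a, ha0, ha⟩ := h.cut ht0 hT hN0 (((C ×ˢ C) ×ˢ Finset.range (N + 1)).image fun x => (x.1.1 / x.1.2) ^ x.2) (by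
    intro q hq
    obtain ⟨x, hx, rfl⟩ := Finset.mem_image.1 hq
    simp only [Finset.mem_product] at hx
    exact pow_ne_zero _ (div_ne_zero (hC0 _ hx.1.1) (hC0 _ hx.1.2)))
  have hwa : w (algebraMap K F a) ≠ 0 := by simpa using ha0
  have cmp : ∀ c ∈ C, ∀ d ∈ C, ∀ k, 0 < k → k ≤ D → (w (algebraMap K F (c / d)) < w t ^ k → w (algebraMap K F (c / d)) < w (algebraMap K F a) ^ k) ∧
      (w t ^ k < w (algebraMap K F (c / d)) → w (algebraMap K F a) ^ k < w (algebraMap K F (c / d))) := by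
    intro c hc d hd k hk hkD
    obtain ⟨m, hm⟩ := Nat.dvd_factorial hk hkD
    rw [← hN] at hm
    have hm0 : m ≠ 0 := by rintro rfl; omega
    have := ha ((c / d) ^ m) (Finset.mem_image.2 ⟨((c, d), m), by
      simp only [Finset.mem_product, Finset.mem_range]
      exact ⟨⟨hc, hd⟩, Nat.lt_succ_of_le (by rw [hm]; exact Nat.le_mul_of_pos_left m hk)⟩, rfl⟩)
    rw [map_pow, map_pow, hm, pow_mul, pow_mul, pow_lt_pow_iff_left₀ zero_le zero_le hm0, pow_lt_pow_iff_left₀ zero_le zero_le hm0,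
      pow_lt_pow_iff_left₀ zero_le zero_le hm0, pow_lt_pow_iff_left₀ zero_le zero_le hm0] at this
    exact this
  have mono : ∀ c ∈ C, ∀ d ∈ C, ∀ i j, i ≤ D → j ≤ D → i ≠ j → w (algebraMap K F c * t ^ i) < w (algebraMap K F d * t ^ j) →
      w (algebraMap K F c * algebraMap K F a ^ i) < w (algebraMap K F d * algebraMap K F a ^ j) := by
    intro c hc d hd i j hi hj hij
    have hc' : 0 < w (algebraMap K F c) := zero_lt_iff.2 (by simpa using hC0 c hc)
    have hd' : 0 < w (algebraMap K F d) := zero_lt_iff.2 (by simpa using hC0 d hd)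
    simp only [map_mul w, map_pow w]
    rcases lt_or_gt_of_ne hij with h1 | h1
    · obtain ⟨k, rfl⟩ := Nat.exists_eq_add_of_lt h1
      have e1 : ∀ s : Γ, s ≠ 0 → (w (algebraMap K F c) * s ^ i < w (algebraMap K F d) * s ^ (i + k + 1) ↔ w (algebraMap K F (c / d)) < s ^ (k + 1)) := by
        intro s hs
        rw [map_div₀, map_div₀, div_lt_iff₀ hd', add_assoc, pow_add, mul_left_comm, mul_comm (s ^ i), mul_lt_mul_iff_left₀ (pow_pos (zero_lt_iff.2 hs) _), mul_comm]
      rw [e1 _ hwt, e1 _ hwa]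
      exact (cmp c hc d hd (k + 1) (by omega) (by omega)).1
    · obtain ⟨k, rfl⟩ := Nat.exists_eq_add_of_lt h1
      have e1 : ∀ s : Γ, s ≠ 0 → (w (algebraMap K F c) * s ^ (j + k + 1) < w (algebraMap K F d) * s ^ j ↔ s ^ (k + 1) < w (algebraMap K F (d / c))) := by
        intro s hs
        rw [map_div₀, map_div₀, lt_div_iff₀ hc', add_assoc, pow_add, mul_left_comm, mul_comm (s ^ j), mul_lt_mul_iff_left₀ (pow_pos (zero_lt_iff.2 hs) _), mul_comm]
      rw [e1 _ hwt, e1 _ hwa]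
      exact (cmp d hd c hc (k + 1) (by omega) (by omega)).2
  have ev : ∀ f : K[X], algebraMap K F (f.eval a) = aeval (algebraMap K F a) f := fun f => by
    rw [aeval_algebraMap_apply, coe_aeval_eq_eval]
  have dom : ∀ f ∈ P, f ≠ 0 → ∃ i ≤ D, f.coeff i ∈ C ∧ w (aeval t f) = w (algebraMap K F (f.coeff i) * t ^ i) ∧
      w (algebraMap K F (f.eval a)) = w (algebraMap K F (f.coeff i) * algebraMap K F a ^ i) := by
    intro f hf hf0
    have hmem : ∀ i ∈ f.support, i ≤ D ∧ f.coeff i ∈ C := fun i hi =>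
      ⟨(le_natDegree_of_mem_supp _ hi).trans (Finset.le_sup hf), Finset.mem_biUnion.2 ⟨f, hf, Finset.mem_image_of_mem _ hi⟩⟩
    obtain ⟨i, hi, hdom⟩ := CV.caseA_dom hT ht0 hf0
    have hci : algebraMap K F (f.coeff i) ≠ 0 := by simpa using hi
    refine ⟨i, (hmem i hi).1, (hmem i hi).2, domin w t f i (by simp [hci, ht0]) hdom, ?_⟩
    rw [ev]
    exact domin w _ f i (by simp [hci, ha0]) fun j hj hji => mono _ (hmem j hj).2 _ (hmem i hi).2 _ _ (hmem j hj).1 (hmem i hi).1 hji (hdom j hj hji)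
  refine ⟨a, fun f hf g hg => ?_⟩
  by_cases hf0 : f = 0
  · simp [hf0]
  obtain ⟨i, hi, hci, e1, e2⟩ := dom f hf hf0
  by_cases hg0 : g = 0
  · rw [e1, e2]; simp [hg0, ht0, ha0, hC0 _ hci]
  obtain ⟨j, hj, hcj, e3, e4⟩ := dom g hg hg0
  rw [e1, e2, e3, e4]
  by_cases hij : i = j
  · subst hij
    simp only [map_mul w, map_pow w]
    rw [mul_le_mul_iff_left₀ (pow_pos (zero_lt_iff.2 hwt) _), mul_le_mul_iff_left₀ (pow_pos (zero_lt_iff.2 hwa) _)]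
  · constructor
    · intro hle
      rcases hle.lt_or_eq with h1 | h1
      · exact (mono _ hci _ hcj _ _ hi hj hij h1).le
      · exfalso
        rcases lt_or_gt_of_ne hij with h2 | h2
        · exact mono_ne hT ht0 h2 (hC0 _ hci) (hC0 _ hcj) h1.symm
        · exact mono_ne hT ht0 h2 (hC0 _ hcj) (hC0 _ hci) h1
    · intro hle
      by_contra hlt
      exact absurd (mono _ hcj _ hci _ _ hj hi (Ne.symm hij) (not_le.1 hlt)) (not_lt.2 hle)
end caseA

end PAC
end Part22

section Part23
open Polynomial FirstOrder
open scoped IntermediateField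

namespace PAC
set_option linter.unusedSectionVars false

section glue
variable {K B : Type*} [Field K] [CommRing B] [Nontrivial B] [Algebra K B] {ι : Type*} {U : Ultrafilter ι}

variable (K) in
/-- partial homomorphisms -/
def PHom (S : Finset B) (φ : B → K) : Prop :=
  ∀ x ∈ S, (∀ y ∈ S, φ (x + y) = φ x + φ y ∧ φ (x * y) = φ x * φ y) ∧ ∀ a : K, algebraMap K B a = x → φ x = a

lemma glue (Φ : Finset B → B → K) (H : ∀ S, PHom K S (Φ S)) : ∃ U : Ultrafilter (Finset B), (∀ x, ∀ᶠ S : Finset B in (U : Filter (Finset B)), x ∈ S) ∧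
    ∃ σ : B →+* Ult U K, (∀ x, σ x = ((fun S => Φ S x : Finset B → K) : Ult U K)) ∧ ∀ a : K, σ (algebraMap K B a) = ((fun _ => a : Finset B → K) : Ult U K) := by
  classical
  let U : Ultrafilter (Finset B) := Ultrafilter.of Filter.atTop
  have hU : ∀ x, ∀ᶠ S : Finset B in (U : Filter (Finset B)), x ∈ S := fun x => Filter.Eventually.filter_mono (Ultrafilter.of_le _)
    ((Filter.eventually_ge_atTop {x}).mono fun S hS => hS (Finset.mem_singleton_self x))
  have hc : ∀ a : K, ((fun S => Φ S (algebraMap K B a) : Finset B → K) : Ult U K) = ((fun _ => a : Finset B → K) : Ult U K) := fun a =>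
    Filter.Germ.coe_eq.2 ((hU (algebraMap K B a)).mono fun S hS => (H S _ hS).2 a rfl)
  refine ⟨U, hU, { toFun := fun x => ((fun S => Φ S x : Finset B → K) : Ult U K), map_one' := ?_, map_mul' := ?_, map_zero' := ?_, map_add' := ?_ }, fun x => rfl, hc⟩
  · have := hc 1; rw [map_one] at this; exact this
  · intro x y
    refine Filter.Germ.coe_eq.2 (((hU x).and (hU y)).mono fun S hS => ((H S _ hS.1).1 y hS.2).2)
  · have := hc 0; rw [map_zero] at this; exact this
  · intro x y
    refine Filter.Germ.coe_eq.2 (((hU x).and (hU y)).mono fun S hS => ((H S _ hS.1).1 y hS.2).1)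

lemma unglue (ρ : B →+* Ult U K) (hρ : ∀ a : K, ρ (algebraMap K B a) = ((fun _ => a : ι → K) : Ult U K)) (S : Finset B) : ∃ φ : B → K, PHom K S φ := by
  classical
  have hrep : ∀ x : B, ∃ f : ι → K, ρ x = (f : Ult U K) := fun x => by
    induction ρ x using Filter.Germ.inductionOn with
    | _ f => exact ⟨f, rfl⟩
  choose Φ hΦ using hrep
  have h1 : ∀ x ∈ S, ∀ᶠ i in U, (∀ y ∈ S, Φ (x + y) i = Φ x i + Φ y i ∧ Φ (x * y) i = Φ x i * Φ y i) ∧ ∀ a : K, algebraMap K B a = x → Φ x i = a := by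
    intro x _
    refine Filter.Eventually.and ((Finset.eventually_all S).2 fun y _ => Filter.Eventually.and ?_ ?_) ?_
    · have := map_add ρ x y
      rw [hΦ, hΦ, hΦ, ← Filter.Germ.coe_add, Filter.Germ.coe_eq] at this
      exact this
    · have := map_mul ρ x y
      rw [hΦ, hΦ, hΦ, ← Filter.Germ.coe_mul, Filter.Germ.coe_eq] at this
      exact this
    · by_cases hx : ∃ a : K, algebraMap K B a = x
      · obtain ⟨a, rfl⟩ := hx
        have := hρ a
        rw [hΦ, Filter.Germ.coe_eq] at this
        filter_upwards [this] with i hi b hb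
        rw [hi, (algebraMap K B).injective hb]
      · exact Filter.Eventually.of_forall fun i a ha => absurd ⟨a, ha⟩ hx
  obtain ⟨i, hi⟩ := ((Finset.eventually_all S).2 h1).exists
  exact ⟨fun x => Φ x i, hi⟩
end glue

section tra
variable {K L : Type*} [Field K] [Field L] {i : K → L} {p e q : ℕ} {π : K} {r : Fin q → K}

/-- elementary maps -/
def Elem (i : K → L) : Prop := ∀ {α : Type} (φ : Language.ring.Formula α) (x : α → K), Rz K φ x ↔ Rz L φ (i ∘ x)

lemma Elem.app (hi : Elem i) {α : Type} {P : (α → K) → Prop} {P' : (α → L) → Prop} (T : Tr P P') (x : α → K) : P x ↔ P' (i ∘ x) := by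
  obtain ⟨φ, h1, h2⟩ := T
  rw [← h1, ← h2, hi]

lemma Elem.fo (hi : Elem i) (h : FO p e q π r) : FO p e q (i π) (i ∘ r) where
  prime := h.prime
  epos := h.epos
  A := (hi.app (α := Empty) trA Empty.elim).1 h.A
  G := (hi.app (α := Unit ⊕ Fin q) (trGd (Tm.var (Sum.inl ())) (fun j => Tm.var (Sum.inr j))) (Sum.elim (fun _ => π) r)).1 h.G
  S := fun m hm => (hi.app (α := Empty) (trS m) Empty.elim).1 (h.S m hm)
  H := fun d => (hi.app (α := Empty) (trH d) Empty.elim).1 (h.H d)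

lemma elem_ult {ι : Type*} (U : Ultrafilter ι) : Elem (fun a : K => ((fun _ => a : ι → K) : Ult U K)) :=
  fun φ x => (los_const U φ x).symm

lemma ov_ult {ι : Type*} (U : Ultrafilter ι) (f : ι → K) : Ov p e (f : Ult U K) ↔ ∀ᶠ i in U, Ov p e (f i) := by
  obtain ⟨φ, h1, h2⟩ := trOv (K := K) (K' := Ult U K) (p := p) (e := e) (Tm.var (α := Unit) ())
  have := los U φ (fun _ => f)
  rw [h2] at this
  refine Iff.trans this ?_
  exact Filter.eventually_congr (Filter.Eventually.of_forall fun i => h1 _)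

instance {ι : Type*} (U : Ultrafilter ι) [CharZero K] : CharZero (Ult U K) := by
  refine charZero_of_inj_zero fun n hn => ?_
  have : ((fun _ => (n : K) : ι → K) : Ult U K) = ((fun _ => 0 : ι → K) : Ult U K) := hn
  rw [Filter.Germ.coe_eq] at this
  obtain ⟨i, hi⟩ := this.exists
  have hi' : (n : K) = 0 := hi
  exact_mod_cast hi'
end tra

section emb
variable {K F Γ : Type*} [Field K] [Field F] [Algebra K F] [LinearOrderedCommGroupWithZero Γ] [CharZero K]
  {w : Valuation F Γ} {π : K} {p e : ℕ}

lemma emb1 {t : F} (htr : Transcendental K t)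
    (hsp : ∀ P : Finset K[X], ∃ a : K, ∀ f ∈ P, ∀ g ∈ P, w (aeval t f) ≤ w (aeval t g) ↔ w (algebraMap K F (f.eval a)) ≤ w (algebraMap K F (g.eval a)))
    (S : Finset F) (hS : ∀ x ∈ S, x ∈ K⟮t⟯) : ∃ φ : F → K, PHom K S φ ∧ ∀ x ∈ S, w x ≤ 1 ↔ w (algebraMap K F (φ x)) ≤ 1 := by
  classical
  have inj : ∀ f g : K[X], aeval t f = aeval t g → f = g := fun f g h => transcendental_iff_injective.1 htr h
  have hrep : ∀ x : F, ∃ r s : K[X], x ∈ K⟮t⟯ → s ≠ 0 ∧ x * aeval t s = aeval t r := by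
    intro x
    by_cases hx : x ∈ K⟮t⟯
    · obtain ⟨r, s, h⟩ := (IntermediateField.mem_adjoin_simple_iff K x).1 hx
      by_cases hs : aeval t s = 0
      · exact ⟨0, 1, fun _ => ⟨one_ne_zero, by simp [h, hs]⟩⟩
      · refine ⟨r, s, fun _ => ⟨fun h0 => hs (by rw [h0, map_zero]), by rw [h, div_mul_cancel₀ _ hs]⟩⟩
    · exact ⟨0, 0, fun h => absurd h hx⟩
  choose R D hRD using hrep
  let S' : Finset F := S ∪ ((S ×ˢ S).image fun x => x.1 + x.2) ∪ ((S ×ˢ S).image fun x => x.1 * x.2)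
  have hS' : ∀ x ∈ S', x ∈ K⟮t⟯ := by
    intro x hx
    simp only [S', Finset.mem_union, Finset.mem_image, Finset.mem_product] at hx
    rcases hx with (hx | ⟨y, hy, rfl⟩) | ⟨y, hy, rfl⟩
    · exact hS x hx
    · exact add_mem (hS _ hy.1) (hS _ hy.2)
    · exact mul_mem (hS _ hy.1) (hS _ hy.2)
  obtain ⟨a, ha⟩ := hsp (insert 0 (S'.image R ∪ S'.image D))
  have hD : ∀ x ∈ S', (D x).eval a ≠ 0 := by
    intro x hx h0
    have := (ha (D x) (by simp only [Finset.mem_insert, Finset.mem_union, Finset.mem_image]; exact Or.inr (Or.inr ⟨x, hx, rfl⟩)) 0 (Finset.mem_insert_self _ _)).2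
      (by rw [h0]; simp)
    rw [map_zero, map_zero, le_zero_iff, map_eq_zero] at this
    exact (hRD x (hS' x hx)).1 (inj _ _ (by rw [this, map_zero]))
  have h1 : ∀ x ∈ S, x ∈ S' := fun x hx => by simp only [S', Finset.mem_union]; exact Or.inl (Or.inl hx)
  refine ⟨fun x => (R x).eval a / (D x).eval a, fun x hx => ⟨fun y hy => ⟨?_, ?_⟩, fun b hb => ?_⟩, fun x hx => ?_⟩
  · have hxy : x + y ∈ S' := by
      simp only [S', Finset.mem_union, Finset.mem_image, Finset.mem_product]; exact Or.inl (Or.inr ⟨(x, y), ⟨hx, hy⟩, rfl⟩)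
    have e1 : R (x + y) * (D x * D y) = (R x * D y + R y * D x) * D (x + y) := inj _ _ (by
      simp only [map_mul, map_add]
      rw [← (hRD _ (hS' _ hxy)).2, ← (hRD _ (hS x hx)).2, ← (hRD _ (hS y hy)).2]; ring)
    have e2 := congrArg (eval a) e1
    simp only [eval_mul, eval_add] at e2
    have n1 := hD _ hxy; have n2 := hD x (h1 x hx); have n3 := hD y (h1 y hy)
    rw [div_add_div _ _ n2 n3, div_eq_div_iff n1 (mul_ne_zero n2 n3), e2]; ring
  · have hxy : x * y ∈ S' := by
      simp only [S', Finset.mem_union, Finset.mem_image, Finset.mem_product]; exact Or.inr ⟨(x, y), ⟨hx, hy⟩, rfl⟩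
    have e1 : R (x * y) * (D x * D y) = (R x * R y) * D (x * y) := inj _ _ (by
      simp only [map_mul]
      rw [← (hRD _ (hS' _ hxy)).2, ← (hRD _ (hS x hx)).2, ← (hRD _ (hS y hy)).2]; ring)
    have e2 := congrArg (eval a) e1
    simp only [eval_mul] at e2
    have n1 := hD _ hxy; have n2 := hD x (h1 x hx); have n3 := hD y (h1 y hy)
    rw [div_mul_div_comm, div_eq_div_iff n1 (mul_ne_zero n2 n3), e2]
  · have e1 : R x = C b * D x := inj _ _ (by
      rw [← (hRD _ (hS x hx)).2, map_mul, aeval_C, hb])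
    beta_reduce; rw [e1, eval_mul, eval_C, mul_div_cancel_right₀ _ (hD x (h1 x hx))]
  · have n2 := hD x (h1 x hx)
    have n3 : aeval t (D x) ≠ 0 := fun h0 => (hRD x (hS x hx)).1 (inj _ _ (by rw [h0, map_zero]))
    have hx' : x = aeval t (R x) / aeval t (D x) := by rw [← (hRD x (hS x hx)).2, mul_div_cancel_right₀ _ n3]
    have p1 : 0 < w (aeval t (D x)) := zero_lt_iff.2 (by simpa using n3)
    have p2 : 0 < w (algebraMap K F ((D x).eval a)) := zero_lt_iff.2 (by simpa using n2)
    conv_lhs => rw [hx']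
    rw [map_div₀, map_div₀, map_div₀, div_le_one₀ p1, div_le_one₀ p2]
    exact ha _ (by simp only [Finset.mem_insert, Finset.mem_union, Finset.mem_image]; exact Or.inr (Or.inl ⟨x, h1 x hx, rfl⟩)) _
      (by simp only [Finset.mem_insert, Finset.mem_union, Finset.mem_image]; exact Or.inr (Or.inr ⟨x, h1 x hx, rfl⟩))

/-- first step: the constants can be taken in the chain -/
lemma emb (t : ℕ → F) (htr : ∀ k, Transcendental K (t k)) (hmono : ∀ k, K⟮t k⟯ ≤ K⟮t (k + 1)⟯)
    (hsp : ∀ k, ∀ P : Finset K[X], ∃ a : K, ∀ f ∈ P, ∀ g ∈ P, w (aeval (t k) f) ≤ w (aeval (t k) g) ↔ w (algebraMap K F (f.eval a)) ≤ w (algebraMap K F (g.eval a)))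
    (S : Finset ((⨆ k, K⟮t k⟯ : IntermediateField K F))) :
    ∃ φ : (⨆ k, K⟮t k⟯ : IntermediateField K F) → K, PHom K S φ ∧ ∀ x ∈ S, w (x : F) ≤ 1 ↔ w (algebraMap K F (φ x)) ≤ 1 := by
  classical
  have hm : Monotone fun k => K⟮t k⟯ := monotone_nat_of_le_succ hmono
  have h1 : ∀ x : (⨆ k, K⟮t k⟯ : IntermediateField K F), ∃ k, (x : F) ∈ K⟮t k⟯ := fun x => by
    have := x.2
    rw [← SetLike.mem_coe, IntermediateField.coe_iSup_of_directed hm.directed_le, Set.mem_iUnion] at this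
    exact this
  choose k hk using h1
  obtain ⟨φ, h2, h3⟩ := emb1 (htr (S.sup k)) (hsp (S.sup k)) (S.image Subtype.val) (by
    intro x hx
    obtain ⟨y, hy, rfl⟩ := Finset.mem_image.1 hx
    exact hm (Finset.le_sup hy) (hk y))
  refine ⟨fun x => φ x, fun x hx => ⟨fun y hy => ?_, fun a ha => ?_⟩, fun x hx => h3 x (Finset.mem_image_of_mem _ hx)⟩
  · exact (h2 x (Finset.mem_image_of_mem _ hx)).1 y (Finset.mem_image_of_mem _ hy)
  · exact (h2 x (Finset.mem_image_of_mem _ hx)).2 a (by rw [← ha]; rfl)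
end emb

end PAC
end Part23

section Part24
open Polynomial FirstOrder
open scoped IntermediateField

namespace PAC
set_option linter.unusedSectionVars false

section step
variable {K F Γ : Type*} [Field K] [Field F] [Algebra K F] [LinearOrderedCommGroupWithZero Γ] [CharZero K]
  {w : Valuation F Γ} {π : K} {p e : ℕ}

lemma isIntegral_mono {K1 K2 : Type*} [Field K1] [Field K2] [Algebra K1 F] [Algebra K2 F] (L1 : IntermediateField K1 F) (L2 : IntermediateField K2 F)
    (h : ∀ x ∈ L1, x ∈ L2) {x : F} (hx : IsIntegral L1 x) : IsIntegral L2 x :=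
  hx.map_of_comp_eq ((algebraMap L1 F).codRestrict L2 fun y => h _ y.2) (RingHom.id F) rfl

theorem CV.core (h : CV w π p e) (M : IntermediateField K F)
    (hE : ∀ S : Finset M, ∃ φ : M → K, PHom K S φ ∧ ∀ x ∈ S, w (x : F) ≤ 1 ↔ w (algebraMap K F (φ x)) ≤ 1)
    (hV : ∀ m : F, m ∈ M → m ≠ 0 → ∀ n : ℕ, 0 < n → ∃ c : K, c ≠ 0 ∧ ∃ s : F, s ∈ M ∧ s ≠ 0 ∧ w m = w (algebraMap K F c) * w s ^ n)
    (S : Finset F) (hS : ∀ x ∈ S, IsIntegral M x) : ∃ φ : F → K, PHom K S φ := by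
  classical
  have hM : ∀ x : F, IsIntegral M x → x ≠ 0 → ∃ m : M, w x = w (algebraMap M F m) := by
    intro x hx hx0
    obtain ⟨n, hn, -, m, hm, hxm⟩ := exists_pow_eq (K := M) w (minpoly.ne_zero hx) hx0 (minpoly.aeval M x)
    obtain ⟨c, hc, s, hs, hs0, hms⟩ := hV m m.2 (by simpa using hm) n hn
    have hs0' : w s ≠ 0 := by simpa using hs0
    obtain ⟨y, hy, hxy⟩ := h.pur (x := x / s) (div_ne_zero hx0 hs0) hn hc (by
      rw [map_div₀, div_pow, hxm]
      exact (div_eq_iff (pow_ne_zero _ hs0')).2 hms)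
    refine ⟨algebraMap K M y * ⟨s, hs⟩, ?_⟩
    rw [map_div₀, div_eq_iff hs0'] at hxy
    rw [hxy, ← map_mul]; rfl
  choose Φ hΦ hΦw using hE
  obtain ⟨U, hU, σ, hσ, hσc⟩ := glue Φ hΦ
  obtain ⟨q, r, hFO⟩ := h.pK.toFO
  obtain ⟨V, hV1, hV2, -⟩ := (Elem.fo (elem_ult U) hFO).toPA
  letI : Algebra M (Ult U K) := σ.toAlgebra
  haveI : CharZero M := charZero_of_injective_algebraMap (algebraMap K M).injective
  have he : (w.comap (algebraMap M F)).IsEquiv (V.valuation.comap (algebraMap M (Ult U K))) := by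
    refine Valuation.isEquiv_of_val_le_one fun {m} => ?_
    rw [Valuation.comap_apply, Valuation.comap_apply, ValuationSubring.valuation_le_one_iff, hV1]
    change _ ↔ Ov p e (σ m)
    rw [hσ, ov_ult]
    have h1 : ∀ᶠ S : Finset M in (U : Filter (Finset M)), (w (algebraMap M F m) ≤ 1 ↔ Ov p e (Φ S m)) := (hU m).mono fun S hS => by
      rw [← h.pK.ov_iff]; exact hΦw S m hS
    constructor
    · intro hm; exact h1.mono fun S hS => hS.1 hm
    · intro hm
      obtain ⟨S, h2, h3⟩ := (h1.and hm).exists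
      exact h2.2 h3
  have hfin : FiniteDimensional M (IntermediateField.adjoin M (S : Set F)) := IntermediateField.finiteDimensional_adjoin fun x hx => hS x hx
  obtain ⟨α, hα⟩ := Field.exists_primitive_element M (IntermediateField.adjoin M (S : Set F))
  set y : F := α.1 with hy
  have hyint : IsIntegral M y := (Algebra.IsIntegral.isIntegral α).map (IntermediateField.adjoin M (S : Set F)).val
  have hadj : IntermediateField.adjoin M (S : Set F) = M⟮y⟯ := by
    have h1 := congrArg (IntermediateField.map (IntermediateField.adjoin M (S : Set F)).val) hα
    rw [IntermediateField.adjoin_map, Set.image_singleton, ← AlgHom.fieldRange_eq_map, IntermediateField.fieldRange_val] at h1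
    exact h1.symm
  obtain ⟨y', hy'⟩ := lemmaH (M := M) w V.valuation h.pF.hens hV2.hens he (fun x hx hx0 k hk => h.imm (M := M) hM x hx hx0 k hk) y hyint
  let ρ : M⟮y⟯ →ₐ[M] Ult U K := (IntermediateField.algHomAdjoinIntegralEquiv M hyint).symm ⟨y', by
    rw [mem_aroots]; exact ⟨minpoly.ne_zero hyint, hy'⟩⟩
  obtain ⟨φ, hφ⟩ := unglue (K := K) (ρ : M⟮y⟯ →+* Ult U K) (fun a => by
    rw [← hσc a]
    exact ρ.commutes (algebraMap K M a)) (S.subtype (fun x => x ∈ M⟮y⟯))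
  have hSm : ∀ x ∈ S, x ∈ M⟮y⟯ := fun x hx => hadj ▸ IntermediateField.subset_adjoin M _ hx
  refine ⟨fun x => if hx : x ∈ M⟮y⟯ then φ ⟨x, hx⟩ else 0, fun x hx => ?_⟩
  have hx1 := hSm x hx
  obtain ⟨h1, h2⟩ := hφ ⟨x, hx1⟩ (Finset.mem_subtype.2 hx)
  refine ⟨fun z hz => ?_, fun a ha => ?_⟩
  · have hz1 := hSm z hz
    beta_reduce; rw [dif_pos hx1, dif_pos hz1, dif_pos (add_mem hx1 hz1), dif_pos (mul_mem hx1 hz1)]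
    exact h1 ⟨z, hz1⟩ (Finset.mem_subtype.2 hz)
  · beta_reduce; rw [dif_pos hx1]
    exact h2 a (Subtype.ext ha)

lemma base_phom (S : Finset F) (hS : ∀ x ∈ S, ∃ a : K, algebraMap K F a = x) : ∃ φ : F → K, PHom K S φ := by
  have hl : Function.LeftInverse (Function.invFun (algebraMap K F)) (algebraMap K F) := Function.leftInverse_invFun (algebraMap K F).injective
  refine ⟨Function.invFun (algebraMap K F), fun x hx => ⟨fun y hy => ?_, fun a ha => by rw [← ha, hl]⟩⟩
  obtain ⟨a, rfl⟩ := hS x hx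
  obtain ⟨b, rfl⟩ := hS y hy
  rw [← map_add, ← map_mul, hl, hl, hl, hl]
  exact ⟨rfl, rfl⟩

lemma mem_chain {t : ℕ → F} (hmono : ∀ k, K⟮t k⟯ ≤ K⟮t (k + 1)⟯) {x : F} (hx : x ∈ (⨆ k, K⟮t k⟯ : IntermediateField K F)) :
    ∃ k, ∃ r s : K[X], x = aeval (t k) r / aeval (t k) s := by
  rw [← SetLike.mem_coe, IntermediateField.coe_iSup_of_directed (monotone_nat_of_le_succ hmono).directed_le, Set.mem_iUnion] at hx
  obtain ⟨k, hk⟩ := hx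
  exact ⟨k, (IntermediateField.mem_adjoin_simple_iff K x).1 hk⟩

lemma CV.trans (h : CV w π p e) {t : F} (ht : ¬ ∃ a : K, algebraMap K F a = t) : Transcendental K t :=
  fun hal => ht (h.base t (isAlgebraic_iff_isIntegral.1 hal))

lemma CV.onestepB (h : CV w π p e) (z : F) (hz : ∀ a : K, ∃ a' : K, w (z - algebraMap K F a') < w (z - algebraMap K F a))
    (S : Finset F) (hS : ∀ x ∈ S, IsIntegral K⟮z⟯ x) : ∃ φ : F → K, PHom K S φ := by
  have hzK : ¬ ∃ a : K, algebraMap K F a = z := by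
    rintro ⟨a, rfl⟩
    obtain ⟨a', ha'⟩ := hz a
    rw [sub_self, map_zero] at ha'
    exact not_lt_zero' ha'
  have hzN : ∀ (a : K) (N : ℕ), ∃ m : K, w (z - algebraMap K F m) ≤ w (z - algebraMap K F a) * w (algebraMap K F π) ^ N := by
    intro a N
    induction N with
    | zero => exact ⟨a, by simp⟩
    | succ N ih =>
      obtain ⟨m, hm⟩ := ih
      obtain ⟨m', hm'⟩ := hz m
      have h0 : 0 < w (z - algebraMap K F m) := zero_le.trans_lt hm'
      have h1 : w ((z - algebraMap K F m') / (z - algebraMap K F m)) ≤ w (algebraMap K F π) := (h.pF.unif _).1 (by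
        rw [map_div₀]; exact (div_lt_one₀ h0).2 hm')
      rw [map_div₀, div_le_iff₀ h0] at h1
      refine ⟨m', h1.trans ?_⟩
      rw [pow_succ, ← mul_assoc, mul_comm]
      exact mul_le_mul_left hm _
  haveI := h.charZero
  let Ω := AlgebraicClosure F
  obtain ⟨V, hVe⟩ := exists_extension (Ω := Ω) w
  have hKF : algebraMap K Ω = (algebraMap F Ω).comp (algebraMap K F) := IsScalarTower.algebraMap_eq K F Ω
  have hKF' : ∀ a, algebraMap K Ω a = algebraMap F Ω (algebraMap K F a) := fun a => by rw [hKF]; rfl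
  have hH : Hens (V.valuation.comap (algebraMap K Ω)) := by
    have : V.valuation.comap (algebraMap K Ω) = (V.valuation.comap (algebraMap F Ω)).comap (algebraMap K F) := by rw [hKF]; rfl
    rw [this]
    exact h.pK.hens.of_equiv (hVe.comap (algebraMap K F)).symm
  have hW : ∀ x y : F, w x ≤ w y ↔ V.valuation (algebraMap F Ω x) ≤ V.valuation (algebraMap F Ω y) := fun x y => (hVe x y).symm
  have hzΩ : ∀ a : K, ∀ k : ℕ, k ≠ 0 → ∃ m : K, V.valuation (algebraMap F Ω z - algebraMap K Ω m) < V.valuation (algebraMap F Ω z - algebraMap K Ω a) * V.valuation (k : Ω) := by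
    intro a k hk
    obtain ⟨N, hN⟩ := h.pF.v_nat hk
    obtain ⟨m, hm⟩ := hzN a (N + 1)
    refine ⟨m, ?_⟩
    rw [hKF', hKF', ← map_sub, ← map_sub, ← map_natCast (algebraMap F Ω), ← map_mul, ← map_mul, ← not_le, ← hW, not_le, map_mul, hN]
    refine hm.trans_lt ?_
    have hπ0 : w (algebraMap K F π) ≠ 0 := by simpa using h.pF.π0
    have hx0 : 0 < w (z - algebraMap K F a) := zero_lt_iff.2 (by
      rw [_root_.map_ne_zero, sub_ne_zero]; exact fun h0 => hzK ⟨a, h0.symm⟩)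
    exact (mul_lt_mul_iff_right₀ hx0).2 (pow_lt_pow_right_of_lt_one₀ (zero_lt_iff.2 hπ0) h.pF.lt_one (Nat.lt_succ_self _))
  have hB : ∀ P : Finset K[X], ∃ a : K, ∀ f ∈ P, w (aeval z f) = w (algebraMap K F (f.eval a)) := by
    intro P
    obtain ⟨a, ha⟩ := caseB hH hzΩ P
    refine ⟨a, fun f hf => ?_⟩
    have := ha f hf
    rw [aeval_algebraMap_apply, hKF'] at this
    exact le_antisymm ((hW _ _).2 this.le) ((hW _ _).2 this.ge)
  have hmono : ∀ k : ℕ, K⟮(fun _ : ℕ => z) k⟯ ≤ K⟮(fun _ : ℕ => z) (k + 1)⟯ := fun k => le_rfl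
  refine h.core (⨆ k : ℕ, K⟮(fun _ : ℕ => z) k⟯) (emb (fun _ => z) (fun _ => h.trans hzK) hmono ?_) ?_ S ?_
  · intro _ P
    obtain ⟨a, ha⟩ := hB P
    exact ⟨a, fun f hf g hg => by rw [ha f hf, ha g hg]⟩
  · intro m hm hm0 n hn
    obtain ⟨-, f, g, rfl⟩ := mem_chain hmono hm
    classical
    obtain ⟨a, ha⟩ := hB {f, g}
    have e1 : w (aeval z f / aeval z g) = w (algebraMap K F (f.eval a / g.eval a)) := by
      rw [map_div₀, ha f (by simp), ha g (by simp), map_div₀, map_div₀]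
    refine ⟨f.eval a / g.eval a, ?_, 1, one_mem _, one_ne_zero, by simpa using e1⟩
    intro h0
    rw [h0, map_zero, map_zero, map_eq_zero] at e1
    exact hm0 e1
  · intro x hx
    exact isIntegral_mono K⟮z⟯ _ (fun y hy => (le_iSup (fun k : ℕ => K⟮(fun _ : ℕ => z) k⟯) 0) hy) (hS x hx)
end step

end PAC
end Part24

section Part25
open Polynomial FirstOrder
open scoped IntermediateField

namespace PAC
set_option linter.unusedSectionVars false

section step
variable {K F Γ : Type*} [Field K] [Field F] [Algebra K F] [LinearOrderedCommGroupWithZero Γ] [CharZero K]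
  {w : Valuation F Γ} {π : K} {p e : ℕ}

lemma CV.onestepA (h : CV w π p e) (z : F) (a0 : K) (hz : ∀ a : K, w (z - algebraMap K F a0) ≤ w (z - algebraMap K F a))
    (hzK : ¬ ∃ a : K, algebraMap K F a = z) (S : Finset F) (hS : ∀ x ∈ S, IsIntegral K⟮z⟯ x) : ∃ φ : F → K, PHom K S φ := by
  classical
  have hz0 : z - algebraMap K F a0 ≠ 0 := fun h0 => hzK ⟨a0, (sub_eq_zero.1 h0).symm⟩
  choose c hc y hy hcy using fun (k : ℕ) (x : {x : F // x ≠ 0}) => h.npow x.2 (Nat.succ_pos k)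
  let t' : ℕ → {x : F // x ≠ 0} := fun k => Nat.rec ⟨z - algebraMap K F a0, hz0⟩ (fun k x => ⟨y k x, hy k x⟩) k
  let t : ℕ → F := fun k => (t' k).1
  have ht0 : ∀ k, t k ≠ 0 := fun k => (t' k).2
  have hstep : ∀ k, ∃ c : K, c ≠ 0 ∧ t k = algebraMap K F c * t (k + 1) ^ (k + 1) := fun k => ⟨c k (t' k), hc k (t' k), hcy k (t' k)⟩
  have hchain : ∀ k n, ∃ c : K, c ≠ 0 ∧ t k = algebraMap K F c * t (k + n) ^ ((k + 1).ascFactorial n) := by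
    intro k n
    induction n with
    | zero => exact ⟨1, one_ne_zero, by simp⟩
    | succ n ih =>
      obtain ⟨c, hc, hk⟩ := ih
      obtain ⟨d, hd, hk'⟩ := hstep (k + n)
      refine ⟨c * d ^ ((k + 1).ascFactorial n), mul_ne_zero hc (pow_ne_zero _ hd), ?_⟩
      rw [hk, hk', Nat.ascFactorial_succ, map_mul, map_pow, mul_pow, ← pow_mul, ← mul_assoc, ← add_assoc, add_right_comm k 1 n]
  have hT : ∀ k, ∀ n : ℕ, 0 < n → ∀ c : K, c ≠ 0 → w (t k) ^ n ≠ w (algebraMap K F c) := by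
    intro k
    induction k with
    | zero =>
      intro n hn c hc he
      obtain ⟨m, -, hm⟩ := h.pur hz0 hn hc he
      obtain ⟨m', hm'⟩ := h.near (M := K) hz0 hm
      have := hz (a0 + m')
      rw [map_add, ← sub_sub] at this
      exact absurd this (not_le.2 hm')
    | succ k ih =>
      intro n hn c hc he
      obtain ⟨d, hd, hk⟩ := hstep k
      refine ih n hn (d ^ n * c ^ (k + 1)) (mul_ne_zero (pow_ne_zero _ hd) (pow_ne_zero _ hc)) ?_
      rw [hk, map_mul, map_pow, mul_pow, ← pow_mul, mul_comm (k + 1), pow_mul, he, map_mul, map_mul, map_pow, map_pow, map_pow, map_pow]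
  have htr : ∀ k, Transcendental K (t k) := fun k => h.trans (by
    rintro ⟨a, ha⟩
    refine hT k 1 one_pos a ?_ (by rw [ha, pow_one])
    rintro rfl
    exact ht0 k (by rw [← ha, map_zero]))
  have hmono : ∀ k, K⟮t k⟯ ≤ K⟮t (k + 1)⟯ := by
    intro k
    rw [IntermediateField.adjoin_simple_le_iff]
    obtain ⟨d, hd, hk⟩ := hstep k
    rw [hk]
    exact mul_mem (algebraMap_mem _ _) (pow_mem (IntermediateField.mem_adjoin_simple_self _ _) _)
  have hmem : ∀ k, t k ∈ (⨆ k, K⟮t k⟯ : IntermediateField K F) := fun k =>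
    (le_iSup (fun k : ℕ => K⟮t k⟯) k) (IntermediateField.mem_adjoin_simple_self _ _)
  refine h.core (⨆ k, K⟮t k⟯) (emb t htr hmono fun k => h.caseA (ht0 k) (hT k)) ?_ S fun x hx => isIntegral_mono K⟮z⟯ _ (fun y hy => ?_) (hS x hx)
  · intro m hm hm0 n hn
    obtain ⟨k, f, g, rfl⟩ := mem_chain hmono hm
    obtain ⟨d, hd, hk⟩ := hchain k n
    obtain ⟨l, hl⟩ := (Nat.dvd_factorial hn le_rfl).trans (Nat.factorial_dvd_ascFactorial (k + 1) n)
    obtain ⟨u, hu⟩ : ∃ u, u = t (k + n) ^ l := ⟨_, rfl⟩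
    have hu0 : u ≠ 0 := hu ▸ pow_ne_zero _ (ht0 _)
    have hum : u ∈ (⨆ k, K⟮t k⟯ : IntermediateField K F) := hu ▸ pow_mem (hmem _) _
    have hku : t k = algebraMap K F d * u ^ n := by rw [hk, hl, hu, ← pow_mul, mul_comm l]
    have key : ∀ f : K[X], aeval (t k) f ≠ 0 → ∃ c : K, c ≠ 0 ∧ ∃ i : ℕ, w (aeval (t k) f) = w (algebraMap K F c) * w (u ^ i) ^ n := by
      intro f hf
      obtain ⟨i, hi, hdom⟩ := CV.caseA_dom (hT k) (ht0 k) (f := f) (by rintro rfl; simp at hf)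
      have hi0 := mem_support_iff.1 hi
      refine ⟨f.coeff i * d ^ i, mul_ne_zero hi0 (pow_ne_zero _ hd), i, ?_⟩
      rw [domin w (t k) f i (by simp [hi0, ht0]) hdom, hku, ← map_pow, ← map_mul, map_mul (algebraMap K F), map_pow (algebraMap K F), mul_pow, ← pow_mul, ← pow_mul, mul_comm n i, mul_assoc]
    obtain ⟨hf, hg⟩ := div_ne_zero_iff.1 hm0
    obtain ⟨c1, hc1, i, h1⟩ := key f hf
    obtain ⟨c2, hc2, j, h2⟩ := key g hg
    refine ⟨c1 / c2, div_ne_zero hc1 hc2, u ^ i / u ^ j, div_mem (pow_mem hum _) (pow_mem hum _),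
      div_ne_zero (pow_ne_zero _ hu0) (pow_ne_zero _ hu0), ?_⟩
    rw [map_div₀, h1, h2, map_div₀, map_div₀, map_div₀, div_pow, div_mul_div_comm]
  · refine (IntermediateField.adjoin_simple_le_iff.2 ?_ : K⟮z⟯ ≤ _) hy
    have : z = t 0 + algebraMap K F a0 := (sub_add_cancel _ _).symm
    rw [this]
    exact add_mem (hmem 0) (algebraMap_mem _ _)

lemma CV.onestep (h : CV w π p e) (z : F) (S : Finset F) (hS : ∀ x ∈ S, IsIntegral K⟮z⟯ x) : ∃ φ : F → K, PHom K S φ := by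
  by_cases hz : ∃ a : K, algebraMap K F a = z
  · refine base_phom S fun x hx => h.base x ?_
    obtain ⟨a, rfl⟩ := hz
    have hbot : K⟮algebraMap K F a⟯ = ⊥ := IntermediateField.adjoin_simple_eq_bot_iff.2 (algebraMap_mem _ _)
    have h1 := isIntegral_mono _ (⊥ : IntermediateField K F) (fun y hy => hbot ▸ hy) (hS x hx)
    exact isIntegral_trans x h1
  · by_cases h1 : ∃ a0 : K, ∀ a : K, w (z - algebraMap K F a0) ≤ w (z - algebraMap K F a)
    · obtain ⟨a0, h1⟩ := h1
      exact h.onestepA z a0 h1 hz S hS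
    · push Not at h1
      exact h.onestepB z h1 S hS

theorem CV.allPE (h : CV w π p e) (S : Finset F) : ∃ φ : F → K, PHom K S φ := by
  classical
  suffices H : ∀ G S : Finset F, (∀ x ∈ S, IsIntegral (IntermediateField.adjoin K (G : Set F)) x) → ∃ φ : F → K, PHom K S φ from
    H S S fun x hx => isIntegral_algebraMap (x := (⟨x, IntermediateField.subset_adjoin K _ hx⟩ : IntermediateField.adjoin K (S : Set F)))
  intro G
  induction G using Finset.induction_on with
  | empty =>
    intro S hS
    refine base_phom S fun x hx => h.base x ?_
    have h1 := isIntegral_mono _ (⊥ : IntermediateField K F) (fun y hy => by simpa using hy) (hS x hx)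
    exact isIntegral_trans x h1
  | insert z G hz ih =>
    intro S hS
    set L := IntermediateField.adjoin K (G : Set F) with hL
    let M := algebraicClosure L F
    have hM : ∀ x : F, IsIntegral M x → ∃ m : M, algebraMap M F m = x := fun x hx =>
      ⟨⟨x, mem_algebraicClosure_iff'.2 (isIntegral_trans x hx)⟩, rfl⟩
    letI : Algebra K M := ((algebraMap L M).comp (algebraMap K L)).toAlgebra
    haveI : IsScalarTower K M F := IsScalarTower.of_algebraMap_eq fun a => rfl
    haveI : CharZero M := charZero_of_injective_algebraMap (algebraMap K M).injective
    obtain ⟨φ, hφ⟩ := (h.sub (M := M) hM).onestep z S fun x hx => by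
      refine isIntegral_mono _ _ (fun y hy => ?_) (hS x hx)
      rw [Finset.coe_insert] at hy
      refine IntermediateField.adjoin_induction K (p := fun y _ => y ∈ M⟮z⟯) (fun y hy => ?_) (fun a => ?_) (fun _ _ _ _ => add_mem) (fun _ _ => inv_mem) (fun _ _ _ _ => mul_mem) hy
      · rcases hy with rfl | hy
        · exact IntermediateField.mem_adjoin_simple_self _ _
        · exact algebraMap_mem M⟮z⟯ (algebraMap L M ⟨y, IntermediateField.subset_adjoin K _ hy⟩)
      · exact algebraMap_mem M⟮z⟯ (algebraMap K M a)
    let φ' : F → F := fun x => algebraMap M F (φ x)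
    obtain ⟨ψ, hψ⟩ := ih (S.image φ') (by
      intro x hx
      obtain ⟨y, -, rfl⟩ := Finset.mem_image.1 hx
      exact mem_algebraicClosure_iff'.1 (φ y).2)
    refine ⟨ψ ∘ φ', fun x hx => ⟨fun y hy => ?_, fun a ha => ?_⟩⟩
    · obtain ⟨h1, h2⟩ := (hφ x hx).1 y hy
      obtain ⟨h3, h4⟩ := (hψ _ (Finset.mem_image_of_mem φ' hx)).1 _ (Finset.mem_image_of_mem φ' hy)
      refine ⟨?_, ?_⟩
      · simp only [Function.comp_apply]; rw [← h3]; simp only [φ', h1, map_add]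
      · simp only [Function.comp_apply]; rw [← h4]; simp only [φ', h2, map_mul]
    · refine (hψ _ (Finset.mem_image_of_mem φ' hx)).2 a ?_
      have h1 := (hφ x hx).2 (algebraMap K M a) ha
      exact congrArg (algebraMap M F) h1.symm
end step

end PAC
end Part25

section Part26
open Polynomial FirstOrder
open scoped IntermediateField

namespace PAC
set_option linter.unusedSectionVars false
set_option linter.style.haveILetI false

section cc
variable {K F Γ : Type*} [Field K] [Field F] [Algebra K F] [LinearOrderedCommGroupWithZero Γ] [CharZero K]
  {w : Valuation F Γ} {p e q : ℕ} {π : K} {r : Fin q → K}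

lemma ov_map {L : Type*} [Field L] (f : K →+* L) {x : K} (h : Ov p e x) : Ov p e (f x) := by
  obtain ⟨y, hy⟩ := h
  exact ⟨f y, by rw [← map_pow, hy]; simp⟩

lemma FO.toCV (hK : FO p e q π r) (hF : FO p e q (algebraMap K F π) (algebraMap K F ∘ r)) : ∃ V : ValuationSubring F, CV V.valuation π p e := by
  haveI : CharZero F := charZero_of_injective_algebraMap (algebraMap K F).injective
  obtain ⟨V, h1, h2, h3⟩ := hK.toPA
  obtain ⟨W, k1, k2, k3⟩ := hF.toPA
  have hπ := h2.π0
  have hin : ∀ x : K, V.valuation x ≤ 1 → W.valuation (algebraMap K F x) ≤ 1 := fun x hx => by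
    rw [ValuationSubring.valuation_le_one_iff, h1] at hx
    rw [ValuationSubring.valuation_le_one_iff, k1]
    exact ov_map _ hx
  have he : V.valuation.IsEquiv (W.valuation.comap (algebraMap K F)) := by
    refine Valuation.isEquiv_of_val_le_one fun {x} => ⟨hin x, fun hx => ?_⟩
    by_contra hlt
    rw [not_le] at hlt
    have h4 : V.valuation x⁻¹ ≤ V.valuation π := (h2.unif _).1 (by rw [map_inv₀]; exact inv_lt_one_of_one_lt₀ hlt)
    have h5 := hin (x⁻¹ / π) (by rw [map_div₀]; exact div_le_one_of_le₀ h4 zero_le)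
    have hw0 : 0 < W.valuation (algebraMap K F π) := zero_lt_iff.2 (by simpa using hπ)
    rw [map_div₀, map_div₀, div_le_one₀ hw0, map_inv₀, map_inv₀] at h5
    have h6 := h5.trans_lt k2.lt_one
    have hx0 : x ≠ 0 := by rintro rfl; simp at hlt
    have hx1 : 0 < W.valuation (algebraMap K F x) := zero_lt_iff.2 (by simpa using hx0)
    exact absurd ((inv_lt_one₀ hx1).1 h6) (not_lt.2 hx)
  refine ⟨W, h2.of_equiv he, k2, fun x hx => ?_⟩
  obtain ⟨j, hj⟩ := k3 x ((ValuationSubring.valuation_le_one_iff _ _).1 hx)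
  exact ⟨r j, hj⟩

lemma CV.toFO (h : CV w π p e) : ∃ q, ∃ r : Fin q → K, FO p e q π r ∧ FO p e q (algebraMap K F π) (algebraMap K F ∘ r) := by
  haveI := h.charZero
  obtain ⟨q, r, hK⟩ := h.pK.toFO
  obtain ⟨q', r', hF⟩ := h.pF.toFO
  obtain ⟨-, -, G2, G3⟩ := hK.G
  refine ⟨q, r, hK, hF.prime, hF.epos, hF.A, ⟨hF.G.1, hF.G.2.1, fun j => ov_map _ (G2 j), fun x hx => ?_⟩, hF.S, hF.H⟩
  rw [← h.pF.ov_iff] at hx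
  obtain ⟨a, ha⟩ := h.res x hx
  have ha1 : w (algebraMap K F a) ≤ 1 := by
    have := w.map_sub x (x - algebraMap K F a)
    rw [sub_sub_cancel] at this
    exact this.trans (max_le hx ha.le)
  obtain ⟨j, y, hy, hay⟩ := G3 a ((h.pK.ov_iff a).1 ha1)
  have hπ := h.pF.π0
  have hw0 : 0 < w (algebraMap K F π) := zero_lt_iff.2 (by simpa using hπ)
  refine ⟨j, algebraMap K F y + (x - algebraMap K F a) / algebraMap K F π, hF.A.1 _ _ (ov_map _ hy) ?_, ?_⟩
  · rw [← h.pF.ov_iff, map_div₀, div_le_one₀ hw0]; exact (h.pF.unif _).1 ha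
  · rw [hay]; simp only [map_add, map_mul, Function.comp_apply]; field_simp; ring
end cc

section el
universe u
variable {α : Type} {p e q : ℕ}

/-- realization of a bounded formula -/
def Bz (K : Type*) [Field K] {n : ℕ} (φ : Language.ring.BoundedFormula α n) (x : α → K) (y : Fin n → K) : Prop :=
  letI := Ring.compatibleRingOfRing K; φ.Realize x y

lemma hom_term {K F : Type*} [Field K] [Field F] (f : K →+* F) {α : Type} (t : Language.ring.Term α) (x : α → K) : Tz t (f ∘ x) = f (Tz t x) := by
  letI := Ring.compatibleRingOfRing K
  letI := Ring.compatibleRingOfRing F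
  induction t with
  | var a => rfl
  | func g ts ih =>
    unfold Tz at *
    cases g with
    | add =>
      simp only [Language.Term.realize]
      erw [Ring.CompatibleRing.funMap_add, Ring.CompatibleRing.funMap_add]
      rw [map_add, ih 0, ih 1]
    | mul =>
      simp only [Language.Term.realize]
      erw [Ring.CompatibleRing.funMap_mul, Ring.CompatibleRing.funMap_mul]
      rw [map_mul, ih 0, ih 1]
    | neg =>
      simp only [Language.Term.realize]
      erw [Ring.CompatibleRing.funMap_neg, Ring.CompatibleRing.funMap_neg]
      rw [map_neg, ih 0]
    | zero =>
      simp only [Language.Term.realize]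
      erw [Ring.CompatibleRing.funMap_zero, Ring.CompatibleRing.funMap_zero]
      rw [map_zero]
    | one =>
      simp only [Language.Term.realize]
      erw [Ring.CompatibleRing.funMap_one, Ring.CompatibleRing.funMap_one]
      rw [map_one]

lemma FO.emb {K F : Type*} [Field K] [Field F] [Algebra K F] [CharZero K] {π : K} {r : Fin q → K} (hK : FO p e q π r)
    (hF : FO p e q (algebraMap K F π) (algebraMap K F ∘ r)) :
    ∃ U : Ultrafilter (Finset F), ∃ σ : F →+* Ult U K, ∀ a : K, σ (algebraMap K F a) = ((fun _ => a : Finset F → K) : Ult U K) := by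
  obtain ⟨V, hV⟩ := hK.toCV hF
  choose Φ hΦ using hV.allPE
  obtain ⟨U, -, σ, -, hσ⟩ := glue Φ hΦ
  exact ⟨U, σ, hσ⟩

lemma elem_bd {n : ℕ} (φ : Language.ring.BoundedFormula α n) : ∀ {K F : Type u} [Field K] [Field F] [Algebra K F] [CharZero K] {π : K} {r : Fin q → K},
    FO p e q π r → FO p e q (algebraMap K F π) (algebraMap K F ∘ r) → ∀ (x : α → K) (y : Fin n → K),
    Bz K φ x y ↔ Bz F φ (algebraMap K F ∘ x) (algebraMap K F ∘ y) := by
  induction φ with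
  | falsum => intros; exact Iff.rfl
  | equal t₁ t₂ =>
    intro K F _ _ _ _ π r hK hF x y
    have key : Sum.elim (algebraMap K F ∘ x) (algebraMap K F ∘ y) = algebraMap K F ∘ Sum.elim x y := by
      funext s; cases s <;> rfl
    change Tz t₁ (Sum.elim x y) = Tz t₂ (Sum.elim x y) ↔ Tz t₁ (Sum.elim (algebraMap K F ∘ x) (algebraMap K F ∘ y)) = Tz t₂ (Sum.elim (algebraMap K F ∘ x) (algebraMap K F ∘ y))
    rw [key, hom_term, hom_term, (algebraMap K F).injective.eq_iff]
  | rel R => exact R.elim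
  | imp f g ihf ihg =>
    intro K F _ _ _ _ π r hK hF x y
    exact imp_congr (ihf hK hF x y) (ihg hK hF x y)
  | all f ih =>
    intro K F _ _ _ _ π r hK hF x y
    constructor
    · intro h b
      obtain ⟨U, σ, hσ⟩ := hK.emb hF
      letI : Algebra F (Ult U K) := σ.toAlgebra
      haveI : CharZero F := charZero_of_injective_algebraMap (algebraMap K F).injective
      have hU : FO p e q (algebraMap F (Ult U K) (algebraMap K F π)) (algebraMap F (Ult U K) ∘ (algebraMap K F ∘ r)) := by
        have h1 : algebraMap F (Ult U K) (algebraMap K F π) = _ := hσ π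
        have h2 : algebraMap F (Ult U K) ∘ (algebraMap K F ∘ r) = fun j => _ := funext fun j => hσ (r j)
        rw [h1, h2]
        have h0 := Elem.fo (elem_ult U) hK
        exact h0
      refine (ih hF hU (algebraMap K F ∘ x) (Fin.snoc (algebraMap K F ∘ y) b)).2 ?_
      have h3 := (los_bd U f.all (fun a _ => x a) (fun a _ => y a)).2 (Filter.Eventually.of_forall fun _ => h) (σ b)
      have e1 : algebraMap F (Ult U K) ∘ (algebraMap K F ∘ x) = fun j => _ := funext fun j => hσ (x j)
      have e2 : algebraMap F (Ult U K) ∘ (Fin.snoc (algebraMap K F ∘ y) b : Fin _ → F) = Fin.snoc (fun j => ((fun _ => y j : Finset F → K) : Ult U K)) (σ b) := by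
        rw [Fin.comp_snoc]
        congr 1
        exact funext fun j => hσ (y j)
      rw [e1, e2]
      exact h3
    · intro h a
      refine (ih hK hF x (Fin.snoc y a)).2 ?_
      rw [Fin.comp_snoc]
      exact h (algebraMap K F a)

/-- ultrapower of a homomorphism -/
noncomputable def ultMap {K F ι : Type*} [Field K] [Field F] (U : Ultrafilter ι) (f : K →+* F) : Ult U K →+* Ult U F where
  toFun := Filter.Germ.map f
  map_one' := by rw [← Filter.Germ.coe_one, Filter.Germ.map_coe]; exact congrArg _ (funext fun _ => map_one f)
  map_zero' := by rw [← Filter.Germ.coe_zero, Filter.Germ.map_coe]; exact congrArg _ (funext fun _ => map_zero f)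
  map_mul' := fun x y => by
    induction x using Filter.Germ.inductionOn with
    | _ x =>
    induction y using Filter.Germ.inductionOn with
    | _ y => exact congrArg _ (funext fun i => map_mul f (x i) (y i))
  map_add' := fun x y => by
    induction x using Filter.Germ.inductionOn with
    | _ x =>
    induction y using Filter.Germ.inductionOn with
    | _ y => exact congrArg _ (funext fun i => map_add f (x i) (y i))

theorem elem_of_FO {K F : Type*} [Field K] [Field F] [Algebra K F] [CharZero K] {π : K} {r : Fin q → K} (hK : FO p e q π r)
    (hF : FO p e q (algebraMap K F π) (algebraMap K F ∘ r)) (φ : Language.ring.Formula α) (x : α → K) :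
    Rz K φ x ↔ Rz F φ (algebraMap K F ∘ x) := by
  let U : Ultrafilter (K × F) := pure (0, 0)
  letI : Algebra (Ult U K) (Ult U F) := (ultMap U (algebraMap K F)).toAlgebra
  have h1 := Elem.fo (elem_ult U) hK
  have h2 := Elem.fo (elem_ult U) hF
  have h3 := elem_bd φ (K := Ult U K) (F := Ult U F) h1 h2 (fun a => ((fun _ => x a : K × F → K) : Ult U K)) default
  rw [← los_const U φ x, ← los_const U φ (algebraMap K F ∘ x)]
  refine h3.trans ?_
  unfold Bz Rz Language.Formula.Realize
  convert Iff.rfl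
  rfl

theorem pts_of_FO {K F : Type*} [Field K] [Field F] [Algebra K F] [CharZero K] {π : K} {r : Fin q → K} (hK : FO p e q π r)
    (hF : FO p e q (algebraMap K F π) (algebraMap K F ∘ r)) (n : ℕ) (S : Finset (MvPolynomial (Fin n) K)) (y : Fin n → F)
    (hy : ∀ P ∈ S, MvPolynomial.aeval y P = 0) : ∃ x : Fin n → K, ∀ P ∈ S, MvPolynomial.eval x P = 0 := by
  obtain ⟨U, σ, hσ⟩ := hK.emb hF
  have hrep : ∀ j, ∃ f : Finset F → K, σ (y j) = (f : Ult U K) := fun j => by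
    induction σ (y j) using Filter.Germ.inductionOn with
    | _ f => exact ⟨f, rfl⟩
  choose f hf using hrep
  have key : ∀ P : MvPolynomial (Fin n) K, σ (MvPolynomial.aeval y P) = ((fun i => MvPolynomial.eval (fun j => f j i) P : Finset F → K) : Ult U K) := by
    intro P
    induction P using MvPolynomial.induction_on with
    | C a => simpa using hσ a
    | add P Q hP hQ => rw [map_add, map_add, hP, hQ, ← Filter.Germ.coe_add]; exact congrArg _ (funext fun i => (map_add _ _ _).symm)
    | mul_X P j hP => rw [map_mul, map_mul, hP, MvPolynomial.aeval_X, hf, ← Filter.Germ.coe_mul]; exact congrArg _ (funext fun i => by simp)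
  have h1 : ∀ P ∈ S, ∀ᶠ i in (U : Filter (Finset F)), MvPolynomial.eval (fun j => f j i) P = 0 := by
    intro P hP
    have h2 := key P
    rw [hy P hP, map_zero, ← Filter.Germ.coe_zero, eq_comm, Filter.Germ.coe_eq] at h2
    exact h2
  obtain ⟨i, hi⟩ := ((Finset.eventually_all S).2 h1).exists
  exact ⟨_, hi⟩
end el

end PAC
end Part26

section Part27
open Polynomial FirstOrder
open scoped IntermediateField

namespace PAC
set_option linter.unusedSectionVars false
set_option linter.style.haveILetI false

section loc
open scoped NNReal

lemma pa_of_norm {E : Type*} [NontriviallyNormedField E] [IsUltrametricDist E] [ProperSpace E] {p : ℕ} (hp : p.Prime) (hp1 : ‖(p : E)‖ < 1)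
    (hp0 : (p : E) ≠ 0) : ∃ (v : Valuation E ℝ≥0) (π : E) (e : ℕ), PA v π p e := by
  classical
  let Ω := AlgebraicClosure E
  let w : Valuation Ω ℝ≥0 :=
    { toFun := fun x => ⟨spectralNorm E Ω x, spectralNorm_nonneg x⟩
      map_zero' := Subtype.ext spectralNorm_zero
      map_one' := Subtype.ext spectralNorm_one
      map_mul' := fun x y => Subtype.ext (spectralAlgNorm_mul (K := E) (L := Ω) x y)
      map_add_le_max' := fun x y => isNonarchimedean_spectralNorm (K := E) (L := Ω) x y }
  have hw : Inv E w := fun σ x => Subtype.ext (spectralNorm_eq_of_equiv σ x).symm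
  obtain ⟨v, hv⟩ : ∃ v, v = w.comap (algebraMap E Ω) := ⟨_, rfl⟩
  have hH : Hens v := hv ▸ hw.hens
  have hvn : ∀ x : E, v x = ‖x‖₊ := fun x => by
    rw [hv]; exact Subtype.ext (spectralNorm_extends x)
  have hlt : ∀ x : E, v x < 1 ↔ ‖x‖ < 1 := fun x => by rw [hvn]; exact Iff.rfl
  have hc : IsCompact (Metric.ball (0 : E) 1) := (isCompact_closedBall (0 : E) 1).of_isClosed_subset (IsUltrametricDist.isClosed_ball 0 1) Metric.ball_subset_closedBall
  obtain ⟨π, hπ, hmax⟩ := hc.exists_isMaxOn ⟨0, by simp⟩ continuous_norm.continuousOn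
  rw [mem_ball_zero_iff] at hπ
  have hmax' : ∀ x : E, ‖x‖ < 1 → ‖x‖ ≤ ‖π‖ := fun x hx => hmax (by rwa [mem_ball_zero_iff])
  have hπpos : 0 < ‖π‖ := (norm_pos_iff.2 hp0).trans_le (hmax' _ hp1)
  have hπ0 : π ≠ 0 := norm_pos_iff.1 hπpos
  have hval : ∀ x : E, x ≠ 0 → ∃ k : ℤ, v x = v π ^ k := by
    intro x hx
    obtain ⟨n, hn1, hn2⟩ := exists_mem_Ico_zpow (norm_pos_iff.2 hx) ((one_lt_inv₀ hπpos).2 hπ)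
    have hxn : 0 < ‖x‖ := norm_pos_iff.2 hx
    have hpn : 0 < ‖π‖ ^ n := zpow_pos hπpos n
    have h1 : 1 ≤ ‖x‖ * ‖π‖ ^ n := by
      rw [inv_zpow] at hn1
      rwa [inv_le_iff_one_le_mul₀ hpn] at hn1
    have h2 : ‖π‖ < ‖(x * π ^ n)⁻¹‖ := by
      rw [norm_inv, norm_mul, norm_zpow, lt_inv_comm₀ hπpos (by positivity)]
      rw [inv_zpow, zpow_add₀ hπpos.ne', zpow_one, mul_inv] at hn2
      calc ‖x‖ * ‖π‖ ^ n < ((‖π‖ ^ n)⁻¹ * ‖π‖⁻¹) * ‖π‖ ^ n := mul_lt_mul_of_pos_right hn2 hpn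
        _ = ‖π‖⁻¹ := by field_simp
    have h3 : ‖(x * π ^ n)⁻¹‖ = 1 := by
      refine le_antisymm ?_ (not_lt.1 fun h => absurd (hmax' _ h) (not_le.2 h2))
      rw [norm_inv, norm_mul, norm_zpow]
      exact inv_le_one_of_one_le₀ h1
    refine ⟨-n, ?_⟩
    have h4 : v (x * π ^ n) = 1 := by
      rw [norm_inv, inv_eq_one] at h3
      rw [hvn]; exact Subtype.ext h3
    rw [map_mul, map_zpow₀] at h4
    rw [zpow_neg]
    exact eq_inv_of_mul_eq_one_left h4
  have hvπ1 : v π < 1 := (hlt π).2 hπ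
  have hvπ0 : 0 < v π := zero_lt_iff.2 (by simpa using hπ0)
  obtain ⟨k, hk⟩ := hval p hp0
  have hk0 : 0 < k := by
    have h1 := (hlt (p : E)).2 hp1
    rw [hk] at h1
    by_contra hle
    exact absurd h1 (not_lt.2 (one_le_zpow_of_nonpos₀ hvπ0 hvπ1.le (not_lt.1 hle)))
  refine ⟨v, π, k.toNat, ⟨⟨hπ0, fun x => ⟨fun h => ?_, fun h => h.trans_lt hvπ1⟩, ?_, hH⟩, hp, by omega, ?_, ?_⟩⟩
  · rw [hvn, hvn]; exact hmax' x ((hlt x).1 h)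
  · obtain ⟨R, -, hR⟩ := (isCompact_closedBall (0 : E) 1).elim_nhds_subcover (fun x => Metric.ball x 1) fun x _ => Metric.ball_mem_nhds x one_pos
    refine ⟨R, fun x hx => ?_⟩
    have hx' : x ∈ Metric.closedBall (0 : E) 1 := by rw [mem_closedBall_zero_iff]; rw [hvn] at hx; exact hx
    obtain ⟨r, hr, hxr⟩ := Set.mem_iUnion₂.1 (hR hx')
    exact ⟨r, hr, (hlt _).2 (by rwa [Metric.mem_ball, dist_eq_norm] at hxr)⟩
  · rw [hk, ← zpow_natCast, Int.toNat_of_nonneg hk0.le]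
  · intro n hn x hx
    obtain ⟨m, hm⟩ := hval x hx
    have hn0 : (n : ℤ) ≠ 0 := by exact_mod_cast hn.ne'
    refine ⟨π ^ (m / n), zpow_ne_zero _ hπ0, (m % n).toNat, ?_, ?_⟩
    · have := Int.emod_lt_of_pos m (Int.natCast_pos.2 hn)
      have := Int.emod_nonneg m hn0
      omega
    · rw [hm, map_zpow₀, ← zpow_natCast, ← zpow_natCast, ← zpow_mul, ← zpow_add₀ hvπ0.ne', Int.toNat_of_nonneg (Int.emod_nonneg m hn0), Int.emod_add_ediv_mul]

lemma pa_padic (p : ℕ) [hp : Fact p.Prime] (E : Type*) [Field E] [Algebra ℚ_[p] E] [FiniteDimensional ℚ_[p] E] :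
    ∃ (v : Valuation E ℝ≥0) (π : E) (e : ℕ), PA v π p e := by
  letI : NontriviallyNormedField E := spectralNorm.nontriviallyNormedField ℚ_[p] E
  letI : NormedAlgebra ℚ_[p] E := spectralNorm.normedAlgebra ℚ_[p] E
  haveI : IsUltrametricDist E := IsUltrametricDist.isUltrametricDist_of_isNonarchimedean_norm (isNonarchimedean_spectralNorm (K := ℚ_[p]) (L := E))
  haveI : ProperSpace E := FiniteDimensional.proper ℚ_[p] E
  haveI : CharZero E := charZero_of_injective_algebraMap (algebraMap ℚ_[p] E).injective
  refine pa_of_norm hp.1 ?_ (by exact_mod_cast hp.1.ne_zero)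
  rw [← map_natCast (algebraMap ℚ_[p] E), norm_algebraMap']
  exact Padic.norm_p_lt_one
end loc

section fin
variable {K E : Type*} [Field K] [Field E]

lemma ree_app (h : RingElemEquiv K E) {P P' : Prop} (T : Tr (fun _ : Empty → K => P) (fun _ : Empty → E => P')) : P ↔ P' := by
  obtain ⟨φ, h1, h2⟩ := T
  exact (h1 default).symm.trans ((h φ).trans (h2 default))

lemma fo_of_ree [CharZero E] (h : RingElemEquiv K E) {p e q : ℕ} {π : E} {r : Fin q → E} (hE : FO p e q π r) :
    CharZero K ∧ ∃ (π : K) (r : Fin q → K), FO p e q π r := by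
  have T : Tr (fun _ : Empty → K => ∃ (π : K) (r : Fin q → K), Gd p e q π r) (fun _ : Empty → E => ∃ (π : E) (r : Fin q → E), Gd p e q π r) := by
    refine Tr.ex (Tr.exF ?_)
    exact trGd (Tm.var (Sum.inl (Sum.inr ()))) (fun j => Tm.var (Sum.inr j))
  obtain ⟨π', r', hG⟩ := (ree_app h T).2 ⟨π, r, hE.G⟩
  refine ⟨charZero_of_inj_zero fun n hn => ?_, π', r', hE.prime, hE.epos, (ree_app h trA).2 hE.A, hG, fun m hm => (ree_app h (trS m)).2 (hE.S m hm), fun d => (ree_app h (trH d)).2 (hE.H d)⟩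
  have : (n : E) = 0 := (ree_app h (Tr.eq (Tm.natCast n) Tm.zero)).1 hn
  exact_mod_cast this
end fin

end PAC
end Part27

/-- If `K` is p-adically closed and `F/K` is a field extension such that the
restriction map `res : G_F → G_K` on absolute Galois groups is an isomorphism, then
`K` is an elementary substructure of `F` in the language of rings; consequently any
variety over `K` with an `F`-rational point has a `K`-rational point.  Here `Ω` is an
algebraic closure of `F`, `G_F = Aut(Ω/F)`, `G_K = Gal(K^sep/K)` for the separable
closure `K^sep` of `K` in `Ω`, and `res` is restriction. -/
theorem padicallyClosed_elementary_of_res_iso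
    (p : ℕ) [Fact p.Prime]
    (K F Ω : Type*) [Field K] [Field F] [Field Ω] [Algebra K F] [Algebra F Ω]
    [Algebra K Ω] [IsScalarTower K F Ω] [IsAlgClosed Ω] [Algebra.IsAlgebraic F Ω]
    (hK : IsPAdicallyClosed p K)
    (hres : Function.Bijective
      (fun σ : Ω ≃ₐ[F] Ω =>
        AlgEquiv.restrictNormal (σ.restrictScalars K) (separableClosure K Ω))) :
    (∀ (n : ℕ) (φ : Language.ring.Formula (Fin n)) (x : Fin n → K),
      (letI := Ring.compatibleRingOfRing K; φ.Realize x) ↔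
        (letI := Ring.compatibleRingOfRing F; φ.Realize (algebraMap K F ∘ x))) ∧
    ∀ (n : ℕ) (S : Finset (MvPolynomial (Fin n) K)),
      (∃ y : Fin n → F, ∀ P ∈ S, MvPolynomial.aeval y P = 0) →
        ∃ x : Fin n → K, ∀ P ∈ S, MvPolynomial.eval x P = 0 := by
  obtain ⟨E, fE, aE, hfin, hree⟩ := hK
  haveI : CharZero E := charZero_of_injective_algebraMap (algebraMap ℚ_[p] E).injective
  obtain ⟨v, π, e, hE⟩ := PAC.pa_padic p E
  obtain ⟨q, r, hFO⟩ := hE.toFO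
  obtain ⟨hc, π', r', hK⟩ := PAC.fo_of_ree hree hFO
  obtain ⟨V, -, hPA, -⟩ := hK.toPA
  obtain ⟨W, h1, h2, h3⟩ := (PAC.resData_of_bijective hres).transfer hPA
  have hCV : PAC.CV W.valuation π' p e := ⟨hPA.of_equiv h1.symm, h2, h3⟩
  obtain ⟨q1, r1, hF1, hF2⟩ := hCV.toFO
  exact ⟨fun n φ x => PAC.elem_of_FO hF1 hF2 φ x, fun n S ⟨y, hy⟩ => PAC.pts_of_FO hF1 hF2 n S y hy⟩
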